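/- For every integer r ≥ 2, every integer Δ ≥ 1 and all reals ν, d, δ > 0 there exist ε, μ, α > 0 and m₀ ∈ ℕ such that the following holds for every integer m ≥ m₀. Let R be a graph on vertex set [r]. Let G be a 3-uniform hypergraph whose vertex set is partitioned into classes V₁,…,V_r and V_{ij} for ij ∈ E(R), where m ≤ |V_i| ≤ m/δ for all i ∈ [r] and |V_{ij}| ≥ δm for all ij ∈ E(R), such that for every ij ∈ E(R) the 3-partite subhypergraph G[V_i, V_j, V_{ij}] (consisting of the edges of G with one vertex in each of V_i, V_j, V_{ij}) is weakly (ε,d)-half-superregular. Let H be a μ-separable graph with Δ(H) ≤ Δ for which there is a graph homomorphism φ : V(H) → [r] into R with |φ⁻¹(i)| = |V_i| for all i ∈ [r] and e(H[φ⁻¹(i), φ⁻¹(j)]) = |V_{ij}| for all ij ∈ E(R). Suppose that for each i ∈ [r] there is a set U_i ⊆ φ⁻¹(i) with |U_i| ≤ αm and, for each x ∈ U_i, a set T_x ⊆ V_{φ(x)} with |T_x| ≥ νm. Then G contains a copy of the 1-expansion of H in which each x ∈ V(H) is mapped into V_{φ(x)}, the new vertex corresponding to each edge xy ∈ E(H)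 is mapped into V_{φ(x)φ(y)}, and for every i ∈ [r] every x ∈ U_i is mapped into T_x. -/

import Mathlib

open Finset
open scoped Classical

/-- Number of ordered pairs `(x,y) ∈ A × B` with `{x,y}` an edge of `G`. -/
noncomputable def pairCount {V : Type*} (G : SimpleGraph V) (A B : Finset V) : ℕ :=
  ((A ×ˢ B).filter (fun p => G.Adj p.1 p.2)).card

/-- Number of neighbours of `v` in `B`. -/
noncomputable def degIn {V : Type*} (G : SimpleGraph V) (v : V) (B : Finset V) : ℕ :=
  (B.filter (fun w => G.Adj v w)).card

/-- Degree of `v` in `G`. -/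
noncomputable def degOf {V : Type*} [Fintype V] (G : SimpleGraph V) (v : V) : ℕ :=
  ((univ : Finset V).filter (fun w => G.Adj v w)).card

/-- Number of edges of `G`. -/
noncomputable def edgeCnt {V : Type*} [Fintype V] (G : SimpleGraph V) : ℕ :=
  ((univ : Finset (Sym2 V)).filter (fun e => e ∈ G.edgeSet)).card

/-- Number of edges of `H` with one endpoint in `A` and the other in `B`. -/
noncomputable def eBetween {W : Type*} [Fintype W] (H : SimpleGraph W) (A B : Finset W) : ℕ :=
  ((univ : Finset (Sym2 W)).filter
    (fun e => e ∈ H.edgeSet ∧ ∃ x ∈ A, ∃ y ∈ B, e = s(x, y))).card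

/-- A graph `H` on `h` vertices is `μ`-separable if there is `X ⊆ V(H)` with `|X| ≤ μ h`
such that every connected component of `H - X` has at most `μ h` vertices. -/
def Separable {W : Type*} [Fintype W] (H : SimpleGraph W) (μ : ℝ) : Prop :=
  ∃ X : Finset W, (X.card : ℝ) ≤ μ * (Fintype.card W : ℝ) ∧
    ∀ K : (SimpleGraph.induce ((↑X : Set W)ᶜ) H).ConnectedComponent,
      (K.supp.ncard : ℝ) ≤ μ * (Fintype.card W : ℝ)

/-- A transversal copy of `H` in the graph collection `G`. -/
def HasTransversal {V C W : Type*} (G : C → SimpleGraph V) (H : SimpleGraph W) : Prop :=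
  ∃ (τ : W → V) (σ : Sym2 W → C),
    Function.Injective τ ∧ Set.InjOn σ H.edgeSet ∧
    ∀ x y, H.Adj x y → (G (σ s(x, y))).Adj (τ x) (τ y)

/-- Density of a collection of bipartite graphs. -/
noncomputable def colDensity {V C : Type*} (G : C → SimpleGraph V)
    (A B : Finset V) (D : Finset C) : ℝ :=
  (∑ c ∈ D, (pairCount (G c) A B : ℝ)) / ((D.card : ℝ) * (A.card : ℝ) * (B.card : ℝ))

/-- `(ε,d)`-regularity of a collection of bipartite graphs with parts `V₁, V₂`
and colour set `D`. -/
def ColReg {V C : Type*} (ε d : ℝ) (G : C → SimpleGraph V)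
    (V₁ V₂ : Finset V) (D : Finset C) : Prop :=
  d ≤ colDensity G V₁ V₂ D ∧
  ∀ V₁' ⊆ V₁, ∀ V₂' ⊆ V₂, ∀ D' ⊆ D,
    ε * (V₁.card : ℝ) ≤ (V₁'.card : ℝ) → ε * (V₂.card : ℝ) ≤ (V₂'.card : ℝ) →
    ε * (D.card : ℝ) ≤ (D'.card : ℝ) →
    |colDensity G V₁' V₂' D' - colDensity G V₁ V₂ D| < ε

/-- `(ε,d)`-superregularity of a collection of bipartite graphs. -/
def ColSuperReg {V C : Type*} (ε d : ℝ) (G : C → SimpleGraph V)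
    (V₁ V₂ : Finset V) (D : Finset C) : Prop :=
  ColReg ε d G V₁ V₂ D ∧
  (∀ v ∈ V₁, d * (V₂.card : ℝ) * (D.card : ℝ) ≤ ∑ c ∈ D, (degIn (G c) v V₂ : ℝ)) ∧
  (∀ v ∈ V₂, d * (V₁.card : ℝ) * (D.card : ℝ) ≤ ∑ c ∈ D, (degIn (G c) v V₁ : ℝ)) ∧
  (∀ c ∈ D, d * (V₁.card : ℝ) * (V₂.card : ℝ) ≤ (pairCount (G c) V₁ V₂ : ℝ))

/-- `(ε,d)`-half-superregularity of a collection of bipartite graphs. -/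
def ColHalfSuperReg {V C : Type*} (ε d : ℝ) (G : C → SimpleGraph V)
    (V₁ V₂ : Finset V) (D : Finset C) : Prop :=
  (∀ V₁' ⊆ V₁, ∀ V₂' ⊆ V₂, ∀ D' ⊆ D,
    ε * (V₁.card : ℝ) ≤ (V₁'.card : ℝ) → ε * (V₂.card : ℝ) ≤ (V₂'.card : ℝ) →
    ε * (D.card : ℝ) ≤ (D'.card : ℝ) →
    d * (D'.card : ℝ) * (V₁'.card : ℝ) * (V₂'.card : ℝ) ≤
      ∑ c ∈ D', (pairCount (G c) V₁' V₂' : ℝ)) ∧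
  (∀ v ∈ V₁, d * (V₂.card : ℝ) * (D.card : ℝ) ≤ ∑ c ∈ D, (degIn (G c) v V₂ : ℝ)) ∧
  (∀ v ∈ V₂, d * (V₁.card : ℝ) * (D.card : ℝ) ≤ ∑ c ∈ D, (degIn (G c) v V₁ : ℝ)) ∧
  (∀ c ∈ D, d * (V₁.card : ℝ) * (V₂.card : ℝ) ≤ (pairCount (G c) V₁ V₂ : ℝ))

/-- `(ε,d)`-half-superregularity of a bipartite graph (given by an adjacency relation)
with parts `V₁, V₂`. -/
def BipHalfSuper {V : Type*} (ε d : ℝ) (A : V → V → Prop) (V₁ V₂ : Finset V) : Prop :=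
  (∀ U₁ ⊆ V₁, ∀ U₂ ⊆ V₂,
    ε * (V₁.card : ℝ) ≤ (U₁.card : ℝ) → ε * (V₂.card : ℝ) ≤ (U₂.card : ℝ) →
    d * (U₁.card : ℝ) * (U₂.card : ℝ) ≤
      (((U₁ ×ˢ U₂).filter (fun p => A p.1 p.2)).card : ℝ)) ∧
  (∀ x ∈ V₁, d * (V₂.card : ℝ) ≤ ((V₂.filter (fun y => A x y)).card : ℝ)) ∧
  (∀ y ∈ V₂, d * (V₁.card : ℝ) ≤ ((V₁.filter (fun x => A x y)).card : ℝ))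

/-- Number of ordered triples `(x₁,x₂,x₃) ∈ U₁ × U₂ × U₃` with `{x₁,x₂,x₃}` an edge. -/
noncomputable def tripCount {V : Type*} (E : Set (Finset V)) (U₁ U₂ U₃ : Finset V) : ℕ :=
  ((U₁ ×ˢ U₂ ×ˢ U₃).filter
    (fun p => ({p.1, p.2.1, p.2.2} : Finset V) ∈ E)).card

/-- Density of the triple `(U₁,U₂,U₃)` in a `3`-graph. -/
noncomputable def tripDensity {V : Type*} (E : Set (Finset V)) (U₁ U₂ U₃ : Finset V) : ℝ :=
  (tripCount E U₁ U₂ U₃ : ℝ) / ((U₁.card : ℝ) * (U₂.card : ℝ) * (U₃.card : ℝ))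

/-- Degree of a vertex in a hypergraph: the number of edges containing it. -/
noncomputable def hDeg {V : Type*} [Fintype V] (E : Set (Finset V)) (v : V) : ℕ :=
  ((univ : Finset (Finset V)).filter (fun e => e ∈ E ∧ v ∈ e)).card

/-- Weak `(ε,d)`-regularity of a 3-partite triple in a 3-graph. -/
def TripReg {V : Type*} (ε d : ℝ) (E : Set (Finset V)) (V₁ V₂ V₃ : Finset V) : Prop :=
  d ≤ tripDensity E V₁ V₂ V₃ ∧
  ∀ U₁ ⊆ V₁, ∀ U₂ ⊆ V₂, ∀ U₃ ⊆ V₃,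
    ε * (V₁.card : ℝ) ≤ (U₁.card : ℝ) → ε * (V₂.card : ℝ) ≤ (U₂.card : ℝ) →
    ε * (V₃.card : ℝ) ≤ (U₃.card : ℝ) →
    |tripDensity E U₁ U₂ U₃ - tripDensity E V₁ V₂ V₃| < ε

/-- Weak `(ε,d)`-half-superregularity of a 3-partite triple in a 3-graph. -/
def TripHalfSuper {V : Type*} (ε d : ℝ) (E : Set (Finset V)) (V₁ V₂ V₃ : Finset V) : Prop :=
  (∀ U₁ ⊆ V₁, ∀ U₂ ⊆ V₂, ∀ U₃ ⊆ V₃,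
    ε * (V₁.card : ℝ) ≤ (U₁.card : ℝ) → ε * (V₂.card : ℝ) ≤ (U₂.card : ℝ) →
    ε * (V₃.card : ℝ) ≤ (U₃.card : ℝ) →
    d * (U₁.card : ℝ) * (U₂.card : ℝ) * (U₃.card : ℝ) ≤ (tripCount E U₁ U₂ U₃ : ℝ)) ∧
  (∀ x ∈ V₁, d * (V₂.card : ℝ) * (V₃.card : ℝ) ≤ (tripCount E {x} V₂ V₃ : ℝ)) ∧
  (∀ y ∈ V₂, d * (V₁.card : ℝ) * (V₃.card : ℝ) ≤ (tripCount E V₁ {y} V₃ : ℝ)) ∧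
  (∀ z ∈ V₃, d * (V₁.card : ℝ) * (V₂.card : ℝ) ≤ (tripCount E V₁ V₂ {z} : ℝ))

/-- A copy of the 1-expansion of `H` in a 3-graph with edge set `E`. -/
def HasExpansionCopy {V W : Type*} (E : Set (Finset V)) (H : SimpleGraph W) : Prop :=
  ∃ (ρv : W → V) (ρe : Sym2 W → V),
    Function.Injective ρv ∧ Set.InjOn ρe H.edgeSet ∧
    (∀ x, ∀ e ∈ H.edgeSet, ρv x ≠ ρe e) ∧
    ∀ x y, H.Adj x y → ({ρv x, ρv y, ρe s(x, y)} : Finset V) ∈ E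

/-- Number of edges (as functions picking one vertex per part) inside the sets `U i`. -/
noncomputable def kCount {V : Type*} {k : ℕ} (E : Set (Fin k → V)) (U : Fin k → Finset V) : ℕ :=
  ((Fintype.piFinset U).filter (fun e => e ∈ E)).card

/-- Density of a `k`-tuple in a `k`-partite `k`-graph. -/
noncomputable def kDensity {V : Type*} {k : ℕ} (E : Set (Fin k → V)) (U : Fin k → Finset V) : ℝ :=
  (kCount E U : ℝ) / ∏ i, ((U i).card : ℝ)

/-- Degree of `x` as a vertex of the `i`-th part of a `k`-partite `k`-graph. -/
noncomputable def kDegAt {V : Type*} [Fintype V] {k : ℕ} (E : Set (Fin k → V))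
    (i : Fin k) (x : V) : ℕ :=
  ((univ : Finset (Fin k → V)).filter (fun e => e ∈ E ∧ e i = x)).card

/-- Weak ε-regularity of a `k`-tuple in a `k`-partite `k`-graph. -/
def KTupleReg {V : Type*} {k : ℕ} (ε : ℝ) (E : Set (Fin k → V)) (Wp : Fin k → Finset V) : Prop :=
  ∀ U : Fin k → Finset V, (∀ i, U i ⊆ Wp i) →
    (∀ i, ε * ((Wp i).card : ℝ) ≤ ((U i).card : ℝ)) →
    |kDensity E U - kDensity E Wp| < ε

/-- Weak `(ε,d)`-regularity of a `k`-partite `k`-graph with parts `P`. -/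
def KReg {V : Type*} {k : ℕ} (ε d : ℝ) (E : Set (Fin k → V)) (P : Fin k → Finset V) : Prop :=
  d ≤ kDensity E P ∧
  ∀ U : Fin k → Finset V, (∀ i, U i ⊆ P i) →
    (∀ i, ε * ((P i).card : ℝ) ≤ ((U i).card : ℝ)) →
    |kDensity E U - kDensity E P| < ε

/-- Weak `(ε,d)`-superregularity of a `k`-partite `k`-graph with parts `P`. -/
def KSuper {V : Type*} [Fintype V] {k : ℕ} (ε d : ℝ) (E : Set (Fin k → V))
    (P : Fin k → Finset V) : Prop :=
  KReg ε d E P ∧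
  ∀ i, ∀ x ∈ P i, d * (∏ j, ((P j).card : ℝ)) / ((P i).card : ℝ) ≤ (kDegAt E i x : ℝ)

/-- Weak `(ε,d)`-half-superregularity of a `k`-partite `k`-graph with parts `P`. -/
def KHalfSuper {V : Type*} [Fintype V] {k : ℕ} (ε d : ℝ) (E : Set (Fin k → V))
    (P : Fin k → Finset V) : Prop :=
  (∀ U : Fin k → Finset V, (∀ i, U i ⊆ P i) →
    (∀ i, ε * ((P i).card : ℝ) ≤ ((U i).card : ℝ)) →
    d ≤ kDensity E U) ∧
  ∀ i, ∀ x ∈ P i, d * (∏ j, ((P j).card : ℝ)) / ((P i).card : ℝ) ≤ (kDegAt E i x : ℝ)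

/-- An `R`-template: vertex clusters `Vc`, colour clusters `Cc i j` (one for each
edge `ij` of `R`), and for each colour `c ∈ Cc i j` a bipartite graph `Ge c i j`
with parts `Vc i`, `Vc j`.  The graph `G_c` of the collection is the union of the
`Ge c i j` over the edges `ij` of `R` whose colour cluster contains `c`. -/
structure GTemplate (V C : Type*) (r : ℕ) where
  R : SimpleGraph (Fin r)
  Vc : Fin r → Finset V
  Cc : Fin r → Fin r → Finset C
  Ge : C → Fin r → Fin r → SimpleGraph V
  Cc_symm : ∀ i j, Cc i j = Cc j i
  Ge_symm : ∀ c i j, Ge c i j = Ge c j i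
  Vc_disj : ∀ i j, i ≠ j → Disjoint (Vc i) (Vc j)
  Cc_support : ∀ i j, ¬ R.Adj i j → Cc i j = ∅
  Ge_support : ∀ c i j, c ∉ Cc i j → Ge c i j = ⊥
  Ge_bipartite : ∀ c i j x y, (Ge c i j).Adj x y →
    (x ∈ Vc i ∧ y ∈ Vc j) ∨ (x ∈ Vc j ∧ y ∈ Vc i)

namespace GTemplate

variable {V C : Type*} {r : ℕ}

/-- The graph `G_c` of the template: the union of the bipartite pieces. -/
noncomputable def Gc (T : GTemplate V C r) (c : C) : SimpleGraph V :=
  ⨆ i, ⨆ j, T.Ge c i j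

/-- `T` is an `R`-template with parameters `(m, ε, d, δ)`. -/
def IsParam (T : GTemplate V C r) (m ε d δ : ℝ) : Prop :=
  (∀ j, m ≤ ((T.Vc j).card : ℝ) ∧ ((T.Vc j).card : ℝ) ≤ m / δ) ∧
  (∀ i j, T.R.Adj i j → δ * m ≤ ((T.Cc i j).card : ℝ)) ∧
  (∀ i j, T.R.Adj i j →
    ColReg ε d (fun c => T.Ge c i j) (T.Vc i) (T.Vc j) (T.Cc i j))

/-- `T` is a super `R`-template with parameters `(m, ε, d, δ)`. -/
def IsSuperParam (T : GTemplate V C r) (m ε d δ : ℝ) : Prop :=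
  (∀ j, m ≤ ((T.Vc j).card : ℝ) ∧ ((T.Vc j).card : ℝ) ≤ m / δ) ∧
  (∀ i j, T.R.Adj i j → δ * m ≤ ((T.Cc i j).card : ℝ)) ∧
  (∀ i j, T.R.Adj i j →
    ColSuperReg ε d (fun c => T.Ge c i j) (T.Vc i) (T.Vc j) (T.Cc i j))

/-- `T` is a half-super `R`-template with parameters `(m, ε, d, δ)`. -/
def IsHalfSuperParam (T : GTemplate V C r) (m ε d δ : ℝ) : Prop :=
  (∀ j, m ≤ ((T.Vc j).card : ℝ) ∧ ((T.Vc j).card : ℝ) ≤ m / δ) ∧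
  (∀ i j, T.R.Adj i j → δ * m ≤ ((T.Cc i j).card : ℝ)) ∧
  (∀ i j, T.R.Adj i j →
    ColHalfSuperReg ε d (fun c => T.Ge c i j) (T.Vc i) (T.Vc j) (T.Cc i j))

/-- `T` is a semi-super `R`-template with parameters `(m, ε, d, δ)`. -/
def IsSemiSuperParam (T : GTemplate V C r) (m ε d δ : ℝ) : Prop :=
  T.IsParam m ε d δ ∧
  ∀ i j, T.R.Adj i j →
    (∀ v ∈ T.Vc i, d * ((T.Vc j).card : ℝ) * ((T.Cc i j).card : ℝ) ≤
      ∑ c ∈ T.Cc i j, (degIn (T.Ge c i j) v (T.Vc j) : ℝ)) ∧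
    (∀ v ∈ T.Vc j, d * ((T.Vc i).card : ℝ) * ((T.Cc i j).card : ℝ) ≤
      ∑ c ∈ T.Cc i j, (degIn (T.Ge c i j) v (T.Vc i) : ℝ))

/-- The template is rainbow: the colour clusters are pairwise disjoint. -/
def Rainbow (T : GTemplate V C r) : Prop :=
  ∀ i j k l, T.R.Adj i j → T.R.Adj k l → s(i, j) ≠ s(k, l) →
    Disjoint (T.Cc i j) (T.Cc k l)

/-- Adjacency in the `l`-thick graph of the template, between clusters `i` and `j`. -/
def ThickAdj (T : GTemplate V C r) (l : ℝ) (i j : Fin r) (x y : V) : Prop :=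
  l * ((T.Cc i j).card : ℝ) ≤
    (((T.Cc i j).filter (fun c => (T.Ge c i j).Adj x y)).card : ℝ)

end GTemplate

/-! ## Generic lemmas -/

theorem bu_sdr {ι α : Type*} [Nonempty α] (I : Finset ι) (N : ι → Finset α)
    (h : ∀ i ∈ I, I.card ≤ (N i).card) :
    ∃ f : ι → α, Set.InjOn f I ∧ ∀ i ∈ I, f i ∈ N i := by
  have key : ∀ J : Finset ι, J ⊆ I → ∃ f : ι → α, Set.InjOn f J ∧ ∀ i ∈ J, f i ∈ N i := by
    intro J
    induction J using Finset.induction_on with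
    | empty => intro _; exact ⟨fun _ => Classical.arbitrary α, by simp, by simp⟩
    | insert a J ha ih =>
      intro hJ
      obtain ⟨f, hf, hfN⟩ := ih (fun x hx => hJ (mem_insert_of_mem hx))
      have haI : a ∈ I := hJ (mem_insert_self _ _)
      have h1 : (J.image f).card < (N a).card := by
        calc (J.image f).card ≤ J.card := card_image_le
          _ < (insert a J).card := by rw [card_insert_of_notMem ha]; omega
          _ ≤ I.card := card_le_card hJ
          _ ≤ _ := h a haI
      obtain ⟨v, hv, hv'⟩ := Finset.exists_mem_notMem_of_card_lt_card h1
      refine ⟨Function.update f a v, ?_, ?_⟩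
      · have hne : ∀ x ∈ J, x ≠ a := fun x hx e => ha (e ▸ hx)
        intro x hx y hy hxy
        simp only [coe_insert, Set.mem_insert_iff, mem_coe] at hx hy
        rcases hx with rfl | hx <;> rcases hy with rfl | hy
        · rfl
        · rw [Function.update_self, Function.update_of_ne (hne y hy)] at hxy
          exact absurd (hxy ▸ mem_image_of_mem f hy) hv'
        · rw [Function.update_self, Function.update_of_ne (hne x hx)] at hxy
          exact absurd (hxy ▸ mem_image_of_mem f hx) hv'
        · rw [Function.update_of_ne (hne x hx), Function.update_of_ne (hne y hy)] at hxy
          exact hf hx hy hxy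
      · intro i hi
        rcases mem_insert.1 hi with rfl | hi
        · rwa [Function.update_self]
        · rw [Function.update_of_ne (fun (e : i = a) => ha (e ▸ hi))]; exact hfN i hi
  exact key I (Subset.refl _)

theorem bu_hall_half {V : Type*} {p : ℕ} (U : Finset V) (hU : U.card = p)
    (R : Fin p → V → Prop)
    (h1 : ∀ s, 2 * (U.filter (fun u => ¬ R s u)).card ≤ p)
    (h2 : ∀ u ∈ U, 2 * ((univ : Finset (Fin p)).filter (fun s => ¬ R s u)).card ≤ p) :
    ∃ f : Fin p → V, Function.Injective f ∧ ∀ s, f s ∈ U ∧ R s (f s) := by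
  have hall : ∀ A : Finset (Fin p), A.card ≤ (A.biUnion (fun s => U.filter (fun u => R s u))).card := by
    intro A
    by_contra hcon
    push Not at hcon
    have hA : A.Nonempty := by
      rcases A.eq_empty_or_nonempty with rfl | h
      · simp at hcon
      · exact h
    obtain ⟨s, hs⟩ := hA
    have hsub : U.filter (fun u => R s u) ⊆ A.biUnion (fun s => U.filter (fun u => R s u)) :=
      subset_biUnion_of_mem (fun s => U.filter (fun u => R s u)) hs
    have h3 := card_le_card hsub
    have h4 := card_filter_add_card_filter_not (s := U) (fun u => R s u)
    have h5 := h1 s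
    have hAp : A.card ≤ p := by simpa using card_le_univ A
    obtain ⟨u, hu, hu'⟩ := Finset.exists_mem_notMem_of_card_lt_card
      (show (A.biUnion (fun s => U.filter (fun u => R s u))).card < U.card by omega)
    have h6 := h2 u hu
    have h7 : A ⊆ (univ : Finset (Fin p)).filter (fun s => ¬ R s u) := by
      intro t ht
      simp only [mem_filter, mem_univ, true_and]
      intro hR
      exact hu' (mem_biUnion.2 ⟨t, ht, mem_filter.2 ⟨hu, hR⟩⟩)
    have h8 := card_le_card h7
    omega
  obtain ⟨f, hf, hf'⟩ := (Finset.all_card_le_biUnion_card_iff_exists_injective _).1 hall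
  exact ⟨f, hf, fun s => mem_filter.1 (hf' s)⟩

/-- Star gadget absorber. -/
theorem bu_gadget {V : Type*} [Nonempty V] (p L q x : ℕ) (N : Fin p → Fin (L+1) → Finset V)
    (S F : Finset V)
    (g1 : ∀ s l, l ≠ 0 → p * L + F.card ≤ (N s l ∩ N s 0).card)
    (g2 : ∀ s, (S.filter (fun c => ∀ l, c ∉ N s l)).card ≤ x) (hx : 2 * x ≤ p)
    (hS : q + 2 * x + F.card + p * L ≤ S.card) :
    ∃ B0 B1 : Finset V, Disjoint B0 B1 ∧ Disjoint B0 F ∧ Disjoint B1 F ∧ B1 ⊆ S ∧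
      B0.card = p * L ∧ B1.card = q ∧ (∀ b ∈ B0, ∃ s, b ∈ N s 0) ∧
      ∀ U ⊆ B1, U.card = p → ∃ f : Fin p → Fin (L+1) → V,
        (∀ s l s' l', f s l = f s' l' → s = s' ∧ l = l') ∧
        ∀ s l, f s l ∈ N s l ∧ f s l ∈ B0 ∪ U := by
  set I : Finset (Fin p × Fin (L+1)) := (univ : Finset (Fin p)) ×ˢ ((univ : Finset (Fin (L+1))).erase 0) with hI
  have hIc : I.card = p * L := by
    rw [hI, card_product, card_erase_of_mem (mem_univ _)]; simp
  obtain ⟨b, hbinj, hb⟩ := bu_sdr I (fun t => (N t.1 t.2 ∩ N t.1 0) \ F) (by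
    rintro ⟨s, l⟩ hsl
    have hl : l ≠ 0 := by simp [hI] at hsl; exact hsl
    have := g1 s l hl
    have h2 := le_card_sdiff F (N s l ∩ N s 0)
    simp only
    omega)
  have hbI : ∀ s l, l ≠ 0 → (s, l) ∈ I := fun s l hl => by simp [hI, hl]
  set B0 := I.image b with hB0
  have hB0c : B0.card = p * L := by rw [hB0, card_image_of_injOn hbinj, hIc]
  set bad := S.filter (fun c => p < 2 * ((univ : Finset (Fin p)).filter (fun s => ∀ l, c ∉ N s l)).card) with hbad
  have hbadc : bad.card ≤ 2 * x := by
    have dc : ∑ c ∈ bad, ((univ : Finset (Fin p)).filter (fun s => ∀ l, c ∉ N s l)).card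
        = ∑ s : Fin p, (bad.filter (fun c => ∀ l, c ∉ N s l)).card := by
      simp only [card_filter]; rw [sum_comm]
    have h1 : ∑ s : Fin p, (bad.filter (fun c => ∀ l, c ∉ N s l)).card ≤ p * x := by
      calc _ ≤ ∑ s : Fin p, x := sum_le_sum (fun s _ =>
              (card_le_card (filter_subset_filter _ (filter_subset _ _))).trans (g2 s))
        _ = p * x := by simp
    have h2 : bad.card * (p + 1) ≤ 2 * ∑ c ∈ bad, ((univ : Finset (Fin p)).filter (fun s => ∀ l, c ∉ N s l)).card := by
      rw [mul_sum]
      calc _ = ∑ c ∈ bad, (p + 1) := by simp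
        _ ≤ _ := sum_le_sum (fun c hc => by have := (mem_filter.1 hc).2; omega)
    rw [dc] at h2
    by_contra hcon
    push Not at hcon
    nlinarith
  have hB1 : q ≤ (S \ (bad ∪ F ∪ B0)).card := by
    have h2 := le_card_sdiff (bad ∪ F ∪ B0) S
    have h3 := card_union_le (bad ∪ F) B0
    have h4 := card_union_le bad F
    omega
  obtain ⟨B1, hB1s, hB1c⟩ := exists_subset_card_eq hB1
  have hB1m : ∀ c ∈ B1, c ∈ S ∧ c ∉ bad ∧ c ∉ F ∧ c ∉ B0 := by
    intro c hc
    have := hB1s hc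
    simp only [mem_sdiff, mem_union] at this
    tauto
  have hB0m : ∀ s l, l ≠ 0 → b (s, l) ∈ B0 := fun s l hl => mem_image_of_mem b (hbI s l hl)
  refine ⟨B0, B1, ?_, ?_, ?_, fun c hc => (hB1m c hc).1, hB0c, hB1c, ?_, ?_⟩
  · rw [disjoint_left]; intro c h1 h2; exact (hB1m c h2).2.2.2 h1
  · rw [disjoint_left]; intro c h1 h2
    obtain ⟨t, ht, rfl⟩ := mem_image.1 h1
    exact (mem_sdiff.1 (hb t ht)).2 h2
  · rw [disjoint_left]; intro c h1 h2; exact (hB1m c h1).2.2.1 h2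
  · intro c h1
    obtain ⟨t, ht, rfl⟩ := mem_image.1 h1
    exact ⟨t.1, (mem_inter.1 (mem_sdiff.1 (hb t ht)).1).2⟩
  · intro U hU hUc
    obtain ⟨g, hg, hgU⟩ := bu_hall_half U hUc (fun s u => ∃ l, u ∈ N s l) (by
      intro s
      refine le_trans (Nat.mul_le_mul_left 2 (le_trans (card_le_card ?_) (g2 s))) hx
      intro c hc
      simp only [mem_filter, not_exists] at hc ⊢
      exact ⟨(hB1m c (hU hc.1)).1, hc.2⟩) (by
      intro u hu
      have h1 := hB1m u (hU hu)
      by_contra hcon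
      apply h1.2.1
      rw [hbad, mem_filter]
      refine ⟨h1.1, ?_⟩
      simp only [not_exists] at hcon
      omega)
    choose hgU' l0 hl0 using hgU
    have hgB1 : ∀ s, g s ∈ B1 := fun s => hU (hgU' s)
    have hgb : ∀ s s' l, l ≠ 0 → g s ≠ b (s', l) := by
      intro s s' l hl e
      exact (hB1m _ (hgB1 s)).2.2.2 (e ▸ hB0m s' l hl)
    have hnz : ∀ s l, l ≠ l0 s → (if l = 0 then l0 s else l) ≠ 0 := by
      intro s l hl
      split_ifs with h
      · intro h'; apply hl; rw [h, h']
      · exact h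
    refine ⟨fun s l => if l = l0 s then g s else b (s, if l = 0 then l0 s else l), ?_, ?_⟩
    · intro s l s' l' hfe
      simp only at hfe
      by_cases h1 : l = l0 s <;> by_cases h2 : l' = l0 s'
      · rw [if_pos h1, if_pos h2] at hfe
        have := hg hfe
        subst this
        exact ⟨rfl, h1.trans h2.symm⟩
      · rw [if_pos h1, if_neg h2] at hfe
        exact absurd hfe (hgb _ _ _ (hnz _ _ h2))
      · rw [if_neg h1, if_pos h2] at hfe
        exact absurd hfe.symm (hgb _ _ _ (hnz _ _ h1))
      · rw [if_neg h1, if_neg h2] at hfe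
        have := hbinj (hbI _ _ (hnz _ _ h1)) (hbI _ _ (hnz _ _ h2)) hfe
        rw [Prod.mk.injEq] at this
        obtain ⟨rfl, h3⟩ := this
        refine ⟨rfl, ?_⟩
        split_ifs at h3 with h4 h5 h5
        · rw [h4, h5]
        · exact absurd h3.symm h2
        · exact absurd h3 h1
        · exact h3
    · intro s l
      simp only
      split_ifs with h1 h2
      · exact ⟨h1 ▸ hl0 s, mem_union_right _ (hgU' s)⟩
      · have hn := hnz s l h1
        rw [if_pos h2] at hn
        have := mem_inter.1 (mem_sdiff.1 (hb _ (hbI s _ hn))).1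
        exact ⟨h2 ▸ this.2, mem_union_left _ (hB0m s _ hn)⟩
      · have := mem_inter.1 (mem_sdiff.1 (hb _ (hbI s l h2))).1
        exact ⟨this.1, mem_union_left _ (hB0m s _ h2)⟩

theorem bu_dc {α β : Type*} (A : Finset α) (B : Finset β) (R : α → β → Prop) :
    ∑ a ∈ A, ((B.filter (fun b => R a b)).card : ℝ) =
      ∑ b ∈ B, ((A.filter (fun a => R a b)).card : ℝ) := by
  simp only [card_filter, Nat.cast_sum]; rw [sum_comm]

theorem bu_markov {α : Type*} (A : Finset α) (f : α → ℝ) (M t : ℝ) (ht : 0 ≤ t)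
    (hM : ∀ a ∈ A, f a ≤ M) :
    ∑ a ∈ A, f a ≤ M * ((A.filter (fun a => t ≤ f a)).card : ℝ) + t * (A.card : ℝ) := by
  rw [← sum_filter_add_sum_filter_not A (fun a => t ≤ f a)]
  have h1 : ∑ a ∈ A.filter (fun a => t ≤ f a), f a ≤ M * ((A.filter (fun a => t ≤ f a)).card : ℝ) := by
    calc _ ≤ ∑ a ∈ A.filter (fun a => t ≤ f a), M := sum_le_sum (fun a ha => hM a (mem_filter.1 ha).1)
      _ = _ := by rw [sum_const, nsmul_eq_mul]; ring
  have h2 : ∑ a ∈ A.filter (fun a => ¬ t ≤ f a), f a ≤ t * (A.card : ℝ) := by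
    calc _ ≤ ∑ a ∈ A.filter (fun a => ¬ t ≤ f a), t :=
          sum_le_sum (fun a ha => (not_le.1 (mem_filter.1 ha).2).le)
      _ = ((A.filter (fun a => ¬ t ≤ f a)).card : ℝ) * t := by rw [sum_const, nsmul_eq_mul]
      _ ≤ (A.card : ℝ) * t := by
          apply mul_le_mul_of_nonneg_right _ ht
          exact_mod_cast card_le_card (filter_subset _ _)
      _ = _ := by ring
  linarith

/-- Cluster lemma (dependent random choice by averaging). -/
theorem bu_cluster {α γ : Type*} (P : Finset α) (C : Finset γ) (N : α → γ → Prop) (d : ℝ)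
    (hd : 0 < d) (hP : P.Nonempty) (hC : C.Nonempty)
    (h : ∀ c ∈ C, d * (P.card : ℝ) ≤ ((P.filter (fun e => N e c)).card : ℝ)) :
    ∃ S ⊆ C, ∃ P0 ⊆ P, (d^2/16) * (C.card : ℝ) ≤ (S.card : ℝ) ∧
      (d/8) * (P.card : ℝ) ≤ (P0.card : ℝ) ∧
      ∀ e0 ∈ P0, ∀ c ∈ S, (d^2/32) * (P.card : ℝ) ≤
        ((P.filter (fun e => N e c ∧ (d^3/256) * (C.card : ℝ) ≤
          ((C.filter (fun c' => N e c' ∧ N e0 c')).card : ℝ))).card : ℝ) := by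
  have hPc : (0 : ℝ) < P.card := by exact_mod_cast hP.card_pos
  have hCc : (0 : ℝ) < C.card := by exact_mod_cast hC.card_pos
  set κ := d^3/256 with hκ
  have hκ0 : 0 < κ := by positivity
  set Pt := P.filter (fun e => (d/2) * (C.card : ℝ) ≤ ((C.filter (fun c => N e c)).card : ℝ)) with hPt
  have hPtP : Pt ⊆ P := filter_subset _ _
  set Pc : γ → Finset α := fun c => Pt.filter (fun e => N e c) with hPcdef
  -- total size
  have s1 : (d/2) * (P.card : ℝ) * (C.card : ℝ) ≤ ∑ c ∈ C, ((Pc c).card : ℝ) := by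
    have e1 : ∑ c ∈ C, ((P.filter (fun e => N e c)).card : ℝ) = ∑ e ∈ P, ((C.filter (fun c => N e c)).card : ℝ) :=
      (bu_dc P C N).symm
    have e2 : ∑ c ∈ C, ((Pc c).card : ℝ) = ∑ e ∈ Pt, ((C.filter (fun c => N e c)).card : ℝ) :=
      (bu_dc Pt C N).symm
    have e3 : d * (P.card : ℝ) * (C.card : ℝ) ≤ ∑ c ∈ C, ((P.filter (fun e => N e c)).card : ℝ) := by
      calc _ = ∑ c ∈ C, d * (P.card : ℝ) := by rw [sum_const, nsmul_eq_mul]; ring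
        _ ≤ _ := sum_le_sum h
    rw [e1, ← sum_filter_add_sum_filter_not P (fun e => (d/2) * (C.card : ℝ) ≤ ((C.filter (fun c => N e c)).card : ℝ))] at e3
    have e4 : ∑ a ∈ P.filter (fun e => ¬ (d/2) * (C.card : ℝ) ≤ ((C.filter (fun c => N e c)).card : ℝ)), ((C.filter (fun c => N a c)).card : ℝ) ≤ (d/2) * (C.card : ℝ) * (P.card : ℝ) := by
      calc _ ≤ ∑ a ∈ P.filter (fun e => ¬ (d/2) * (C.card : ℝ) ≤ ((C.filter (fun c => N e c)).card : ℝ)), (d/2) * (C.card : ℝ) :=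
            sum_le_sum (fun a ha => (not_le.1 (mem_filter.1 ha).2).le)
        _ = ((P.filter (fun e => ¬ (d/2) * (C.card : ℝ) ≤ ((C.filter (fun c => N e c)).card : ℝ))).card : ℝ) * ((d/2) * (C.card : ℝ)) := by rw [sum_const, nsmul_eq_mul]
        _ ≤ (P.card : ℝ) * ((d/2) * (C.card : ℝ)) := by
            apply mul_le_mul_of_nonneg_right _ (by positivity)
            exact_mod_cast card_le_card (filter_subset _ _)
        _ = _ := by ring
    rw [e2]
    linarith
  -- bad pairs
  set bad : α → α → Prop := fun e e' => ((C.filter (fun c => N e c ∧ N e' c)).card : ℝ) < κ * (C.card : ℝ) with hbad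
  set BP := (Pt ×ˢ Pt).filter (fun q => bad q.1 q.2) with hBP
  set Bc : γ → Finset (α × α) := fun c => BP.filter (fun q => N q.1 c ∧ N q.2 c) with hBc
  have s2 : ∑ c ∈ C, ((Bc c).card : ℝ) ≤ κ * (C.card : ℝ) * (P.card : ℝ)^2 := by
    have e1 : ∑ c ∈ C, ((Bc c).card : ℝ) = ∑ q ∈ BP, ((C.filter (fun c => N q.1 c ∧ N q.2 c)).card : ℝ) :=
      by convert (bu_dc BP C (fun q c => N q.1 c ∧ N q.2 c)).symm
    rw [e1]
    calc _ ≤ ∑ q ∈ BP, κ * (C.card : ℝ) := sum_le_sum (fun q hq => (mem_filter.1 hq).2.le)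
      _ = (BP.card : ℝ) * (κ * (C.card : ℝ)) := by rw [sum_const, nsmul_eq_mul]
      _ ≤ ((P.card : ℝ)^2) * (κ * (C.card : ℝ)) := by
          apply mul_le_mul_of_nonneg_right _ (by positivity)
          have : BP.card ≤ P.card * P.card := by
            calc BP.card ≤ (Pt ×ˢ Pt).card := card_le_card (filter_subset _ _)
              _ = Pt.card * Pt.card := card_product _ _
              _ ≤ _ := Nat.mul_le_mul (card_le_card hPtP) (card_le_card hPtP)
          rw [sq]; exact_mod_cast this
      _ = _ := by ring
  obtain ⟨c, hc, hcc⟩ : ∃ c ∈ C, (d/4) * (P.card : ℝ)^2 ≤ ((Pc c).card : ℝ) * (P.card : ℝ) - (d/(4*κ)) * ((Bc c).card : ℝ) := by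
    by_contra hcon
    push Not at hcon
    have h1 := sum_lt_sum_of_nonempty hC hcon
    rw [sum_sub_distrib, ← sum_mul, ← mul_sum, sum_const, nsmul_eq_mul] at h1
    have h2 : (d/(4*κ)) * ∑ c ∈ C, ((Bc c).card : ℝ) ≤ (d/(4*κ)) * (κ * (C.card : ℝ) * (P.card : ℝ)^2) :=
      mul_le_mul_of_nonneg_left s2 (by positivity)
    have h3 : (d/(4*κ)) * (κ * (C.card : ℝ) * (P.card : ℝ)^2) = (d/4) * ((C.card : ℝ) * (P.card : ℝ)^2) := by
      field_simp
    have h4 := mul_le_mul_of_nonneg_right s1 hPc.le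
    nlinarith
  set Q := Pc c with hQ
  have hQP : Q ⊆ P := (filter_subset _ _).trans hPtP
  have hQt : Q ⊆ Pt := filter_subset _ _
  have hQP' : (Q.card : ℝ) ≤ P.card := by exact_mod_cast card_le_card hQP
  have hBc0 : (0:ℝ) ≤ ((Bc c).card : ℝ) := by positivity
  have q1 : (d/4) * (P.card : ℝ) ≤ (Q.card : ℝ) := by
    have : 0 ≤ (d/(4*κ)) * ((Bc c).card : ℝ) := by positivity
    have h2 : (d/4) * (P.card : ℝ) * (P.card : ℝ) ≤ (Q.card : ℝ) * (P.card : ℝ) := by nlinarith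
    exact le_of_mul_le_mul_right h2 hPc
  have q2 : ((Bc c).card : ℝ) ≤ (4*κ/d) * ((Q.card : ℝ) * (P.card : ℝ)) := by
    have : (d/(4*κ)) * ((Bc c).card : ℝ) ≤ (Q.card : ℝ) * (P.card : ℝ) := by nlinarith [sq_nonneg (P.card : ℝ)]
    calc ((Bc c).card : ℝ) = (4*κ/d) * ((d/(4*κ)) * ((Bc c).card : ℝ)) := by field_simp
      _ ≤ _ := mul_le_mul_of_nonneg_left this (by positivity)
  refine ⟨C.filter (fun c' => (d^2/16) * (P.card : ℝ) ≤ ((Q.filter (fun e => N e c')).card : ℝ)), filter_subset _ _,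
    Q.filter (fun e0 => ((Q.filter (fun e => bad e e0)).card : ℝ) ≤ (d^2/32) * (P.card : ℝ)), (filter_subset _ _).trans hQP, ?_, ?_, ?_⟩
  · have h1 := bu_markov C (fun c' => ((Q.filter (fun e => N e c')).card : ℝ)) (P.card : ℝ) ((d^2/16) * (P.card : ℝ)) (by positivity) (by
      intro c' _
      exact_mod_cast card_le_card ((filter_subset _ _).trans hQP))
    have h2 : (d^2/8) * (P.card : ℝ) * (C.card : ℝ) ≤ ∑ c' ∈ C, ((Q.filter (fun e => N e c')).card : ℝ) := by
      rw [← bu_dc Q C N]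
      calc _ = (d/4 * (P.card : ℝ)) * ((d/2) * (C.card : ℝ)) := by ring
        _ ≤ (Q.card : ℝ) * ((d/2) * (C.card : ℝ)) := mul_le_mul_of_nonneg_right q1 (by positivity)
        _ = ∑ e ∈ Q, (d/2) * (C.card : ℝ) := by rw [sum_const, nsmul_eq_mul]
        _ ≤ _ := sum_le_sum (fun e he => (mem_filter.1 (hQt he)).2)
    have h3 : (P.card : ℝ) * ((d^2/16) * (C.card : ℝ)) ≤ (P.card : ℝ) * ((C.filter (fun c' => (d^2/16) * (P.card : ℝ) ≤ ((Q.filter (fun e => N e c')).card : ℝ))).card : ℝ) := by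
      linarith
    exact le_of_mul_le_mul_left h3 hPc
  · have hb : ∑ e0 ∈ Q, ((Q.filter (fun e => bad e e0)).card : ℝ) ≤ ((Bc c).card : ℝ) := by
      rw [← Nat.cast_sum, ← Finset.card_sigma]
      have : ((Q.sigma fun e0 => Q.filter (fun e => bad e e0)).card) ≤ (Bc c).card := by
        apply card_le_card_of_injOn (fun q => (q.2, q.1))
        · rintro ⟨e0, e⟩ hq
          simp only [coe_sigma, Set.mem_sigma_iff, mem_coe, mem_filter] at hq
          obtain ⟨h1, h2, h3⟩ := hq
          have h4 := mem_filter.1 h1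
          have h5 := mem_filter.1 h2
          simp only [hBc, hBP, mem_coe, mem_filter, mem_product]
          exact ⟨⟨⟨h5.1, h4.1⟩, h3⟩, h5.2, h4.2⟩
        · rintro ⟨a, b⟩ _ ⟨a', b'⟩ _ h
          simp only [Prod.mk.injEq] at h
          obtain ⟨rfl, rfl⟩ := h
          rfl
      exact_mod_cast this
    set G := Q.filter (fun e0 => ((Q.filter (fun e => bad e e0)).card : ℝ) ≤ (d^2/32) * (P.card : ℝ)) with hG
    have h2 : ((Q.filter (fun e0 => ¬ ((Q.filter (fun e => bad e e0)).card : ℝ) ≤ (d^2/32) * (P.card : ℝ))).card : ℝ) * ((d^2/32) * (P.card : ℝ)) ≤ ((Bc c).card : ℝ) := by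
      calc _ = ∑ e0 ∈ Q.filter (fun e0 => ¬ ((Q.filter (fun e => bad e e0)).card : ℝ) ≤ (d^2/32) * (P.card : ℝ)), ((d^2/32) * (P.card : ℝ)) := by rw [sum_const, nsmul_eq_mul]
        _ ≤ ∑ e0 ∈ Q.filter (fun e0 => ¬ ((Q.filter (fun e => bad e e0)).card : ℝ) ≤ (d^2/32) * (P.card : ℝ)), ((Q.filter (fun e => bad e e0)).card : ℝ) :=
            sum_le_sum (fun a ha => (not_le.1 (mem_filter.1 ha).2).le)
        _ ≤ ∑ e0 ∈ Q, ((Q.filter (fun e => bad e e0)).card : ℝ) :=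
            sum_le_sum_of_subset_of_nonneg (filter_subset _ _) (fun _ _ _ => by positivity)
        _ ≤ _ := hb
    have h3 := card_filter_add_card_filter_not (s := Q) (fun e0 => ((Q.filter (fun e => bad e e0)).card : ℝ) ≤ (d^2/32) * (P.card : ℝ))
    have h4 : (4*κ/d) = d^2/64 := by rw [hκ]; field_simp; ring
    rw [h4] at q2
    set B := ((Q.filter (fun e0 => ¬ ((Q.filter (fun e => bad e e0)).card : ℝ) ≤ (d^2/32) * (P.card : ℝ))).card) with hB
    have h5 : (B : ℝ) * ((d^2/32) * (P.card : ℝ)) ≤ ((Q.card : ℝ)/2) * ((d^2/32) * (P.card : ℝ)) := by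
      calc _ ≤ _ := h2
        _ ≤ _ := q2
        _ = _ := by ring
    have h6 := le_of_mul_le_mul_right h5 (by positivity)
    have h7 : (G.card : ℝ) + (B : ℝ) = Q.card := by exact_mod_cast h3
    linarith
  · intro e0 he0 c' hc'
    have h1 := (mem_filter.1 he0).2
    have h2 := (mem_filter.1 hc').2
    have h3 : Q.filter (fun e => N e c') ⊆ P.filter (fun e => N e c' ∧ κ * (C.card : ℝ) ≤
          ((C.filter (fun c' => N e c' ∧ N e0 c')).card : ℝ)) ∪ Q.filter (fun e => bad e e0) := by
      intro e he
      obtain ⟨h4, h5⟩ := mem_filter.1 he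
      rw [mem_union, mem_filter, mem_filter]
      by_cases hbe : bad e e0
      · exact Or.inr ⟨h4, hbe⟩
      · exact Or.inl ⟨hQP h4, h5, not_lt.1 hbe⟩
    have h4 : ((Q.filter (fun e => N e c')).card : ℝ) ≤ ((P.filter (fun e => N e c' ∧ κ * (C.card : ℝ) ≤
          ((C.filter (fun c' => N e c' ∧ N e0 c')).card : ℝ))).card : ℝ) + ((Q.filter (fun e => bad e e0)).card : ℝ) := by
      exact_mod_cast (card_le_card h3).trans (card_union_le _ _)
    linarith

theorem bu_bins {W β : Type*} (Y : Finset W) (comp : W → β) (b q : ℕ) (hq : 1 ≤ q)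
    (hb : ∀ k, (Y.filter (fun w => comp w = k)).card ≤ b) :
    ∃ χ : β → Fin q, ∀ k, (Y.filter (fun w => χ (comp w) = k)).card * q ≤ Y.card + q * b := by
  have key : ∀ T : Finset β, ∃ χ : β → Fin q, ∀ k,
      (Y.filter (fun w => comp w ∈ T ∧ χ (comp w) = k)).card * q ≤ Y.card + q * b := by
    intro T
    induction T using Finset.induction_on with
    | empty => exact ⟨fun _ => ⟨0, hq⟩, by simp⟩
    | insert a T ha ih =>
      obtain ⟨χ, hχ⟩ := ih
      have hne : (univ : Finset (Fin q)).Nonempty := ⟨⟨0, hq⟩, mem_univ _⟩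
      obtain ⟨k0, _, hk0⟩ := exists_min_image univ
        (fun k => (Y.filter (fun w => comp w ∈ T ∧ χ (comp w) = k)).card) hne
      have hmin : (Y.filter (fun w => comp w ∈ T ∧ χ (comp w) = k0)).card * q ≤ Y.card := by
        calc _ = ∑ k : Fin q, (Y.filter (fun w => comp w ∈ T ∧ χ (comp w) = k0)).card := by
              simp [mul_comm]
          _ ≤ ∑ k : Fin q, (Y.filter (fun w => comp w ∈ T ∧ χ (comp w) = k)).card :=
              sum_le_sum (fun k hk => hk0 k hk)
          _ = ((univ : Finset (Fin q)).biUnion (fun k => Y.filter (fun w => comp w ∈ T ∧ χ (comp w) = k))).card := by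
              rw [card_biUnion]
              intro i _ j _ hij
              rw [Function.onFun, disjoint_left]
              intro w h1 h2
              exact hij ((mem_filter.1 h1).2.2.symm.trans (mem_filter.1 h2).2.2)
          _ ≤ Y.card := card_le_card (biUnion_subset.2 (fun k _ => filter_subset _ _))
      refine ⟨Function.update χ a k0, ?_⟩
      intro k
      by_cases hk : k = k0
      · subst hk
        have hsub : Y.filter (fun w => comp w ∈ insert a T ∧ Function.update χ a k (comp w) = k) ⊆
            Y.filter (fun w => comp w ∈ T ∧ χ (comp w) = k) ∪ Y.filter (fun w => comp w = a) := by
          intro w hw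
          obtain ⟨h1, h2, h3⟩ := mem_filter.1 hw
          rw [mem_union, mem_filter, mem_filter]
          by_cases hwa : comp w = a
          · exact Or.inr ⟨h1, hwa⟩
          · rw [Function.update_of_ne hwa] at h3
            exact Or.inl ⟨h1, (mem_insert.1 h2).resolve_left hwa, h3⟩
        have h1 := (card_le_card hsub).trans (card_union_le _ _)
        have h2 := hb a
        calc _ ≤ ((Y.filter (fun w => comp w ∈ T ∧ χ (comp w) = k)).card + b) * q :=
              Nat.mul_le_mul_right _ (by omega)
          _ ≤ _ := by rw [add_mul, mul_comm b q]; omega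
      · refine le_trans (Nat.mul_le_mul_right q (card_le_card ?_)) (hχ k)
        intro w hw
        obtain ⟨h1, h2, h3⟩ := mem_filter.1 hw
        rw [mem_filter]
        by_cases hwa : comp w = a
        · rw [hwa, Function.update_self] at h3; exact absurd h3.symm hk
        · rw [Function.update_of_ne hwa] at h3
          exact ⟨h1, (mem_insert.1 h2).resolve_left hwa, h3⟩
  obtain ⟨χ, hχ⟩ := key (Y.image comp)
  refine ⟨χ, fun k => ?_⟩
  refine le_trans (Nat.mul_le_mul_right q (card_le_card ?_)) (hχ k)
  intro w hw
  obtain ⟨h1, h2⟩ := mem_filter.1 hw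
  exact mem_filter.2 ⟨h1, mem_image_of_mem _ h1, h2⟩

theorem bu_select {W β τ : Type*} [Fintype τ] (Y : Finset W) (comp : W → β) (b q : ℕ) (hq : 1 ≤ q)
    (hb : ∀ k, (Y.filter (fun w => comp w = k)).card ≤ b) (Cand : τ → Finset W)
    (hC : ∀ t, Cand t ⊆ Y) :
    ∃ K ⊆ Y, (∀ w ∈ K, ∀ w' ∈ Y, comp w = comp w' → w' ∈ K) ∧
      K.card * q ≤ Fintype.card τ * (Y.card + q * b) ∧
      ∀ t, (Cand t).card ≤ q * (Cand t ∩ K).card := by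
  obtain ⟨χ, hχ⟩ := bu_bins Y comp b q hq hb
  have hne : (univ : Finset (Fin q)).Nonempty := ⟨⟨0, hq⟩, mem_univ _⟩
  have hbest : ∀ t, ∃ k : Fin q, (Cand t).card ≤ q * ((Cand t).filter (fun w => χ (comp w) = k)).card := by
    intro t
    obtain ⟨k0, _, hk0⟩ := exists_max_image univ
        (fun k => ((Cand t).filter (fun w => χ (comp w) = k)).card) hne
    refine ⟨k0, ?_⟩
    rw [card_eq_sum_card_fiberwise (f := fun w => χ (comp w)) (s := Cand t) (t := univ) (fun _ _ => mem_coe.2 (mem_univ _))]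
    calc _ ≤ ∑ k : Fin q, ((Cand t).filter (fun w => χ (comp w) = k0)).card := sum_le_sum (fun k hk => hk0 k hk)
      _ = _ := by simp
  choose κ hκ using hbest
  refine ⟨Y.filter (fun w => ∃ t, χ (comp w) = κ t), filter_subset _ _, ?_, ?_, ?_⟩
  · intro w hw w' hw' he
    obtain ⟨_, t, ht⟩ := mem_filter.1 hw
    exact mem_filter.2 ⟨hw', t, by rw [← he, ht]⟩
  · have hsub : Y.filter (fun w => ∃ t, χ (comp w) = κ t) ⊆ (univ : Finset τ).biUnion (fun t => Y.filter (fun w => χ (comp w) = κ t)) := by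
      intro w hw
      obtain ⟨h1, t, ht⟩ := mem_filter.1 hw
      exact mem_biUnion.2 ⟨t, mem_univ _, mem_filter.2 ⟨h1, ht⟩⟩
    calc _ ≤ (∑ t : τ, (Y.filter (fun w => χ (comp w) = κ t)).card) * q :=
          Nat.mul_le_mul_right _ ((card_le_card hsub).trans card_biUnion_le)
      _ = ∑ t : τ, (Y.filter (fun w => χ (comp w) = κ t)).card * q := sum_mul _ _ _
      _ ≤ ∑ t : τ, (Y.card + q * b) := sum_le_sum (fun t _ => hχ (κ t))
      _ = _ := by simp
  · intro t
    refine (hκ t).trans (Nat.mul_le_mul_left q (card_le_card ?_))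
    intro w hw
    obtain ⟨h1, h2⟩ := mem_filter.1 hw
    exact mem_inter.2 ⟨h1, mem_filter.2 ⟨hC t h1, t, h2⟩⟩

theorem bu_indep {W ι : Type*} [Fintype W] [Nonempty W] (I : Finset ι) (Cand : ι → Finset W) (conf : W → W → Prop)
    (hsym : ∀ x y, conf x y → conf y x) (K : ℕ) (hK1 : 1 ≤ K)
    (hK : ∀ w, ((univ : Finset W).filter (fun w' => conf w w')).card ≤ K)
    (hI : ∀ t ∈ I, I.card * K ≤ (Cand t).card) :
    ∃ w : ι → W, (∀ t ∈ I, w t ∈ Cand t) ∧ ∀ t ∈ I, ∀ t' ∈ I, t ≠ t' → ¬ conf (w t) (w t') := by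
  have key : ∀ J ⊆ I, ∃ w : ι → W, (∀ t ∈ J, w t ∈ Cand t) ∧ ∀ t ∈ J, ∀ t' ∈ J, t ≠ t' → ¬ conf (w t) (w t') := by
    intro J
    induction J using Finset.induction_on with
    | empty => intro _; exact ⟨fun _ => Classical.arbitrary W, by simp, by simp⟩
    | insert a J ha ih =>
      intro hJ
      obtain ⟨w, h1, h2⟩ := ih (fun x hx => hJ (mem_insert_of_mem hx))
      have haI : a ∈ I := hJ (mem_insert_self _ _)
      have hc : (J.biUnion (fun t => (univ : Finset W).filter (fun w' => conf (w t) w'))).card < (Cand a).card := by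
        have e1 : (J.biUnion (fun t => (univ : Finset W).filter (fun w' => conf (w t) w'))).card ≤ J.card * K :=
          card_biUnion_le_card_mul _ _ _ (fun t _ => hK _)
        have e2 : J.card + 1 ≤ I.card := by
          rw [← card_insert_of_notMem ha]; exact card_le_card hJ
        have e3 := Nat.mul_le_mul_right K e2
        have e4 := hI a haI
        have e5 : (J.card + 1) * K = J.card * K + K := by ring
        omega
      obtain ⟨v, hv, hv'⟩ := Finset.exists_mem_notMem_of_card_lt_card hc
      have hvn : ∀ t ∈ J, ¬ conf (w t) v := fun t ht hcf =>
        hv' (mem_biUnion.2 ⟨t, ht, mem_filter.2 ⟨mem_univ _, hcf⟩⟩)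
      have hne : ∀ x ∈ J, x ≠ a := fun x hx e => ha (e ▸ hx)
      refine ⟨Function.update w a v, ?_, ?_⟩
      · intro t ht
        rcases mem_insert.1 ht with rfl | ht
        · rwa [Function.update_self]
        · rw [Function.update_of_ne (hne t ht)]; exact h1 t ht
      · intro t ht t' ht' htt
        rcases mem_insert.1 ht with hta | hta <;> rcases mem_insert.1 ht' with htb | htb
        · exact absurd (hta.trans htb.symm) htt
        · rw [hta, Function.update_self, Function.update_of_ne (hne t' htb)]
          exact fun h => hvn t' htb (hsym _ _ h)
        · rw [htb, Function.update_self, Function.update_of_ne (hne t hta)]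
          exact hvn t hta
        · rw [Function.update_of_ne (hne t hta), Function.update_of_ne (hne t' htb)]
          exact h2 t hta t' htb htt
  exact key I (Subset.refl _)

/-- Closed neighbourhood. -/
noncomputable def bu_cl {W : Type*} [Fintype W] (H : SimpleGraph W) (S : Finset W) : Finset W :=
  univ.filter (fun w => ∃ s ∈ S, w = s ∨ H.Adj s w)

theorem bu_mem_cl {W : Type*} [Fintype W] {H : SimpleGraph W} {S : Finset W} {w : W} :
    w ∈ bu_cl H S ↔ ∃ s ∈ S, w = s ∨ H.Adj s w := by simp [bu_cl]

theorem bu_cl_card {W : Type*} [Fintype W] (H : SimpleGraph W) (Δ : ℕ) (hΔ : ∀ w, degOf H w ≤ Δ)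
    (S : Finset W) : (bu_cl H S).card ≤ S.card * (Δ + 1) := by
  have hsub : bu_cl H S ⊆ S.biUnion (fun s => insert s (univ.filter (fun w => H.Adj s w))) := by
    intro w hw
    obtain ⟨s, hs, h⟩ := bu_mem_cl.1 hw
    refine mem_biUnion.2 ⟨s, hs, ?_⟩
    rcases h with h | h
    · exact mem_insert.2 (Or.inl h)
    · exact mem_insert_of_mem (mem_filter.2 ⟨mem_univ _, h⟩)
  refine (card_le_card hsub).trans (card_biUnion_le_card_mul _ _ _ (fun s _ => ?_))
  exact (card_insert_le _ _).trans (Nat.add_le_add_right (hΔ s) 1)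

theorem bu_sub_cl {W : Type*} [Fintype W] (H : SimpleGraph W) (S : Finset W) : S ⊆ bu_cl H S :=
  fun w hw => bu_mem_cl.2 ⟨w, hw, Or.inl rfl⟩

/-- Ball of radius two. -/
noncomputable def bu_B2 {W : Type*} [Fintype W] (H : SimpleGraph W) (w : W) : Finset W :=
  bu_cl H (bu_cl H {w})

/-- Choosing far apart items. -/
theorem bu_items {W ι : Type*} [Fintype W] [Nonempty W] (H : SimpleGraph W) (Δ : ℕ)
    (hΔ : ∀ w, degOf H w ≤ Δ) (I : Finset ι) (Cand : ι → Finset W)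
    (hI : ∀ t ∈ I, I.card * (Δ + 1)^4 ≤ (Cand t).card) :
    ∃ w : ι → W, (∀ t ∈ I, w t ∈ Cand t) ∧
      ∀ t ∈ I, ∀ t' ∈ I, t ≠ t' → Disjoint (bu_B2 H (w t)) (bu_B2 H (w t')) := by
  obtain ⟨w, h1, h2⟩ := bu_indep I Cand (fun x y => ¬ Disjoint (bu_B2 H x) (bu_B2 H y))
    (fun x y h h' => h h'.symm) ((Δ+1)^4) (Nat.one_le_pow _ _ (by omega)) (by
      intro x
      refine le_trans (card_le_card (t := bu_cl H (bu_cl H (bu_B2 H x))) ?_) ?_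
      · intro y hy
        simp only [mem_filter, mem_univ, true_and] at hy
        have := hy
        rw [not_disjoint_iff] at this
        obtain ⟨z, hz, hz'⟩ := this
        obtain ⟨a, ha, haz⟩ := bu_mem_cl.1 hz'
        obtain ⟨y', hy', hya⟩ := bu_mem_cl.1 ha
        rw [mem_singleton] at hy'
        subst hy'
        refine bu_mem_cl.2 ⟨a, bu_mem_cl.2 ⟨z, hz, ?_⟩, ?_⟩
        · rcases haz with h | h
          · exact Or.inl h.symm
          · exact Or.inr h.symm
        · rcases hya with h | h
          · exact Or.inl h.symm
          · exact Or.inr h.symm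
      have e1 := bu_cl_card H Δ hΔ (bu_cl H (bu_B2 H x))
      have e2 := bu_cl_card H Δ hΔ (bu_B2 H x)
      have e3 := bu_cl_card H Δ hΔ (bu_cl H {x})
      have e4 := bu_cl_card H Δ hΔ {x}
      rw [card_singleton, one_mul] at e4
      calc _ ≤ _ := e1
        _ ≤ ((bu_B2 H x).card * (Δ+1)) * (Δ+1) := Nat.mul_le_mul_right _ e2
        _ ≤ (((bu_cl H {x}).card * (Δ+1)) * (Δ+1)) * (Δ+1) :=
            Nat.mul_le_mul_right _ (Nat.mul_le_mul_right _ e3)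
        _ ≤ (((Δ+1) * (Δ+1)) * (Δ+1)) * (Δ+1) := 
            Nat.mul_le_mul_right _ (Nat.mul_le_mul_right _ (Nat.mul_le_mul_right _ e4))
        _ = _ := by ring) hI
  exact ⟨w, h1, fun t ht t' ht' hne => not_not.1 (h2 t ht t' ht' hne)⟩

theorem bu_param (θ π M : ℝ) (hθ : 0 < θ) (hπ : 0 < π) (hπ1 : π ≤ 1) (hM : 0 < M) :
    ∃ (σ : ℝ) (L : ℕ), 0 < σ ∧ σ * ((L:ℝ) + 1) ≤ θ ∧ (1 - π)^L * M ≤ σ / 16 := by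
  have h0 : (0:ℝ) ≤ 1 - π := by linarith
  have h1 : (1 - π) < 1 := by linarith
  have t1 := tendsto_self_mul_const_pow_of_lt_one h0 h1
  have t2 := tendsto_pow_atTop_nhds_zero_of_lt_one h0 h1
  have t3 := t1.add t2
  rw [add_zero] at t3
  have hpos : 0 < θ / (16 * M) := by positivity
  obtain ⟨L, hL⟩ := (t3.eventually (gt_mem_nhds hpos)).exists
  refine ⟨θ / ((L:ℝ)+1), L, by positivity, ?_, ?_⟩
  · rw [div_mul_cancel₀]; positivity
  · have hL1 : (0:ℝ) < (L:ℝ) + 1 := by positivity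
    rw [div_div, le_div_iff₀ (by positivity)]
    rw [lt_div_iff₀ (by positivity)] at hL
    nlinarith

/-! ## Context and greedy lemma -/

noncomputable def bu_lk {V : Type} (E : Set (Finset V)) (S : Finset V) (u v : V) : Finset V :=
  S.filter (fun c => ({u, v, c} : Finset V) ∈ E)

def bu_Thk {V : Type} (E : Set (Finset V)) (l : ℝ) (S : Finset V) (u v : V) : Prop :=
  l * (S.card : ℝ) ≤ ((bu_lk E S u v).card : ℝ)

theorem bu_lk_comm {V : Type} (E : Set (Finset V)) (S : Finset V) (u v : V) :
    bu_lk E S u v = bu_lk E S v u := by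
  unfold bu_lk
  congr 1
  ext c
  rw [Finset.insert_comm]

theorem bu_Thk_comm {V : Type} {E : Set (Finset V)} {l : ℝ} {S : Finset V} {u v : V}
    (h : bu_Thk E l S u v) : bu_Thk E l S v u := by
  unfold bu_Thk at *
  rwa [bu_lk_comm]

structure BUCtx (r : ℕ) (V W : Type) [Fintype V] [Fintype W] where
  E : Set (Finset V)
  R : SimpleGraph (Fin r)
  Vc : Fin r → Finset V
  Vij : Fin r → Fin r → Finset V
  H : SimpleGraph W
  φ : W → Fin r
  Δ : ℕ
  l : ℝ
  e0 : ℝ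
  l_pos : 0 < l
  l_le : l ≤ 1 / 2
  e0_pos : 0 < e0
  vij_symm : ∀ i j, Vij i j = Vij j i
  vc_disj : ∀ i j, i ≠ j → Disjoint (Vc i) (Vc j)
  vcij_disj : ∀ i j k, R.Adj j k → Disjoint (Vc i) (Vij j k)
  vij_disj : ∀ i j k l, R.Adj i j → R.Adj k l → s(i, j) ≠ s(k, l) →
        Disjoint (Vij i j) (Vij k l)
  deg : ∀ w, degOf H w ≤ Δ
  hom : ∀ x y, H.Adj x y → R.Adj (φ x) (φ y)
  typ : ∀ i j, R.Adj i j → ∀ P ⊆ Vij i j, e0 ≤ (P.card : ℝ) → ∀ A ⊆ Vc j, e0 ≤ (A.card : ℝ) →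
    (((Vc i).filter (fun u => ((A.filter (fun v => bu_Thk E l P u v)).card : ℝ) <
      l * (A.card : ℝ))).card : ℝ) ≤ e0
  ctyp : ∀ i j, R.Adj i j → ∀ A ⊆ Vc i, e0 ≤ (A.card : ℝ) → ∀ B ⊆ Vc j, e0 ≤ (B.card : ℝ) →
    (((Vij i j).filter (fun c => (((A ×ˢ B).filter
      (fun q => ({q.1, q.2, c} : Finset V) ∈ E)).card : ℝ) <
      l * ((A.card : ℝ) * (B.card : ℝ)))).card : ℝ) ≤ e0
  vdeg : ∀ i j, R.Adj i j → ∀ u ∈ Vc i, l * ((Vc j).card : ℝ) ≤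
    (((Vc j).filter (fun v => bu_Thk E l (Vij i j) u v)).card : ℝ)
  cdeg : ∀ i j, R.Adj i j → ∀ c ∈ Vij i j, l * (((Vc i).card : ℝ) * ((Vc j).card : ℝ)) ≤
    ((((Vc i) ×ˢ (Vc j)).filter (fun q => ({q.1, q.2, c} : Finset V) ∈ E)).card : ℝ)
  vcard : ∀ i : Fin r, ((univ : Finset W).filter (fun x => φ x = i)).card = (Vc i).card
  ecard : ∀ i j : Fin r, R.Adj i j →
          eBetween H ((univ : Finset W).filter (fun x => φ x = i))
            ((univ : Finset W).filter (fun x => φ x = j)) = (Vij i j).card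

namespace BUCtx

variable {r : ℕ} {V W : Type} [Fintype V] [Fintype W] (X : BUCtx r V W)

def Th (P : Finset V) (u v : V) : Prop := bu_Thk X.E X.l P u v

theorem Th_comm {P : Finset V} {u v : V} (h : X.Th P u v) : X.Th P v u := bu_Thk_comm h

/-- candidates -/
noncomputable def cand (D : Finset W) (ρ : W → V) (P : W → W → Finset V) (S : Finset V) (z : W) :
    Finset V :=
  S.filter (fun v => ∀ y ∈ D, X.H.Adj y z → X.Th (P y z) (ρ y) v)

noncomputable def dg (D : Finset W) (z : W) : ℕ := (D.filter (fun y => X.H.Adj y z)).card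

theorem dg_le (D : Finset W) (z : W) : X.dg D z ≤ X.Δ := by
  refine le_trans (card_le_card ?_) (X.deg z)
  intro y hy
  exact mem_filter.2 ⟨mem_univ _, (mem_filter.1 hy).2.symm⟩

theorem l_le_one : X.l ≤ 1 := by have := X.l_le; linarith

theorem pow_dg (D : Finset W) (z : W) : X.l ^ X.Δ ≤ X.l ^ (X.dg D z) :=
  pow_le_pow_of_le_one X.l_pos.le X.l_le_one (X.dg_le D z)

theorem step_choose {κ : Type*} (K : Finset κ) (i : Fin r) (j : κ → Fin r) (P S : κ → Finset V)
    (A F : Finset V) (hA : A ⊆ X.Vc i)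
    (hadj : ∀ k ∈ K, X.R.Adj i (j k)) (hP : ∀ k ∈ K, P k ⊆ X.Vij i (j k) ∧ X.e0 ≤ ((P k).card : ℝ))
    (hS : ∀ k ∈ K, S k ⊆ X.Vc (j k) ∧ X.e0 ≤ ((S k).card : ℝ))
    (hc : (F.card : ℝ) + (K.card : ℝ) * X.e0 < (A.card : ℝ)) :
    ∃ v ∈ A, v ∉ F ∧ ∀ k ∈ K, X.l * ((S k).card : ℝ) ≤
      (((S k).filter (fun w => X.Th (P k) v w)).card : ℝ) := by
  by_contra hcon
  push Not at hcon
  have hsub : A ⊆ F ∪ K.biUnion (fun k => (X.Vc i).filter (fun u =>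
      (((S k).filter (fun v => bu_Thk X.E X.l (P k) u v)).card : ℝ) < X.l * ((S k).card : ℝ))) := by
    intro v hv
    rw [mem_union]
    by_cases hF : v ∈ F
    · exact Or.inl hF
    · obtain ⟨k, hk, hlt⟩ := hcon v hv hF
      exact Or.inr (mem_biUnion.2 ⟨k, hk, mem_filter.2 ⟨hA hv, hlt⟩⟩)
  have h1 := (card_le_card hsub).trans (card_union_le _ _)
  have h2 : ((K.biUnion (fun k => (X.Vc i).filter (fun u =>
      (((S k).filter (fun v => bu_Thk X.E X.l (P k) u v)).card : ℝ) < X.l * ((S k).card : ℝ)))).card : ℝ)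
      ≤ (K.card : ℝ) * X.e0 := by
    refine le_trans (Nat.cast_le.2 card_biUnion_le) ?_
    push_cast
    calc _ ≤ ∑ k ∈ K, X.e0 := sum_le_sum (fun k hk =>
            X.typ i (j k) (hadj k hk) (P k) (hP k hk).1 (hP k hk).2 (S k) (hS k hk).1 (hS k hk).2)
      _ = _ := by rw [sum_const, nsmul_eq_mul]
  have h3 : (A.card : ℝ) ≤ (F.card : ℝ) + ((K.biUnion (fun k => (X.Vc i).filter (fun u =>
      (((S k).filter (fun v => bu_Thk X.E X.l (P k) u v)).card : ℝ) < X.l * ((S k).card : ℝ)))).card : ℝ) := by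
    exact_mod_cast h1
  linarith

theorem cand_insert {D : Finset W} {ρ : W → V} {P : W → W → Finset V} {S : Finset V} {z y : W} {v : V}
    (hy : y ∉ D) :
    X.cand (insert y D) (Function.update ρ y v) P S z =
      (X.cand D ρ P S z).filter (fun w => X.H.Adj y z → X.Th (P y z) v w) := by
  ext w
  simp only [cand, mem_filter]
  constructor
  · rintro ⟨h1, h2⟩
    refine ⟨⟨h1, fun y' hy' ha => ?_⟩, fun ha => ?_⟩
    · have := h2 y' (mem_insert_of_mem hy') ha
      rwa [Function.update_of_ne (fun (e : y' = y) => hy (e ▸ hy'))] at this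
    · have := h2 y (mem_insert_self _ _) ha
      rwa [Function.update_self] at this
  · rintro ⟨⟨h1, h2⟩, h3⟩
    refine ⟨h1, fun y' hy' ha => ?_⟩
    rcases mem_insert.1 hy' with e | hy'
    · subst e; rw [Function.update_self]; exact h3 ha
    · rw [Function.update_of_ne (fun (e : y' = y) => hy (e ▸ hy'))]; exact h2 y' hy' ha

theorem greedy {Q : Type} [Fintype Q] (q0 : Q) (D : Finset W) (P : W → W → Finset V)
    (A : W → Q → Finset V) (F : Finset V) [Nonempty V]
    (hP : ∀ y ∈ D, ∀ z, X.H.Adj y z → P y z ⊆ X.Vij (X.φ y) (X.φ z) ∧ X.e0 ≤ ((P y z).card : ℝ))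
    (hPs : ∀ y z, P y z = P z y)
    (hA : ∀ y ∈ D, ∀ q, A y q ⊆ X.Vc (X.φ y))
    (hA1 : ∀ y ∈ D, ∀ z, X.H.Adj y z → ∀ q, A z q ⊆ X.Vc (X.φ z))
    (hA2 : ∀ y ∈ D, ∀ z, X.H.Adj y z → ∀ q, X.e0 ≤ X.l ^ X.Δ * ((A z q).card : ℝ))
    (hA3 : ∀ y ∈ D, (D.card : ℝ) + (F.card : ℝ) + (X.Δ : ℝ) * (Fintype.card Q : ℝ) * X.e0 <
      X.l ^ X.Δ * ((A y q0).card : ℝ)) :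
    ∃ ρ : W → V, Set.InjOn ρ D ∧ (∀ y ∈ D, ρ y ∈ A y q0 ∧ ρ y ∉ F) ∧
      (∀ y ∈ D, ∀ z ∈ D, X.H.Adj y z → X.Th (P y z) (ρ y) (ρ z)) ∧
      ∀ z, z ∉ D → ∀ q, X.l ^ (X.dg D z) * ((A z q).card : ℝ) ≤ ((X.cand D ρ P (A z q) z).card : ℝ) := by
  have key : ∀ D' ⊆ D, ∃ ρ : W → V, Set.InjOn ρ D' ∧ (∀ y ∈ D', ρ y ∈ A y q0 ∧ ρ y ∉ F) ∧
      (∀ y ∈ D', ∀ z ∈ D', X.H.Adj y z → X.Th (P y z) (ρ y) (ρ z)) ∧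
      ∀ z, z ∉ D' → ∀ q, X.l ^ (X.dg D' z) * ((A z q).card : ℝ) ≤ ((X.cand D' ρ P (A z q) z).card : ℝ) := by
    intro D'
    induction D' using Finset.induction_on with
    | empty =>
      intro _
      refine ⟨fun _ => Classical.arbitrary V, by simp, by simp, by simp, ?_⟩
      intro z _ q
      simp [cand, dg]
    | insert y D' hy ih =>
      intro hD'
      obtain ⟨ρ, h1, h2, h3, h4⟩ := ih (fun x hx => hD' (mem_insert_of_mem hx))
      have hyD : y ∈ D := hD' (mem_insert_self _ _)
      have hl := X.l_pos
      have hl1 := X.l_le_one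
      set Nb := univ.filter (fun z => X.H.Adj y z ∧ z ∉ D') with hNb
      have hNbc : Nb.card ≤ X.Δ := by
        refine le_trans (card_le_card ?_) (X.deg y)
        intro z hz
        exact mem_filter.2 ⟨mem_univ _, (mem_filter.1 hz).2.1⟩
      obtain ⟨v, hvA, hvF, hv⟩ := X.step_choose (Nb ×ˢ (univ : Finset Q)) (X.φ y)
        (fun k => X.φ k.1) (fun k => P y k.1) (fun k => X.cand D' ρ P (A k.1 k.2) k.1)
        (X.cand D' ρ P (A y q0) y) (D'.image ρ ∪ F)
        ((filter_subset _ _).trans (hA y hyD q0))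
        (by
          rintro ⟨z, q⟩ hz
          exact X.hom _ _ (mem_filter.1 (mem_product.1 hz).1).2.1)
        (by
          rintro ⟨z, q⟩ hz
          exact hP y hyD z (mem_filter.1 (mem_product.1 hz).1).2.1)
        (by
          rintro ⟨z, q⟩ hz
          have ha := (mem_filter.1 (mem_product.1 hz).1).2
          refine ⟨(filter_subset _ _).trans (hA1 y hyD z ha.1 q), ?_⟩
          refine le_trans ?_ (h4 z ha.2 q)
          refine le_trans (hA2 y hyD z ha.1 q) ?_
          exact mul_le_mul_of_nonneg_right (X.pow_dg _ _) (by positivity))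
        (by
          have e1 : ((D'.image ρ ∪ F).card : ℝ) ≤ (D.card : ℝ) + (F.card : ℝ) := by
            have : (D'.image ρ ∪ F).card ≤ D.card + F.card :=
              (card_union_le _ _).trans (Nat.add_le_add_right
                (card_image_le.trans (card_le_card (fun x hx => hD' (mem_insert_of_mem hx)))) _)
            exact_mod_cast this
          have e2 : ((Nb ×ˢ (univ : Finset Q)).card : ℝ) * X.e0 ≤ (X.Δ : ℝ) * (Fintype.card Q : ℝ) * X.e0 := by
            apply mul_le_mul_of_nonneg_right _ X.e0_pos.le
            rw [card_product]
            push_cast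
            exact mul_le_mul_of_nonneg_right (by exact_mod_cast hNbc) (by positivity)
          have e3 : X.l ^ X.Δ * ((A y q0).card : ℝ) ≤ ((X.cand D' ρ P (A y q0) y).card : ℝ) :=
            (mul_le_mul_of_nonneg_right (X.pow_dg _ _) (by positivity)).trans (h4 y hy q0)
          have := hA3 y hyD
          linarith)
      have hne : ∀ x ∈ D', x ≠ y := fun x hx e => hy (e ▸ hx)
      rw [mem_union, not_or] at hvF
      have hvc := mem_filter.1 hvA
      refine ⟨Function.update ρ y v, ?_, ?_, ?_, ?_⟩
      · intro a ha b hb hab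
        simp only [coe_insert, Set.mem_insert_iff, mem_coe] at ha hb
        rcases ha with ha | ha <;> rcases hb with hb | hb
        · rw [ha, hb]
        · rw [ha, Function.update_self, Function.update_of_ne (hne b hb)] at hab
          exact absurd (hab ▸ mem_image_of_mem ρ hb) hvF.1
        · rw [hb, Function.update_self, Function.update_of_ne (hne a ha)] at hab
          exact absurd (hab ▸ mem_image_of_mem ρ ha) hvF.1
        · rw [Function.update_of_ne (hne a ha), Function.update_of_ne (hne b hb)] at hab
          exact h1 ha hb hab
      · intro a ha
        rcases mem_insert.1 ha with e | ha
        · rw [e, Function.update_self]; exact ⟨hvc.1, hvF.2⟩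
        · rw [Function.update_of_ne (hne a ha)]; exact h2 a ha
      · intro a ha b hb hab
        rcases mem_insert.1 ha with e | ha <;> rcases mem_insert.1 hb with e' | hb
        · rw [e, e'] at hab; exact absurd hab (SimpleGraph.irrefl _)
        · rw [e] at hab ⊢
          rw [Function.update_self, Function.update_of_ne (hne b hb)]
          rw [hPs]
          exact X.Th_comm (hvc.2 b hb hab.symm)
        · rw [e'] at hab ⊢
          rw [Function.update_self, Function.update_of_ne (hne a ha)]
          exact hvc.2 a ha hab
        · rw [Function.update_of_ne (hne a ha), Function.update_of_ne (hne b hb)]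
          exact h3 a ha b hb hab
      · intro z hz q
        rw [mem_insert, not_or] at hz
        rw [X.cand_insert hy]
        by_cases ha : X.H.Adj y z
        · have e1 : X.dg (insert y D') z = X.dg D' z + 1 := by
            unfold dg
            rw [filter_insert, if_pos ha, card_insert_of_notMem]
            exact fun h => hy (mem_filter.1 h).1
          have e2 := hv (z, q) (mem_product.2 ⟨mem_filter.2 ⟨mem_univ _, ha, hz.2⟩, mem_univ _⟩)
          have e3 := h4 z hz.2 q
          rw [e1, pow_succ]
          have e4 : (X.cand D' ρ P (A z q) z).filter (fun w => X.H.Adj y z → X.Th (P y z) v w) =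
              (X.cand D' ρ P (A z q) z).filter (fun w => X.Th (P y z) v w) := by
            apply filter_congr; intro w _; simp [ha]
          rw [e4]
          refine le_trans ?_ e2
          calc _ = X.l * (X.l ^ X.dg D' z * ((A z q).card : ℝ)) := by ring
            _ ≤ _ := mul_le_mul_of_nonneg_left e3 hl.le
        · have e1 : X.dg (insert y D') z = X.dg D' z := by
            unfold dg
            rw [filter_insert, if_neg ha]
          have e4 : (X.cand D' ρ P (A z q) z).filter (fun w => X.H.Adj y z → X.Th (P y z) v w) =
              (X.cand D' ρ P (A z q) z) := by
            apply filter_true_of_mem; intro w _ h; exact absurd h ha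
          rw [e4, e1]
          exact h4 z hz.2 q
  exact key D (Subset.refl _)

end BUCtx

namespace BUCtx

variable {r : ℕ} {V W : Type} [Fintype V] [Fintype W] (X : BUCtx r V W)

/-- Partial embedding state. -/
structure St (A : W → Finset V) (P : W → W → Finset V) (Z : Finset W) (SE : Set (Sym2 W))
    (D : Finset W) (ρ : W → V) : Prop where
  inj : Set.InjOn ρ D
  mem : ∀ y ∈ D, ρ y ∈ X.Vc (X.φ y)
  thk : ∀ y ∈ D, ∀ z ∈ D, X.H.Adj y z → s(y, z) ∉ SE → X.Th (P y z) (ρ y) (ρ z)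
  inv : ∀ z ∈ Z, z ∉ D → X.l ^ (X.dg D z) * ((A z).card : ℝ) ≤ ((X.cand D ρ P (A z) z).card : ℝ)

noncomputable def mix (D2 : Finset W) (ρ ρ2 : W → V) : W → V := fun y => if y ∈ D2 then ρ2 y else ρ y

theorem mix_in {D2 : Finset W} {ρ ρ2 : W → V} {y : W} (h : y ∈ D2) : mix D2 ρ ρ2 y = ρ2 y := if_pos h
theorem mix_out {D2 : Finset W} {ρ ρ2 : W → V} {y : W} (h : y ∉ D2) : mix D2 ρ ρ2 y = ρ y := if_neg h

theorem dg_union {D D2 : Finset W} (h : Disjoint D D2) (z : W) :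
    X.dg (D ∪ D2) z = X.dg D z + X.dg D2 z := by
  unfold dg
  rw [filter_union, card_union_of_disjoint]
  exact disjoint_filter_filter h

theorem cand_mix {D D2 : Finset W} (h : Disjoint D D2) (ρ ρ2 : W → V) (P : W → W → Finset V)
    (S : Finset V) (z : W) :
    X.cand (D ∪ D2) (mix D2 ρ ρ2) P S z = X.cand D2 ρ2 P (X.cand D ρ P S z) z := by
  ext v
  simp only [cand, mem_filter]
  constructor
  · rintro ⟨h1, h2⟩
    refine ⟨⟨h1, fun y hy ha => ?_⟩, fun y hy ha => ?_⟩
    · have := h2 y (mem_union_left _ hy) ha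
      rwa [mix_out (disjoint_left.1 h hy)] at this
    · have := h2 y (mem_union_right _ hy) ha
      rwa [mix_in hy] at this
  · rintro ⟨⟨h1, h2⟩, h3⟩
    refine ⟨h1, fun y hy ha => ?_⟩
    by_cases hy2 : y ∈ D2
    · rw [mix_in hy2]; exact h3 y hy2 ha
    · rw [mix_out hy2]; exact h2 y ((mem_union.1 hy).resolve_right hy2) ha

theorem cand_congr {D : Finset W} {ρ ρ' : W → V} {P P' : W → W → Finset V} {S : Finset V} {z : W}
    (h : ∀ y ∈ D, X.H.Adj y z → ρ y = ρ' y ∧ P y z = P' y z) :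
    X.cand D ρ P S z = X.cand D ρ' P' S z := by
  unfold cand
  apply filter_congr
  intro v _
  refine forall_congr' fun y => forall_congr' fun hy => forall_congr' fun ha => ?_
  rw [(h y hy ha).1, (h y hy ha).2]

theorem cand_subset (D : Finset W) (ρ : W → V) (P : W → W → Finset V) (S : Finset V) (z : W) :
    X.cand D ρ P S z ⊆ S := filter_subset _ _

theorem cand_of_dg {D : Finset W} {z : W} (h : X.dg D z = 0) (ρ : W → V) (P : W → W → Finset V)
    (S : Finset V) : X.cand D ρ P S z = S := by
  unfold cand
  apply filter_true_of_mem
  intro v _ y hy ha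
  have : y ∈ D.filter (fun y => X.H.Adj y z) := mem_filter.2 ⟨hy, ha⟩
  rw [card_eq_zero.1 h] at this
  simp at this

theorem not_adj_of_dg {D : Finset W} {z y : W} (h : X.dg D z = 0) (hy : y ∈ D) : ¬ X.H.Adj y z := by
  intro ha
  have : y ∈ D.filter (fun y => X.H.Adj y z) := mem_filter.2 ⟨hy, ha⟩
  rw [card_eq_zero.1 h] at this
  simp at this

theorem dg_eq_zero {D : Finset W} {z : W} (h : ∀ y ∈ D, ¬ X.H.Adj y z) : X.dg D z = 0 := by
  unfold dg
  rw [card_eq_zero, filter_eq_empty_iff]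
  exact fun y hy => h y hy

variable {X}

theorem St.extend {A : W → Finset V} {P : W → W → Finset V} {Z : Finset W} {SE : Set (Sym2 W)}
    {D : Finset W} {ρ : W → V} (hS : X.St A P Z SE D ρ) (hPs : ∀ y z, P y z = P z y)
    {D2 : Finset W} {ρ2 : W → V} (hd : Disjoint D D2) (hi : Set.InjOn ρ2 D2)
    (hm : ∀ y ∈ D2, ρ2 y ∈ X.Vc (X.φ y)) (hnew : ∀ y ∈ D2, ρ2 y ∉ D.image ρ)
    (ht : ∀ y ∈ D2, ∀ z ∈ D2, X.H.Adj y z → s(y, z) ∉ SE → X.Th (P y z) (ρ2 y) (ρ2 z))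
    (ht2 : ∀ y ∈ D, ∀ z ∈ D2, X.H.Adj y z → s(y, z) ∉ SE → X.Th (P y z) (ρ y) (ρ2 z))
    (hinv : ∀ z ∈ Z, z ∉ D → z ∉ D2 → X.l ^ (X.dg D2 z) * ((X.cand D ρ P (A z) z).card : ℝ) ≤
      ((X.cand D2 ρ2 P (X.cand D ρ P (A z) z) z).card : ℝ)) :
    X.St A P Z SE (D ∪ D2) (mix D2 ρ ρ2) := by
  have hD : ∀ y ∈ D, mix D2 ρ ρ2 y = ρ y := fun y hy => mix_out (disjoint_left.1 hd hy)
  have hD2 : ∀ y ∈ D2, mix D2 ρ ρ2 y = ρ2 y := fun y hy => mix_in hy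
  refine ⟨?_, ?_, ?_, ?_⟩
  · intro a ha b hb hab
    simp only [coe_union, Set.mem_union, mem_coe] at ha hb
    rcases ha with ha | ha <;> rcases hb with hb | hb
    · rw [hD a ha, hD b hb] at hab; exact hS.inj ha hb hab
    · rw [hD a ha, hD2 b hb] at hab
      exact absurd (hab ▸ mem_image_of_mem ρ ha) (hnew b hb)
    · rw [hD2 a ha, hD b hb] at hab
      exact absurd (hab ▸ mem_image_of_mem ρ hb) (hnew a ha)
    · rw [hD2 a ha, hD2 b hb] at hab; exact hi ha hb hab
  · intro y hy
    rcases mem_union.1 hy with hy | hy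
    · rw [hD y hy]; exact hS.mem y hy
    · rw [hD2 y hy]; exact hm y hy
  · intro a ha b hb hab hse
    rcases mem_union.1 ha with ha | ha <;> rcases mem_union.1 hb with hb | hb
    · rw [hD a ha, hD b hb]; exact hS.thk a ha b hb hab hse
    · rw [hD a ha, hD2 b hb]; exact ht2 a ha b hb hab hse
    · rw [hD2 a ha, hD b hb, hPs]
      exact X.Th_comm (ht2 b hb a ha hab.symm (by rwa [Sym2.eq_swap]))
    · rw [hD2 a ha, hD2 b hb]; exact ht a ha b hb hab hse
  · intro z hz hzD
    rw [mem_union, not_or] at hzD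
    rw [X.cand_mix hd, X.dg_union hd, pow_add]
    refine le_trans ?_ (hinv z hz hzD.1 hzD.2)
    have h1 := hS.inv z hz hzD.1
    have h2 : 0 ≤ X.l ^ (X.dg D2 z) := pow_nonneg X.l_pos.le _
    calc _ = X.l ^ (X.dg D2 z) * (X.l ^ (X.dg D z) * ((A z).card : ℝ)) := by ring
      _ ≤ _ := mul_le_mul_of_nonneg_left h1 h2

theorem St.greedy [Nonempty V] {A : W → Finset V} {P : W → W → Finset V} {Z : Finset W} {SE : Set (Sym2 W)}
    {D : Finset W} {ρ : W → V} (hS : X.St A P Z SE D ρ) (hPs : ∀ y z, P y z = P z y)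
    {Q : Type} [Fintype Q] [Nonempty Q] (D2 : Finset W) (hd : Disjoint D D2) (T : W → Finset V) (F : Finset V)
    (Sx : W → Q → Finset V)
    (hP : ∀ y ∈ D2, ∀ z, X.H.Adj y z → P y z ⊆ X.Vij (X.φ y) (X.φ z) ∧ X.e0 ≤ ((P y z).card : ℝ))
    (hT : ∀ y ∈ D2, T y ⊆ X.Vc (X.φ y))
    (hTD : ∀ w ∈ D, ∀ y ∈ D2, X.H.Adj w y → s(w, y) ∉ SE → ∀ v ∈ T y, X.Th (P w y) (ρ w) v)
    (hT0 : ∀ y ∈ D2, X.e0 ≤ X.l ^ X.Δ * ((T y).card : ℝ))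
    (hA1 : ∀ y ∈ D2, ∀ z ∈ Z, X.H.Adj y z → A z ⊆ X.Vc (X.φ z) ∧ X.e0 ≤ X.l ^ (2 * X.Δ) * ((A z).card : ℝ))
    (hA2 : ∀ y ∈ D2, ∀ z, z ∉ Z → z ∉ D2 → X.H.Adj y z → ∀ q, Sx z q ⊆ X.Vc (X.φ z) ∧ X.e0 ≤ X.l ^ X.Δ * ((Sx z q).card : ℝ))
    (hVc : ∀ y ∈ D2, ∀ z ∈ D, X.H.Adj y z → X.e0 ≤ X.l ^ X.Δ * ((X.Vc (X.φ z)).card : ℝ))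
    (hA3 : ∀ y ∈ D2, (D2.card : ℝ) + ((F.card : ℝ) + D.card) + (X.Δ : ℝ) * (Fintype.card Q : ℝ) * X.e0 <
      X.l ^ X.Δ * ((T y).card : ℝ)) :
    ∃ ρ' : W → V, X.St A P Z SE (D ∪ D2) ρ' ∧ (∀ y, y ∉ D2 → ρ' y = ρ y) ∧
      (∀ y ∈ D2, ρ' y ∈ T y ∧ ρ' y ∉ F ∧ ρ' y ∉ D.image ρ) ∧
      (∀ y ∈ D2, ∀ z ∈ D2, X.H.Adj y z → X.Th (P y z) (ρ' y) (ρ' z)) ∧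
      ∀ z, z ∉ Z → z ∉ D → z ∉ D2 → ∀ q, X.l ^ (X.dg D2 z) * ((Sx z q).card : ℝ) ≤
        ((X.cand D2 ρ' P (Sx z q) z).card : ℝ) := by
  obtain ⟨ρ2, g1, g2, g3, g4⟩ := X.greedy (Classical.arbitrary Q) D2 P
    (fun z q => if z ∈ D2 then T z else if z ∈ D then X.Vc (X.φ z) else
      if z ∈ Z then X.cand D ρ P (A z) z else Sx z q)
    (F ∪ D.image ρ) hP hPs
    (by intro y hy q; rw [if_pos hy]; exact hT y hy)
    (by
      intro y hy z ha q
      split_ifs with h1 h2 h3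
      · exact hT z h1
      · exact Subset.refl _
      · exact (X.cand_subset _ _ _ _ _).trans (hA1 y hy z h3 ha).1
      · exact (hA2 y hy z h3 h1 ha q).1)
    (by
      intro y hy z ha q
      split_ifs with h1 h2 h3
      · exact hT0 z h1
      · exact hVc y hy z h2 ha
      · refine (hA1 y hy z h3 ha).2.trans ?_
        rw [two_mul, pow_add, mul_assoc]
        refine mul_le_mul_of_nonneg_left ?_ (pow_nonneg X.l_pos.le _)
        exact (mul_le_mul_of_nonneg_right (X.pow_dg _ _) (by positivity)).trans (hS.inv z h3 h2)
      · exact (hA2 y hy z h3 h1 ha q).2)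
    (by
      intro y hy
      rw [if_pos hy]
      refine lt_of_le_of_lt ?_ (hA3 y hy)
      have : ((F ∪ D.image ρ).card : ℝ) ≤ (F.card : ℝ) + D.card := by
        exact_mod_cast (card_union_le _ _).trans (Nat.add_le_add_left card_image_le _)
      linarith)
  have g2' : ∀ y ∈ D2, ρ2 y ∈ T y ∧ ρ2 y ∉ F ∧ ρ2 y ∉ D.image ρ := by
    intro y hy
    have := g2 y hy
    rw [if_pos hy, mem_union, not_or] at this
    exact ⟨this.1, this.2.1, this.2.2⟩
  refine ⟨mix D2 ρ ρ2, ?_, fun y hy => mix_out hy, ?_, ?_, ?_⟩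
  · refine hS.extend hPs hd g1 (fun y hy => hT y hy (g2' y hy).1) (fun y hy => (g2' y hy).2.2)
      (fun y hy z hz ha _ => g3 y hy z hz ha)
      (fun w hw y hy ha hse => hTD w hw y hy ha hse _ (g2' y hy).1) ?_
    intro z hz hzD hzD2
    have := g4 z hzD2 (Classical.arbitrary Q)
    rwa [if_neg hzD2, if_neg hzD, if_pos hz] at this
  · intro y hy; rw [mix_in hy]; exact g2' y hy
  · intro y hy z hz ha; rw [mix_in hy, mix_in hz]; exact g3 y hy z hz ha
  · intro z hzZ hzD hzD2 q
    have := g4 z hzD2 q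
    rw [if_neg hzD2, if_neg hzD, if_neg hzZ] at this
    refine this.trans_eq ?_
    congr 2
    exact X.cand_congr (fun y hy _ => ⟨(mix_in hy).symm, rfl⟩)

theorem St.single {A : W → Finset V} {P : W → W → Finset V} {Z : Finset W} {SE : Set (Sym2 W)}
    {D : Finset W} {ρ : W → V} (hS : X.St A P Z SE D ρ) (hPs : ∀ y z, P y z = P z y)
    (b : W) (v : V) (hb : b ∉ D) (hv : v ∈ X.Vc (X.φ b)) (hvD : v ∉ D.image ρ)
    (hbd : X.dg D b = 0)
    (hz : ∀ z ∈ Z, X.H.Adj b z → X.dg D z = 0 ∧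
      X.l * ((A z).card : ℝ) ≤ (((A z).filter (fun w => X.Th (P b z) v w)).card : ℝ)) :
    ∃ ρ' : W → V, X.St A P Z SE (D ∪ {b}) ρ' ∧ (∀ y, y ≠ b → ρ' y = ρ y) ∧ ρ' b = v := by
  refine ⟨mix {b} ρ (fun _ => v), ?_, fun y hy => mix_out (by simpa using hy), mix_in (mem_singleton_self b)⟩
  refine hS.extend hPs (disjoint_singleton_right.2 hb) (by simp) ?_ ?_ ?_ ?_ ?_
  · intro y hy; rw [mem_singleton] at hy; rw [hy]; exact hv
  · intro y hy; exact hvD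
  · intro y hy z hz ha
    rw [mem_singleton] at hy hz
    rw [hy, hz] at ha
    exact absurd ha (SimpleGraph.irrefl _)
  · intro y hy z hz ha
    rw [mem_singleton] at hz
    rw [hz] at ha
    exact absurd ha (X.not_adj_of_dg hbd hy)
  · intro z hzZ hzD hzb
    by_cases ha : X.H.Adj b z
    · obtain ⟨h1, h2⟩ := hz z hzZ ha
      rw [X.cand_of_dg h1]
      have e1 : X.dg {b} z = 1 := by unfold dg; rw [filter_singleton, if_pos ha, card_singleton]
      rw [e1, pow_one]
      refine h2.trans_eq ?_
      congr 2
      unfold cand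
      apply filter_congr
      intro w _
      simp [ha]
    · have e1 : X.dg {b} z = 0 := by unfold dg; rw [filter_singleton, if_neg ha, card_empty]
      rw [e1, X.cand_of_dg e1, pow_zero, one_mul]

theorem St.congr {A A' : W → Finset V} {P P' : W → W → Finset V} {Z Z' : Finset W} {SE : Set (Sym2 W)}
    {D : Finset W} {ρ : W → V} (hS : X.St A P Z SE D ρ)
    (h1 : ∀ y ∈ D, ∀ z ∈ D, X.H.Adj y z → s(y, z) ∉ SE → P y z = P' y z)
    (h2 : ∀ z ∈ Z', z ∉ D → X.dg D z = 0 ∨ (z ∈ Z ∧ A z = A' z ∧ ∀ y ∈ D, X.H.Adj y z → P y z = P' y z)) :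
    X.St A' P' Z' SE D ρ := by
  refine ⟨hS.inj, hS.mem, ?_, ?_⟩
  · intro y hy z hz ha hse
    rw [← h1 y hy z hz ha hse]; exact hS.thk y hy z hz ha hse
  · intro z hz hzD
    rcases h2 z hz hzD with h | ⟨h3, h4, h5⟩
    · rw [X.cand_of_dg h, h, pow_zero, one_mul]
    · rw [← h4, ← X.cand_congr (P := P) (ρ := ρ) (fun y hy ha => ⟨rfl, h5 y hy ha⟩)]
      exact hS.inv z h3 hzD

/-- Placing a pair inside a dense pair relation. -/
theorem St.pair [Nonempty V] {A : W → Finset V} {P : W → W → Finset V} {Z : Finset W} {SE : Set (Sym2 W)}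
    {D : Finset W} {ρ : W → V} (hS : X.St A P Z SE D ρ) (hPs : ∀ y z, P y z = P z y)
    (x y : W) (hxy : X.H.Adj x y) (hse : s(x, y) ∈ SE) (hx : x ∉ D) (hy : y ∉ D)
    (hdx : X.dg D x = 0) (hdy : X.dg D y = 0)
    (A1 A2 F : Finset V) (hA1 : A1 ⊆ X.Vc (X.φ x)) (hA2 : A2 ⊆ X.Vc (X.φ y))
    (Pi : V → V → Prop)
    (hP : ∀ w, (w = x ∨ w = y) → ∀ z, X.H.Adj w z → P w z ⊆ X.Vij (X.φ w) (X.φ z) ∧ X.e0 ≤ ((P w z).card : ℝ))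
    (hAz : ∀ z, (X.H.Adj x z ∨ X.H.Adj y z) → z ∈ Z ∧ A z ⊆ X.Vc (X.φ z) ∧ X.e0 ≤ X.l ^ (2 * X.Δ) * ((A z).card : ℝ))
    (c : ℝ) (hc : (F.card : ℝ) + D.card + 2 + (X.Δ : ℝ) * X.e0 + X.e0 ≤ X.l ^ X.Δ * c)
    (hPi : c * ((A1.card : ℝ) + A2.card) < (((A1 ×ˢ A2).filter (fun q => Pi q.1 q.2)).card : ℝ)) :
    ∃ ρ' : W → V, X.St A P Z SE (D ∪ {x, y}) ρ' ∧ (∀ w, w ≠ x → w ≠ y → ρ' w = ρ w) ∧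
      ρ' x ∈ A1 ∧ ρ' y ∈ A2 ∧ Pi (ρ' x) (ρ' y) ∧ ρ' x ∉ F ∧ ρ' y ∉ F ∧
      ρ' x ∉ D.image ρ ∧ ρ' y ∉ D.image ρ := by
  have hxney : x ≠ y := hxy.ne
  have hlp : 0 < X.l ^ X.Δ := pow_pos X.l_pos _
  have hlp1 : X.l ^ X.Δ ≤ 1 := pow_le_one₀ X.l_pos.le X.l_le_one
  have he0 := X.e0_pos
  have hc0 : 0 < c := by
    have : 0 < X.l ^ X.Δ * c := lt_of_lt_of_le (by positivity) hc
    exact (mul_pos_iff_of_pos_left hlp).1 this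
  set T1 := A1.filter (fun u => c ≤ ((A2.filter (fun v => Pi u v)).card : ℝ)) with hT1
  have hT1c : c < (T1.card : ℝ) := by
    have h1 := bu_markov A1 (fun u => ((A2.filter (fun v => Pi u v)).card : ℝ)) (A2.card : ℝ) c hc0.le
      (fun u _ => Nat.cast_le.2 (card_le_card (filter_subset _ _)))
    have h2 : ∑ u ∈ A1, ((A2.filter (fun v => Pi u v)).card : ℝ) = (((A1 ×ˢ A2).filter (fun q => Pi q.1 q.2)).card : ℝ) := by
      simp only [card_filter, Nat.cast_sum]
      rw [sum_product]
    rw [h2] at h1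
    have h3 : c * (A2.card : ℝ) < (A2.card : ℝ) * (T1.card : ℝ) := by linarith
    have h4 : (0:ℝ) ≤ A2.card := by positivity
    by_contra hcon
    push Not at hcon
    nlinarith
  have hcardD : X.l ^ X.Δ * c ≤ X.l ^ X.Δ * (T1.card : ℝ) := mul_le_mul_of_nonneg_left hT1c.le hlp.le
  have hU : (Fintype.card Unit : ℝ) = 1 := by simp
  have hD0 : (0:ℝ) ≤ (F.card : ℝ) + D.card := by positivity
  have hΔe : 0 ≤ (X.Δ : ℝ) * X.e0 := by positivity
  obtain ⟨ρ1, s1, s2, s3, -, -⟩ := hS.greedy hPs (Q := Unit) {x} (disjoint_singleton_right.2 hx)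
    (fun _ => T1) F (fun z _ => X.Vc (X.φ z))
    (by intro w hw; rw [mem_singleton] at hw; exact hP w (Or.inl hw))
    (by intro w hw; rw [mem_singleton] at hw; rw [hw]; exact (filter_subset _ _).trans hA1)
    (by intro w hw z hz ha; rw [mem_singleton] at hz; rw [hz] at ha; exact absurd ha (X.not_adj_of_dg hdx hw))
    (by intro w hw; linarith)
    (by
      intro w hw z hz ha; rw [mem_singleton] at hw; rw [hw] at ha; exact (hAz z (Or.inl ha)).2)
    (by
      intro w hw z hz _ ha; rw [mem_singleton] at hw; rw [hw] at ha; exact absurd (hAz z (Or.inl ha)).1 hz)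
    (by
      intro w hw z hz ha; rw [mem_singleton] at hw; rw [hw] at ha
      exact absurd ha.symm (X.not_adj_of_dg hdx hz))
    (by
      intro w hw
      rw [hU, card_singleton]; push_cast
      linarith)
  obtain ⟨hx1, hx2, hx3⟩ := s3 x (mem_singleton_self _)
  have hx1' := mem_filter.1 hx1
  set T2 := A2.filter (fun v => Pi (ρ1 x) v) with hT2
  have hcardD2 : X.l ^ X.Δ * c ≤ X.l ^ X.Δ * (T2.card : ℝ) := mul_le_mul_of_nonneg_left hx1'.2 hlp.le
  have hd2 : Disjoint (D ∪ {x}) {y} := by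
    rw [disjoint_singleton_right, mem_union, mem_singleton]
    push Not; exact ⟨hy, hxney.symm⟩
  obtain ⟨ρ2, t1, t2, t3, -, -⟩ := s1.greedy hPs (Q := Unit) {y} hd2
    (fun _ => T2) F (fun z _ => X.Vc (X.φ z))
    (by intro w hw; rw [mem_singleton] at hw; exact hP w (Or.inr hw))
    (by intro w hw; rw [mem_singleton] at hw; rw [hw]; exact (filter_subset _ _).trans hA2)
    (by
      intro w hw z hz ha hse'
      rw [mem_singleton] at hz; rw [hz] at ha hse'
      rcases mem_union.1 hw with hw | hw
      · exact absurd ha (X.not_adj_of_dg hdy hw)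
      · rw [mem_singleton] at hw; rw [hw] at hse'; exact absurd hse hse')
    (by intro w hw; linarith)
    (by
      intro w hw z hz ha; rw [mem_singleton] at hw; rw [hw] at ha; exact (hAz z (Or.inr ha)).2)
    (by
      intro w hw z hz _ ha; rw [mem_singleton] at hw; rw [hw] at ha; exact absurd (hAz z (Or.inr ha)).1 hz)
    (by
      intro w hw z hz ha; rw [mem_singleton] at hw; rw [hw] at ha
      rcases mem_union.1 hz with hz | hz
      · exact absurd ha.symm (X.not_adj_of_dg hdy hz)
      · rw [mem_singleton] at hz; rw [hz]
        refine le_trans ?_ (mul_le_mul_of_nonneg_left (Nat.cast_le.2 (card_le_card ((filter_subset _ _).trans hA1 : T1 ⊆ _))) hlp.le)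
        linarith)
    (by
      intro w hw
      have : ((D ∪ {x}).card : ℝ) ≤ D.card + 1 := by exact_mod_cast card_union_le _ _
      rw [hU, card_singleton]; push_cast
      linarith)
  obtain ⟨hy1, hy2, hy3⟩ := t3 y (mem_singleton_self _)
  have hy1' := mem_filter.1 hy1
  have e1 : ρ2 x = ρ1 x := t2 x (by simpa using hxney)
  refine ⟨ρ2, ?_, ?_, ?_, hy1'.1, ?_, ?_, hy2, ?_, ?_⟩
  · have : D ∪ {x} ∪ {y} = D ∪ {x, y} := by rw [union_assoc]; rfl
    rw [← this]; exact t1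
  · intro w hw1 hw2
    rw [t2 w (by simpa using hw2), s2 w (by simpa using hw1)]
  · rw [e1]; exact hx1'.1
  · rw [e1]; exact hy1'.2
  · rw [e1]; exact hx2
  · rw [e1]; exact hx3
  · intro h
    apply hy3
    obtain ⟨w, hw, hwe⟩ := mem_image.1 h
    refine mem_image.2 ⟨w, mem_union_left _ hw, ?_⟩
    rw [s2 w (by rw [mem_singleton]; intro e; exact hx (e ▸ hw))]; exact hwe

end BUCtx

/-- Sequential placement. -/
theorem bu_seq {V W γ : Type} (Good : Finset W → (W → V) → Prop) (body : γ → Finset W)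
    (Q : γ → (W → V) → Prop)
    (hQ : ∀ g ρ ρ', (∀ y ∈ body g, ρ y = ρ' y) → Q g ρ → Q g ρ')
    (D0 : Finset W) (ρ0 : W → V) (h0 : Good D0 ρ0) (Gd : Finset γ)
    (hdis : ∀ g ∈ Gd, ∀ g' ∈ Gd, g ≠ g' → Disjoint (body g) (body g'))
    (step : ∀ G' ⊆ Gd, ∀ g ∈ Gd, g ∉ G' → ∀ ρ, Good (D0 ∪ G'.biUnion body) ρ →
      (∀ y, y ∉ G'.biUnion body → ρ y = ρ0 y) → (∀ g' ∈ G', Q g' ρ) →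
      ∃ ρ', Good (D0 ∪ G'.biUnion body ∪ body g) ρ' ∧ (∀ y, y ∉ body g → ρ' y = ρ y) ∧ Q g ρ') :
    ∃ ρ, Good (D0 ∪ Gd.biUnion body) ρ ∧ (∀ y, y ∉ Gd.biUnion body → ρ y = ρ0 y) ∧
      ∀ g ∈ Gd, Q g ρ := by
  have key : ∀ G' ⊆ Gd, ∃ ρ, Good (D0 ∪ G'.biUnion body) ρ ∧
      (∀ y, y ∉ G'.biUnion body → ρ y = ρ0 y) ∧ ∀ g ∈ G', Q g ρ := by
    intro G'
    induction G' using Finset.induction_on with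
    | empty => intro _; exact ⟨ρ0, by simpa using h0, fun _ _ => rfl, by simp⟩
    | insert g G' hg ih =>
      intro hsub
      obtain ⟨ρ, h1, h2, h3⟩ := ih ((subset_insert _ _).trans hsub)
      have hgG := hsub (mem_insert_self _ _)
      obtain ⟨ρ', k1, k2, k3⟩ := step G' ((subset_insert _ _).trans hsub) g hgG hg ρ h1 h2 h3
      refine ⟨ρ', ?_, ?_, ?_⟩
      · have : D0 ∪ (insert g G').biUnion body = D0 ∪ G'.biUnion body ∪ body g := by
          rw [biUnion_insert, union_assoc, union_comm (body g)]
        rw [this]; exact k1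
      · intro y hy
        rw [biUnion_insert, mem_union, not_or] at hy
        rw [k2 y hy.1, h2 y hy.2]
      · intro g' hg'
        rcases mem_insert.1 hg' with e | hg'
        · rw [e]; exact k3
        · refine hQ g' ρ ρ' (fun y hy => ?_) (h3 g' hg')
          refine (k2 y (fun hyg => ?_)).symm
          have hne : g' ≠ g := fun (e : g' = g) => hg (e ▸ hg')
          exact disjoint_left.1 (hdis g' (hsub (mem_insert_of_mem hg')) g hgG hne) hy hyg
  exact key Gd (Subset.refl _)

namespace BUCtx

variable {r : ℕ} {V W : Type} [Fintype V] [Fintype W] (X : BUCtx r V W)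

abbrev PR : Type := {q : Fin r × Fin r // q.1 < q.2 ∧ X.R.Adj q.1 q.2}

def Vq (q : X.PR) : Finset V := X.Vij q.1.1 q.1.2

noncomputable def Eq (q : X.PR) : Finset (Sym2 W) :=
  (univ : Finset (Sym2 W)).filter (fun e => e ∈ X.H.edgeSet ∧
    ∃ x ∈ (univ : Finset W).filter (fun x => X.φ x = q.1.1),
    ∃ y ∈ (univ : Finset W).filter (fun x => X.φ x = q.1.2), e = s(x, y))

theorem Eq_card (q : X.PR) : (X.Eq q).card = (X.Vq q).card := X.ecard _ _ q.2.2

theorem mem_Eq {q : X.PR} {e : Sym2 W} : e ∈ X.Eq q ↔ ∃ x y, e = s(x, y) ∧ X.H.Adj x y ∧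
    X.φ x = q.1.1 ∧ X.φ y = q.1.2 := by
  unfold Eq
  simp only [mem_filter, mem_univ, true_and]
  constructor
  · rintro ⟨h, x, hx, y, hy, rfl⟩
    exact ⟨x, y, rfl, h, hx, hy⟩
  · rintro ⟨x, y, rfl, h, hx, hy⟩
    exact ⟨h, x, hx, y, hy, rfl⟩

noncomputable def edges : Finset (Sym2 W) := (univ : Finset (Sym2 W)).filter (fun e => e ∈ X.H.edgeSet)

theorem mem_edges {x y : W} : s(x, y) ∈ X.edges ↔ X.H.Adj x y := by
  unfold edges; simp

theorem Eq_sub (q : X.PR) : X.Eq q ⊆ X.edges := by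
  intro e he
  exact mem_filter.2 ⟨mem_univ _, (mem_filter.1 he).2.1⟩

theorem exists_q {e : Sym2 W} (he : e ∈ X.edges) : ∃ q, e ∈ X.Eq q := by
  induction e using Sym2.ind with
  | _ x y =>
    have ha := X.mem_edges.1 he
    have hR := X.hom x y ha
    rcases lt_or_gt_of_ne hR.ne with h | h
    · exact ⟨⟨(X.φ x, X.φ y), h, hR⟩, X.mem_Eq.2 ⟨x, y, rfl, ha, rfl, rfl⟩⟩
    · exact ⟨⟨(X.φ y, X.φ x), h, hR.symm⟩, X.mem_Eq.2 ⟨y, x, Sym2.eq_swap, ha.symm, rfl, rfl⟩⟩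

theorem q_unique {e : Sym2 W} {q q' : X.PR} (h : e ∈ X.Eq q) (h' : e ∈ X.Eq q') : q = q' := by
  obtain ⟨x, y, rfl, -, h1, h2⟩ := X.mem_Eq.1 h
  obtain ⟨x', y', he, -, h1', h2'⟩ := X.mem_Eq.1 h'
  have a := q.2.1
  have b := q'.2.1
  rcases Sym2.eq_iff.1 he with ⟨e1, e2⟩ | ⟨e1, e2⟩
  · subst e1; subst e2
    exact Subtype.ext (Prod.ext (h1.symm.trans h1') (h2.symm.trans h2'))
  · subst e1; subst e2
    rw [← h1, ← h2] at a
    rw [← h1', ← h2'] at b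
    exact absurd a (not_lt.2 b.le)

theorem Vq_disj {q q' : X.PR} (h : q ≠ q') : Disjoint (X.Vq q) (X.Vq q') := by
  refine X.vij_disj _ _ _ _ q.2.2 q'.2.2 (fun he => h ?_)
  have a := q.2.1
  have b := q'.2.1
  rcases Sym2.eq_iff.1 he with ⟨e1, e2⟩ | ⟨e1, e2⟩
  · exact Subtype.ext (Prod.ext e1 e2)
  · rw [e1, e2] at a
    exact absurd a (not_lt.2 b.le)

/-- colour list of an edge -/
noncomputable def lst (ρ : W → V) (e : Sym2 W) : Finset V :=
  univ.filter (fun c => ∃ x y, e = s(x, y) ∧ c ∈ X.Vij (X.φ x) (X.φ y) ∧ ({ρ x, ρ y, c} : Finset V) ∈ X.E)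

theorem mem_lst {ρ : W → V} {x y : W} {c : V} : c ∈ X.lst ρ s(x, y) ↔
    c ∈ X.Vij (X.φ x) (X.φ y) ∧ ({ρ x, ρ y, c} : Finset V) ∈ X.E := by
  unfold lst
  simp only [mem_filter, mem_univ, true_and]
  constructor
  · rintro ⟨x', y', he, h1, h2⟩
    rcases Sym2.eq_iff.1 he with ⟨e1, e2⟩ | ⟨e1, e2⟩
    · subst e1; subst e2; exact ⟨h1, h2⟩
    · subst e1; subst e2
      rw [X.vij_symm, Finset.insert_comm]; exact ⟨h1, h2⟩
  · rintro ⟨h1, h2⟩; exact ⟨x, y, rfl, h1, h2⟩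

theorem lst_inter {ρ : W → V} {x y : W} (Pl : Finset V) :
    X.lst ρ s(x, y) ∩ Pl = bu_lk X.E (X.Vij (X.φ x) (X.φ y) ∩ Pl) (ρ x) (ρ y) := by
  ext c
  rw [mem_inter, mem_lst]
  unfold bu_lk
  rw [mem_filter, mem_inter]
  tauto

theorem lst_eq {ρ : W → V} {x y : W} :
    X.lst ρ s(x, y) = bu_lk X.E (X.Vij (X.φ x) (X.φ y)) (ρ x) (ρ y) := by
  ext c
  rw [mem_lst]
  unfold bu_lk
  rw [mem_filter]

theorem lst_sub {ρ : W → V} {e : Sym2 W} {q : X.PR} (h : e ∈ X.Eq q) : X.lst ρ e ⊆ X.Vq q := by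
  obtain ⟨x, y, rfl, -, h1, h2⟩ := X.mem_Eq.1 h
  intro c hc
  have := (X.mem_lst.1 hc).1
  rw [h1, h2] at this; exact this

theorem lst_congr {ρ ρ' : W → V} {e : Sym2 W} (h : ∀ x ∈ e, ρ x = ρ' x) : X.lst ρ e = X.lst ρ' e := by
  induction e using Sym2.ind with
  | _ x y =>
    ext c
    rw [mem_lst, mem_lst, h x (by simp), h y (by simp)]

def Col (ρ : W → V) (I : Finset (Sym2 W)) (C : Finset V) : Prop :=
  ∃ f : Sym2 W → V, Set.InjOn f I ∧ I.image f = C ∧ ∀ e ∈ I, f e ∈ X.lst ρ e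

variable {X}

theorem Col.congr {ρ ρ' : W → V} {I : Finset (Sym2 W)} {C : Finset V} (h : X.Col ρ I C)
    (hr : ∀ e ∈ I, ∀ x ∈ e, ρ x = ρ' x) : X.Col ρ' I C := by
  obtain ⟨f, h1, h2, h3⟩ := h
  exact ⟨f, h1, h2, fun e he => by rw [← X.lst_congr (hr e he)]; exact h3 e he⟩

theorem Col.union {ρ : W → V} {I I' : Finset (Sym2 W)} {C C' : Finset V} (h : X.Col ρ I C)
    (h' : X.Col ρ I' C') (hI : Disjoint I I') (hC : Disjoint C C') : X.Col ρ (I ∪ I') (C ∪ C') := by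
  obtain ⟨f, h1, h2, h3⟩ := h
  obtain ⟨f', h1', h2', h3'⟩ := h'
  have hf : ∀ e ∈ I, (if e ∈ I then f e else f' e) = f e := fun e he => if_pos he
  have hf' : ∀ e ∈ I', (if e ∈ I then f e else f' e) = f' e := fun e he => if_neg (disjoint_right.1 hI he)
  have m1 : ∀ e ∈ I, f e ∈ C := fun e he => h2 ▸ mem_image_of_mem f he
  have m2 : ∀ e ∈ I', f' e ∈ C' := fun e he => h2' ▸ mem_image_of_mem f' he
  refine ⟨fun e => if e ∈ I then f e else f' e, ?_, ?_, ?_⟩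
  · intro a ha b hb hab
    simp only [coe_union, Set.mem_union, mem_coe] at ha hb
    simp only at hab
    rcases ha with ha | ha <;> rcases hb with hb | hb
    · rw [hf a ha, hf b hb] at hab; exact h1 ha hb hab
    · rw [hf a ha, hf' b hb] at hab
      exact absurd (hab ▸ m1 a ha) (disjoint_right.1 hC (m2 b hb))
    · rw [hf' a ha, hf b hb] at hab
      exact absurd (hab ▸ m2 a ha) (disjoint_left.1 hC (m1 b hb))
    · rw [hf' a ha, hf' b hb] at hab; exact h1' ha hb hab
  · rw [image_union, ← h2, ← h2']
    congr 1
    · exact image_congr (fun e he => hf e he)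
    · exact image_congr (fun e he => hf' e he)
  · intro e he
    rcases mem_union.1 he with he | he
    · simp only; rw [hf e he]; exact h3 e he
    · simp only; rw [hf' e he]; exact h3' e he

theorem Col.card_q {ρ : W → V} {I : Finset (Sym2 W)} {C : Finset V} (h : X.Col ρ I C)
    (hI : I ⊆ X.edges) (q : X.PR) : (X.Vq q ∩ C).card = (X.Eq q ∩ I).card := by
  obtain ⟨f, h1, h2, h3⟩ := h
  have : X.Vq q ∩ C = (X.Eq q ∩ I).image f := by
    ext c
    rw [mem_inter, ← h2, mem_image, mem_image]
    constructor
    · rintro ⟨hq, e, he, rfl⟩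
      refine ⟨e, mem_inter.2 ⟨?_, he⟩, rfl⟩
      obtain ⟨q', hq'⟩ := X.exists_q (hI he)
      have := X.lst_sub hq' (h3 e he)
      by_cases hne : q = q'
      · rw [hne]; exact hq'
      · exact absurd this (disjoint_left.1 (X.Vq_disj hne) hq)
    · rintro ⟨e, he, rfl⟩
      rw [mem_inter] at he
      exact ⟨X.lst_sub he.1 (h3 e he.2), e, he.2, rfl⟩
  rw [this, card_image_of_injOn]
  exact h1.mono (fun e he => (mem_inter.1 he).2)

theorem Col.sub {ρ : W → V} {I : Finset (Sym2 W)} {C : Finset V} (h : X.Col ρ I C)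
    (hI : I ⊆ X.edges) {c : V} (hc : c ∈ C) : ∃ q, c ∈ X.Vq q := by
  obtain ⟨f, h1, h2, h3⟩ := h
  rw [← h2] at hc
  obtain ⟨e, he, rfl⟩ := mem_image.1 hc
  obtain ⟨q', hq'⟩ := X.exists_q (hI he)
  exact ⟨q', X.lst_sub hq' (h3 e he)⟩

theorem Col.sdr [Nonempty V] (ρ : W → V) (I : Finset (Sym2 W)) (Pl : Finset V)
    (h : ∀ e ∈ I, I.card ≤ (X.lst ρ e ∩ Pl).card) : ∃ C ⊆ Pl, X.Col ρ I C := by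
  obtain ⟨f, h1, h2⟩ := bu_sdr I (fun e => X.lst ρ e ∩ Pl) h
  refine ⟨I.image f, ?_, f, h1, rfl, fun e he => (mem_inter.1 (h2 e he)).1⟩
  intro c hc
  obtain ⟨e, he, rfl⟩ := mem_image.1 hc
  exact (mem_inter.1 (h2 e he)).2

variable (X)

noncomputable def tch (S : Finset W) : Finset (Sym2 W) := X.edges.filter (fun e => ∃ x ∈ S, x ∈ e)

theorem mem_tch {S : Finset W} {x y : W} : s(x, y) ∈ X.tch S ↔ X.H.Adj x y ∧ (x ∈ S ∨ y ∈ S) := by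
  unfold tch
  rw [mem_filter, mem_edges]
  refine and_congr_right fun _ => ?_
  simp only [Sym2.mem_iff]
  constructor
  · rintro ⟨z, hz, rfl | rfl⟩
    · exact Or.inl hz
    · exact Or.inr hz
  · rintro (h | h)
    · exact ⟨x, h, Or.inl rfl⟩
    · exact ⟨y, h, Or.inr rfl⟩

theorem tch_card (S : Finset W) : (X.tch S).card ≤ S.card * X.Δ := by
  have : X.tch S ⊆ S.biUnion (fun x => ((univ : Finset W).filter (fun w => X.H.Adj x w)).image (fun y => s(x, y))) := by
    intro e he
    induction e using Sym2.ind with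
    | _ x y =>
      obtain ⟨ha, h⟩ := X.mem_tch.1 he
      rw [mem_biUnion]
      rcases h with h | h
      · exact ⟨x, h, mem_image.2 ⟨y, by simpa using ha, rfl⟩⟩
      · exact ⟨y, h, mem_image.2 ⟨x, by simpa using ha.symm, Sym2.eq_swap⟩⟩
  refine (card_le_card this).trans (card_biUnion_le_card_mul _ _ _ (fun x _ => ?_))
  exact card_image_le.trans (X.deg x)

theorem tch_sub (S : Finset W) : X.tch S ⊆ X.edges := filter_subset _ _

theorem image_card {D : Finset W} {ρ : W → V} (hi : Set.InjOn ρ D) (hm : ∀ y ∈ D, ρ y ∈ X.Vc (X.φ y))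
    (i : Fin r) : (X.Vc i ∩ D.image ρ).card = (D.filter (fun y => X.φ y = i)).card := by
  have : X.Vc i ∩ D.image ρ = (D.filter (fun y => X.φ y = i)).image ρ := by
    ext v
    rw [mem_inter, mem_image, mem_image]
    constructor
    · rintro ⟨h1, y, hy, rfl⟩
      refine ⟨y, mem_filter.2 ⟨hy, ?_⟩, rfl⟩
      by_contra hne
      exact disjoint_left.1 (X.vc_disj _ _ hne) (hm y hy) h1
    · rintro ⟨y, hy, rfl⟩
      rw [mem_filter] at hy
      exact ⟨hy.2 ▸ hm y hy.1, y, hy.1, rfl⟩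
  rw [this, card_image_of_injOn]
  exact hi.mono (fun e he => (mem_filter.1 he).1)

end BUCtx

namespace BUCtx

variable {r : ℕ} {V W : Type} [Fintype V] [Fintype W]

/-- Preparation data: sizes, regions of `H`, items. -/
structure Pre (X : BUCtx r V W) where
  m : ℝ
  clo : ℝ
  chi : ℝ
  vhi : ℝ
  ν : ℝ
  Nab : ℝ
  Nre : ℝ
  Nu : ℝ
  Nch : ℝ
  pc : ℕ
  Lc : ℕ
  pv : ℕ
  Lv : ℕ
  s : ℕ
  ξ : ℕ
  qn : ℕ
  Hab : Finset W
  Hre : Finset W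
  Xp : Finset W
  Us : Finset W
  χ : W → Fin qn
  Ts : W → Finset V
  wA : (X.PR × Fin pc × Fin (Lc+1)) ⊕ (Fin r × Fin pv × Fin (Lv+1)) ⊕ (Fin r × Fin ξ) ⊕ (X.PR × Fin ξ) → W
  yc : X.PR → Fin pc → Fin (Lc+1) → W
  yb : X.PR → Fin ξ → W
  wR : (Fin r × Fin s) ⊕ (X.PR × Fin s) → W
  yr : X.PR → Fin s → W
  dis1 : Disjoint Hab Hre
  dis2 : Disjoint Hab Xp
  dis3 : Disjoint Hab Us
  dis4 : Disjoint Hre Xp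
  dis5 : Disjoint Hre Us
  dis6 : Disjoint Xp Us
  eab : ∀ x y, X.H.Adj x y → x ∈ Hab → y ∈ Hab ∨ y ∈ Xp
  ere : ∀ x y, X.H.Adj x y → x ∈ Hre → y ∈ Hre ∨ y ∈ Xp
  eus : ∀ x y, X.H.Adj x y → x ∈ Us → y ∈ Us ∨ y ∈ Xp
  ech : ∀ x y, X.H.Adj x y → x ∉ Hab → x ∉ Hre → x ∉ Xp → x ∉ Us → y ∉ Xp → χ x = χ y
  hTs : ∀ x ∈ Us, Ts x ⊆ X.Vc (X.φ x) ∧ ν * m ≤ ((Ts x).card : ℝ)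
  wA_sub : ∀ t, bu_B2 X.H (wA t) ⊆ Hab
  wA_dis : ∀ t t', t ≠ t' → Disjoint (bu_B2 X.H (wA t)) (bu_B2 X.H (wA t'))
  wR_sub : ∀ t, bu_B2 X.H (wR t) ⊆ Hre
  wR_dis : ∀ t t', t ≠ t' → Disjoint (bu_B2 X.H (wR t)) (bu_B2 X.H (wR t'))
  c_col : ∀ q k l, X.φ (wA (Sum.inl (q, k, l))) = q.1.1 ∧ X.φ (yc q k l) = q.1.2 ∧
    X.H.Adj (wA (Sum.inl (q, k, l))) (yc q k l)
  c_buf : ∀ i k l, X.φ (wA (Sum.inr (Sum.inl (i, k, l)))) = i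
  c_sg : ∀ i k, X.φ (wA (Sum.inr (Sum.inr (Sum.inl (i, k))))) = i
  c_pr : ∀ q k, X.φ (wA (Sum.inr (Sum.inr (Sum.inr (q, k))))) = q.1.1 ∧ X.φ (yb q k) = q.1.2 ∧
    X.H.Adj (wA (Sum.inr (Sum.inr (Sum.inr (q, k))))) (yb q k)
  c_sr : ∀ i k, X.φ (wR (Sum.inl (i, k))) = i
  c_prr : ∀ q k, X.φ (wR (Sum.inr (q, k))) = q.1.1 ∧ X.φ (yr q k) = q.1.2 ∧
    X.H.Adj (wR (Sum.inr (q, k))) (yr q k)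
  hr : 1 ≤ r
  hm : 0 < m
  hν : 0 < ν
  n_v : ∀ i, m ≤ ((X.Vc i).card : ℝ) ∧ ((X.Vc i).card : ℝ) ≤ vhi
  n_c : ∀ q, clo ≤ ((X.Vq q).card : ℝ) ∧ ((X.Vq q).card : ℝ) ≤ chi
  n_ab : (Hab.card : ℝ) ≤ Nab
  n_re : (Hre.card : ℝ) + Xp.card ≤ Nre
  n_u : (Us.card : ℝ) ≤ Nu
  n_ch : ∀ k, (((univ : Finset W).filter (fun x => x ∉ Hab ∧ x ∉ Hre ∧ x ∉ Xp ∧ x ∉ Us ∧ χ x = k)).card : ℝ) ≤ Nch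
  k1 : Nab + Nu + r * (pv * (Lv + 1) + Nre) + 2 + (r^2 + 2 * X.Δ + 3) * X.e0 ≤ X.l ^ (2 * X.Δ) * X.l^2 / 256 * m
  k1' : Nab + Nu + r * (pv * (Lv + 1) + Nre) + 2 + (r^2 + 2 * X.Δ + 3) * X.e0 ≤ X.l ^ X.Δ * (ν * m)
  k2 : (pc * Lc : ℝ) ≤ X.l^3 / 256 * clo
  k3 : (1 - X.l^2 / 64)^Lc * chi ≤ pc / 2
  k4 : pc * (Lc + 2) + X.Δ * (Nre + r * (pv * (Lv + 1))) + X.Δ * (Nab + Nu) + X.e0 + 1 ≤ X.l^2 / 16 * clo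
  k5 : pv * (Lv + 3) + Nre + Nab ≤ X.l ^ (2 * X.Δ) * m
  k6 : (1 - X.l ^ X.Δ)^Lv * vhi ≤ pv / 2
  k7 : (s : ℝ) ≤ pv / 2 ∧ (s : ℝ) ≤ pc / 2
  k8 : Nre + 2 + (X.Δ + 2) * X.e0 ≤ X.l ^ (3 * X.Δ) * X.l * pv / 16
  k9 : X.Δ * (Nre + r * (pv * (Lv + 1))) + X.e0 ≤ X.l * pc / 2
  k10 : Nch * (X.Δ + 1) + (X.Δ + 2) * X.e0 < X.l ^ X.Δ * X.l * s
  k11 : r * X.e0 ≤ ξ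
  k12 : ξ ≤ s

variable {X : BUCtx r V W}

theorem cl_mem_B2 {w z y : W} (hz : z ∈ bu_cl X.H {w}) (h : X.H.Adj z y) : y ∈ bu_B2 X.H w :=
  bu_mem_cl.2 ⟨z, hz, Or.inr h⟩

theorem cl_sub_B2 (w : W) : bu_cl X.H {w} ⊆ bu_B2 X.H w := bu_sub_cl _ _

theorem self_cl (w : W) : w ∈ bu_cl X.H {w} := bu_sub_cl _ _ (mem_singleton_self w)

theorem nb_cl {w y : W} (h : X.H.Adj w y) : y ∈ bu_cl X.H {w} :=
  bu_mem_cl.2 ⟨w, mem_singleton_self w, Or.inr h⟩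

theorem fresh_dg {D : Finset W} {w z : W} (hD : Disjoint D (bu_B2 X.H w)) (hz : z ∈ bu_cl X.H {w}) :
    X.dg D z = 0 :=
  X.dg_eq_zero (fun y hy ha => disjoint_left.1 hD hy (cl_mem_B2 hz ha.symm))

theorem fresh_not {D : Finset W} {w z : W} (hD : Disjoint D (bu_B2 X.H w)) (hz : z ∈ bu_cl X.H {w}) :
    z ∉ D := fun h => disjoint_left.1 hD h (cl_sub_B2 w hz)

theorem Vij_q (X : BUCtx r V W) {x y : W} (h : X.H.Adj x y) : ∃ q : X.PR, X.Vij (X.φ x) (X.φ y) = X.Vq q := by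
  have hR := X.hom x y h
  rcases lt_or_gt_of_ne hR.ne with h | h
  · exact ⟨⟨(X.φ x, X.φ y), h, hR⟩, rfl⟩
  · exact ⟨⟨(X.φ y, X.φ x), h, hR.symm⟩, X.vij_symm _ _⟩

namespace Pre

variable (K : Pre X)

def xc (q : X.PR) (k : Fin K.pc) (l : Fin (K.Lc+1)) : W := K.wA (Sum.inl (q, k, l))
def bf (i : Fin r) (k : Fin K.pv) (l : Fin (K.Lv+1)) : W := K.wA (Sum.inr (Sum.inl (i, k, l)))
def sg (i : Fin r) (k : Fin K.ξ) : W := K.wA (Sum.inr (Sum.inr (Sum.inl (i, k))))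
def xb (q : X.PR) (k : Fin K.ξ) : W := K.wA (Sum.inr (Sum.inr (Sum.inr (q, k))))
def sr (i : Fin r) (k : Fin K.s) : W := K.wR (Sum.inl (i, k))
def xr (q : X.PR) (k : Fin K.s) : W := K.wR (Sum.inr (q, k))

theorem l_pos' : 0 < X.l := X.l_pos
theorem lD_pos : 0 < X.l ^ X.Δ := pow_pos X.l_pos _
theorem lD_le : X.l ^ X.Δ ≤ 1 := pow_le_one₀ X.l_pos.le X.l_le_one
theorem l2_eq : X.l ^ (2 * X.Δ) = X.l ^ X.Δ * X.l ^ X.Δ := by rw [two_mul, pow_add]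
theorem l2_le : X.l ^ (2 * X.Δ) ≤ X.l ^ X.Δ := by
  rw [l2_eq]; nlinarith [lD_pos (X := X), lD_le (X := X)]

theorem Nab_nn : 0 ≤ K.Nab := le_trans (by positivity) K.n_ab
theorem Nre_nn : 0 ≤ K.Nre := le_trans (by positivity) K.n_re
theorem Nu_nn : 0 ≤ K.Nu := le_trans (by positivity) K.n_u

theorem e0_m : X.e0 ≤ X.l ^ (2 * X.Δ) * K.m := by
  have h1 := K.k1
  have h2 := K.Nab_nn
  have h3 := K.Nre_nn
  have h4 := K.Nu_nn
  have h5 := X.e0_pos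
  have h6 : 0 ≤ (r:ℝ) * (K.pv * (K.Lv + 1) + K.Nre) := by positivity
  have h7 : X.e0 ≤ (r^2 + 2 * X.Δ + 3) * X.e0 := by
    have : (0:ℝ) ≤ r^2 + 2 * X.Δ := by positivity
    nlinarith
  have h8 : X.l ^ (2 * X.Δ) * X.l^2 / 256 * K.m ≤ X.l ^ (2 * X.Δ) * K.m := by
    have a : 0 ≤ X.l ^ (2 * X.Δ) * K.m := mul_nonneg (pow_nonneg X.l_pos.le _) K.hm.le
    have b : X.l^2 / 256 ≤ 1 := by nlinarith [X.l_pos, X.l_le]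
    calc _ = (X.l ^ (2 * X.Δ) * K.m) * (X.l^2/256) := by ring
      _ ≤ _ := mul_le_of_le_one_right a b
  linarith

theorem e0_m1 : X.e0 ≤ X.l ^ X.Δ * K.m :=
  K.e0_m.trans (mul_le_mul_of_nonneg_right l2_le K.hm.le)

theorem e0_Vc (K : Pre X) (i : Fin r) : X.e0 ≤ X.l ^ (2 * X.Δ) * ((X.Vc i).card : ℝ) :=
  K.e0_m.trans (mul_le_mul_of_nonneg_left (K.n_v i).1 (pow_nonneg X.l_pos.le _))

theorem e0_Vc1 (K : Pre X) (i : Fin r) : X.e0 ≤ X.l ^ X.Δ * ((X.Vc i).card : ℝ) :=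
  K.e0_m1.trans (mul_le_mul_of_nonneg_left (K.n_v i).1 (pow_nonneg X.l_pos.le _))

theorem clo_pos : 0 < K.clo := by
  have h1 := K.k4
  have h2 := K.Nab_nn
  have h3 := K.Nre_nn
  have h4 := K.Nu_nn
  have h5 := X.e0_pos
  have h6 : 0 ≤ (K.pc : ℝ) * (K.Lc + 2) + X.Δ * (K.Nre + r * (K.pv * (K.Lv + 1))) + X.Δ * (K.Nab + K.Nu) := by positivity
  have h7 : 0 < X.l^2 / 16 * K.clo := by linarith
  exact (mul_pos_iff_of_pos_left (by have := X.l_pos; positivity)).1 h7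

theorem e0_clo : X.e0 ≤ K.clo := by
  have h1 := K.k4
  have h2 := K.Nab_nn
  have h3 := K.Nre_nn
  have h4 := K.Nu_nn
  have h5 := X.e0_pos
  have h6 : 0 ≤ (K.pc : ℝ) * (K.Lc + 2) + X.Δ * (K.Nre + r * (K.pv * (K.Lv + 1))) + X.Δ * (K.Nab + K.Nu) := by positivity
  have h7 : X.l^2 / 16 * K.clo ≤ K.clo := by
    have b : X.l^2 / 16 ≤ 1 := by nlinarith [X.l_pos, X.l_le]
    exact mul_le_of_le_one_left K.clo_pos.le b
  linarith

theorem Vij_clo {x y : W} (h : X.H.Adj x y) : K.clo ≤ ((X.Vij (X.φ x) (X.φ y)).card : ℝ) := by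
  obtain ⟨q, hq⟩ := X.Vij_q h
  rw [hq]; exact (K.n_c q).1

theorem e0_Vij (K : Pre X) {x y : W} (h : X.H.Adj x y) : X.e0 ≤ ((X.Vij (X.φ x) (X.φ y)).card : ℝ) :=
  K.e0_clo.trans (K.Vij_clo h)

/-- A single step placing a pair. -/
theorem pstep [Nonempty V] {A : W → Finset V} {P : W → W → Finset V} {Z : Finset W} {SE : Set (Sym2 W)}
    {D : Finset W} {ρ : W → V} (hS : X.St A P Z SE D ρ) (hPs : ∀ y z, P y z = P z y)
    (x y : W) (hxy : X.H.Adj x y) (hse : s(x, y) ∈ SE) (hD : Disjoint D (bu_B2 X.H x))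
    (hDab : D ⊆ K.Hab)
    (hP : ∀ w, (w = x ∨ w = y) → ∀ z, X.H.Adj w z → P w z = X.Vij (X.φ w) (X.φ z))
    (hA : ∀ z, (X.H.Adj x z ∨ X.H.Adj y z) → z ∈ Z ∧ A z = X.Vc (X.φ z))
    (F : Finset V) (hF : (F.card : ℝ) ≤ r * (K.pv * (K.Lv + 1) + K.Nre) + r^2 * X.e0)
    (Pi : V → V → Prop)
    (hPi : X.l^2/64 * (((X.Vc (X.φ x)).card : ℝ) * (X.Vc (X.φ y)).card) ≤
      ((((X.Vc (X.φ x)) ×ˢ (X.Vc (X.φ y))).filter (fun q => Pi q.1 q.2)).card : ℝ)) :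
    ∃ ρ' : W → V, X.St A P Z SE (D ∪ {x, y}) ρ' ∧ (∀ w, w ≠ x → w ≠ y → ρ' w = ρ w) ∧
      Pi (ρ' x) (ρ' y) ∧ ρ' x ∉ F ∧ ρ' y ∉ F := by
  have a1 := (K.n_v (X.φ x)).1
  have a2 := (K.n_v (X.φ y)).1
  have hm := K.hm
  have hl := X.l_pos
  obtain ⟨ρ', h1, h2, h3, h4, h5, h6, h7, -, -⟩ := hS.pair hPs x y hxy hse
    (fresh_not hD (self_cl x)) (fresh_not hD (nb_cl hxy))
    (fresh_dg hD (self_cl x)) (fresh_dg hD (nb_cl hxy)) (X.Vc (X.φ x)) (X.Vc (X.φ y)) F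
    (Subset.refl _) (Subset.refl _) Pi
    (by intro w hw z ha; rw [hP w hw z ha]; exact ⟨Subset.refl _, K.e0_Vij ha⟩)
    (by
      intro z hz
      obtain ⟨b1, b2⟩ := hA z hz
      rw [b2]; exact ⟨b1, Subset.refl _, K.e0_Vc _⟩)
    (X.l^2/256 * K.m)
    (by
      have h1 := K.k1
      have hDc : (D.card : ℝ) ≤ K.Nab := (Nat.cast_le.2 (card_le_card hDab)).trans K.n_ab
      have h4 := K.Nu_nn
      have h5 := X.e0_pos
      have h6 : X.l ^ (2 * X.Δ) * X.l^2 / 256 * K.m ≤ X.l ^ X.Δ * (X.l^2/256 * K.m) := by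
        calc _ = X.l ^ (2 * X.Δ) * (X.l^2/256 * K.m) := by ring
          _ ≤ _ := mul_le_mul_of_nonneg_right l2_le (by positivity)
      have : 0 ≤ (X.Δ : ℝ) * X.e0 := by positivity
      nlinarith)
    (by
      refine lt_of_lt_of_le ?_ hPi
      have c1 : K.m * (((X.Vc (X.φ x)).card : ℝ) + (X.Vc (X.φ y)).card) ≤
        2 * (((X.Vc (X.φ x)).card : ℝ) * (X.Vc (X.φ y)).card) := by nlinarith
      have c2 : 0 < (((X.Vc (X.φ x)).card : ℝ) * (X.Vc (X.φ y)).card) := mul_pos (by linarith) (by linarith)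
      have c3 : 0 < X.l^2 := by positivity
      nlinarith)
  exact ⟨ρ', h1, h2, h5, h6, h7⟩

end Pre
end BUCtx

theorem bu_avg {α γ : Type*} (P : Finset α) (S T : Finset γ) (N : α → γ → Prop) (G : α → Prop) (a : ℝ)
    (ha : 0 ≤ a) (hS : S.Nonempty) (hTS : T ⊆ S)
    (h : ∀ c ∈ S, 2 * a * (P.card : ℝ) ≤ ((P.filter (fun e => N e c ∧ G e)).card : ℝ)) :
    a * (P.card : ℝ) ≤ ((P.filter (fun e => G e ∧ a * (T.card : ℝ) ≤ ((T.filter (fun c => N e c)).card : ℝ))).card : ℝ) := by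
  have hP0 : (0:ℝ) ≤ P.card := by positivity
  rcases T.eq_empty_or_nonempty with rfl | hT
  · obtain ⟨c, hc⟩ := hS
    have h1 := h c hc
    have h2 : ((P.filter (fun e => N e c ∧ G e)).card : ℝ) ≤
      ((P.filter (fun e => G e ∧ a * (((∅ : Finset γ)).card : ℝ) ≤ (((∅ : Finset γ).filter (fun c => N e c)).card : ℝ))).card : ℝ) := by
      refine Nat.cast_le.2 (card_le_card ?_)
      intro e he
      rw [mem_filter] at he ⊢
      exact ⟨he.1, he.2.2, by simp⟩
    have : 0 ≤ a * (P.card : ℝ) := by positivity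
    linarith
  · set Q := P.filter (fun e => G e) with hQ
    have hTc : (0:ℝ) < T.card := by exact_mod_cast hT.card_pos
    have h1 := bu_markov Q (fun e => ((T.filter (fun c => N e c)).card : ℝ)) (T.card : ℝ) (a * T.card)
      (by positivity) (fun e _ => Nat.cast_le.2 (card_le_card (filter_subset _ _)))
    rw [bu_dc] at h1
    have h2 : (T.card : ℝ) * (2 * a * (P.card : ℝ)) ≤ ∑ b ∈ T, ((Q.filter (fun e => N e b)).card : ℝ) := by
      rw [← nsmul_eq_mul, ← sum_const]
      refine sum_le_sum (fun c hc => (h c (hTS hc)).trans (Nat.cast_le.2 (card_le_card ?_)))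
      intro e he
      rw [mem_filter] at he ⊢
      exact ⟨mem_filter.2 ⟨he.1, he.2.2⟩, he.2.1⟩
    have h3 : (Q.card : ℝ) ≤ P.card := Nat.cast_le.2 (card_le_card (filter_subset _ _))
    have h4 : (((Q.filter (fun e => a * (T.card : ℝ) ≤ ((T.filter (fun c => N e c)).card : ℝ))).card : ℝ)) ≤
      ((P.filter (fun e => G e ∧ a * (T.card : ℝ) ≤ ((T.filter (fun c => N e c)).card : ℝ))).card : ℝ) := by
      refine Nat.cast_le.2 (card_le_card ?_)
      intro e he
      rw [mem_filter, mem_filter] at he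
      exact mem_filter.2 ⟨he.1.1, he.1.2, he.2⟩
    have h5 : a * (T.card : ℝ) * Q.card ≤ a * (T.card : ℝ) * P.card := mul_le_mul_of_nonneg_left h3 (by positivity)
    have h6 : (T.card : ℝ) * (a * P.card) ≤ T.card * ((Q.filter (fun e => a * (T.card : ℝ) ≤ ((T.filter (fun c => N e c)).card : ℝ))).card : ℝ) := by
      nlinarith
    exact (le_of_mul_le_mul_left h6 hTc).trans h4

namespace BUCtx
variable {r : ℕ} {V W : Type} [Fintype V] [Fintype W] {X : BUCtx r V W}
namespace Pre
variable (K : Pre X)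

/-- the colour-gadget edge -/
def ec (q : X.PR) (k : Fin K.pc) (l : Fin (K.Lc+1)) : Sym2 W := s(K.xc q k l, K.yc q k l)

noncomputable def cb (q : X.PR) (k : Fin K.pc) (n : ℕ) : Finset W :=
  ((univ : Finset (Fin (K.Lc+1))).filter (fun l => l.val ≤ n)).biUnion (fun l => {K.xc q k l, K.yc q k l})

theorem xc_adj (q : X.PR) (k : Fin K.pc) (l : Fin (K.Lc+1)) : X.H.Adj (K.xc q k l) (K.yc q k l) :=
  (K.c_col q k l).2.2

theorem pair_sub_cl {x y : W} (h : X.H.Adj x y) : ({x, y} : Finset W) ⊆ bu_cl X.H {x} := by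
  intro z hz
  rw [mem_insert, mem_singleton] at hz
  rcases hz with rfl | rfl
  · exact self_cl _
  · exact nb_cl h

theorem colgad [Nonempty V] (q : X.PR) (k : Fin K.pc) (S : Finset V) (hSn : S.Nonempty) (hSq : S ⊆ X.Vq q)
    (P0 : Finset (V × V)) (hP0 : P0 ⊆ (X.Vc q.1.1) ×ˢ (X.Vc q.1.2))
    (hP0c : X.l / 8 * (((X.Vc q.1.1) ×ˢ (X.Vc q.1.2)).card : ℝ) ≤ (P0.card : ℝ))
    (hcl : ∀ e0 ∈ P0, ∀ c ∈ S, (X.l^2/32) * (((X.Vc q.1.1) ×ˢ (X.Vc q.1.2)).card : ℝ) ≤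
        ((((X.Vc q.1.1) ×ˢ (X.Vc q.1.2)).filter (fun e => (({e.1, e.2, c} : Finset V) ∈ X.E) ∧
          (X.l^3/256) * ((X.Vq q).card : ℝ) ≤
          (((X.Vq q).filter (fun c' => ({e.1, e.2, c'} : Finset V) ∈ X.E ∧ ({e0.1, e0.2, c'} : Finset V) ∈ X.E)).card : ℝ))).card : ℝ))
    {SE : Set (Sym2 W)} (hSE : ∀ l, K.ec q k l ∈ SE)
    (D : Finset W) (ρ : W → V)
    (hS : X.St (fun z => X.Vc (X.φ z)) (fun y z => X.Vij (X.φ y) (X.φ z)) univ SE D ρ)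
    (hDab : D ⊆ K.Hab) (hDB : ∀ l, Disjoint D (bu_B2 X.H (K.xc q k l))) :
    ∃ ρ' : W → V, X.St (fun z => X.Vc (X.φ z)) (fun y z => X.Vij (X.φ y) (X.φ z)) univ SE (D ∪ K.cb q k K.Lc) ρ' ∧
      (∀ w, w ∉ K.cb q k K.Lc → ρ' w = ρ w) ∧
      (∀ l, l ≠ 0 → (X.l^3/256) * ((X.Vq q).card : ℝ) ≤ ((X.lst ρ' (K.ec q k l) ∩ X.lst ρ' (K.ec q k 0)).card : ℝ)) ∧
      ((S.filter (fun c => ∀ l, c ∉ X.lst ρ' (K.ec q k l))).card : ℝ) ≤ (1 - X.l^2/64)^K.Lc * (S.card : ℝ) := by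
  have hl := X.l_pos
  have hl2 := X.l_le
  have hφx : ∀ l, X.φ (K.xc q k l) = q.1.1 := fun l => (K.c_col q k l).1
  have hφy : ∀ l, X.φ (K.yc q k l) = q.1.2 := fun l => (K.c_col q k l).2.1
  have hlst : ∀ (ρ : W → V) l c, c ∈ X.lst ρ (K.ec q k l) ↔ c ∈ X.Vq q ∧ ({ρ (K.xc q k l), ρ (K.yc q k l), c} : Finset V) ∈ X.E := by
    intro ρ l c
    unfold ec
    rw [X.mem_lst, hφx, hφy]; rfl
  have hF0 : (((∅ : Finset V)).card : ℝ) ≤ r * (K.pv * (K.Lv + 1) + K.Nre) + r^2 * X.e0 := by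
    have := K.Nre_nn; have := X.e0_pos
    rw [card_empty, Nat.cast_zero]; positivity
  have key : ∀ n, n ≤ K.Lc → ∃ ρ' : W → V,
      X.St (fun z => X.Vc (X.φ z)) (fun y z => X.Vij (X.φ y) (X.φ z)) univ SE (D ∪ K.cb q k n) ρ' ∧
      (∀ w, w ∉ K.cb q k n → ρ' w = ρ w) ∧ (ρ' (K.xc q k 0), ρ' (K.yc q k 0)) ∈ P0 ∧
      (∀ l, l ≠ 0 → l.val ≤ n → (X.l^3/256) * ((X.Vq q).card : ℝ) ≤ ((X.lst ρ' (K.ec q k l) ∩ X.lst ρ' (K.ec q k 0)).card : ℝ)) ∧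
      ((S.filter (fun c => ∀ l : Fin (K.Lc+1), l.val ≤ n → c ∉ X.lst ρ' (K.ec q k l))).card : ℝ) ≤ (1 - X.l^2/64)^n * (S.card : ℝ) := by
    intro n
    induction n with
    | zero =>
      intro _
      have hcb : K.cb q k 0 = {K.xc q k 0, K.yc q k 0} := by
        unfold cb
        have : ((univ : Finset (Fin (K.Lc+1))).filter (fun l => l.val ≤ 0)) = {0} := by
          ext l
          rw [mem_filter, mem_singleton]
          constructor
          · rintro ⟨-, h⟩; exact Fin.ext (by simpa using h)
          · rintro rfl; simp
        rw [this, singleton_biUnion]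
      obtain ⟨ρ', h1, h2, h3, -, -⟩ := K.pstep hS (fun y z => X.vij_symm _ _) (K.xc q k 0) (K.yc q k 0)
        (K.xc_adj q k 0) (hSE 0) (hDB 0) hDab (fun _ _ _ _ => rfl) (fun _ _ => ⟨mem_univ _, rfl⟩) ∅ hF0
        (fun u v => (u, v) ∈ P0) (by
          rw [hφx, hφy]
          rw [card_product] at hP0c
          push_cast at hP0c
          refine le_trans ?_ (Nat.cast_le.2 (card_le_card (s := P0) (fun p hp => by
            simp only [mem_filter]; exact ⟨hP0 hp, hp⟩)))
          refine le_trans ?_ hP0c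
          apply mul_le_mul_of_nonneg_right _ (by positivity)
          nlinarith)
      refine ⟨ρ', by rw [hcb]; exact h1, ?_, h3, ?_, ?_⟩
      · intro w hw
        rw [hcb, mem_insert, mem_singleton, not_or] at hw
        exact h2 w hw.1 hw.2
      · intro l hl0 hl1
        exact absurd (Fin.ext (by simpa using hl1)) hl0
      · rw [pow_zero, one_mul]
        exact Nat.cast_le.2 (card_le_card (filter_subset _ _))
    | succ n ih =>
      intro hn
      obtain ⟨ρ1, h1, h2, h3, h4, h5⟩ := ih (by omega)
      set ln : Fin (K.Lc+1) := ⟨n+1, by omega⟩ with hln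
      set T := S.filter (fun c => ∀ l : Fin (K.Lc+1), l.val ≤ n → c ∉ X.lst ρ1 (K.ec q k l)) with hT
      have hcb : K.cb q k (n+1) = K.cb q k n ∪ {K.xc q k ln, K.yc q k ln} := by
        unfold cb
        have : ((univ : Finset (Fin (K.Lc+1))).filter (fun l => l.val ≤ n+1)) =
            ((univ : Finset (Fin (K.Lc+1))).filter (fun l => l.val ≤ n)) ∪ {ln} := by
          ext l
          rw [mem_filter, mem_union, mem_filter, mem_singleton, Fin.ext_iff]
          simp only [mem_univ, true_and, hln]
          omega
        rw [this, union_biUnion, singleton_biUnion]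
      have hne : ∀ l : Fin (K.Lc+1), l.val ≤ n → l ≠ ln := by
        intro l hl e; rw [e] at hl; simp [hln] at hl
      have hdisj : ∀ l l' : Fin (K.Lc+1), l ≠ l' → Disjoint (bu_B2 X.H (K.xc q k l)) (bu_B2 X.H (K.xc q k l')) := by
        intro l l' hll
        apply K.wA_dis
        intro e
        apply hll
        simpa using e
      have hcbB : Disjoint (K.cb q k n) (bu_B2 X.H (K.xc q k ln)) := by
        unfold cb
        rw [disjoint_biUnion_left]
        intro l hl
        refine (hdisj l ln (hne l (mem_filter.1 hl).2)).mono_left ?_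
        exact (pair_sub_cl (K.xc_adj q k l)).trans (cl_sub_B2 _)
      have hcbab : K.cb q k n ⊆ K.Hab := by
        unfold cb
        rw [biUnion_subset]
        intro l _
        exact ((pair_sub_cl (K.xc_adj q k l)).trans (cl_sub_B2 _)).trans (K.wA_sub _)
      have hav := bu_avg ((X.Vc q.1.1) ×ˢ (X.Vc q.1.2)) S T (fun e c => ({e.1, e.2, c} : Finset V) ∈ X.E)
        (fun e => (X.l^3/256) * ((X.Vq q).card : ℝ) ≤
          (((X.Vq q).filter (fun c' => ({e.1, e.2, c'} : Finset V) ∈ X.E ∧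
            ({ρ1 (K.xc q k 0), ρ1 (K.yc q k 0), c'} : Finset V) ∈ X.E)).card : ℝ)) (X.l^2/64) (by positivity)
        hSn (filter_subset _ _) (by
          intro c hc
          have := hcl _ h3 c hc
          have e : 2 * (X.l^2/64) = X.l^2/32 := by ring
          rw [e]
          exact this)
      obtain ⟨ρ', g1, g2, g3, -, -⟩ := K.pstep h1 (fun y z => X.vij_symm _ _) (K.xc q k ln) (K.yc q k ln)
        (K.xc_adj q k ln) (hSE ln) (disjoint_union_left.2 ⟨hDB ln, hcbB⟩) (union_subset hDab hcbab)
        (fun _ _ _ _ => rfl) (fun _ _ => ⟨mem_univ _, rfl⟩) ∅ hF0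
        (fun u v => (X.l^3/256) * ((X.Vq q).card : ℝ) ≤
          (((X.Vq q).filter (fun c' => ({u, v, c'} : Finset V) ∈ X.E ∧
            ({ρ1 (K.xc q k 0), ρ1 (K.yc q k 0), c'} : Finset V) ∈ X.E)).card : ℝ) ∧
            (X.l^2/64) * (T.card : ℝ) ≤ ((T.filter (fun c => ({u, v, c} : Finset V) ∈ X.E)).card : ℝ)) (by
          rw [hφx, hφy]
          rw [card_product] at hav
          push_cast at hav
          refine hav.trans (Nat.cast_le.2 (card_le_card (fun p hp => ?_)))
          simp only [mem_filter] at hp ⊢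
          exact hp)
      have hold : ∀ l : Fin (K.Lc+1), l.val ≤ n → ρ' (K.xc q k l) = ρ1 (K.xc q k l) ∧ ρ' (K.yc q k l) = ρ1 (K.yc q k l) := by
        intro l hl
        have hd := hdisj l ln (hne l hl)
        have m1 : K.xc q k ln ∈ bu_B2 X.H (K.xc q k ln) := cl_sub_B2 _ (self_cl _)
        have m2 : K.yc q k ln ∈ bu_B2 X.H (K.xc q k ln) := cl_sub_B2 _ (nb_cl (K.xc_adj q k ln))
        have m3 : K.xc q k l ∈ bu_B2 X.H (K.xc q k l) := cl_sub_B2 _ (self_cl _)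
        have m4 : K.yc q k l ∈ bu_B2 X.H (K.xc q k l) := cl_sub_B2 _ (nb_cl (K.xc_adj q k l))
        exact ⟨g2 _ (fun e => disjoint_left.1 hd m3 (e ▸ m1)) (fun e => disjoint_left.1 hd m3 (e ▸ m2)),
          g2 _ (fun e => disjoint_left.1 hd m4 (e ▸ m1)) (fun e => disjoint_left.1 hd m4 (e ▸ m2))⟩
      have hlo : ∀ l : Fin (K.Lc+1), l.val ≤ n → X.lst ρ' (K.ec q k l) = X.lst ρ1 (K.ec q k l) := by
        intro l hl
        ext c
        rw [hlst, hlst, (hold l hl).1, (hold l hl).2]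
      refine ⟨ρ', ?_, ?_, ?_, ?_, ?_⟩
      · rw [hcb, ← union_assoc]; exact g1
      · intro w hw
        rw [hcb, mem_union, mem_insert, mem_singleton, not_or, not_or] at hw
        rw [g2 w hw.2.1 hw.2.2, h2 w hw.1]
      · rw [(hold 0 (by simp)).1, (hold 0 (by simp)).2]; exact h3
      · intro l hl0 hl1
        by_cases hle : l.val ≤ n
        · rw [hlo l hle, hlo 0 (by simp)]; exact h4 l hl0 hle
        · have : l = ln := Fin.ext (by simp [hln]; omega)
          subst this
          refine g3.1.trans (Nat.cast_le.2 (card_le_card ?_))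
          intro c hc
          rw [mem_filter] at hc
          rw [mem_inter, hlst, hlst, (hold 0 (by simp)).1, (hold 0 (by simp)).2]
          exact ⟨⟨hc.1, hc.2.1⟩, hc.1, hc.2.2⟩
      · have e1 : S.filter (fun c => ∀ l : Fin (K.Lc+1), l.val ≤ n+1 → c ∉ X.lst ρ' (K.ec q k l)) ⊆
            T \ (T.filter (fun c => ({ρ' (K.xc q k ln), ρ' (K.yc q k ln), c} : Finset V) ∈ X.E)) := by
          intro c hc
          rw [mem_filter] at hc
          rw [mem_sdiff, hT, mem_filter]
          refine ⟨⟨hc.1, fun l hl => ?_⟩, fun h => ?_⟩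
          · rw [← hlo l hl]; exact hc.2 l (by omega)
          · rw [mem_filter] at h
            exact hc.2 ln (by simp [hln]) ((hlst _ _ _).2 ⟨hSq hc.1, h.2⟩)
        have e2 := card_le_card e1
        rw [card_sdiff_of_subset (filter_subset _ _)] at e2
        have e3 : ((S.filter (fun c => ∀ l : Fin (K.Lc+1), l.val ≤ n+1 → c ∉ X.lst ρ' (K.ec q k l))).card : ℝ) ≤
            (T.card : ℝ) - ((T.filter (fun c => ({ρ' (K.xc q k ln), ρ' (K.yc q k ln), c} : Finset V) ∈ X.E)).card : ℝ) := by
          rw [← Nat.cast_sub (card_le_card (filter_subset _ _))]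
          exact Nat.cast_le.2 e2
        have e4 := g3.2
        have e5 : 0 ≤ 1 - X.l^2/64 := by nlinarith
        calc _ ≤ (1 - X.l^2/64) * (T.card : ℝ) := by linarith
          _ ≤ (1 - X.l^2/64) * ((1 - X.l^2/64)^n * (S.card : ℝ)) := mul_le_mul_of_nonneg_left h5 e5
          _ = _ := by ring
  obtain ⟨ρ', h1, h2, -, h4, h5⟩ := key K.Lc le_rfl
  refine ⟨ρ', h1, h2, fun l hl0 => h4 l hl0 (by omega), ?_⟩
  refine le_trans (Nat.cast_le.2 (card_le_card ?_)) h5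
  intro c hc
  rw [mem_filter] at hc ⊢
  exact ⟨hc.1, fun l _ => hc.2 l⟩

end Pre
end BUCtx

namespace BUCtx
variable {r : ℕ} {V W : Type} [Fintype V] [Fintype W] {X : BUCtx r V W}
namespace Pre
variable (K : Pre X)

/-- all colour-gadget edges -/
noncomputable def SF : Finset (Sym2 W) :=
  (univ : Finset (X.PR × Fin K.pc × Fin (K.Lc+1))).image (fun t => K.ec t.1 t.2.1 t.2.2)

noncomputable def Buf : Finset W :=
  (univ : Finset (Fin r × Fin K.pv × Fin (K.Lv+1))).image (fun t => K.bf t.1 t.2.1 t.2.2)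

noncomputable def DA : Finset W :=
  (univ : Finset (X.PR × Fin K.pc)).biUnion (fun t => K.cb t.1 t.2 K.Lc)

noncomputable def late : Finset (Sym2 W) := X.tch (K.Hre ∪ K.Xp ∪ K.Buf)

theorem Buf_card : (K.Buf.card : ℝ) ≤ r * (K.pv * (K.Lv + 1)) := by
  have h : K.Buf.card ≤ r * (K.pv * (K.Lv + 1)) := by
    refine card_image_le.trans ?_
    simp
  have := (Nat.cast_le (α := ℝ)).2 h
  push_cast at this
  exact this

theorem late_card : (K.late.card : ℝ) ≤ X.Δ * (K.Nre + r * (K.pv * (K.Lv + 1))) := by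
  have h1 : (K.late.card : ℝ) ≤ ((K.Hre ∪ K.Xp ∪ K.Buf).card : ℝ) * X.Δ := by
    have := (Nat.cast_le (α := ℝ)).2 (X.tch_card (K.Hre ∪ K.Xp ∪ K.Buf))
    push_cast at this
    exact this
  have h2 : ((K.Hre ∪ K.Xp ∪ K.Buf).card : ℝ) ≤ K.Hre.card + K.Xp.card + K.Buf.card := by
    have a := card_union_le (K.Hre ∪ K.Xp) K.Buf
    have b := card_union_le K.Hre K.Xp
    exact_mod_cast (by omega : (K.Hre ∪ K.Xp ∪ K.Buf).card ≤ K.Hre.card + K.Xp.card + K.Buf.card)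
  have h3 := K.n_re
  have h4 := K.Buf_card
  have : (0:ℝ) ≤ X.Δ := by positivity
  nlinarith

theorem mem_cb {q : X.PR} {k : Fin K.pc} {n : ℕ} {w : W} : w ∈ K.cb q k n ↔
    ∃ l : Fin (K.Lc+1), l.val ≤ n ∧ (w = K.xc q k l ∨ w = K.yc q k l) := by
  unfold cb
  simp only [mem_biUnion, mem_filter, mem_univ, true_and, mem_insert, mem_singleton]

theorem mem_DA {w : W} : w ∈ K.DA ↔ ∃ q k l, (w = K.xc q k l ∨ w = K.yc q k l) := by
  unfold DA
  simp only [mem_biUnion, mem_univ, true_and, mem_cb]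
  constructor
  · rintro ⟨t, l, -, h⟩; exact ⟨t.1, t.2, l, h⟩
  · rintro ⟨q, k, l, h⟩; exact ⟨(q, k), l, by omega, h⟩

theorem cb_cl {q : X.PR} {k : Fin K.pc} {n : ℕ} {w : W} (h : w ∈ K.cb q k n) :
    ∃ l : Fin (K.Lc+1), w ∈ bu_cl X.H {K.xc q k l} := by
  obtain ⟨l, -, h⟩ := K.mem_cb.1 h
  refine ⟨l, pair_sub_cl (K.xc_adj q k l) ?_⟩
  rw [mem_insert, mem_singleton]; exact h

theorem cb_Hab (q : X.PR) (k : Fin K.pc) (n : ℕ) : K.cb q k n ⊆ K.Hab := by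
  intro w hw
  obtain ⟨l, hl⟩ := K.cb_cl hw
  exact K.wA_sub _ (cl_sub_B2 _ hl)

theorem DA_Hab : K.DA ⊆ K.Hab := by
  unfold DA
  rw [biUnion_subset]
  intro t _
  exact K.cb_Hab _ _ _

theorem cb_dis_B2 {q q' : X.PR} {k k' : Fin K.pc} (h : (q, k) ≠ (q', k')) (n : ℕ) (l : Fin (K.Lc+1)) :
    Disjoint (K.cb q k n) (bu_B2 X.H (K.xc q' k' l)) := by
  rw [disjoint_left]
  intro w hw hw'
  obtain ⟨l', hl'⟩ := K.cb_cl hw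
  refine disjoint_left.1 (K.wA_dis (Sum.inl (q, k, l')) (Sum.inl (q', k', l)) ?_) (cl_sub_B2 _ hl') hw'
  intro e
  apply h
  simp only [Sum.inl.injEq, Prod.mk.injEq] at e
  rw [e.1, e.2.1]

theorem ec_Eq (q : X.PR) (k : Fin K.pc) (l : Fin (K.Lc+1)) : K.ec q k l ∈ X.Eq q :=
  X.mem_Eq.2 ⟨_, _, rfl, K.xc_adj q k l, (K.c_col q k l).1, (K.c_col q k l).2.1⟩

theorem ec_inj : Function.Injective (fun t : X.PR × Fin K.pc × Fin (K.Lc+1) => K.ec t.1 t.2.1 t.2.2) := by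
  rintro ⟨q, k, l⟩ ⟨q', k', l'⟩ h
  by_contra hne
  have hd := K.wA_dis (Sum.inl (q, k, l)) (Sum.inl (q', k', l')) (by simpa using hne)
  have h1 : K.xc q k l ∈ K.ec q' k' l' := by
    have : K.xc q k l ∈ K.ec q k l := Sym2.mem_mk_left _ _
    have h' : K.ec q k l = K.ec q' k' l' := h
    rwa [h'] at this
  have h2 : K.xc q k l ∈ bu_B2 X.H (K.xc q' k' l') := by
    apply cl_sub_B2
    rcases Sym2.mem_iff.1 h1 with e | e
    · rw [e]; exact self_cl _
    · rw [e]; exact nb_cl (K.xc_adj q' k' l')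
  exact disjoint_left.1 hd (cl_sub_B2 _ (self_cl _)) h2

theorem SF_sub : K.SF ⊆ X.edges := by
  intro e he
  obtain ⟨t, -, rfl⟩ := mem_image.1 he
  exact X.Eq_sub _ (K.ec_Eq _ _ _)

theorem mem_SF {e : Sym2 W} : e ∈ K.SF ↔ ∃ q k l, e = K.ec q k l := by
  unfold SF
  rw [mem_image]
  constructor
  · rintro ⟨t, -, rfl⟩; exact ⟨_, _, _, rfl⟩
  · rintro ⟨q, k, l, rfl⟩; exact ⟨(q, k, l), mem_univ _, rfl⟩

theorem SF_DA {e : Sym2 W} (he : e ∈ K.SF) : ∀ x ∈ e, x ∈ K.DA := by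
  obtain ⟨q, k, l, rfl⟩ := K.mem_SF.1 he
  intro x hx
  exact K.mem_DA.2 ⟨q, k, l, Sym2.mem_iff.1 hx⟩

theorem SF_card (q : X.PR) : (X.Eq q ∩ K.SF).card = K.pc * (K.Lc + 1) := by
  have : X.Eq q ∩ K.SF = ((univ : Finset (Fin K.pc × Fin (K.Lc+1)))).image (fun t => K.ec q t.1 t.2) := by
    ext e
    rw [mem_inter, mem_SF, mem_image]
    constructor
    · rintro ⟨h1, q', k, l, rfl⟩
      have := X.q_unique h1 (K.ec_Eq q' k l)
      subst this
      exact ⟨(k, l), mem_univ _, rfl⟩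
    · rintro ⟨t, -, rfl⟩
      exact ⟨K.ec_Eq _ _ _, _, _, _, rfl⟩
  rw [this, card_image_of_injective]
  · simp
  · intro t t' h
    have := K.ec_inj (a₁ := (q, t.1, t.2)) (a₂ := (q, t'.1, t'.2)) h
    simpa [Prod.ext_iff] using this

/-- Stage A: colour absorber. -/
theorem stageA [Nonempty V] : ∃ ρ : W → V,
    X.St (fun z => X.Vc (X.φ z)) (fun y z => X.Vij (X.φ y) (X.φ z)) univ (K.SF : Set (Sym2 W)) K.DA ρ ∧
    ∃ B0 B1 : Finset V, Disjoint B0 B1 ∧ (∀ q, (X.Vq q ∩ B0).card = K.pc * K.Lc) ∧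
      (∀ q, (X.Vq q ∩ B1).card + K.s = K.pc + (X.Eq q ∩ K.late).card) ∧
      (∀ ρ' : W → V, (∀ y ∈ K.DA, ρ' y = ρ y) → ∀ U ⊆ B1, (∀ q, (X.Vq q ∩ U).card = K.pc) →
        ∃ C ⊆ B0 ∪ U, X.Col ρ' K.SF C) := by
  have hl := X.l_pos
  have hl2 := X.l_le
  have hVn : ∀ i, (X.Vc i).Nonempty := fun i => card_pos.1 (by
    have := (K.n_v i).1; have := K.hm
    exact_mod_cast (by linarith : (0:ℝ) < (X.Vc i).card))
  have hCn : ∀ q, (X.Vq q).Nonempty := fun q => card_pos.1 (by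
    have := (K.n_c q).1; have := K.clo_pos
    exact_mod_cast (by linarith : (0:ℝ) < (X.Vq q).card))
  have hclu : ∀ q : X.PR, ∃ S ⊆ X.Vq q, ∃ P0 ⊆ (X.Vc q.1.1) ×ˢ (X.Vc q.1.2),
      X.l^2/16 * ((X.Vq q).card : ℝ) ≤ (S.card : ℝ) ∧
      X.l / 8 * (((X.Vc q.1.1) ×ˢ (X.Vc q.1.2)).card : ℝ) ≤ (P0.card : ℝ) ∧
      ∀ e0 ∈ P0, ∀ c ∈ S, (X.l^2/32) * (((X.Vc q.1.1) ×ˢ (X.Vc q.1.2)).card : ℝ) ≤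
        ((((X.Vc q.1.1) ×ˢ (X.Vc q.1.2)).filter (fun e => (({e.1, e.2, c} : Finset V) ∈ X.E) ∧
          (X.l^3/256) * ((X.Vq q).card : ℝ) ≤
          (((X.Vq q).filter (fun c' => ({e.1, e.2, c'} : Finset V) ∈ X.E ∧ ({e0.1, e0.2, c'} : Finset V) ∈ X.E)).card : ℝ))).card : ℝ) := by
    intro q
    have := bu_cluster ((X.Vc q.1.1) ×ˢ (X.Vc q.1.2)) (X.Vq q) (fun e c => ({e.1, e.2, c} : Finset V) ∈ X.E) X.l hl
      ((hVn _).product (hVn _)) (hCn q) (by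
        intro c hc
        rw [card_product]
        push_cast
        have := X.cdeg q.1.1 q.1.2 q.2.2 c hc
        convert this using 3)
    obtain ⟨S, hS, P0, hP0, h1, h2, h3⟩ := this
    exact ⟨S, hS, P0, hP0, h1, h2, h3⟩
  choose S hSs P0 hP0 hSc hP0c hcl using hclu
  have hSn : ∀ q, (S q).Nonempty := fun q => card_pos.1 (by
    have := hSc q
    have h2 : (0:ℝ) < (X.Vq q).card := by exact_mod_cast (hCn q).card_pos
    have : (0:ℝ) < (S q).card := lt_of_lt_of_le (by positivity) this
    exact_mod_cast this)
  have hseq := bu_seq (V := V) (W := W) (γ := X.PR × Fin K.pc)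
    (fun D ρ => X.St (fun z => X.Vc (X.φ z)) (fun y z => X.Vij (X.φ y) (X.φ z)) univ (K.SF : Set (Sym2 W)) D ρ)
    (fun t => K.cb t.1 t.2 K.Lc)
    (fun t ρ => (∀ l, l ≠ 0 → (X.l^3/256) * ((X.Vq t.1).card : ℝ) ≤ ((X.lst ρ (K.ec t.1 t.2 l) ∩ X.lst ρ (K.ec t.1 t.2 0)).card : ℝ)) ∧
      (((S t.1).filter (fun c => ∀ l, c ∉ X.lst ρ (K.ec t.1 t.2 l))).card : ℝ) ≤ (1 - X.l^2/64)^K.Lc * ((S t.1).card : ℝ))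
    (by
      intro t ρ ρ' h hq
      have : ∀ l, X.lst ρ (K.ec t.1 t.2 l) = X.lst ρ' (K.ec t.1 t.2 l) := by
        intro l
        apply X.lst_congr
        intro x hx
        exact h x (K.mem_cb.2 ⟨l, by omega, Sym2.mem_iff.1 hx⟩)
      simp only [this] at hq
      exact hq)
    ∅ (fun _ => Classical.arbitrary V)
    ⟨by simp, by simp, by simp, by
      intro z _ _
      rw [X.cand_of_dg (X.dg_eq_zero (by simp)), X.dg_eq_zero (by simp)]
      simp⟩ univ
    (by
      intro g _ g' _ hgg
      rw [disjoint_left]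
      intro w hw hw'
      obtain ⟨l', hl'⟩ := K.cb_cl hw'
      exact disjoint_left.1 (K.cb_dis_B2 (q := g.1) (k := g.2) (q' := g'.1) (k' := g'.2) hgg K.Lc l') hw (cl_sub_B2 _ hl'))
    (by
      intro G' _ g _ hg ρ hS _ _
      obtain ⟨ρ', h1, h2, h3, h4⟩ := K.colgad g.1 g.2 (S g.1) (hSn _) (hSs _) (P0 g.1) (hP0 _) (hP0c _) (hcl _)
        (fun l => mem_coe.2 (K.mem_SF.2 ⟨g.1, g.2, l, rfl⟩)) _ ρ hS
        (by
          rw [empty_union, biUnion_subset]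
          intro t _; exact K.cb_Hab _ _ _)
        (by
          intro l
          rw [empty_union, disjoint_biUnion_left]
          intro t ht
          exact K.cb_dis_B2 (q := t.1) (k := t.2) (q' := g.1) (k' := g.2) (fun (e : t = g) => hg (e ▸ ht)) _ l)
      exact ⟨ρ', h1, h2, h3, h4⟩)
  obtain ⟨ρ, hSt, -, hQ⟩ := hseq
  rw [empty_union] at hSt
  refine ⟨ρ, hSt, ?_⟩
  have hgad : ∀ q : X.PR, ∃ B0 B1 : Finset V, Disjoint B0 B1 ∧ B0 ⊆ X.Vq q ∧ B1 ⊆ X.Vq q ∧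
      B0.card = K.pc * K.Lc ∧ B1.card = K.pc + (X.Eq q ∩ K.late).card - K.s ∧
      ∀ U ⊆ B1, U.card = K.pc → ∃ f : Fin K.pc → Fin (K.Lc+1) → V,
        (∀ s l s' l', f s l = f s' l' → s = s' ∧ l = l') ∧
        ∀ s l, f s l ∈ X.lst ρ (K.ec q s l) ∧ f s l ∈ B0 ∪ U := by
    intro q
    obtain ⟨B0, B1, h1, -, -, h4, h5, h6, h7, h8⟩ := bu_gadget K.pc K.Lc (K.pc + (X.Eq q ∩ K.late).card - K.s) (K.pc / 2)
      (fun s l => X.lst ρ (K.ec q s l)) (S q) ∅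
      (by
        intro s l hl0
        have h1 := (hQ (q, s) (mem_univ _)).1 l hl0
        have h2 := K.k2
        have h3 := (K.n_c q).1
        have : ((K.pc * K.Lc : ℕ) : ℝ) ≤ ((X.lst ρ (K.ec q s l) ∩ X.lst ρ (K.ec q s 0)).card : ℝ) := by
          refine le_trans ?_ h1
          push_cast
          refine h2.trans (mul_le_mul_of_nonneg_left h3 (by positivity))
        simpa using Nat.cast_le.1 this)
      (by
        intro s
        have h1 := (hQ (q, s) (mem_univ _)).2
        have h2 := K.k3
        have h3 : ((S q).card : ℝ) ≤ K.chi := (Nat.cast_le.2 (card_le_card (hSs q))).trans (K.n_c q).2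
        have h4 : 0 ≤ (1 - X.l^2/64)^K.Lc := pow_nonneg (by nlinarith) _
        have h5 := (h1.trans (mul_le_mul_of_nonneg_left h3 h4)).trans h2
        rw [Nat.le_div_iff_mul_le (by norm_num)]
        rw [le_div_iff₀ (by norm_num)] at h5
        exact_mod_cast h5)
      (by omega)
      (by
        have h1 := K.k4
        have h2 := (K.n_c q).1
        have h3 := hSc q
        have h4 : ((X.Eq q ∩ K.late).card : ℝ) ≤ X.Δ * (K.Nre + r * (K.pv * (K.Lv + 1))) :=
          (Nat.cast_le.2 (card_le_card inter_subset_right)).trans K.late_card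
        have h5 : X.l^2/16 * K.clo ≤ X.l^2/16 * ((X.Vq q).card : ℝ) := mul_le_mul_of_nonneg_left h2 (by positivity)
        have h6 := K.Nab_nn
        have h7 := K.Nu_nn
        have h8 := X.e0_pos
        have h9 : 0 ≤ (X.Δ : ℝ) * (K.Nab + K.Nu) := by positivity
        have : ((2 * K.pc + (X.Eq q ∩ K.late).card + K.pc * K.Lc : ℕ) : ℝ) ≤ ((S q).card : ℝ) := by
          push_cast
          nlinarith
        have := Nat.cast_le.1 this
        rw [card_empty]
        omega)
    refine ⟨B0, B1, h1, ?_, h4.trans (hSs q), h5, h6, h8⟩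
    intro b hb
    obtain ⟨s, hs⟩ := h7 b hb
    exact X.lst_sub (K.ec_Eq q s 0) hs
  choose B0 B1 hd hB0 hB1 hc0 hc1 habs using hgad
  have hB0q : ∀ q, X.Vq q ∩ univ.biUnion B0 = B0 q := by
    intro q
    ext c
    simp only [mem_inter, mem_biUnion, mem_univ, true_and]
    constructor
    · rintro ⟨h1, q', h2⟩
      by_cases h : q = q'
      · rw [h]; exact h2
      · exact absurd (hB0 q' h2) (disjoint_left.1 (X.Vq_disj h) h1)
    · intro h; exact ⟨hB0 q h, q, h⟩
  have hB1q : ∀ q, X.Vq q ∩ univ.biUnion B1 = B1 q := by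
    intro q
    ext c
    simp only [mem_inter, mem_biUnion, mem_univ, true_and]
    constructor
    · rintro ⟨h1, q', h2⟩
      by_cases h : q = q'
      · rw [h]; exact h2
      · exact absurd (hB1 q' h2) (disjoint_left.1 (X.Vq_disj h) h1)
    · intro h; exact ⟨hB1 q h, q, h⟩
  refine ⟨univ.biUnion B0, univ.biUnion B1, ?_, ?_, ?_, ?_⟩
  · rw [disjoint_left]
    intro c h1 h2
    obtain ⟨q, -, h⟩ := mem_biUnion.1 h1
    have h3 : c ∈ B1 q := by rw [← hB1q]; exact mem_inter.2 ⟨hB0 q h, h2⟩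
    exact disjoint_left.1 (hd q) h h3
  · intro q; rw [hB0q]; exact hc0 q
  · intro q
    rw [hB1q, hc1 q]
    have : (K.s : ℝ) ≤ K.pc := by
      have := K.k7.2
      have : (0:ℝ) ≤ K.pc := by positivity
      linarith
    have : K.s ≤ K.pc := by exact_mod_cast this
    omega
  · intro ρ' hρ' U hU hUc
    have hex : ∀ q, ∃ f : Fin K.pc → Fin (K.Lc+1) → V,
        (∀ s l s' l', f s l = f s' l' → s = s' ∧ l = l') ∧
        ∀ s l, f s l ∈ X.lst ρ (K.ec q s l) ∧ f s l ∈ B0 q ∪ (X.Vq q ∩ U) := by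
      intro q
      apply habs q _ _ (hUc q)
      intro c hc
      rw [← hB1q]
      exact mem_inter.2 ⟨(mem_inter.1 hc).1, hU (mem_inter.1 hc).2⟩
    choose f hf1 hf2 using hex
    set F : Sym2 W → V := Function.extend (fun t : X.PR × Fin K.pc × Fin (K.Lc+1) => K.ec t.1 t.2.1 t.2.2)
      (fun t => f t.1 t.2.1 t.2.2) (fun _ => Classical.arbitrary V) with hF
    have hFe : ∀ q k l, F (K.ec q k l) = f q k l := by
      intro q k l
      exact K.ec_inj.extend_apply _ _ (q, k, l)
    refine ⟨K.SF.image F, ?_, F, ?_, rfl, ?_⟩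
    · intro c hc
      obtain ⟨e, he, rfl⟩ := mem_image.1 hc
      obtain ⟨q, k, l, rfl⟩ := K.mem_SF.1 he
      rw [hFe]
      rcases mem_union.1 (hf2 q k l).2 with h | h
      · exact mem_union_left _ (mem_biUnion.2 ⟨q, mem_univ _, h⟩)
      · exact mem_union_right _ (mem_inter.1 h).2
    · intro e he e' he' h
      obtain ⟨q, k, l, rfl⟩ := K.mem_SF.1 he
      obtain ⟨q', k', l', rfl⟩ := K.mem_SF.1 he'
      rw [hFe, hFe] at h
      have hq : q = q' := by
        by_contra hne
        have h1 := X.lst_sub (K.ec_Eq q k l) (hf2 q k l).1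
        have h2 := X.lst_sub (K.ec_Eq q' k' l') (hf2 q' k' l').1
        rw [← h] at h2
        exact disjoint_left.1 (X.Vq_disj hne) h1 h2
      subst hq
      obtain ⟨h1, h2⟩ := hf1 q _ _ _ _ h
      rw [h1, h2]
    · intro e he
      obtain ⟨q, k, l, rfl⟩ := K.mem_SF.1 he
      rw [hFe]
      have : X.lst ρ' (K.ec q k l) = X.lst ρ (K.ec q k l) :=
        X.lst_congr (fun x hx => hρ' x (K.SF_DA he x hx))
      rw [this]
      exact (hf2 q k l).1

end Pre
end BUCtx

namespace BUCtx
variable {r : ℕ} {V W : Type} [Fintype V] [Fintype W] {X : BUCtx r V W}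

theorem St.monoSE {A : W → Finset V} {P : W → W → Finset V} {Z : Finset W} {SE SE2 : Set (Sym2 W)}
    {D : Finset W} {ρ : W → V} (hS : X.St A P Z SE D ρ) (h : SE ⊆ SE2) : X.St A P Z SE2 D ρ :=
  ⟨hS.inj, hS.mem, fun y hy z hz ha hs => hS.thk y hy z hz ha (fun h' => hs (h h')), hS.inv⟩

noncomputable def nbs (X : BUCtx r V W) (b : W) : Finset W := univ.filter (fun y => X.H.Adj b y)

theorem mem_nbs {b y : W} : y ∈ X.nbs b ↔ X.H.Adj b y := by
  unfold nbs; rw [mem_filter]; exact ⟨fun h => h.2, fun h => ⟨mem_univ _, h⟩⟩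

theorem nbs_cl (b : W) : X.nbs b ⊆ bu_cl X.H {b} := fun y hy => nb_cl (X := X) (mem_nbs.1 hy)

theorem cand_univ (ρ : W → V) (P : W → W → Finset V) (S : Finset V) (b : W) :
    X.cand (X.nbs b) ρ P S b = X.cand univ ρ P S b := by
  unfold cand
  ext v
  simp only [mem_filter, mem_nbs, mem_univ, true_implies]
  exact ⟨fun h => ⟨h.1, fun y ha => h.2 y ha.symm ha⟩, fun h => ⟨h.1, fun y _ ha => h.2 y ha⟩⟩

namespace Pre
variable (K : Pre X)

/-- late region -/
noncomputable def LS : Finset W := K.Hre ∪ K.Xp ∪ K.Buf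

noncomputable def PB (B1 : Finset V) (y z : W) : Finset V :=
  if y ∈ K.LS ∨ z ∈ K.LS then X.Vij (X.φ y) (X.φ z) ∩ B1 else X.Vij (X.φ y) (X.φ z)

theorem PB_symm (B1 : Finset V) (y z : W) : K.PB B1 y z = K.PB B1 z y := by
  unfold PB
  rw [X.vij_symm (X.φ y) (X.φ z)]
  exact if_congr or_comm rfl rfl

theorem PB_sub (B1 : Finset V) (y z : W) : K.PB B1 y z ⊆ X.Vij (X.φ y) (X.φ z) := by
  unfold PB
  split_ifs
  · exact inter_subset_left
  · exact Subset.refl _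

def B1ok (B1 : Finset V) : Prop := ∀ q, (X.Vq q ∩ B1).card + K.s = K.pc + (X.Eq q ∩ K.late).card

theorem pc_half {B1 : Finset V} (h : K.B1ok B1) (q : X.PR) : (K.pc : ℝ) / 2 ≤ ((X.Vq q ∩ B1).card : ℝ) := by
  have h1 := h q
  have h2 := K.k7.2
  have h3 : ((X.Vq q ∩ B1).card : ℝ) + K.s = K.pc + (X.Eq q ∩ K.late).card := by exact_mod_cast h1
  have : (0:ℝ) ≤ (X.Eq q ∩ K.late).card := by positivity
  linarith

theorem e0_pc : X.e0 ≤ X.l * K.pc / 2 := by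
  have h1 := K.k9
  have h2 := K.Nre_nn
  have : 0 ≤ (X.Δ : ℝ) * (K.Nre + r * (K.pv * (K.Lv + 1))) := by positivity
  linarith

theorem e0_pc' : X.e0 ≤ K.pc / 2 := by
  have h1 := K.e0_pc
  have h2 := X.l_le_one
  have : (0:ℝ) ≤ K.pc := by positivity
  nlinarith

theorem PB_big {B1 : Finset V} (h : K.B1ok B1) {y z : W} (ha : X.H.Adj y z) :
    K.PB B1 y z ⊆ X.Vij (X.φ y) (X.φ z) ∧ X.e0 ≤ ((K.PB B1 y z).card : ℝ) := by
  refine ⟨K.PB_sub B1 y z, ?_⟩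
  unfold PB
  split_ifs
  · obtain ⟨q, hq⟩ := X.Vij_q ha
    rw [hq]
    exact K.e0_pc'.trans (K.pc_half h q)
  · exact K.e0_Vij ha

noncomputable def PBp : Finset (Sym2 W) :=
  (univ : Finset (X.PR × Fin K.ξ)).image (fun t => s(K.xb t.1 t.2, K.yb t.1 t.2))
noncomputable def PRp : Finset (Sym2 W) :=
  (univ : Finset (X.PR × Fin K.s)).image (fun t => s(K.xr t.1 t.2, K.yr t.1 t.2))
noncomputable def SE : Finset (Sym2 W) := K.SF ∪ K.PBp ∪ K.PRp

theorem mem_Buf {w : W} : w ∈ K.Buf ↔ ∃ i k l, w = K.bf i k l := by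
  unfold Buf
  rw [mem_image]
  constructor
  · rintro ⟨t, -, rfl⟩; exact ⟨_, _, _, rfl⟩
  · rintro ⟨q, k, l, rfl⟩; exact ⟨(q, k, l), mem_univ _, rfl⟩

theorem Buf_Hab : K.Buf ⊆ K.Hab := by
  intro w hw
  obtain ⟨i, k, l, rfl⟩ := K.mem_Buf.1 hw
  exact K.wA_sub _ (cl_sub_B2 _ (self_cl _))

theorem self_B2 (w : W) : w ∈ bu_B2 X.H w := cl_sub_B2 (X := X) w (self_cl w)

theorem bf_inj : Function.Injective (fun t : Fin r × Fin K.pv × Fin (K.Lv+1) => K.bf t.1 t.2.1 t.2.2) := by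
  rintro ⟨i, k, l⟩ ⟨i', k', l'⟩ h
  by_contra hne
  have hd := K.wA_dis (Sum.inr (Sum.inl (i, k, l))) (Sum.inr (Sum.inl (i', k', l'))) (by simpa using hne)
  have h' : K.bf i k l = K.bf i' k' l' := h
  have h2 : K.bf i k l ∈ bu_B2 X.H (K.bf i' k' l') := by rw [h']; exact self_B2 (X := X) _
  exact disjoint_left.1 hd (self_B2 (X := X) _) h2

/-- an item neighbourhood of another kind contains no buffer vertex -/
theorem B2_Buf {t} {w : W} (hw : w ∈ bu_B2 X.H (K.wA t)) (hb : w ∈ K.Buf) :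
    ∃ i k l, t = Sum.inr (Sum.inl (i, k, l)) ∧ w = K.bf i k l := by
  obtain ⟨i, k, l, rfl⟩ := K.mem_Buf.1 hb
  refine ⟨i, k, l, ?_, rfl⟩
  by_contra hne
  exact disjoint_left.1 (K.wA_dis _ _ hne) hw (self_B2 (X := X) _)

theorem Hab_LS {w : W} (h : w ∈ K.Hab) (hb : w ∉ K.Buf) : w ∉ K.LS := by
  unfold LS
  rw [mem_union, mem_union, not_or, not_or]
  exact ⟨⟨disjoint_left.1 K.dis1 h, disjoint_left.1 K.dis2 h⟩, hb⟩

theorem DA_cl {w : W} (h : w ∈ K.DA) : ∃ q k l, w ∈ bu_cl X.H {K.wA (Sum.inl (q, k, l))} := by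
  obtain ⟨q, k, l, h⟩ := K.mem_DA.1 h
  refine ⟨q, k, l, pair_sub_cl (K.xc_adj q k l) ?_⟩
  rw [mem_insert, mem_singleton]; exact h

theorem DA_LS {w : W} (h : w ∈ K.DA) : w ∉ K.LS := by
  obtain ⟨q, k, l, h⟩ := K.DA_cl h
  refine K.Hab_LS (K.wA_sub _ (cl_sub_B2 _ h)) (fun hb => ?_)
  obtain ⟨_, _, _, h1, -⟩ := K.B2_Buf (cl_sub_B2 _ h) hb
  cases h1

theorem DA_nb {w z : W} (h : w ∈ K.DA) (ha : X.H.Adj w z) : z ∉ K.LS := by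
  obtain ⟨q, k, l, h⟩ := K.DA_cl h
  have h2 := cl_mem_B2 h ha
  refine K.Hab_LS (K.wA_sub _ h2) (fun hb => ?_)
  obtain ⟨_, _, _, h1, -⟩ := K.B2_Buf h2 hb
  cases h1

/-- buffer gadget body -/
noncomputable def vb (i : Fin r) (k : Fin K.pv) (n : ℕ) : Finset W :=
  ((univ : Finset (Fin (K.Lv+1))).filter (fun l => l.val ≤ n)).biUnion (fun l => X.nbs (K.bf i k l))

theorem mem_vb {i : Fin r} {k : Fin K.pv} {n : ℕ} {w : W} : w ∈ K.vb i k n ↔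
    ∃ l : Fin (K.Lv+1), l.val ≤ n ∧ X.H.Adj (K.bf i k l) w := by
  unfold vb
  simp only [mem_biUnion, mem_filter, mem_univ, true_and, mem_nbs]

theorem vb_cl {i : Fin r} {k : Fin K.pv} {n : ℕ} {w : W} (h : w ∈ K.vb i k n) :
    ∃ l : Fin (K.Lv+1), w ∈ bu_cl X.H {K.wA (Sum.inr (Sum.inl (i, k, l)))} := by
  obtain ⟨l, -, h⟩ := K.mem_vb.1 h
  exact ⟨l, nb_cl h⟩

theorem vb_Hab (i : Fin r) (k : Fin K.pv) (n : ℕ) : K.vb i k n ⊆ K.Hab := by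
  intro w hw
  obtain ⟨l, hl⟩ := K.vb_cl hw
  exact K.wA_sub _ (cl_sub_B2 _ hl)

/-- candidates for a buffer vertex -/
noncomputable def Nb (B1 : Finset V) (ρ : W → V) (b : W) : Finset V :=
  X.cand univ ρ (K.PB B1) (X.Vc (X.φ b)) b

theorem Nb_congr {B1 : Finset V} {ρ ρ' : W → V} {b : W} (h : ∀ y, X.H.Adj b y → ρ y = ρ' y) :
    K.Nb B1 ρ b = K.Nb B1 ρ' b :=
  X.cand_congr (fun y _ ha => ⟨h y ha.symm, rfl⟩)

theorem cand_Nb {B1 : Finset V} {ρ : W → V} {b : W} {S : Finset V} (hS : S ⊆ X.Vc (X.φ b)) :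
    X.cand (X.nbs b) ρ (K.PB B1) S b = S ∩ K.Nb B1 ρ b := by
  rw [X.cand_univ]
  unfold Nb cand
  ext v
  simp only [mem_filter, mem_inter]
  exact ⟨fun h => ⟨h.1, hS h.1, h.2⟩, fun h => ⟨h.1, h.2.2⟩⟩

/-- placing the neighbourhood of one buffer vertex -/
theorem vstep [Nonempty V] {B1 : Finset V} (hB1 : K.B1ok B1) {SE : Set (Sym2 W)}
    {D : Finset W} {ρ : W → V} (hS : X.St (fun z => X.Vc (X.φ z)) (K.PB B1) (K.Bufᶜ) SE D ρ)
    (hDab : D ⊆ K.Hab) (i : Fin r) (k : Fin K.pv) (l : Fin (K.Lv+1))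
    (hDB : Disjoint D (bu_B2 X.H (K.bf i k l)))
    (Sx : Bool → Finset V) (hSx : ∀ q, Sx q ⊆ X.Vc i ∧ X.e0 ≤ X.l ^ X.Δ * ((Sx q).card : ℝ)) :
    ∃ ρ' : W → V, X.St (fun z => X.Vc (X.φ z)) (K.PB B1) (K.Bufᶜ) SE (D ∪ X.nbs (K.bf i k l)) ρ' ∧
      (∀ y, y ∉ X.nbs (K.bf i k l) → ρ' y = ρ y) ∧
      ∀ q, X.l ^ X.Δ * ((Sx q).card : ℝ) ≤ ((Sx q ∩ K.Nb B1 ρ' (K.bf i k l)).card : ℝ) := by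
  have hφ : X.φ (K.bf i k l) = i := K.c_buf i k l
  have hl := X.l_pos
  have hcl : ∀ y ∈ X.nbs (K.bf i k l), y ∈ bu_cl X.H {K.bf i k l} := fun y hy => nbs_cl _ hy
  have hdis : Disjoint D (X.nbs (K.bf i k l)) :=
    hDB.mono_right ((nbs_cl _).trans (cl_sub_B2 _))
  have hno : ∀ y ∈ X.nbs (K.bf i k l), ∀ w ∈ D, ¬ X.H.Adj y w := fun y hy w hw ha =>
    disjoint_left.1 hDB hw (cl_mem_B2 (hcl y hy) ha)
  obtain ⟨ρ', h1, h2, -, -, h5⟩ := hS.greedy (K.PB_symm B1) (Q := Bool) (X.nbs (K.bf i k l)) hdis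
    (fun y => X.Vc (X.φ y)) ∅ (fun _ => Sx)
    (fun y _ z ha => K.PB_big hB1 ha)
    (fun y _ => Subset.refl _)
    (fun w hw y hy ha => absurd ha.symm (hno y hy w hw))
    (fun y _ => K.e0_Vc1 _)
    (fun y _ z _ _ => ⟨Subset.refl _, K.e0_Vc _⟩)
    (by
      intro y hy z hz _ ha q
      have hzb : z ∈ K.Buf := by
        by_contra h; exact hz (mem_compl.2 h)
      obtain ⟨i', k', l', h1, h2⟩ := K.B2_Buf (cl_mem_B2 (hcl y hy) ha) hzb
      rw [h2]
      have : i' = i := by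
        simp only [Sum.inr.injEq, Sum.inl.injEq, Prod.mk.injEq] at h1
        exact h1.1.symm
      subst this
      have : X.φ (K.bf i' k' l') = i' := K.c_buf _ _ _
      rw [this]; exact hSx q)
    (fun y _ z _ _ => K.e0_Vc1 _)
    (by
      intro y _
      have h1 := K.k1
      have h2 : (((X.nbs (K.bf i k l)).card : ℝ) + D.card) ≤ K.Nab := by
        refine le_trans ?_ K.n_ab
        have := card_union_of_disjoint hdis
        have h3 : (D ∪ X.nbs (K.bf i k l)).card ≤ K.Hab.card := card_le_card (union_subset hDab (by
          exact ((nbs_cl _).trans (cl_sub_B2 _)).trans (K.wA_sub _)))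
        rw [this] at h3
        have := (Nat.cast_le (α := ℝ)).2 h3
        push_cast at this
        linarith
      have h3 := K.Nre_nn
      have h4 := K.Nu_nn
      have h5 := X.e0_pos
      have h6 : 0 ≤ (r:ℝ) * (K.pv * (K.Lv + 1) + K.Nre) := by positivity
      have h7 : X.l ^ (2 * X.Δ) * X.l^2 / 256 * K.m ≤ X.l ^ X.Δ * ((X.Vc (X.φ y)).card : ℝ) := by
        have a : X.l^2 / 256 ≤ 1 := by nlinarith [X.l_le]
        calc _ = (X.l ^ (2 * X.Δ) * K.m) * (X.l^2/256) := by ring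
          _ ≤ X.l ^ (2 * X.Δ) * K.m := mul_le_of_le_one_right (mul_nonneg (pow_nonneg hl.le _) K.hm.le) a
          _ ≤ X.l ^ X.Δ * K.m := mul_le_mul_of_nonneg_right l2_le K.hm.le
          _ ≤ _ := mul_le_mul_of_nonneg_left (K.n_v _).1 lD_pos.le
      have h8 : 0 ≤ (r:ℝ)^2 * X.e0 := by positivity
      rw [card_empty]
      simp only [Nat.cast_zero, Fintype.card_bool, Nat.cast_ofNat]
      nlinarith)
  refine ⟨ρ', h1, h2, ?_⟩
  intro q
  have hb : K.bf i k l ∈ K.Buf := K.mem_Buf.2 ⟨_, _, _, rfl⟩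
  have h6 := h5 (K.bf i k l) (by rw [mem_compl, not_not]; exact hb)
    (fun h => disjoint_left.1 hDB h (self_B2 (X := X) _))
    (fun h => (mem_nbs.1 h).ne rfl) q
  rw [K.cand_Nb (by rw [hφ]; exact (hSx q).1)] at h6
  refine le_trans (mul_le_mul_of_nonneg_right (X.pow_dg _ _) (by positivity)) h6

end Pre
end BUCtx

namespace BUCtx
variable {r : ℕ} {V W : Type} [Fintype V] [Fintype W] {X : BUCtx r V W}
namespace Pre
variable (K : Pre X)

theorem e0_pv : X.e0 ≤ X.l ^ (3 * X.Δ) * X.l * K.pv / 16 := by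
  have h1 := K.k8
  have h2 := K.Nre_nn
  have h3 := X.e0_pos
  have : 0 ≤ (X.Δ : ℝ) * X.e0 := by positivity
  linarith

theorem l3_le : X.l ^ (3 * X.Δ) ≤ X.l ^ X.Δ :=
  pow_le_pow_of_le_one X.l_pos.le X.l_le_one (by omega)

theorem e0_pv' : X.e0 ≤ X.l ^ X.Δ * (K.pv / 2) := by
  refine K.e0_pv.trans ?_
  have h1 := l3_le (X := X)
  have h2 := X.l_le_one
  have h3 := X.l_pos
  have h4 : 0 ≤ X.l ^ (3 * X.Δ) := pow_nonneg h3.le _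
  have h5 : (0:ℝ) ≤ K.pv := by positivity
  have h6 := lD_pos (X := X)
  calc X.l ^ (3 * X.Δ) * X.l * K.pv / 16 = (X.l ^ (3 * X.Δ) * X.l) * (K.pv / 16) := by ring
    _ ≤ (X.l ^ X.Δ * 1) * (K.pv / 16) :=
        mul_le_mul_of_nonneg_right (mul_le_mul h1 h2 h3.le h6.le) (by positivity)
    _ ≤ _ := by nlinarith

theorem vgad [Nonempty V] {B1 : Finset V} (hB1 : K.B1ok B1) {SE : Set (Sym2 W)}
    {D : Finset W} {ρ : W → V} (hS : X.St (fun z => X.Vc (X.φ z)) (K.PB B1) (K.Bufᶜ) SE D ρ)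
    (hDab : D ⊆ K.Hab) (i : Fin r) (k : Fin K.pv)
    (hDB : ∀ l, Disjoint D (bu_B2 X.H (K.bf i k l))) :
    ∃ ρ' : W → V, X.St (fun z => X.Vc (X.φ z)) (K.PB B1) (K.Bufᶜ) SE (D ∪ K.vb i k K.Lv) ρ' ∧
      (∀ y, y ∉ K.vb i k K.Lv → ρ' y = ρ y) ∧
      (∀ l, l ≠ 0 → X.l ^ (2 * X.Δ) * K.m ≤ ((K.Nb B1 ρ' (K.bf i k l) ∩ K.Nb B1 ρ' (K.bf i k 0)).card : ℝ)) ∧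
      (((X.Vc i).filter (fun c => ∀ l, c ∉ K.Nb B1 ρ' (K.bf i k l))).card : ℝ) ≤ K.pv / 2 := by
  have hl := X.l_pos
  have hlD := lD_pos (X := X)
  have hlD1 := lD_le (X := X)
  have hφ : ∀ l, X.φ (K.bf i k l) = i := fun l => K.c_buf i k l
  have hdisj : ∀ l l' : Fin (K.Lv+1), l ≠ l' → Disjoint (bu_B2 X.H (K.bf i k l)) (bu_B2 X.H (K.bf i k l')) := by
    intro l l' hll
    apply K.wA_dis
    intro e
    apply hll
    simpa using e
  have key : ∀ n, n ≤ K.Lv → ∃ ρ' : W → V,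
      X.St (fun z => X.Vc (X.φ z)) (K.PB B1) (K.Bufᶜ) SE (D ∪ K.vb i k n) ρ' ∧
      (∀ y, y ∉ K.vb i k n → ρ' y = ρ y) ∧
      X.l ^ X.Δ * ((X.Vc i).card : ℝ) ≤ ((K.Nb B1 ρ' (K.bf i k 0)).card : ℝ) ∧
      (∀ l, l ≠ 0 → l.val ≤ n → X.l ^ (2 * X.Δ) * K.m ≤ ((K.Nb B1 ρ' (K.bf i k l) ∩ K.Nb B1 ρ' (K.bf i k 0)).card : ℝ)) ∧
      ((((X.Vc i).filter (fun c => ∀ l : Fin (K.Lv+1), l.val ≤ n → c ∉ K.Nb B1 ρ' (K.bf i k l))).card : ℝ) ≤ K.pv / 2 ∨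
       (((X.Vc i).filter (fun c => ∀ l : Fin (K.Lv+1), l.val ≤ n → c ∉ K.Nb B1 ρ' (K.bf i k l))).card : ℝ) ≤ (1 - X.l ^ X.Δ)^n * ((X.Vc i).card : ℝ)) := by
    intro n
    induction n with
    | zero =>
      intro _
      have hvb : K.vb i k 0 = X.nbs (K.bf i k 0) := by
        unfold vb
        have : ((univ : Finset (Fin (K.Lv+1))).filter (fun l => l.val ≤ 0)) = {0} := by
          ext l
          rw [mem_filter, mem_singleton]
          constructor
          · rintro ⟨-, h⟩; exact Fin.ext (by simpa using h)
          · rintro rfl; simp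
        rw [this, singleton_biUnion]
      obtain ⟨ρ', h1, h2, h3⟩ := K.vstep hB1 hS hDab i k 0 (hDB 0) (fun _ => X.Vc i)
        (fun _ => ⟨Subset.refl _, K.e0_Vc1 i⟩)
      refine ⟨ρ', by rw [hvb]; exact h1, by rw [hvb]; exact h2, ?_, ?_, Or.inr ?_⟩
      · exact (h3 true).trans (Nat.cast_le.2 (card_le_card inter_subset_right))
      · intro l hl0 hl1
        exact absurd (Fin.ext (by simpa using hl1)) hl0
      · rw [pow_zero, one_mul]
        exact Nat.cast_le.2 (card_le_card (filter_subset _ _))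
    | succ n ih =>
      intro hn
      obtain ⟨ρ1, h1, h2, h3, h4, h5⟩ := ih (by omega)
      set ln : Fin (K.Lv+1) := ⟨n+1, by omega⟩ with hln
      set T := (X.Vc i).filter (fun c => ∀ l : Fin (K.Lv+1), l.val ≤ n → c ∉ K.Nb B1 ρ1 (K.bf i k l)) with hT
      have hvb : K.vb i k (n+1) = K.vb i k n ∪ X.nbs (K.bf i k ln) := by
        unfold vb
        have : ((univ : Finset (Fin (K.Lv+1))).filter (fun l => l.val ≤ n+1)) =
            ((univ : Finset (Fin (K.Lv+1))).filter (fun l => l.val ≤ n)) ∪ {ln} := by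
          ext l
          rw [mem_filter, mem_union, mem_filter, mem_singleton, Fin.ext_iff]
          simp only [mem_univ, true_and, hln]
          omega
        rw [this, union_biUnion, singleton_biUnion]
      have hne : ∀ l : Fin (K.Lv+1), l.val ≤ n → l ≠ ln := by
        intro l hl e; rw [e] at hl; simp [hln] at hl
      have hcbB : Disjoint (K.vb i k n) (bu_B2 X.H (K.bf i k ln)) := by
        rw [disjoint_left]
        intro w hw hw'
        obtain ⟨l, hl, ha⟩ := K.mem_vb.1 hw
        exact disjoint_left.1 (hdisj l ln (hne l hl)) (cl_sub_B2 _ (nb_cl ha)) hw'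
      obtain ⟨ρ', g1, g2, g3⟩ := K.vstep hB1 h1 (union_subset hDab (K.vb_Hab i k n)) i k ln
        (disjoint_union_left.2 ⟨hDB ln, hcbB⟩)
        (fun q => if q then K.Nb B1 ρ1 (K.bf i k 0) else if (T.card : ℝ) ≤ K.pv / 2 then X.Vc i else T)
        (by
          intro q
          cases q
          · simp only [Bool.false_eq_true, if_false]
            split_ifs with hc
            · exact ⟨Subset.refl _, K.e0_Vc1 i⟩
            · refine ⟨filter_subset _ _, K.e0_pv'.trans (mul_le_mul_of_nonneg_left (by linarith) hlD.le)⟩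
          · simp only [if_true]
            refine ⟨?_, ?_⟩
            · have := X.cand_subset univ ρ1 (K.PB B1) (X.Vc (X.φ (K.bf i k 0))) (K.bf i k 0)
              rw [hφ] at this
              unfold Nb
              rw [hφ]
              exact this
            · have a := K.e0_Vc i
              rw [l2_eq, mul_assoc] at a
              exact a.trans (mul_le_mul_of_nonneg_left h3 hlD.le))
      have hlo : ∀ l : Fin (K.Lv+1), l.val ≤ n → K.Nb B1 ρ' (K.bf i k l) = K.Nb B1 ρ1 (K.bf i k l) := by
        intro l hl
        apply K.Nb_congr
        intro y hy
        apply g2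
        intro hy'
        exact disjoint_left.1 (hdisj l ln (hne l hl)) (cl_sub_B2 _ (nb_cl hy)) (cl_sub_B2 _ (nbs_cl _ hy'))
      refine ⟨ρ', ?_, ?_, ?_, ?_, ?_⟩
      · rw [hvb, ← union_assoc]; exact g1
      · intro w hw
        rw [hvb, mem_union, not_or] at hw
        rw [g2 w hw.2, h2 w hw.1]
      · rw [hlo 0 (by simp)]; exact h3
      · intro l hl0 hl1
        by_cases hle : l.val ≤ n
        · rw [hlo l hle, hlo 0 (by simp)]; exact h4 l hl0 hle
        · have : l = ln := Fin.ext (by simp [hln]; omega)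
          subst this
          have a := g3 true
          simp only [if_true] at a
          rw [hlo 0 (by simp), inter_comm]
          refine le_trans ?_ a
          rw [l2_eq, mul_assoc]
          refine mul_le_mul_of_nonneg_left ?_ hlD.le
          exact (mul_le_mul_of_nonneg_left (K.n_v i).1 hlD.le).trans h3
      · have e1 : (X.Vc i).filter (fun c => ∀ l : Fin (K.Lv+1), l.val ≤ n+1 → c ∉ K.Nb B1 ρ' (K.bf i k l)) ⊆
            T \ (T ∩ K.Nb B1 ρ' (K.bf i k ln)) := by
          intro c hc
          rw [mem_filter] at hc
          rw [mem_sdiff, hT, mem_filter]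
          refine ⟨⟨hc.1, fun l hl => ?_⟩, fun h => ?_⟩
          · rw [← hlo l hl]; exact hc.2 l (by omega)
          · exact hc.2 ln (by simp [hln]) (mem_inter.1 h).2
        have e2 := card_le_card e1
        by_cases hc : (T.card : ℝ) ≤ K.pv / 2
        · left
          refine le_trans (Nat.cast_le.2 (e2.trans (card_le_card sdiff_subset))) hc
        · right
          have a := g3 false
          simp only [Bool.false_eq_true, if_false, if_neg hc] at a
          rw [card_sdiff_of_subset inter_subset_left] at e2
          have e3 : (((X.Vc i).filter (fun c => ∀ l : Fin (K.Lv+1), l.val ≤ n+1 → c ∉ K.Nb B1 ρ' (K.bf i k l))).card : ℝ) ≤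
              (T.card : ℝ) - ((T ∩ K.Nb B1 ρ' (K.bf i k ln)).card : ℝ) := by
            rw [← Nat.cast_sub (card_le_card inter_subset_left)]
            exact Nat.cast_le.2 e2
          have h5' := h5.resolve_left hc
          calc _ ≤ (1 - X.l ^ X.Δ) * (T.card : ℝ) := by linarith
            _ ≤ (1 - X.l ^ X.Δ) * ((1 - X.l ^ X.Δ)^n * ((X.Vc i).card : ℝ)) :=
                mul_le_mul_of_nonneg_left h5' (by linarith)
            _ = _ := by ring
  obtain ⟨ρ', h1, h2, -, h4, h5⟩ := key K.Lv le_rfl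
  refine ⟨ρ', h1, h2, fun l hl0 => h4 l hl0 (by omega), ?_⟩
  have h6 : (((X.Vc i).filter (fun c => ∀ l : Fin (K.Lv+1), l.val ≤ K.Lv → c ∉ K.Nb B1 ρ' (K.bf i k l))).card : ℝ) ≤ K.pv / 2 := by
    rcases h5 with h | h
    · exact h
    · refine h.trans (le_trans ?_ K.k6)
      exact mul_le_mul_of_nonneg_left (K.n_v i).2 (pow_nonneg (by linarith) _)
  refine le_trans (Nat.cast_le.2 (card_le_card ?_)) h6
  intro c hc
  rw [mem_filter] at hc ⊢
  exact ⟨hc.1, fun l _ => hc.2 l⟩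

noncomputable def DN : Finset W :=
  (univ : Finset (Fin r × Fin K.pv)).biUnion (fun t => K.vb t.1 t.2 K.Lv)

theorem mem_DN {w : W} : w ∈ K.DN ↔ ∃ b ∈ K.Buf, X.H.Adj b w := by
  unfold DN
  simp only [mem_biUnion, mem_univ, true_and, mem_vb]
  constructor
  · rintro ⟨t, l, -, h⟩; exact ⟨_, K.mem_Buf.2 ⟨t.1, t.2, l, rfl⟩, h⟩
  · rintro ⟨b, hb, h⟩
    obtain ⟨i, k, l, rfl⟩ := K.mem_Buf.1 hb
    exact ⟨(i, k), l, by omega, h⟩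

theorem DN_cl {w : W} (h : w ∈ K.DN) : ∃ i k l, w ∈ bu_cl X.H {K.wA (Sum.inr (Sum.inl (i, k, l)))} := by
  obtain ⟨b, hb, ha⟩ := K.mem_DN.1 h
  obtain ⟨i, k, l, rfl⟩ := K.mem_Buf.1 hb
  exact ⟨i, k, l, nb_cl ha⟩

noncomputable def DB : Finset W := K.DA ∪ K.DN

theorem DB_Hab : K.DB ⊆ K.Hab := by
  intro w hw
  rcases mem_union.1 hw with h | h
  · exact K.DA_Hab h
  · obtain ⟨i, k, l, h⟩ := K.DN_cl h
    exact K.wA_sub _ (cl_sub_B2 _ h)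

theorem DN_Buf {w : W} (h : w ∈ K.DN) : w ∉ K.Buf := by
  intro hb
  obtain ⟨b, hb', ha⟩ := K.mem_DN.1 h
  obtain ⟨i, k, l, rfl⟩ := K.mem_Buf.1 hb'
  obtain ⟨i', k', l', h1, h2⟩ := K.B2_Buf (t := Sum.inr (Sum.inl (i, k, l))) (cl_sub_B2 _ (nb_cl ha)) hb
  simp only [Sum.inr.injEq, Sum.inl.injEq] at h1
  obtain ⟨rfl, rfl, rfl⟩ := (Prod.mk.injEq _ _ _ _ ▸ h1 : i = i' ∧ (k, l) = (k', l'))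
  exact ha.ne h2.symm

theorem DB_Buf {w : W} (h : w ∈ K.DB) : w ∉ K.Buf := by
  rcases mem_union.1 h with h | h
  · intro hb
    exact K.DA_LS h (mem_union_right _ hb)
  · exact K.DN_Buf h

/-- class part of late vertices -/
noncomputable def lc (i : Fin r) : ℕ := ((K.Hre ∪ K.Xp).filter (fun y => X.φ y = i)).card

theorem lc_le (i : Fin r) : (K.lc i : ℝ) ≤ K.Nre := by
  refine le_trans ?_ K.n_re
  have : K.lc i ≤ K.Hre.card + K.Xp.card := (card_le_card (filter_subset _ _)).trans (card_union_le _ _)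
  exact_mod_cast this

/-- Stage B: vertex absorber. -/
theorem stageB [Nonempty V] {B1 : Finset V} (hB1 : K.B1ok B1) {ρA : W → V}
    (hA : X.St (fun z => X.Vc (X.φ z)) (fun y z => X.Vij (X.φ y) (X.φ z)) univ (K.SF : Set (Sym2 W)) K.DA ρA) :
    ∃ ρ : W → V, X.St (fun z => X.Vc (X.φ z)) (K.PB B1) (K.Bufᶜ) (K.SE : Set (Sym2 W)) K.DB ρ ∧
      (∀ y ∈ K.DA, ρ y = ρA y) ∧
      ∃ B0v B1v : Finset V, Disjoint B0v B1v ∧ Disjoint (B0v ∪ B1v) (K.DB.image ρ) ∧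
        (∀ i, (X.Vc i ∩ B0v).card = K.pv * K.Lv) ∧ (∀ i, (X.Vc i ∩ B1v).card + K.s = K.pv + K.lc i) ∧
        (∀ v ∈ B0v ∪ B1v, ∃ i, v ∈ X.Vc i) ∧
        ∀ ρ' : W → V, (∀ y ∈ K.DB, ρ' y = ρ y) → ∀ U ⊆ B1v, (∀ i, (X.Vc i ∩ U).card = K.pv) →
          ∃ g : W → V, Set.InjOn g K.Buf ∧ ∀ b ∈ K.Buf, g b ∈ X.Vc (X.φ b) ∧ g b ∈ B0v ∪ U ∧
            ∀ y, X.H.Adj y b → X.Th (K.PB B1 y b) (ρ' y) (g b) := by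
  have hseq := bu_seq (V := V) (W := W) (γ := Fin r × Fin K.pv)
    (fun D ρ => X.St (fun z => X.Vc (X.φ z)) (K.PB B1) (K.Bufᶜ) (K.SE : Set (Sym2 W)) D ρ)
    (fun t => K.vb t.1 t.2 K.Lv)
    (fun t ρ => (∀ l, l ≠ 0 → X.l ^ (2 * X.Δ) * K.m ≤ ((K.Nb B1 ρ (K.bf t.1 t.2 l) ∩ K.Nb B1 ρ (K.bf t.1 t.2 0)).card : ℝ)) ∧
      (((X.Vc t.1).filter (fun c => ∀ l, c ∉ K.Nb B1 ρ (K.bf t.1 t.2 l))).card : ℝ) ≤ K.pv / 2)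
    (by
      intro t ρ ρ' h hq
      have : ∀ l, K.Nb B1 ρ (K.bf t.1 t.2 l) = K.Nb B1 ρ' (K.bf t.1 t.2 l) := by
        intro l
        apply K.Nb_congr
        intro y hy
        exact h y (K.mem_vb.2 ⟨l, by omega, hy⟩)
      simp only [this] at hq
      exact hq)
    K.DA ρA
    ((hA.monoSE (by
      unfold SE; intro e he; rw [mem_coe] at he ⊢
      exact mem_union_left _ (mem_union_left _ he))).congr
      (by
        intro y hy z hz _ _
        unfold PB
        rw [if_neg]
        rintro (h | h)
        · exact K.DA_LS hy h
        · exact K.DA_LS hz h)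
      (by
        intro z _ _
        refine Or.inr ⟨mem_univ _, rfl, fun y hy ha => ?_⟩
        unfold PB
        rw [if_neg]
        rintro (h | h)
        · exact K.DA_LS hy h
        · exact K.DA_nb hy ha h)) univ
    (by
      intro g _ g' _ hgg
      rw [disjoint_left]
      intro w hw hw'
      obtain ⟨l, hl⟩ := K.vb_cl hw
      obtain ⟨l', hl'⟩ := K.vb_cl hw'
      refine disjoint_left.1 (K.wA_dis _ _ ?_) (cl_sub_B2 _ hl) (cl_sub_B2 _ hl')
      intro e
      apply hgg
      simp only [Sum.inr.injEq, Sum.inl.injEq, Prod.mk.injEq] at e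
      exact Prod.ext e.1 e.2.1)
    (by
      intro G' _ g _ hg ρ hS _ _
      obtain ⟨ρ', h1, h2, h3, h4⟩ := K.vgad hB1 hS
        (union_subset K.DA_Hab (by
          rw [biUnion_subset]
          intro t _; exact K.vb_Hab _ _ _)) g.1 g.2
        (by
          intro l
          rw [disjoint_left]
          intro w hw hw'
          rcases mem_union.1 hw with hw | hw
          · obtain ⟨q, k, l', h⟩ := K.DA_cl hw
            exact disjoint_left.1 (K.wA_dis _ _ (by simp)) (cl_sub_B2 _ h) hw'
          · obtain ⟨t, ht, hw⟩ := mem_biUnion.1 hw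
            obtain ⟨l', hl'⟩ := K.vb_cl hw
            refine disjoint_left.1 (K.wA_dis _ _ ?_) (cl_sub_B2 _ hl') hw'
            intro e
            simp only [Sum.inr.injEq, Sum.inl.injEq, Prod.mk.injEq] at e
            exact hg ((Prod.ext e.1 e.2.1 : t = g) ▸ ht))
      exact ⟨ρ', h1, h2, h3, h4⟩)
  obtain ⟨ρ, hSt, hoff, hQ⟩ := hseq
  have hSt' : X.St (fun z => X.Vc (X.φ z)) (K.PB B1) (K.Bufᶜ) (K.SE : Set (Sym2 W)) K.DB ρ := hSt
  refine ⟨ρ, hSt', ?_, ?_⟩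
  · intro y hy
    apply hoff
    intro hy'
    obtain ⟨q, k, l, h⟩ := K.DA_cl hy
    obtain ⟨i', k', l', h'⟩ := K.DN_cl hy'
    exact disjoint_left.1 (K.wA_dis _ _ (by simp)) (cl_sub_B2 _ h) (cl_sub_B2 _ h')
  have himg : ((K.DB.image ρ).card : ℝ) ≤ K.Nab :=
    (Nat.cast_le.2 (card_image_le.trans (card_le_card K.DB_Hab))).trans K.n_ab
  have hNsub : ∀ i k l, K.Nb B1 ρ (K.bf i k l) ⊆ X.Vc i := by
    intro i k l
    have h : X.φ (K.bf i k l) = i := K.c_buf i k l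
    have := X.cand_subset univ ρ (K.PB B1) (X.Vc (X.φ (K.bf i k l))) (K.bf i k l)
    unfold Nb
    rw [h] at this ⊢
    exact this
  have hgad : ∀ i : Fin r, ∃ B0 B1' : Finset V, Disjoint B0 B1' ∧ Disjoint B0 (K.DB.image ρ) ∧
      Disjoint B1' (K.DB.image ρ) ∧ B0 ⊆ X.Vc i ∧ B1' ⊆ X.Vc i ∧
      B0.card = K.pv * K.Lv ∧ B1'.card = K.pv + K.lc i - K.s ∧
      ∀ U ⊆ B1', U.card = K.pv → ∃ f : Fin K.pv → Fin (K.Lv+1) → V,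
        (∀ s l s' l', f s l = f s' l' → s = s' ∧ l = l') ∧
        ∀ s l, f s l ∈ K.Nb B1 ρ (K.bf i s l) ∧ f s l ∈ B0 ∪ U := by
    intro i
    have hk5 := K.k5
    have hNre := K.Nre_nn
    have hk5' : X.l ^ (2 * X.Δ) * K.m ≤ ((X.Vc i).card : ℝ) := by
      refine le_trans ?_ (K.n_v i).1
      exact mul_le_of_le_one_left K.hm.le (l2_le.trans lD_le)
    have hlc := K.lc_le i
    have hpv : (0:ℝ) ≤ K.pv := by positivity
    obtain ⟨B0, B1', h1, h2, h3, h4, h5, h6, h7, h8⟩ := bu_gadget K.pv K.Lv (K.pv + K.lc i - K.s) (K.pv / 2)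
      (fun s l => K.Nb B1 ρ (K.bf i s l)) (X.Vc i) (K.DB.image ρ)
      (by
        intro s l hl0
        have h1 := (hQ (i, s) (mem_univ _)).1 l hl0
        have : ((K.pv * K.Lv + (K.DB.image ρ).card : ℕ) : ℝ) ≤
            ((K.Nb B1 ρ (K.bf i s l) ∩ K.Nb B1 ρ (K.bf i s 0)).card : ℝ) := by
          refine le_trans ?_ h1
          push_cast
          nlinarith
        exact Nat.cast_le.1 this)
      (by
        intro s
        have h1 := (hQ (i, s) (mem_univ _)).2
        rw [Nat.le_div_iff_mul_le (by norm_num)]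
        rw [le_div_iff₀ (by norm_num)] at h1
        exact_mod_cast h1)
      (by omega)
      (by
        have : ((2 * K.pv + K.lc i + (K.DB.image ρ).card + K.pv * K.Lv : ℕ) : ℝ) ≤ ((X.Vc i).card : ℝ) := by
          push_cast
          nlinarith
        have := Nat.cast_le.1 this
        omega)
    refine ⟨B0, B1', h1, h2, h3, ?_, h4, h5, h6, h8⟩
    intro b hb
    obtain ⟨s, hs⟩ := h7 b hb
    exact hNsub i s 0 hs
  choose B0 B1' hd hd0 hd1 hB0 hB1' hc0 hc1 habs using hgad
  have hB0q : ∀ q, X.Vc q ∩ univ.biUnion B0 = B0 q := by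
    intro q
    ext c
    simp only [mem_inter, mem_biUnion, mem_univ, true_and]
    constructor
    · rintro ⟨h1, q', h2⟩
      by_cases h : q = q'
      · rw [h]; exact h2
      · exact absurd (hB0 q' h2) (disjoint_left.1 (X.vc_disj _ _ h) h1)
    · intro h; exact ⟨hB0 q h, q, h⟩
  have hB1q : ∀ q, X.Vc q ∩ univ.biUnion B1' = B1' q := by
    intro q
    ext c
    simp only [mem_inter, mem_biUnion, mem_univ, true_and]
    constructor
    · rintro ⟨h1, q', h2⟩
      by_cases h : q = q'
      · rw [h]; exact h2
      · exact absurd (hB1' q' h2) (disjoint_left.1 (X.vc_disj _ _ h) h1)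
    · intro h; exact ⟨hB1' q h, q, h⟩
  refine ⟨univ.biUnion B0, univ.biUnion B1', ?_, ?_, ?_, ?_, ?_, ?_⟩
  · rw [disjoint_left]
    intro c h1 h2
    obtain ⟨q, -, h⟩ := mem_biUnion.1 h1
    have h3 : c ∈ B1' q := by rw [← hB1q]; exact mem_inter.2 ⟨hB0 q h, h2⟩
    exact disjoint_left.1 (hd q) h h3
  · rw [disjoint_union_left, disjoint_biUnion_left, disjoint_biUnion_left]
    exact ⟨fun i _ => hd0 i, fun i _ => hd1 i⟩
  · intro q; rw [hB0q]; exact hc0 q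
  · intro q
    rw [hB1q, hc1 q]
    have : (K.s : ℝ) ≤ K.pv := by
      have := K.k7.1
      have : (0:ℝ) ≤ K.pv := by positivity
      linarith
    have : K.s ≤ K.pv := by exact_mod_cast this
    omega
  · intro v hv
    rcases mem_union.1 hv with h | h
    · obtain ⟨i, -, h⟩ := mem_biUnion.1 h
      exact ⟨i, hB0 i h⟩
    · obtain ⟨i, -, h⟩ := mem_biUnion.1 h
      exact ⟨i, hB1' i h⟩
  · intro ρ' hρ' U hU hUc
    have hex : ∀ q, ∃ f : Fin K.pv → Fin (K.Lv+1) → V,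
        (∀ s l s' l', f s l = f s' l' → s = s' ∧ l = l') ∧
        ∀ s l, f s l ∈ K.Nb B1 ρ (K.bf q s l) ∧ f s l ∈ B0 q ∪ (X.Vc q ∩ U) := by
      intro q
      apply habs q _ _ (hUc q)
      intro c hc
      rw [← hB1q]
      exact mem_inter.2 ⟨(mem_inter.1 hc).1, hU (mem_inter.1 hc).2⟩
    choose f hf1 hf2 using hex
    set F : W → V := Function.extend (fun t : Fin r × Fin K.pv × Fin (K.Lv+1) => K.bf t.1 t.2.1 t.2.2)
      (fun t => f t.1 t.2.1 t.2.2) (fun _ => Classical.arbitrary V) with hF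
    have hFe : ∀ q k l, F (K.bf q k l) = f q k l := by
      intro q k l
      exact K.bf_inj.extend_apply _ _ (q, k, l)
    refine ⟨F, ?_, ?_⟩
    · intro e he e' he' h
      obtain ⟨q, k, l, rfl⟩ := K.mem_Buf.1 he
      obtain ⟨q', k', l', rfl⟩ := K.mem_Buf.1 he'
      rw [hFe, hFe] at h
      have hq : q = q' := by
        by_contra hne
        have h1 := hNsub q k l (hf2 q k l).1
        have h2 := hNsub q' k' l' (hf2 q' k' l').1
        rw [← h] at h2
        exact disjoint_left.1 (X.vc_disj _ _ hne) h1 h2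
      subst hq
      obtain ⟨h1, h2⟩ := hf1 q _ _ _ _ h
      rw [h1, h2]
    · intro b hb
      obtain ⟨q, k, l, rfl⟩ := K.mem_Buf.1 hb
      rw [hFe]
      have hφ : X.φ (K.bf q k l) = q := K.c_buf q k l
      refine ⟨by rw [hφ]; exact hNsub _ _ _ (hf2 q k l).1, ?_, ?_⟩
      · rcases mem_union.1 (hf2 q k l).2 with h | h
        · exact mem_union_left _ (mem_biUnion.2 ⟨q, mem_univ _, h⟩)
        · exact mem_union_right _ (mem_inter.1 h).2
      · intro y hy
        have h1 := (hf2 q k l).1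
        unfold Nb cand at h1
        rw [mem_filter] at h1
        rw [hρ' y (mem_union_right _ (K.mem_DN.2 ⟨_, hb, hy.symm⟩))]
        exact h1.2 y (mem_univ _) hy

end Pre
end BUCtx

theorem bu_enum {ι V : Type} (S : ι → Finset V) (n : ℕ) (hd : ∀ i j, i ≠ j → Disjoint (S i) (S j))
    (hn : ∀ i, (S i).card = n) : ∃ c : ι → Fin n → V, (∀ i k, c i k ∈ S i) ∧
      (Function.Injective (fun t : ι × Fin n => c t.1 t.2)) ∧ ∀ i, ∀ v ∈ S i, ∃ k, c i k = v := by
  have e : ∀ i, ∃ f : Fin n → V, (∀ k, f k ∈ S i) ∧ Function.Injective f ∧ ∀ v ∈ S i, ∃ k, f k = v := by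
    intro i
    let g := ((S i).equivFinOfCardEq (hn i)).symm
    refine ⟨fun k => (g k).1, fun k => (g k).2, fun a b h => g.injective (Subtype.ext h), ?_⟩
    intro v hv
    exact ⟨g.symm ⟨v, hv⟩, by simp⟩
  choose f h1 h2 h3 using e
  refine ⟨f, h1, ?_, h3⟩
  rintro ⟨i, k⟩ ⟨i', k'⟩ h
  have h' : f i k = f i' k' := h
  have hi : i = i' := by
    by_contra hne
    exact disjoint_left.1 (hd _ _ hne) (h1 i k) (h' ▸ h1 i' k')
  subst hi
  rw [h2 i h']

namespace BUCtx
variable {r : ℕ} {V W : Type} [Fintype V] [Fintype W] {X : BUCtx r V W}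

theorem Col.of_fam [Nonempty V] {γ : Type} [Fintype γ] {ρ : W → V} (e : γ → Sym2 W) (c : γ → V)
    (he : Function.Injective e) (hc : Function.Injective c) (h : ∀ t, c t ∈ X.lst ρ (e t)) :
    X.Col ρ (univ.image e) (univ.image c) := by
  refine ⟨Function.extend e c (fun _ => Classical.arbitrary V), ?_, ?_, ?_⟩
  · intro a ha b hb hab
    obtain ⟨t, -, rfl⟩ := mem_image.1 (mem_coe.1 ha)
    obtain ⟨t', -, rfl⟩ := mem_image.1 (mem_coe.1 hb)
    rw [he.extend_apply, he.extend_apply] at hab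
    rw [hc hab]
  · rw [image_image]
    apply image_congr
    intro t _
    exact he.extend_apply _ _ _
  · intro a ha
    obtain ⟨t, -, rfl⟩ := mem_image.1 ha
    rw [he.extend_apply]; exact h t

namespace Pre
variable (K : Pre X)

/-- Fixed configuration after the absorbers have been built. -/
structure Cfg (K : Pre X) where
  B0 : Finset V
  B1 : Finset V
  Y0 : Finset V
  Y1 : Finset V
  I0 : Finset V
  BC : Finset V
  BV : Finset V
  dB : Disjoint B0 B1
  hB0 : ∀ q, (X.Vq q ∩ B0).card = K.pc * K.Lc
  hB1 : K.B1ok B1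
  dY : Disjoint Y0 Y1
  dYI : Disjoint (Y0 ∪ Y1) I0
  hY0 : ∀ i, (X.Vc i ∩ Y0).card = K.pv * K.Lv
  hY1 : ∀ i, (X.Vc i ∩ Y1).card + K.s = K.pv + K.lc i
  cY : ∀ v ∈ Y0 ∪ Y1, ∃ i, v ∈ X.Vc i
  dBC : Disjoint BC (B0 ∪ B1)
  hBC : ∀ q, (X.Vq q ∩ BC).card = K.ξ
  cBC : ∀ c ∈ BC, ∃ q, c ∈ X.Vq q
  dBV : Disjoint BV (Y0 ∪ Y1)
  dBVI : Disjoint BV I0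
  hBV : ∀ i, (X.Vc i ∩ BV).card = K.ξ
  cBV : ∀ v ∈ BV, ∃ i, v ∈ X.Vc i
  gc : ∀ q, ∀ c ∈ X.Vq q, c ∉ B0 ∪ B1 → c ∉ BC →
    X.l * (((X.Vc q.1.1 ∩ Y1).card : ℝ) * ((X.Vc q.1.2 ∩ Y1).card : ℝ)) ≤
    ((((X.Vc q.1.1 ∩ Y1) ×ˢ (X.Vc q.1.2 ∩ Y1)).filter (fun p => ({p.1, p.2, c} : Finset V) ∈ X.E)).card : ℝ)
  gv : ∀ i j, X.R.Adj i j → ∀ u ∈ X.Vc i, u ∉ Y0 ∪ Y1 → u ∉ I0 → u ∉ BV →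
    X.l * ((X.Vc j ∩ Y1).card : ℝ) ≤
      (((X.Vc j ∩ Y1).filter (fun v => bu_Thk X.E X.l (X.Vij i j ∩ B1) u v)).card : ℝ)

theorem pv_half {Y1 : Finset V} {i : Fin r} (h : (X.Vc i ∩ Y1).card + K.s = K.pv + K.lc i) :
    (K.pv : ℝ) / 2 ≤ ((X.Vc i ∩ Y1).card : ℝ) := by
  have h2 := K.k7.1
  have h3 : ((X.Vc i ∩ Y1).card : ℝ) + K.s = K.pv + K.lc i := by exact_mod_cast h
  have : (0:ℝ) ≤ K.lc i := by positivity
  linarith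

theorem e0_pvh : X.e0 ≤ K.pv / 2 := by
  refine K.e0_pv'.trans ?_
  have := lD_le (X := X)
  have : (0:ℝ) ≤ K.pv / 2 := by positivity
  nlinarith

theorem e0_ξ : X.e0 ≤ K.ξ := by
  refine le_trans ?_ K.k11
  have : (1:ℝ) ≤ r := by exact_mod_cast K.hr
  have := X.e0_pos
  nlinarith

theorem exists_cfg {B0 B1 Y0 Y1 I0 : Finset V} (dB : Disjoint B0 B1)
    (hB0 : ∀ q, (X.Vq q ∩ B0).card = K.pc * K.Lc) (hB1 : K.B1ok B1)
    (dY : Disjoint Y0 Y1) (dYI : Disjoint (Y0 ∪ Y1) I0)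
    (hY0 : ∀ i, (X.Vc i ∩ Y0).card = K.pv * K.Lv)
    (hY1 : ∀ i, (X.Vc i ∩ Y1).card + K.s = K.pv + K.lc i)
    (cY : ∀ v ∈ Y0 ∪ Y1, ∃ i, v ∈ X.Vc i) (hI : (I0.card : ℝ) ≤ K.Nab) :
    ∃ C : K.Cfg, C.B0 = B0 ∧ C.B1 = B1 ∧ C.Y0 = Y0 ∧ C.Y1 = Y1 ∧ C.I0 = I0 := by
  have hY1e : ∀ i, X.e0 ≤ ((X.Vc i ∩ Y1).card : ℝ) := fun i => K.e0_pvh.trans (K.pv_half (hY1 i))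
  have hξs : (K.ξ : ℝ) ≤ K.s := by exact_mod_cast K.k12
  have hc : ∀ q, ∃ S : Finset V, S ⊆ X.Vq q \ (B0 ∪ B1) ∧ S.card = K.ξ ∧
      ∀ c ∈ X.Vq q, c ∉ B0 ∪ B1 → c ∉ S →
    X.l * (((X.Vc q.1.1 ∩ Y1).card : ℝ) * ((X.Vc q.1.2 ∩ Y1).card : ℝ)) ≤
    ((((X.Vc q.1.1 ∩ Y1) ×ˢ (X.Vc q.1.2 ∩ Y1)).filter (fun p => ({p.1, p.2, c} : Finset V) ∈ X.E)).card : ℝ) := by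
    intro q
    have h1 := X.ctyp q.1.1 q.1.2 q.2.2 (X.Vc q.1.1 ∩ Y1) inter_subset_left (hY1e _)
      (X.Vc q.1.2 ∩ Y1) inter_subset_left (hY1e _)
    set Bad := (X.Vij q.1.1 q.1.2).filter (fun c => ((((X.Vc q.1.1 ∩ Y1) ×ˢ (X.Vc q.1.2 ∩ Y1)).filter
      (fun q => ({q.1, q.2, c} : Finset V) ∈ X.E)).card : ℝ) <
      X.l * (((X.Vc q.1.1 ∩ Y1).card : ℝ) * ((X.Vc q.1.2 ∩ Y1).card : ℝ))) with hBad
    have h2 : Bad.card ≤ K.ξ := by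
      have := h1.trans K.e0_ξ
      exact_mod_cast this
    have h3 : K.ξ ≤ (X.Vq q \ (B0 ∪ B1)).card := by
      have a1 : (X.Vq q).card ≤ (X.Vq q \ (B0 ∪ B1)).card + ((X.Vq q ∩ B0).card + (X.Vq q ∩ B1).card) := by
        rw [← card_sdiff_add_card_inter (X.Vq q) (B0 ∪ B1), inter_union_distrib_left]
        exact Nat.add_le_add_left (card_union_le _ _) _
      have a2 := hB0 q
      have a3 := hB1 q
      have a4 : (((X.Eq q) ∩ K.late).card : ℝ) ≤ X.Δ * (K.Nre + r * (K.pv * (K.Lv + 1))) :=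
        le_trans (Nat.cast_le.2 (card_le_card inter_subset_right)) K.late_card
      have a5 := (K.n_c q).1
      have a6 := K.k4
      have a7 := K.k7.2
      have a8 : X.l^2 / 16 * K.clo ≤ K.clo := by
        have b : X.l^2 / 16 ≤ 1 := by nlinarith [X.l_pos, X.l_le]
        exact mul_le_of_le_one_left K.clo_pos.le b
      have a9 : 0 ≤ X.Δ * (K.Nab + K.Nu) := by
        have := K.Nab_nn; have := K.Nu_nn; positivity
      have a10 := X.e0_pos
      have a11 : ((X.Vq q).card : ℝ) ≤ ((X.Vq q \ (B0 ∪ B1)).card : ℝ) + (K.pc * K.Lc + (K.pc + ((X.Eq q) ∩ K.late).card)) := by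
        have : (X.Vq q).card ≤ (X.Vq q \ (B0 ∪ B1)).card + (K.pc * K.Lc + (K.pc + ((X.Eq q) ∩ K.late).card)) := by omega
        exact_mod_cast this
      have a12 : (0:ℝ) ≤ K.pc := by positivity
      have : (K.ξ : ℝ) ≤ ((X.Vq q \ (B0 ∪ B1)).card : ℝ) := by nlinarith
      exact_mod_cast this
    obtain ⟨S, s1, s2, s3⟩ := exists_subsuperset_card_eq (s := Bad \ (B0 ∪ B1)) (t := X.Vq q \ (B0 ∪ B1))
      (sdiff_subset_sdiff (filter_subset _ _) (Subset.refl _))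
      ((card_le_card sdiff_subset).trans h2) h3
    refine ⟨S, s2, s3, ?_⟩
    intro c hc1 hc2 hc3
    by_contra hlt
    push Not at hlt
    exact hc3 (s1 (mem_sdiff.2 ⟨by rw [hBad]; simp only [mem_filter]; exact ⟨hc1, hlt⟩, hc2⟩))
  have hv : ∀ i, ∃ S : Finset V, S ⊆ X.Vc i \ (Y0 ∪ Y1 ∪ I0) ∧ S.card = K.ξ ∧
      ∀ j, X.R.Adj i j → ∀ u ∈ X.Vc i, u ∉ Y0 ∪ Y1 ∪ I0 → u ∉ S →
    X.l * ((X.Vc j ∩ Y1).card : ℝ) ≤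
      (((X.Vc j ∩ Y1).filter (fun v => bu_Thk X.E X.l (X.Vij i j ∩ B1) u v)).card : ℝ) := by
    intro i
    set bad : Fin r → Finset V := fun j => (X.Vc i).filter (fun u =>
      (((X.Vc j ∩ Y1).filter (fun v => bu_Thk X.E X.l (X.Vij i j ∩ B1) u v)).card : ℝ) <
      X.l * ((X.Vc j ∩ Y1).card : ℝ)) with hbad
    set Bad := ((univ : Finset (Fin r)).filter (fun j => X.R.Adj i j)).biUnion bad with hBad
    have h2 : Bad.card ≤ K.ξ := by
      have : (Bad.card : ℝ) ≤ K.ξ := by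
        refine le_trans ?_ K.k11
        have h3 : (Bad.card : ℝ) ≤ ∑ j ∈ (univ : Finset (Fin r)).filter (fun j => X.R.Adj i j), ((bad j).card : ℝ) := by
          exact_mod_cast card_biUnion_le
        refine h3.trans ?_
        have h4 : ∀ j ∈ (univ : Finset (Fin r)).filter (fun j => X.R.Adj i j), ((bad j).card : ℝ) ≤ X.e0 := by
          intro j hj
          rw [mem_filter] at hj
          have hP : X.e0 ≤ ((X.Vij i j ∩ B1).card : ℝ) := by
            rcases lt_or_gt_of_ne hj.2.ne with h | h
            · exact K.e0_pc'.trans (K.pc_half hB1 ⟨(i, j), h, hj.2⟩)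
            · rw [X.vij_symm]
              exact K.e0_pc'.trans (K.pc_half hB1 ⟨(j, i), h, hj.2.symm⟩)
          exact X.typ i j hj.2 (X.Vij i j ∩ B1) inter_subset_left hP (X.Vc j ∩ Y1) inter_subset_left (hY1e j)
        refine (sum_le_sum h4).trans ?_
        rw [sum_const, nsmul_eq_mul]
        refine mul_le_mul_of_nonneg_right ?_ X.e0_pos.le
        have := card_le_univ ((univ : Finset (Fin r)).filter (fun j => X.R.Adj i j))
        rw [Fintype.card_fin] at this
        exact_mod_cast this
      exact_mod_cast this
    have h3 : K.ξ ≤ (X.Vc i \ (Y0 ∪ Y1 ∪ I0)).card := by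
      have a1 : (X.Vc i).card ≤ (X.Vc i \ (Y0 ∪ Y1 ∪ I0)).card + ((X.Vc i ∩ Y0).card + (X.Vc i ∩ Y1).card + I0.card) := by
        rw [← card_sdiff_add_card_inter (X.Vc i) (Y0 ∪ Y1 ∪ I0), inter_union_distrib_left, inter_union_distrib_left]
        refine Nat.add_le_add_left ((card_union_le _ _).trans ?_) _
        exact Nat.add_le_add (card_union_le _ _) (card_le_card inter_subset_right)
      have a2 := hY0 i
      have a3 := hY1 i
      have a4 := K.lc_le i
      have a5 := (K.n_v i).1
      have a6 := K.k5
      have a7 := K.k7.1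
      have a8 : X.l ^ (2 * X.Δ) * K.m ≤ K.m := mul_le_of_le_one_left K.hm.le (l2_le.trans lD_le)
      have a11 : ((X.Vc i).card : ℝ) ≤ ((X.Vc i \ (Y0 ∪ Y1 ∪ I0)).card : ℝ) + (K.pv * K.Lv + (K.pv + K.lc i) + I0.card) := by
        have : (X.Vc i).card ≤ (X.Vc i \ (Y0 ∪ Y1 ∪ I0)).card + (K.pv * K.Lv + (K.pv + K.lc i) + I0.card) := by omega
        exact_mod_cast this
      have a12 : (0:ℝ) ≤ K.pv := by positivity
      have : (K.ξ : ℝ) ≤ ((X.Vc i \ (Y0 ∪ Y1 ∪ I0)).card : ℝ) := by nlinarith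
      exact_mod_cast this
    obtain ⟨S, s1, s2, s3⟩ := exists_subsuperset_card_eq (s := Bad \ (Y0 ∪ Y1 ∪ I0)) (t := X.Vc i \ (Y0 ∪ Y1 ∪ I0))
      (sdiff_subset_sdiff (by
        rw [hBad, biUnion_subset]; intro j _; exact filter_subset _ _) (Subset.refl _))
      ((card_le_card sdiff_subset).trans h2) h3
    refine ⟨S, s2, s3, ?_⟩
    intro j hj u hc1 hc2 hc3
    by_contra hlt
    push Not at hlt
    refine hc3 (s1 (mem_sdiff.2 ⟨?_, hc2⟩))
    rw [hBad, mem_biUnion]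
    refine ⟨j, by simpa using hj, ?_⟩
    rw [hbad]; simp only [mem_filter]; exact ⟨hc1, hlt⟩
  choose SC c1 c2 c3 using hc
  choose SV v1 v2 v3 using hv
  have hSCq : ∀ q, X.Vq q ∩ univ.biUnion SC = SC q := by
    intro q
    ext c
    simp only [mem_inter, mem_biUnion, mem_univ, true_and]
    constructor
    · rintro ⟨h1, q', h2⟩
      by_cases h : q = q'
      · rw [h]; exact h2
      · exact absurd (mem_sdiff.1 (c1 q' h2)).1 (disjoint_left.1 (X.Vq_disj h) h1)
    · intro h; exact ⟨(mem_sdiff.1 (c1 q h)).1, q, h⟩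
  have hSVq : ∀ q, X.Vc q ∩ univ.biUnion SV = SV q := by
    intro q
    ext c
    simp only [mem_inter, mem_biUnion, mem_univ, true_and]
    constructor
    · rintro ⟨h1, q', h2⟩
      by_cases h : q = q'
      · rw [h]; exact h2
      · exact absurd (mem_sdiff.1 (v1 q' h2)).1 (disjoint_left.1 (X.vc_disj _ _ h) h1)
    · intro h; exact ⟨(mem_sdiff.1 (v1 q h)).1, q, h⟩
  refine ⟨⟨B0, B1, Y0, Y1, I0, univ.biUnion SC, univ.biUnion SV, dB, hB0, hB1, dY, dYI, hY0, hY1, cY,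
    ?_, ?_, ?_, ?_, ?_, ?_, ?_, ?_, ?_⟩, rfl, rfl, rfl, rfl, rfl⟩
  · rw [disjoint_biUnion_left]
    intro q _
    exact disjoint_left.2 (fun c hc => (mem_sdiff.1 (c1 q hc)).2)
  · intro q; rw [hSCq]; exact c2 q
  · intro c hc
    obtain ⟨q, -, h⟩ := mem_biUnion.1 hc
    exact ⟨q, (mem_sdiff.1 (c1 q h)).1⟩
  · rw [disjoint_biUnion_left]
    intro q _
    exact disjoint_left.2 (fun c hc h => (mem_sdiff.1 (v1 q hc)).2 (mem_union_left _ h))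
  · rw [disjoint_biUnion_left]
    intro q _
    exact disjoint_left.2 (fun c hc h => (mem_sdiff.1 (v1 q hc)).2 (mem_union_right _ h))
  · intro q; rw [hSVq]; exact v2 q
  · intro c hc
    obtain ⟨q, -, h⟩ := mem_biUnion.1 hc
    exact ⟨q, (mem_sdiff.1 (v1 q h)).1⟩
  · intro q c h1 h2 h3
    exact c3 q c h1 h2 (fun h => h3 (mem_biUnion.2 ⟨q, mem_univ _, h⟩))
  · intro i j ha u h1 h2 h3 h4
    exact v3 i j ha u h1 (by rw [mem_union, not_or]; exact ⟨h2, h3⟩) (fun h => h4 (mem_biUnion.2 ⟨i, mem_univ _, h⟩))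

/-- target sets -/
noncomputable def AY (Y1 : Finset V) (z : W) : Finset V :=
  if z ∈ K.Hre ∪ K.Xp then X.Vc (X.φ z) ∩ Y1 else X.Vc (X.φ z)

theorem AY_out {Y1 : Finset V} {z : W} (h : z ∉ K.LS) : K.AY Y1 z = X.Vc (X.φ z) := by
  unfold AY
  rw [if_neg]
  exact fun h' => h (mem_union_left _ h')

theorem AY_sub (Y1 : Finset V) (z : W) : K.AY Y1 z ⊆ X.Vc (X.φ z) := by
  unfold AY
  split_ifs
  · exact inter_subset_left
  · exact Subset.refl _

theorem PB_out {B1 : Finset V} {y z : W} (hy : y ∉ K.LS) (hz : z ∉ K.LS) :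
    K.PB B1 y z = X.Vij (X.φ y) (X.φ z) := by
  unfold PB
  rw [if_neg]
  rintro (h | h)
  · exact hy h
  · exact hz h

theorem item_LS {t} (ht : ∀ i k l, t ≠ Sum.inr (Sum.inl (i, k, l))) {z : W} (hz : z ∈ bu_B2 X.H (K.wA t)) :
    z ∉ K.LS := by
  refine K.Hab_LS (K.wA_sub _ hz) (fun hb => ?_)
  obtain ⟨i, k, l, h1, -⟩ := K.B2_Buf hz hb
  exact ht _ _ _ h1

theorem LS_Buf {z : W} (h : z ∉ K.LS) : z ∈ K.Bufᶜ :=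
  mem_compl.2 (fun h' => h (mem_union_right _ h'))

end Pre
end BUCtx

namespace BUCtx
variable {r : ℕ} {V W : Type} [Fintype V] [Fintype W] {X : BUCtx r V W}
namespace Pre
variable (K : Pre X)

theorem card_cls (S : Finset V) (h : ∀ v ∈ S, ∃ i, v ∈ X.Vc i) (b : ℝ)
    (hb : ∀ i, ((X.Vc i ∩ S).card : ℝ) ≤ b) : (S.card : ℝ) ≤ r * b := by
  have h1 : S ⊆ (univ : Finset (Fin r)).biUnion (fun i => X.Vc i ∩ S) := by
    intro v hv
    obtain ⟨i, hi⟩ := h v hv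
    exact mem_biUnion.2 ⟨i, mem_univ _, mem_inter.2 ⟨hi, hv⟩⟩
  have h2 : (S.card : ℝ) ≤ ∑ i : Fin r, ((X.Vc i ∩ S).card : ℝ) := by
    exact_mod_cast (card_le_card h1).trans card_biUnion_le
  refine h2.trans ((sum_le_sum (fun i _ => hb i)).trans ?_)
  simp

theorem Cfg.F_card {K : Pre X} (C : K.Cfg) :
    ((C.Y0 ∪ C.Y1 ∪ C.BV).card : ℝ) ≤ r * (K.pv * (K.Lv + 1) + K.Nre) := by
  apply card_cls (X := X)
  · intro v hv
    rcases mem_union.1 hv with h | h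
    · exact C.cY v h
    · exact C.cBV v h
  · intro i
    have h1 : (X.Vc i ∩ (C.Y0 ∪ C.Y1 ∪ C.BV)).card ≤ (X.Vc i ∩ C.Y0).card + (X.Vc i ∩ C.Y1).card + (X.Vc i ∩ C.BV).card := by
      rw [inter_union_distrib_left, inter_union_distrib_left]
      exact (card_union_le _ _).trans (Nat.add_le_add_right (card_union_le _ _) _)
    have h2 := C.hY0 i
    have h3 := C.hY1 i
    have h4 := C.hBV i
    have h5 := K.k12
    have h6 : (X.Vc i ∩ (C.Y0 ∪ C.Y1 ∪ C.BV)).card ≤ K.pv * (K.Lv + 1) + K.lc i := by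
      rw [mul_add, mul_one]; omega
    have h7 : ((X.Vc i ∩ (C.Y0 ∪ C.Y1 ∪ C.BV)).card : ℝ) ≤ K.pv * (K.Lv + 1) + K.lc i := by exact_mod_cast h6
    have := K.lc_le i
    linarith

theorem DB_item {w : W} (h : w ∈ K.DB) : ∃ t, (∀ a, t ≠ Sum.inr (Sum.inr a)) ∧ w ∈ bu_cl X.H {K.wA t} := by
  rcases mem_union.1 h with h | h
  · obtain ⟨q, k, l, h⟩ := K.DA_cl h
    exact ⟨_, by simp, h⟩
  · obtain ⟨i, k, l, h⟩ := K.DN_cl h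
    exact ⟨_, by simp, h⟩

theorem DB_nb {y z : W} (h : y ∈ K.DB) (ha : X.H.Adj y z) : z ∈ K.Hab := by
  obtain ⟨t, -, ht⟩ := K.DB_item h
  exact K.wA_sub _ (cl_mem_B2 ht ha)

theorem Hab_late {z : W} (h : z ∈ K.Hab) : z ∉ K.Hre ∪ K.Xp := by
  rw [mem_union, not_or]
  exact ⟨disjoint_left.1 K.dis1 h, disjoint_left.1 K.dis2 h⟩

theorem xb_adj (q : X.PR) (k : Fin K.ξ) : X.H.Adj (K.xb q k) (K.yb q k) := (K.c_pr q k).2.2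

theorem xr_adj (q : X.PR) (k : Fin K.s) : X.H.Adj (K.xr q k) (K.yr q k) := (K.c_prr q k).2.2

theorem pb_inj : Function.Injective (fun t : X.PR × Fin K.ξ => s(K.xb t.1 t.2, K.yb t.1 t.2)) := by
  rintro ⟨q, k⟩ ⟨q', k'⟩ h
  by_contra hne
  have h' : s(K.xb q k, K.yb q k) = s(K.xb q' k', K.yb q' k') := h
  have h1 : K.xb q k ∈ s(K.xb q' k', K.yb q' k') := by rw [← h']; simp
  have h2 : K.xb q k ∈ bu_cl X.H {K.xb q' k'} := by
    apply pair_sub_cl (K.xb_adj q' k')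
    rw [mem_insert, mem_singleton]; exact Sym2.mem_iff.1 h1
  exact disjoint_left.1 (K.wA_dis (Sum.inr (Sum.inr (Sum.inr (q, k)))) (Sum.inr (Sum.inr (Sum.inr (q', k'))))
    (by simpa using hne)) (self_B2 (X := X) _) (cl_sub_B2 _ h2)

theorem pr_inj : Function.Injective (fun t : X.PR × Fin K.s => s(K.xr t.1 t.2, K.yr t.1 t.2)) := by
  rintro ⟨q, k⟩ ⟨q', k'⟩ h
  by_contra hne
  have h' : s(K.xr q k, K.yr q k) = s(K.xr q' k', K.yr q' k') := h
  have h1 : K.xr q k ∈ s(K.xr q' k', K.yr q' k') := by rw [← h']; simp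
  have h2 : K.xr q k ∈ bu_cl X.H {K.xr q' k'} := by
    apply pair_sub_cl (K.xr_adj q' k')
    rw [mem_insert, mem_singleton]; exact Sym2.mem_iff.1 h1
  exact disjoint_left.1 (K.wR_dis (Sum.inr (q, k)) (Sum.inr (q', k'))
    (by simpa using hne)) (self_B2 (X := X) _) (cl_sub_B2 _ h2)

noncomputable def DP : Finset W :=
  (univ : Finset (X.PR × Fin K.ξ)).biUnion (fun t => {K.xb t.1 t.2, K.yb t.1 t.2})
noncomputable def DG : Finset W :=
  (univ : Finset (Fin r × Fin K.ξ)).biUnion (fun t => {K.sg t.1 t.2})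
noncomputable def DC : Finset W := K.DB ∪ K.DP ∪ K.DG

theorem pb_cl {q : X.PR} {k : Fin K.ξ} {w : W} (h : w ∈ ({K.xb q k, K.yb q k} : Finset W)) :
    w ∈ bu_cl X.H {K.wA (Sum.inr (Sum.inr (Sum.inr (q, k))))} := pair_sub_cl (K.xb_adj q k) h

theorem DC_Hab : K.DC ⊆ K.Hab := by
  intro w hw
  rcases mem_union.1 hw with h | h
  · rcases mem_union.1 h with h | h
    · exact K.DB_Hab h
    · obtain ⟨t, -, h⟩ := mem_biUnion.1 h
      exact K.wA_sub _ (cl_sub_B2 _ (K.pb_cl h))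
  · obtain ⟨t, -, h⟩ := mem_biUnion.1 h
    rw [mem_singleton] at h
    rw [h]; exact K.wA_sub _ (self_B2 (X := X) _)

theorem DC_Buf {w : W} (hw : w ∈ K.DC) : w ∉ K.Buf := by
  rcases mem_union.1 hw with h | h
  · rcases mem_union.1 h with h | h
    · exact K.DB_Buf h
    · obtain ⟨t, -, h⟩ := mem_biUnion.1 h
      exact mem_compl.1 (K.LS_Buf (K.item_LS (by simp) (cl_sub_B2 _ (K.pb_cl h))))
  · obtain ⟨t, -, h⟩ := mem_biUnion.1 h
    rw [mem_singleton] at h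
    exact mem_compl.1 (K.LS_Buf (K.item_LS (t := Sum.inr (Sum.inr (Sum.inl t))) (by simp) (by rw [h]; exact self_B2 (X := X) _)))

theorem stageC [Nonempty V] (C : K.Cfg) {ρB : W → V}
    (hS : X.St (fun z => X.Vc (X.φ z)) (K.PB C.B1) (K.Bufᶜ) (K.SE : Set (Sym2 W)) K.DB ρB)
    (hI : K.DB.image ρB = C.I0) :
    ∃ ρ : W → V, X.St (K.AY C.Y1) (K.PB C.B1) (K.Bufᶜ) (K.SE : Set (Sym2 W)) K.DC ρ ∧
      (∀ y ∈ K.DB, ρ y = ρB y) ∧ Disjoint (K.DC.image ρ) (C.Y0 ∪ C.Y1) ∧ C.BV ⊆ K.DC.image ρ ∧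
      X.Col ρ K.PBp C.BC := by
  have hl := X.l_pos
  have hS0 : X.St (K.AY C.Y1) (K.PB C.B1) (K.Bufᶜ) (K.SE : Set (Sym2 W)) K.DB ρB := by
    refine hS.congr (fun _ _ _ _ _ _ => rfl) (fun z hz _ => ?_)
    by_cases h : z ∈ K.Hre ∪ K.Xp
    · refine Or.inl (X.dg_eq_zero (fun y hy ha => ?_))
      exact K.Hab_late (K.DB_nb hy ha) h
    · refine Or.inr ⟨hz, ?_, fun _ _ _ => rfl⟩
      unfold AY; rw [if_neg h]
  obtain ⟨cc, cc1, cc2, cc3⟩ := bu_enum (fun q : X.PR => X.Vq q ∩ C.BC) K.ξ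
    (fun q q' h => (X.Vq_disj h).mono inter_subset_left inter_subset_left) C.hBC
  obtain ⟨vv, vv1, vv2, vv3⟩ := bu_enum (fun i : Fin r => X.Vc i ∩ C.BV) K.ξ
    (fun q q' h => (X.vc_disj q q' h).mono inter_subset_left inter_subset_left) C.hBV
  have hseq := bu_seq (V := V) (W := W) (γ := X.PR × Fin K.ξ)
    (fun D ρ => X.St (K.AY C.Y1) (K.PB C.B1) (K.Bufᶜ) (K.SE : Set (Sym2 W)) D ρ)
    (fun t => {K.xb t.1 t.2, K.yb t.1 t.2})
    (fun t ρ => ({ρ (K.xb t.1 t.2), ρ (K.yb t.1 t.2), cc t.1 t.2} : Finset V) ∈ X.E ∧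
      ρ (K.xb t.1 t.2) ∉ C.Y0 ∪ C.Y1 ∪ C.BV ∧ ρ (K.yb t.1 t.2) ∉ C.Y0 ∪ C.Y1 ∪ C.BV)
    (by
      intro t ρ ρ' h hq
      rw [h _ (mem_insert_self _ _), h _ (mem_insert_of_mem (mem_singleton_self _))] at hq
      exact hq) K.DB ρB hS0 univ
    (by
      intro g _ g' _ hgg
      rw [disjoint_left]
      intro w hw hw'
      refine disjoint_left.1 (K.wA_dis (Sum.inr (Sum.inr (Sum.inr g))) (Sum.inr (Sum.inr (Sum.inr g'))) ?_)
        (cl_sub_B2 _ (K.pb_cl hw)) (cl_sub_B2 _ (K.pb_cl hw'))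
      simpa using hgg)
    (by
      intro G' _ g _ hg ρ hSt _ _
      have hnl : ∀ z, z ∈ bu_B2 X.H (K.xb g.1 g.2) → z ∉ K.LS := fun z hz => K.item_LS (by simp) hz
      have hxcl := self_cl (X := X) (K.xb g.1 g.2)
      have hycl := nb_cl (K.xb_adj g.1 g.2)
      have hcm := mem_inter.1 (cc1 g.1 g.2)
      obtain ⟨ρ', h1, h2, h3, h4, h5⟩ := K.pstep hSt (K.PB_symm _) (K.xb g.1 g.2) (K.yb g.1 g.2)
        (K.xb_adj g.1 g.2)
        (by
          rw [mem_coe]; unfold SE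
          exact mem_union_left _ (mem_union_right _ (mem_image.2 ⟨g, mem_univ _, rfl⟩)))
        (by
          rw [disjoint_left]
          intro w hw hw'
          rcases mem_union.1 hw with hw | hw
          · obtain ⟨t, ht, h⟩ := K.DB_item hw
            exact disjoint_left.1 (K.wA_dis _ _ (ht _)) (cl_sub_B2 _ h) hw'
          · obtain ⟨t, ht, hw⟩ := mem_biUnion.1 hw
            refine disjoint_left.1 (K.wA_dis _ _ ?_) (cl_sub_B2 _ (K.pb_cl hw)) hw'
            intro e
            simp only [Sum.inr.injEq] at e
            exact hg ((Prod.ext (Prod.mk.inj e).1 (Prod.mk.inj e).2 : t = g) ▸ ht))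
        (union_subset K.DB_Hab (by
          rw [biUnion_subset]
          intro t _ w hw; exact K.wA_sub _ (cl_sub_B2 _ (K.pb_cl hw))))
        (by
          intro w hw z ha
          have hwc : w ∈ bu_cl X.H {K.xb g.1 g.2} := by rcases hw with rfl | rfl <;> assumption
          exact K.PB_out (hnl _ (cl_sub_B2 _ hwc)) (hnl _ (cl_mem_B2 hwc ha)))
        (by
          intro z hz
          have hz' : z ∉ K.LS := by
            rcases hz with h | h
            · exact hnl _ (cl_mem_B2 hxcl h)
            · exact hnl _ (cl_mem_B2 hycl h)
          exact ⟨K.LS_Buf hz', K.AY_out hz'⟩)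
        (C.Y0 ∪ C.Y1 ∪ C.BV)
        (C.F_card.trans (by have := X.e0_pos; nlinarith [mul_nonneg (sq_nonneg (r:ℝ)) this.le]))
        (fun u v => ({u, v, cc g.1 g.2} : Finset V) ∈ X.E)
        (by
          have e1 : X.φ (K.xb g.1 g.2) = g.1.1.1 := (K.c_pr g.1 g.2).1
          have e2 : X.φ (K.yb g.1 g.2) = g.1.1.2 := (K.c_pr g.1 g.2).2.1
          rw [e1, e2]
          refine le_trans ?_ (X.cdeg g.1.1.1 g.1.1.2 g.1.2.2 _ hcm.1)
          refine mul_le_mul_of_nonneg_right ?_ (by positivity)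
          nlinarith [X.l_le])
      refine ⟨ρ', h1, ?_, h3, h4, h5⟩
      intro y hy
      rw [mem_insert, mem_singleton, not_or] at hy
      exact h2 y hy.1 hy.2)
  obtain ⟨ρ1, hSt1, hoff1, hQ1⟩ := hseq
  have hSt1' : X.St (K.AY C.Y1) (K.PB C.B1) (K.Bufᶜ) (K.SE : Set (Sym2 W)) (K.DB ∪ K.DP) ρ1 := hSt1
  have hDBP : Disjoint K.DB K.DP := by
    rw [disjoint_left]
    intro w hw hw'
    obtain ⟨t, ht, h⟩ := K.DB_item hw
    obtain ⟨t', -, h'⟩ := mem_biUnion.1 hw'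
    exact disjoint_left.1 (K.wA_dis _ _ (ht _)) (cl_sub_B2 _ h) (cl_sub_B2 _ (K.pb_cl h'))
  have hagree1 : ∀ y ∈ K.DB, ρ1 y = ρB y := fun y hy => hoff1 y (disjoint_left.1 hDBP hy)
  have himg1 : ∀ y ∈ K.DB ∪ K.DP, ρ1 y ∉ C.Y0 ∪ C.Y1 ∪ C.BV := by
    intro y hy
    rcases mem_union.1 hy with h | h
    · rw [hagree1 y h]
      have : ρB y ∈ C.I0 := by rw [← hI]; exact mem_image_of_mem _ h
      rw [mem_union, not_or]
      exact ⟨disjoint_right.1 C.dYI this, disjoint_right.1 C.dBVI this⟩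
    · obtain ⟨t, -, h⟩ := mem_biUnion.1 h
      have := (hQ1 t (mem_univ _)).2
      rw [mem_insert, mem_singleton] at h
      rcases h with h | h
      · rw [h]; exact this.1
      · rw [h]; exact this.2
  have hseq2 := bu_seq (V := V) (W := W) (γ := Fin r × Fin K.ξ)
    (fun D ρ => X.St (K.AY C.Y1) (K.PB C.B1) (K.Bufᶜ) (K.SE : Set (Sym2 W)) D ρ)
    (fun t => {K.sg t.1 t.2})
    (fun t ρ => ρ (K.sg t.1 t.2) = vv t.1 t.2)
    (by
      intro t ρ ρ' h hq
      rw [h _ (mem_singleton_self _)] at hq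
      exact hq) (K.DB ∪ K.DP) ρ1 hSt1' univ
    (by
      intro g _ g' _ hgg
      rw [disjoint_left]
      intro w hw hw'
      rw [mem_singleton] at hw hw'
      have a1 : w ∈ bu_B2 X.H (K.sg g.1 g.2) := hw.symm ▸ self_B2 (X := X) (K.sg g.1 g.2)
      have a2 : w ∈ bu_B2 X.H (K.sg g'.1 g'.2) := hw'.symm ▸ self_B2 (X := X) (K.sg g'.1 g'.2)
      exact disjoint_left.1 (K.wA_dis (Sum.inr (Sum.inr (Sum.inl g))) (Sum.inr (Sum.inr (Sum.inl g'))) (by simpa using hgg)) a1 a2)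
    (by
      intro G' _ g _ hg ρ hSt hoff hQ
      have hnl : ∀ z, z ∈ bu_B2 X.H (K.sg g.1 g.2) → z ∉ K.LS := fun z hz => K.item_LS (by simp) hz
      have hcl := self_cl (X := X) (K.sg g.1 g.2)
      have hvm := mem_inter.1 (vv1 g.1 g.2)
      have hφ : X.φ (K.sg g.1 g.2) = g.1 := K.c_sg _ _
      have hdisj : Disjoint (K.DB ∪ K.DP ∪ G'.biUnion (fun t => {K.sg t.1 t.2})) (bu_B2 X.H (K.sg g.1 g.2)) := by
        rw [disjoint_left]
        intro w hw hw'
        rcases mem_union.1 hw with hw | hw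
        · rcases mem_union.1 hw with hw | hw
          · obtain ⟨t, ht, h⟩ := K.DB_item hw
            exact disjoint_left.1 (K.wA_dis _ _ (ht _)) (cl_sub_B2 _ h) hw'
          · obtain ⟨t, ht, hw⟩ := mem_biUnion.1 hw
            exact disjoint_left.1 (K.wA_dis _ _ (by simp)) (cl_sub_B2 _ (K.pb_cl hw)) hw'
        · obtain ⟨t, ht, hw⟩ := mem_biUnion.1 hw
          rw [mem_singleton] at hw
          rw [hw] at hw'
          refine disjoint_left.1 (K.wA_dis (Sum.inr (Sum.inr (Sum.inl t))) (Sum.inr (Sum.inr (Sum.inl g))) ?_)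
            (self_B2 (X := X) _) hw'
          intro e
          simp only [Sum.inr.injEq, Sum.inl.injEq] at e
          exact hg (e ▸ ht)
      obtain ⟨ρ', h1, h2, h3⟩ := hSt.single (K.PB_symm _) (K.sg g.1 g.2) (vv g.1 g.2)
        (fresh_not hdisj hcl) (by rw [hφ]; exact hvm.1)
        (by
          intro hmem
          obtain ⟨y, hy, e⟩ := mem_image.1 hmem
          rcases mem_union.1 hy with hy' | hy'
          · have hyn : y ∉ G'.biUnion (fun t => {K.sg t.1 t.2}) := by
              intro h
              obtain ⟨t, ht, h⟩ := mem_biUnion.1 h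
              rw [mem_singleton] at h
              rcases mem_union.1 hy' with hw | hw
              · obtain ⟨t', ht', h'⟩ := K.DB_item hw
                exact disjoint_left.1 (K.wA_dis _ (Sum.inr (Sum.inr (Sum.inl t))) (ht' _)) (cl_sub_B2 _ h') (by rw [h]; exact self_B2 (X := X) _)
              · obtain ⟨t', ht', hw⟩ := mem_biUnion.1 hw
                exact disjoint_left.1 (K.wA_dis _ (Sum.inr (Sum.inr (Sum.inl t))) (by simp)) (cl_sub_B2 _ (K.pb_cl hw)) (by rw [h]; exact self_B2 (X := X) _)
            rw [hoff y hyn] at e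
            apply himg1 y hy'
            rw [e]; exact mem_union_right _ hvm.2
          · obtain ⟨t, ht, h⟩ := mem_biUnion.1 hy'
            rw [mem_singleton] at h
            rw [h, hQ t ht] at e
            have := vv2 (a₁ := t) (a₂ := g) e
            exact hg (this ▸ ht))
        (fresh_dg hdisj hcl)
        (by
          intro z _ ha
          refine ⟨fresh_dg hdisj (nb_cl ha), ?_⟩
          have hz := hnl z (cl_mem_B2 hcl ha)
          rw [K.AY_out hz, K.PB_out (hnl _ (self_B2 (X := X) _)) hz, hφ]
          have := X.hom _ _ ha
          rw [hφ] at this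
          exact X.vdeg g.1 (X.φ z) this _ hvm.1)
      refine ⟨ρ', h1, ?_, h3⟩
      intro y hy
      rw [mem_singleton] at hy
      exact h2 y hy)
  obtain ⟨ρ, hSt, hoff, hQ⟩ := hseq2
  have hdG : Disjoint (K.DB ∪ K.DP) K.DG := by
    rw [disjoint_left]
    intro w hw hw'
    obtain ⟨t, -, h⟩ := mem_biUnion.1 hw'
    rw [mem_singleton] at h
    rcases mem_union.1 hw with hw | hw
    · obtain ⟨t', ht', h'⟩ := K.DB_item hw
      exact disjoint_left.1 (K.wA_dis _ (Sum.inr (Sum.inr (Sum.inl t))) (ht' _)) (cl_sub_B2 _ h') (by rw [h]; exact self_B2 (X := X) _)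
    · obtain ⟨t', ht', hw⟩ := mem_biUnion.1 hw
      exact disjoint_left.1 (K.wA_dis _ (Sum.inr (Sum.inr (Sum.inl t))) (by simp)) (cl_sub_B2 _ (K.pb_cl hw)) (by rw [h]; exact self_B2 (X := X) _)
  have hag : ∀ y ∈ K.DB ∪ K.DP, ρ y = ρ1 y := fun y hy => hoff y (disjoint_left.1 hdG hy)
  refine ⟨ρ, hSt, ?_, ?_, ?_, ?_⟩
  · intro y hy
    rw [hag y (mem_union_left _ hy), hagree1 y hy]
  · rw [disjoint_left]
    intro v hv
    obtain ⟨y, hy, rfl⟩ := mem_image.1 hv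
    rcases mem_union.1 hy with h | h
    · rw [hag y h]
      exact fun h' => himg1 y h (mem_union_left _ h')
    · obtain ⟨t, -, h⟩ := mem_biUnion.1 h
      rw [mem_singleton] at h
      rw [h, hQ t (mem_univ _)]
      exact disjoint_left.1 C.dBV (mem_inter.1 (vv1 t.1 t.2)).2
  · intro v hv
    obtain ⟨i, hi⟩ := C.cBV v hv
    obtain ⟨k, hk⟩ := vv3 i v (mem_inter.2 ⟨hi, hv⟩)
    rw [← hk, ← hQ (i, k) (mem_univ _)]
    exact mem_image_of_mem _ (mem_union_right _ (mem_biUnion.2 ⟨(i, k), mem_univ _, mem_singleton_self _⟩))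
  · have hcol := Col.of_fam (X := X) (ρ := ρ) _ (fun t : X.PR × Fin K.ξ => cc t.1 t.2) K.pb_inj cc2 (by
      intro t
      have e1 : X.φ (K.xb t.1 t.2) = t.1.1.1 := (K.c_pr t.1 t.2).1
      have e2 : X.φ (K.yb t.1 t.2) = t.1.1.2 := (K.c_pr t.1 t.2).2.1
      have hb : ∀ y ∈ ({K.xb t.1 t.2, K.yb t.1 t.2} : Finset W), y ∈ K.DB ∪ K.DP := fun y hy =>
        mem_union_right _ (mem_biUnion.2 ⟨t, mem_univ _, hy⟩)
      refine X.mem_lst.2 ⟨?_, ?_⟩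
      · rw [e1, e2]; exact (mem_inter.1 (cc1 t.1 t.2)).1
      · rw [hag _ (hb _ (mem_insert_self _ _)), hag _ (hb _ (mem_insert_of_mem (mem_singleton_self _)))]
        exact (hQ1 t (mem_univ _)).1)
    have hBC : (univ : Finset (X.PR × Fin K.ξ)).image (fun t => cc t.1 t.2) = C.BC := by
      ext c
      rw [mem_image]
      constructor
      · rintro ⟨t, -, rfl⟩; exact (mem_inter.1 (cc1 t.1 t.2)).2
      · intro hc
        obtain ⟨q, hq⟩ := C.cBC c hc
        obtain ⟨k, hk⟩ := cc3 q c (mem_inter.2 ⟨hq, hc⟩)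
        exact ⟨(q, k), mem_univ _, hk⟩
    rw [hBC] at hcol
    exact hcol

end Pre
end BUCtx

namespace BUCtx
variable {r : ℕ} {V W : Type} [Fintype V] [Fintype W] {X : BUCtx r V W}
namespace Pre
variable (K : Pre X)

/-- edges touching `D` which are neither absorber edges nor late -/
noncomputable def oth (D : Finset W) : Finset (Sym2 W) := X.tch D \ (K.SF ∪ K.late)

def SE2 : Set (Sym2 W) := {e | e ∈ K.SE ∨ e ∉ K.late}

structure Good (C : K.Cfg) (D : Finset W) (ρ : W → V) : Prop where
  st : X.St (K.AY C.Y1) (K.PB C.B1) (K.Bufᶜ) K.SE2 D ρ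
  dY : Disjoint (D.image ρ) (C.Y0 ∪ C.Y1)
  col : ∃ Cd, X.Col ρ (K.oth D) Cd ∧ C.BC ⊆ Cd ∧ Disjoint Cd (C.B0 ∪ C.B1)

noncomputable def DD : Finset W := (K.Hab \ K.Buf) ∪ K.Us

theorem oth_sub (D : Finset W) : K.oth D ⊆ X.edges := sdiff_subset.trans (X.tch_sub _)

theorem mem_late {x y : W} (h : X.H.Adj x y) : s(x, y) ∈ K.late ↔ x ∈ K.LS ∨ y ∈ K.LS := by
  unfold late
  rw [X.mem_tch]
  exact ⟨fun h => h.2, fun h' => ⟨h, h'⟩⟩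

theorem mem_oth {D : Finset W} {x y : W} : s(x, y) ∈ K.oth D ↔ X.H.Adj x y ∧ (x ∈ D ∨ y ∈ D) ∧
    s(x, y) ∉ K.SF ∧ x ∉ K.LS ∧ y ∉ K.LS := by
  unfold oth
  rw [mem_sdiff, X.mem_tch, mem_union, not_or]
  constructor
  · rintro ⟨⟨h1, h2⟩, h3, h4⟩
    rw [K.mem_late h1, not_or] at h4
    exact ⟨h1, h2, h3, h4.1, h4.2⟩
  · rintro ⟨h1, h2, h3, h4, h5⟩
    refine ⟨⟨h1, h2⟩, h3, ?_⟩
    rw [K.mem_late h1, not_or]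
    exact ⟨h4, h5⟩

theorem PRp_late : K.PRp ⊆ K.late := by
  intro e he
  obtain ⟨⟨q, k⟩, -, rfl⟩ := mem_image.1 he
  refine (K.mem_late (K.xr_adj q k)).2 (Or.inl ?_)
  exact mem_union_left _ (mem_union_left _ (K.wR_sub _ (self_B2 (X := X) (K.xr q k))))

theorem SF_late {e : Sym2 W} (he : e ∈ K.SF) : e ∉ K.late := by
  intro hl
  have h1 := K.SF_DA he
  induction e using Sym2.ind with
  | _ x y =>
    have ha := X.mem_edges.1 (K.SF_sub he)
    rcases (K.mem_late ha).1 hl with h | h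
    · exact K.DA_LS (h1 x (by simp)) h
    · exact K.DA_LS (h1 y (by simp)) h

theorem DC_DD : K.DC ⊆ K.DD := fun _ hw => mem_union_left _ (mem_sdiff.2 ⟨K.DC_Hab hw, K.DC_Buf hw⟩)

theorem xb_DC (q : X.PR) (k : Fin K.ξ) : K.xb q k ∈ K.DC ∧ K.yb q k ∈ K.DC := by
  have h : ∀ w ∈ ({K.xb q k, K.yb q k} : Finset W), w ∈ K.DC := fun w hw =>
    mem_union_left _ (mem_union_right _ (mem_biUnion.2 ⟨(q, k), mem_univ _, hw⟩))
  exact ⟨h _ (by simp), h _ (by simp)⟩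

theorem PBp_oth : K.PBp ⊆ K.oth K.DD := by
  intro e he
  obtain ⟨⟨q, k⟩, -, rfl⟩ := mem_image.1 he
  refine K.mem_oth.2 ⟨K.xb_adj q k, Or.inl (K.DC_DD (K.xb_DC q k).1), ?_, ?_, ?_⟩
  · intro h
    obtain ⟨q', k', l, h'⟩ := K.DA_cl (K.SF_DA h (K.xb q k) (by simp))
    exact disjoint_left.1 (K.wA_dis (Sum.inr (Sum.inr (Sum.inr (q, k)))) (Sum.inl (q', k', l)) (by simp))
      (self_B2 (X := X) _) (cl_sub_B2 _ h')
  · exact K.item_LS (t := Sum.inr (Sum.inr (Sum.inr (q, k)))) (by simp) (self_B2 (X := X) _)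
  · exact K.item_LS (t := Sum.inr (Sum.inr (Sum.inr (q, k)))) (by simp) (cl_sub_B2 _ (nb_cl (K.xb_adj q k)))

theorem DD_LS {w : W} (h : w ∈ K.DD) : w ∉ K.LS := by
  rcases mem_union.1 h with h | h
  · exact K.Hab_LS (mem_sdiff.1 h).1 (mem_sdiff.1 h).2
  · unfold LS
    rw [mem_union, mem_union, not_or, not_or]
    exact ⟨⟨disjoint_right.1 K.dis5 h, disjoint_right.1 K.dis6 h⟩, fun hb => disjoint_left.1 K.dis3 (K.Buf_Hab hb) h⟩

theorem DD_nb {x y : W} (h : x ∈ K.DD) (ha : X.H.Adj x y) : y ∈ K.DD ∨ y ∈ K.LS := by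
  by_cases hy : y ∈ K.LS
  · exact Or.inr hy
  left
  have h1 : y ∉ K.Xp := fun h => hy (mem_union_left _ (mem_union_right _ h))
  have h2 : y ∉ K.Buf := fun h => hy (mem_union_right _ h)
  rcases mem_union.1 h with h | h
  · rcases K.eab x y ha (mem_sdiff.1 h).1 with h | h
    · exact mem_union_left _ (mem_sdiff.2 ⟨h, h2⟩)
    · exact absurd h h1
  · rcases K.eus x y ha h with h | h
    · exact mem_union_right _ h
    · exact absurd h h1

theorem DD_card : (K.DD.card : ℝ) ≤ K.Nab + K.Nu := by
  have h1 : K.DD.card ≤ K.Hab.card + K.Us.card :=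
    (card_union_le _ _).trans (Nat.add_le_add_right (card_le_card sdiff_subset) _)
  have h2 : (K.DD.card : ℝ) ≤ K.Hab.card + K.Us.card := by exact_mod_cast h1
  linarith [K.n_ab, K.n_u]

theorem AY_big (C : K.Cfg) (z : W) : X.e0 ≤ X.l ^ (2 * X.Δ) * ((K.AY C.Y1 z).card : ℝ) := by
  unfold AY
  split_ifs
  · refine le_trans ?_ (mul_le_mul_of_nonneg_left (K.pv_half (C.hY1 _)) (pow_nonneg X.l_pos.le _))
    refine K.e0_pv.trans ?_
    have h1 : X.l ^ (3 * X.Δ) ≤ X.l ^ (2 * X.Δ) := pow_le_pow_of_le_one X.l_pos.le X.l_le_one (by omega)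
    have h2 := X.l_le_one
    have h3 := X.l_pos
    have h4 : X.l ^ (3 * X.Δ) * X.l ≤ X.l ^ (2 * X.Δ) * 1 := mul_le_mul h1 h2 h3.le (pow_nonneg h3.le _)
    have h5 : (0:ℝ) ≤ K.pv := by positivity
    have h6 : 0 ≤ X.l ^ (2 * X.Δ) * K.pv := mul_nonneg (pow_nonneg h3.le _) h5
    have h7 := mul_le_mul_of_nonneg_right h4 h5
    linarith
  · exact K.e0_Vc _

set_option maxHeartbeats 1600000 in
theorem stageD [Nonempty V] (C : K.Cfg) {ρC : W → V}
    (hS : X.St (K.AY C.Y1) (K.PB C.B1) (K.Bufᶜ) (K.SE : Set (Sym2 W)) K.DC ρC)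
    (hY : Disjoint (K.DC.image ρC) (C.Y0 ∪ C.Y1)) (hcol : X.Col ρC K.PBp C.BC) :
    ∃ ρ, K.Good C K.DD ρ ∧ (∀ y ∈ K.DC, ρ y = ρC y) ∧ ∀ y ∈ K.Us, ρ y ∈ K.Ts y := by
  have hl := X.l_pos
  have hDU : K.DC ∪ (K.DD \ K.DC) = K.DD := union_sdiff_of_subset K.DC_DD
  have hTc : ∀ y ∈ K.DD \ K.DC, y ∉ K.Us →
      X.l ^ X.Δ * K.m ≤ ((X.cand K.DC ρC (K.PB C.B1) (K.AY C.Y1 y) y).card : ℝ) := by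
    intro y hy hu
    have hy := mem_sdiff.1 hy
    have h1 := hS.inv y (K.LS_Buf (K.DD_LS hy.1)) hy.2
    rw [K.AY_out (K.DD_LS hy.1)] at h1 ⊢
    refine le_trans ?_ h1
    exact mul_le_mul (X.pow_dg _ _) (K.n_v _).1 K.hm.le (pow_nonneg hl.le _)
  have hF : ((C.Y0 ∪ C.Y1).card : ℝ) ≤ r * (K.pv * (K.Lv + 1) + K.Nre) :=
    le_trans (Nat.cast_le.2 (card_le_card subset_union_left)) C.F_card
  have hDcard : ((K.DD \ K.DC).card : ℝ) + K.DC.card ≤ K.Nab + K.Nu := by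
    refine le_trans (le_of_eq ?_) K.DD_card
    exact_mod_cast card_sdiff_add_card_eq_card K.DC_DD
  have hk1 := K.k1
  have hk1' := K.k1'
  have he0 := X.e0_pos
  have hNab := K.Nab_nn
  have hNu := K.Nu_nn
  have hNre := K.Nre_nn
  have hΔ0 : (0:ℝ) ≤ X.Δ := by positivity
  have hrr : 0 ≤ (r:ℝ) * (K.pv * (K.Lv + 1) + K.Nre) := by positivity
  have hre : X.e0 + X.Δ * X.e0 ≤ ((r:ℝ)^2 + 2 * X.Δ + 3) * X.e0 := by
    have h0 : 0 ≤ (r:ℝ)^2 * X.e0 := by positivity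
    have h0' : 0 ≤ X.Δ * X.e0 := by positivity
    nlinarith
  have hDe : 0 ≤ X.Δ * X.e0 := by positivity
  have hkm : X.l ^ (2 * X.Δ) * X.l^2 / 256 * K.m ≤ X.l ^ (2 * X.Δ) * K.m := by
    have a : 0 ≤ X.l ^ (2 * X.Δ) * K.m := mul_nonneg (pow_nonneg X.l_pos.le _) K.hm.le
    have b : X.l^2 / 256 ≤ 1 := by nlinarith [X.l_pos, X.l_le]
    calc _ = (X.l ^ (2 * X.Δ) * K.m) * (X.l^2/256) := by ring
      _ ≤ _ := mul_le_of_le_one_right a b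
  have hTbig : ∀ y ∈ K.DD \ K.DC, K.Nab + K.Nu + r * (K.pv * (K.Lv + 1) + K.Nre) + X.e0 + X.Δ * X.e0 <
      X.l ^ X.Δ * ((if y ∈ K.Us then K.Ts y else X.cand K.DC ρC (K.PB C.B1) (K.AY C.Y1 y) y).card : ℝ) := by
    intro y hy
    split_ifs with hu
    · have := mul_le_mul_of_nonneg_left (K.hTs y hu).2 (pow_nonneg hl.le X.Δ)
      linarith
    · have := mul_le_mul_of_nonneg_left (hTc y hy hu) (pow_nonneg hl.le X.Δ)
      rw [← mul_assoc, ← l2_eq] at this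
      linarith
  obtain ⟨ρ, g1, g2, g3, g4, -⟩ := hS.greedy (Q := Unit) (K.PB_symm C.B1) (K.DD \ K.DC) disjoint_sdiff
    (fun y => if y ∈ K.Us then K.Ts y else X.cand K.DC ρC (K.PB C.B1) (K.AY C.Y1 y) y) (C.Y0 ∪ C.Y1)
    (fun z _ => X.Vc (X.φ z))
    (fun y _ z ha => K.PB_big C.hB1 ha)
    (by
      intro y _
      split_ifs with hu
      · exact (K.hTs y hu).1
      · exact (X.cand_subset _ _ _ _ _).trans (K.AY_sub _ _))
    (by
      intro w hw y hy ha _ v hv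
      split_ifs at hv with hu
      · exfalso
        rcases K.eab w y ha (K.DC_Hab hw) with h | h
        · exact disjoint_left.1 K.dis3 h hu
        · exact disjoint_left.1 K.dis6 h hu
      · exact (mem_filter.1 hv).2 w hw ha)
    (by
      intro y hy
      have := hTbig y hy
      linarith)
    (fun y _ z _ _ => ⟨K.AY_sub _ _, K.AY_big C z⟩)
    (by
      intro y _ z _ _ _ _
      exact ⟨Subset.refl _, K.e0_Vc1 _⟩)
    (fun y _ z _ _ => K.e0_Vc1 _)
    (by
      intro y hy
      have := hTbig y hy
      simp only [Fintype.card_unit, Nat.cast_one, mul_one]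
      linarith)
  rw [hDU] at g1
  have hagree : ∀ y ∈ K.DC, ρ y = ρC y := fun y hy => g2 y (fun h => (mem_sdiff.1 h).2 hy)
  have hDY : Disjoint (K.DD.image ρ) (C.Y0 ∪ C.Y1) := by
    rw [disjoint_left]
    intro v hv
    obtain ⟨y, hy, rfl⟩ := mem_image.1 hv
    by_cases hc : y ∈ K.DC
    · rw [hagree y hc]
      exact disjoint_left.1 hY (mem_image_of_mem _ hc)
    · exact (g3 y (mem_sdiff.2 ⟨hy, hc⟩)).2.1
  have hUs : ∀ y ∈ K.Us, ρ y ∈ K.Ts y := by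
    intro y hy
    have := (g3 y (mem_sdiff.2 ⟨mem_union_right _ hy, fun h => disjoint_left.1 K.dis3 (K.DC_Hab h) hy⟩)).1
    rwa [if_pos hy] at this
  refine ⟨ρ, ⟨g1.monoSE (fun e he => Or.inl he), hDY, ?_⟩, hagree, hUs⟩
  -- colour early edges
  have hearly : ((K.oth K.DD \ K.PBp).card : ℝ) ≤ X.Δ * (K.Nab + K.Nu) := by
    have h1 : (K.oth K.DD \ K.PBp).card ≤ K.DD.card * X.Δ :=
      (card_le_card (sdiff_subset.trans sdiff_subset)).trans (X.tch_card _)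
    have h2 : ((K.oth K.DD \ K.PBp).card : ℝ) ≤ K.DD.card * X.Δ := by exact_mod_cast h1
    have := mul_le_mul_of_nonneg_right K.DD_card hΔ0
    linarith
  obtain ⟨Ce, hCe, hcolE⟩ := Col.sdr (X := X) ρ (K.oth K.DD \ K.PBp) (C.B0 ∪ C.B1 ∪ C.BC)ᶜ (by
    intro e he
    induction e using Sym2.ind with
    | _ x y =>
    obtain ⟨he1, he2⟩ := mem_sdiff.1 he
    obtain ⟨ha, hxy, hsf, hx, hy⟩ := K.mem_oth.1 he1
    have hxD : x ∈ K.DD := by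
      rcases hxy with h | h
      · exact h
      · exact (K.DD_nb h ha.symm).resolve_right hx
    have hyD : y ∈ K.DD := (K.DD_nb hxD ha).resolve_right hy
    have hth := g1.thk x hxD y hyD ha (by
      intro h
      rcases mem_union.1 (mem_coe.1 h) with h | h
      · rcases mem_union.1 h with h | h
        · exact hsf h
        · exact he2 h
      · rcases (K.mem_late ha).1 (K.PRp_late h) with h | h
        · exact hx h
        · exact hy h)
    rw [K.PB_out hx hy] at hth
    have hth' : X.l * ((X.Vij (X.φ x) (X.φ y)).card : ℝ) ≤ ((X.lst ρ s(x, y)).card : ℝ) := by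
      rw [X.lst_eq]; exact hth
    obtain ⟨q, hq⟩ := X.exists_q (X.mem_edges.2 ha)
    have hsubq := X.lst_sub (ρ := ρ) hq
    have hcard : (X.lst ρ s(x, y)).card ≤ (X.lst ρ s(x, y) ∩ (C.B0 ∪ C.B1 ∪ C.BC)ᶜ).card +
        ((X.Vq q ∩ C.B0).card + (X.Vq q ∩ C.B1).card + (X.Vq q ∩ C.BC).card) := by
      have : X.lst ρ s(x, y) ⊆ (X.lst ρ s(x, y) ∩ (C.B0 ∪ C.B1 ∪ C.BC)ᶜ) ∪ (X.Vq q ∩ C.B0 ∪ X.Vq q ∩ C.B1 ∪ X.Vq q ∩ C.BC) := by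
        intro c hc
        have hcq := hsubq hc
        by_cases h : c ∈ C.B0 ∪ C.B1 ∪ C.BC
        · refine mem_union_right _ ?_
          rw [← inter_union_distrib_left, ← inter_union_distrib_left]
          exact mem_inter.2 ⟨hcq, h⟩
        · exact mem_union_left _ (mem_inter.2 ⟨hc, mem_compl.2 h⟩)
      refine (card_le_card this).trans ((card_union_le _ _).trans (Nat.add_le_add_left ?_ _))
      exact (card_union_le _ _).trans (Nat.add_le_add_right (card_union_le _ _) _)
    rw [C.hB0 q, C.hBC q] at hcard
    have hB1 := C.hB1 q
    have hk12 := K.k12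
    have hcard2 : (X.lst ρ s(x, y)).card ≤ (X.lst ρ s(x, y) ∩ (C.B0 ∪ C.B1 ∪ C.BC)ᶜ).card +
        (K.pc * K.Lc + K.pc + K.late.card) := by
      have : (X.Eq q ∩ K.late).card ≤ K.late.card := card_le_card inter_subset_right
      omega
    have hcard3 : ((X.lst ρ s(x, y)).card : ℝ) ≤ ((X.lst ρ s(x, y) ∩ (C.B0 ∪ C.B1 ∪ C.BC)ᶜ).card : ℝ) +
        (K.pc * K.Lc + K.pc + K.late.card) := by exact_mod_cast hcard2
    have hlc := K.late_card
    have hk4 := K.k4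
    have hclo := K.Vij_clo ha
    have h9 : X.l * K.clo ≤ X.l * ((X.Vij (X.φ x) (X.φ y)).card : ℝ) := mul_le_mul_of_nonneg_left hclo hl.le
    have h10 : X.l^2 / 16 * K.clo ≤ X.l * K.clo := by
      refine mul_le_mul_of_nonneg_right ?_ K.clo_pos.le
      nlinarith [X.l_le_one]
    have hpc : (0:ℝ) ≤ K.pc := by positivity
    have : ((K.oth K.DD \ K.PBp).card : ℝ) ≤ ((X.lst ρ s(x, y) ∩ (C.B0 ∪ C.B1 ∪ C.BC)ᶜ).card : ℝ) := by
      have e1 : (K.pc : ℝ) * (K.Lc + 2) = K.pc * K.Lc + 2 * K.pc := by ring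
      linarith
    exact_mod_cast this)
  have hcolP : X.Col ρ K.PBp C.BC := hcol.congr (by
    intro e he x hx
    obtain ⟨⟨q, k⟩, -, rfl⟩ := mem_image.1 he
    refine (hagree x ?_).symm
    rcases Sym2.mem_iff.1 hx with rfl | rfl
    · exact (K.xb_DC q k).1
    · exact (K.xb_DC q k).2)
  refine ⟨C.BC ∪ Ce, ?_, subset_union_left, ?_⟩
  · have := hcolP.union hcolE disjoint_sdiff (by
      rw [disjoint_left]
      intro c hc hc'
      exact mem_compl.1 (hCe hc') (mem_union_right _ hc))
    rwa [union_sdiff_of_subset K.PBp_oth] at this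
  · rw [disjoint_union_left]
    refine ⟨C.dBC, ?_⟩
    rw [disjoint_left]
    intro c hc hc'
    exact mem_compl.1 (hCe hc) (mem_union_left _ hc')

end Pre
end BUCtx

namespace BUCtx
variable {r : ℕ} {V W : Type} [Fintype V] [Fintype W] {X : BUCtx r V W}
namespace Pre
variable (K : Pre X)

theorem Buf_cls (i : Fin r) : (K.Buf.filter (fun y => X.φ y = i)).card = K.pv * (K.Lv + 1) := by
  have : K.Buf.filter (fun y => X.φ y = i) =
      (univ : Finset (Fin K.pv × Fin (K.Lv+1))).image (fun t => K.bf i t.1 t.2) := by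
    ext w
    rw [mem_filter, mem_image, K.mem_Buf]
    constructor
    · rintro ⟨⟨i', k, l, rfl⟩, h⟩
      have : i' = i := by rw [← h]; exact (K.c_buf i' k l).symm
      subst this
      exact ⟨(k, l), mem_univ _, rfl⟩
    · rintro ⟨⟨k, l⟩, -, rfl⟩
      exact ⟨⟨i, k, l, rfl⟩, K.c_buf i k l⟩
  rw [this, card_image_of_injective]
  · simp
  · rintro ⟨k, l⟩ ⟨k', l'⟩ h
    have := K.bf_inj (a₁ := (i, k, l)) (a₂ := (i, k', l')) h
    simpa using this

theorem LS_cls (i : Fin r) : (K.LS.filter (fun y => X.φ y = i)).card = K.lc i + K.pv * (K.Lv + 1) := by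
  rw [← K.Buf_cls i]
  unfold LS lc
  rw [filter_union, card_union_of_disjoint]
  refine (disjoint_filter_filter ?_)
  rw [disjoint_left]
  intro w hw hb
  exact K.Hab_late (K.Buf_Hab hb) hw

/-- vertex counting -/
theorem vert_count (C : K.Cfg) {D : Finset W} {ρ : W → V} (hi : Set.InjOn ρ D)
    (hm : ∀ y ∈ D, ρ y ∈ X.Vc (X.φ y)) (hd : Disjoint (D.image ρ) (C.Y0 ∪ C.Y1)) (i : Fin r) :
    (X.Vc i ∩ (C.Y0 ∪ C.Y1 ∪ D.image ρ)ᶜ).card + (D.filter (fun y => X.φ y = i)).card +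
      (K.LS.filter (fun y => X.φ y = i)).card = ((univ : Finset W).filter (fun y => X.φ y = i)).card + K.s := by
  have h1 : (X.Vc i ∩ (C.Y0 ∪ C.Y1 ∪ D.image ρ)).card =
      (X.Vc i ∩ C.Y0).card + (X.Vc i ∩ C.Y1).card + (X.Vc i ∩ D.image ρ).card := by
    rw [inter_union_distrib_left, inter_union_distrib_left, card_union_of_disjoint, card_union_of_disjoint]
    · exact C.dY.mono inter_subset_right inter_subset_right
    · rw [← inter_union_distrib_left]
      exact hd.symm.mono inter_subset_right inter_subset_right
  have h2 : (X.Vc i ∩ (C.Y0 ∪ C.Y1 ∪ D.image ρ)ᶜ).card + (X.Vc i ∩ (C.Y0 ∪ C.Y1 ∪ D.image ρ)).card = (X.Vc i).card := by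
    rw [← sdiff_eq_inter_compl, card_sdiff_add_card_inter]
  rw [K.LS_cls, X.vcard i]
  rw [X.image_card hi hm] at h1
  have h3 := C.hY0 i
  have h4 := C.hY1 i
  have h5 : K.pv * (K.Lv + 1) = K.pv * K.Lv + K.pv := by ring
  omega

theorem col_count (C : K.Cfg) {I : Finset (Sym2 W)} {Cd : Finset V} {ρ : W → V} (h : X.Col ρ I Cd)
    (hI : I ⊆ X.edges) (hd : Disjoint Cd (C.B0 ∪ C.B1)) (q : X.PR) :
    (X.Vq q ∩ (C.B0 ∪ C.B1 ∪ Cd)ᶜ).card + (X.Eq q ∩ I).card + (X.Eq q ∩ K.SF).card + (X.Eq q ∩ K.late).card =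
      (X.Eq q).card + K.s := by
  have h1 : (X.Vq q ∩ (C.B0 ∪ C.B1 ∪ Cd)).card =
      (X.Vq q ∩ C.B0).card + (X.Vq q ∩ C.B1).card + (X.Vq q ∩ Cd).card := by
    rw [inter_union_distrib_left, inter_union_distrib_left, card_union_of_disjoint, card_union_of_disjoint]
    · exact C.dB.mono inter_subset_right inter_subset_right
    · rw [← inter_union_distrib_left]
      exact hd.symm.mono inter_subset_right inter_subset_right
  have h2 : (X.Vq q ∩ (C.B0 ∪ C.B1 ∪ Cd)ᶜ).card + (X.Vq q ∩ (C.B0 ∪ C.B1 ∪ Cd)).card = (X.Vq q).card := by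
    rw [← sdiff_eq_inter_compl, card_sdiff_add_card_inter]
  rw [K.SF_card, X.Eq_card]
  rw [h.card_q hI] at h1
  have h3 := C.hB0 q
  have h4 := C.hB1 q
  have h5 : K.pc * (K.Lc + 1) = K.pc * K.Lc + K.pc := by ring
  omega

theorem free_v (C : K.Cfg) {D : Finset W} {ρ : W → V} (h : K.Good C D ρ) (hD : Disjoint D K.LS) (i : Fin r) :
    K.s ≤ (X.Vc i ∩ (C.Y0 ∪ C.Y1 ∪ D.image ρ)ᶜ).card := by
  have h1 := K.vert_count C h.st.inj h.st.mem h.dY i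
  have h2 : (D.filter (fun y => X.φ y = i)).card + (K.LS.filter (fun y => X.φ y = i)).card ≤
      ((univ : Finset W).filter (fun y => X.φ y = i)).card := by
    rw [← card_union_of_disjoint (disjoint_filter_filter hD), ← filter_union]
    exact card_le_card (filter_subset_filter _ (subset_univ _))
  omega

theorem free_c (C : K.Cfg) {I : Finset (Sym2 W)} {Cd : Finset V} {ρ : W → V} (h : X.Col ρ I Cd)
    (hI : I ⊆ X.edges) (hI2 : Disjoint I (K.SF ∪ K.late)) (hd : Disjoint Cd (C.B0 ∪ C.B1)) (q : X.PR) :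
    K.s ≤ (X.Vq q ∩ (C.B0 ∪ C.B1 ∪ Cd)ᶜ).card := by
  have h1 := K.col_count C h hI hd q
  have h3 : Disjoint K.SF K.late := disjoint_left.2 (fun e he => K.SF_late he)
  have h2 : (X.Eq q ∩ I).card + (X.Eq q ∩ K.SF).card + (X.Eq q ∩ K.late).card ≤ (X.Eq q).card := by
    rw [disjoint_union_right] at hI2
    rw [← card_union_of_disjoint, ← card_union_of_disjoint, ← inter_union_distrib_left, ← inter_union_distrib_left]
    · exact card_le_card inter_subset_left
    · rw [← inter_union_distrib_left]
      exact (disjoint_union_left.2 ⟨hI2.2, h3⟩).mono inter_subset_right inter_subset_right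
    · exact hI2.1.mono inter_subset_right inter_subset_right
  omega

noncomputable def chk (k : Fin K.qn) : Finset W :=
  (univ : Finset W).filter (fun x => x ∉ K.Hab ∧ x ∉ K.Hre ∧ x ∉ K.Xp ∧ x ∉ K.Us ∧ K.χ x = k)

theorem mem_chk {k : Fin K.qn} {x : W} : x ∈ K.chk k ↔
    x ∉ K.Hab ∧ x ∉ K.Hre ∧ x ∉ K.Xp ∧ x ∉ K.Us ∧ K.χ x = k := by
  unfold chk
  simp only [mem_filter, mem_univ, true_and]

theorem chk_nb {k : Fin K.qn} {x y : W} (h : x ∈ K.chk k) (ha : X.H.Adj x y) : y ∈ K.chk k ∨ y ∈ K.Xp := by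
  obtain ⟨h1, h2, h3, h4, h5⟩ := K.mem_chk.1 h
  by_cases hy : y ∈ K.Xp
  · exact Or.inr hy
  left
  refine K.mem_chk.2 ⟨fun hh => ?_, fun hh => ?_, hy, fun hh => ?_, ?_⟩
  · exact (K.eab y x ha.symm hh).elim h1 h3
  · exact (K.ere y x ha.symm hh).elim h2 h3
  · exact (K.eus y x ha.symm hh).elim h4 h3
  · rw [← K.ech x y ha h1 h2 h3 h4 hy, h5]

theorem chk_LS {k : Fin K.qn} {x : W} (h : x ∈ K.chk k) : x ∉ K.LS := by
  obtain ⟨h1, h2, h3, h4, h5⟩ := K.mem_chk.1 h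
  unfold LS
  rw [mem_union, mem_union, not_or, not_or]
  exact ⟨⟨h2, h3⟩, fun hb => h1 (K.Buf_Hab hb)⟩

theorem chk_card (k : Fin K.qn) : ((K.chk k).card : ℝ) ≤ K.Nch := by
  refine le_trans (le_of_eq ?_) (K.n_ch k)
  unfold chk
  congr!

theorem Nch_nn [Nonempty (Fin K.qn)] : 0 ≤ K.Nch :=
  le_trans (by positivity) (K.chk_card (Classical.arbitrary _))

set_option maxHeartbeats 1600000 in
theorem chunk_step [Nonempty V] (C : K.Cfg) {D : Finset W} {ρ : W → V} (h : K.Good C D ρ)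
    (hD : Disjoint D K.LS) (k : Fin K.qn) (hk : Disjoint D (K.chk k)) :
    ∃ ρ', K.Good C (D ∪ K.chk k) ρ' ∧ ∀ y, y ∉ K.chk k → ρ' y = ρ y := by
  have hl := X.l_pos
  have hl1 := X.l_le_one
  have he0 := X.e0_pos
  haveI : Nonempty (Fin K.qn) := ⟨k⟩
  have hN := K.Nch_nn
  have hk10 := K.k10
  have hΔ0 : (0:ℝ) ≤ X.Δ := by positivity
  have hDe : 0 ≤ X.Δ * X.e0 := by positivity
  have hND : 0 ≤ K.Nch * X.Δ := by positivity
  have hs0 : (0:ℝ) ≤ K.s := by positivity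
  have hlD := lD_pos (X := X)
  have hlD1 := lD_le (X := X)
  have hls : X.l ^ X.Δ * X.l * K.s ≤ X.l ^ X.Δ * K.s :=
    mul_le_mul_of_nonneg_right (mul_le_of_le_one_right hlD.le hl1) hs0
  have hls2 : X.l ^ X.Δ * X.l * K.s ≤ X.l * K.s :=
    mul_le_mul_of_nonneg_right (mul_le_of_le_one_left hl.le hlD1) hs0
  have hls3 : X.l * K.s ≤ K.s := mul_le_of_le_one_left hs0 hl1
  obtain ⟨Cd, hc1, hc2, hc3⟩ := h.col
  have hoth : Disjoint (K.oth D) (K.SF ∪ K.late) := sdiff_disjoint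
  have hfc := K.free_c C hc1 (K.oth_sub D) hoth hc3
  have hfv := K.free_v C h hD
  set Pl : Finset V := (C.B0 ∪ C.B1 ∪ Cd)ᶜ with hPl
  have hnoD : ∀ y ∈ D, ∀ z ∈ K.chk k, ¬ X.H.Adj y z := by
    intro y hy z hz ha
    rcases K.chk_nb hz ha.symm with h | h
    · exact disjoint_left.1 hk hy h
    · exact disjoint_left.1 hD hy (mem_union_left _ (mem_union_right _ h))
  obtain ⟨ρ2, g1, g2, g3, g4⟩ := X.greedy (Q := Unit) () (K.chk k)
    (fun y z => if y ∈ K.chk k ∧ z ∈ K.chk k then X.Vij (X.φ y) (X.φ z) ∩ Pl else K.PB C.B1 y z)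
    (fun z _ => if z ∈ K.chk k then X.Vc (X.φ z) ∩ (C.Y0 ∪ C.Y1 ∪ D.image ρ)ᶜ else
      X.cand D ρ (K.PB C.B1) (K.AY C.Y1 z) z) ∅
    (by
      intro y _ z ha
      split_ifs
      · refine ⟨inter_subset_left, ?_⟩
        obtain ⟨q, hq⟩ := X.Vij_q ha
        rw [hq]
        have : (K.s : ℝ) ≤ ((X.Vq q ∩ Pl).card : ℝ) := by exact_mod_cast hfc q
        linarith
      · exact K.PB_big C.hB1 ha)
    (by
      intro y z
      rw [X.vij_symm (X.φ y) (X.φ z), K.PB_symm C.B1 y z]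
      exact if_congr and_comm rfl rfl)
    (by
      intro y hy _
      rw [if_pos hy]; exact inter_subset_left)
    (by
      intro y _ z _ _
      split_ifs
      · exact inter_subset_left
      · exact (X.cand_subset _ _ _ _ _).trans (K.AY_sub _ _))
    (by
      intro y hy z ha _
      split_ifs with hz
      · have h1 : (K.s : ℝ) ≤ ((X.Vc (X.φ z) ∩ (C.Y0 ∪ C.Y1 ∪ D.image ρ)ᶜ).card : ℝ) := by exact_mod_cast hfv _
        have h2 := mul_le_mul_of_nonneg_left h1 hlD.le
        linarith
      · have hzX : z ∈ K.Xp := (K.chk_nb hy ha).resolve_left hz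
        have hzB : z ∈ K.Bufᶜ := mem_compl.2 (fun hb => disjoint_left.1 K.dis2 (K.Buf_Hab hb) hzX)
        have hzD : z ∉ D := fun h => disjoint_left.1 hD h (mem_union_left _ (mem_union_right _ hzX))
        have h1 := h.st.inv z hzB hzD
        have h2 := K.AY_big C z
        rw [l2_eq, mul_assoc] at h2
        refine h2.trans (mul_le_mul_of_nonneg_left ?_ hlD.le)
        exact (mul_le_mul_of_nonneg_right (X.pow_dg _ _) (by positivity)).trans h1)
    (by
      intro y hy
      rw [if_pos hy]
      have h1 : (K.s : ℝ) ≤ ((X.Vc (X.φ y) ∩ (C.Y0 ∪ C.Y1 ∪ D.image ρ)ᶜ).card : ℝ) := by exact_mod_cast hfv _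
      have h2 := mul_le_mul_of_nonneg_left h1 hlD.le
      have h3 := K.chk_card k
      simp only [Fintype.card_unit, Nat.cast_one, mul_one, card_empty, Nat.cast_zero, add_zero]
      linarith)
  have g2' : ∀ y ∈ K.chk k, ρ2 y ∈ X.Vc (X.φ y) ∧ ρ2 y ∉ C.Y0 ∪ C.Y1 ∧ ρ2 y ∉ D.image ρ := by
    intro y hy
    have := (g2 y hy).1
    rw [if_pos hy, mem_inter, mem_compl, mem_union, not_or] at this
    exact this
  have hnl : ∀ y ∈ K.chk k, ∀ z ∈ K.chk k, X.H.Adj y z → s(y, z) ∉ K.late := by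
    intro y hy z hz ha hh
    rcases (K.mem_late ha).1 hh with h | h
    · exact K.chk_LS hy h
    · exact K.chk_LS hz h
  have hSt := h.st.extend (K.PB_symm C.B1) (D2 := K.chk k) (ρ2 := ρ2) hk g1 (fun y hy => (g2' y hy).1)
    (fun y hy => (g2' y hy).2.2)
    (by
      intro y hy z hz ha hn
      exact absurd (Or.inr (hnl y hy z hz ha)) hn)
    (fun y hy z hz ha => absurd ha (hnoD y hy z hz))
    (by
      intro z _ _ hz
      have := g4 z hz ()
      rw [if_neg hz] at this
      refine this.trans (le_of_eq ?_)
      congr 1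
      refine congrArg card (X.cand_congr (fun y hy ha => ⟨rfl, ?_⟩))
      rw [if_neg (fun hh => hz hh.2)])
  have hin : ∀ y ∈ K.chk k, mix (K.chk k) ρ ρ2 y = ρ2 y := fun y hy => mix_in hy
  have hout : ∀ y, y ∉ K.chk k → mix (K.chk k) ρ ρ2 y = ρ y := fun y hy => mix_out hy
  refine ⟨mix (K.chk k) ρ ρ2, ⟨hSt, ?_, ?_⟩, hout⟩
  · rw [disjoint_left]
    intro v hv
    obtain ⟨y, hy, rfl⟩ := mem_image.1 hv
    rcases mem_union.1 hy with hy | hy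
    · rw [hout y (disjoint_left.1 hk hy)]
      exact disjoint_left.1 h.dY (mem_image_of_mem _ hy)
    · rw [hin y hy]; exact (g2' y hy).2.1
  -- colours
  have hnewe : ∀ x y, s(x, y) ∈ K.oth (D ∪ K.chk k) \ K.oth D → X.H.Adj x y ∧ x ∈ K.chk k ∧ y ∈ K.chk k := by
    intro x y he
    obtain ⟨he1, he2⟩ := mem_sdiff.1 he
    obtain ⟨ha, hxy, hsf, hx, hy⟩ := K.mem_oth.1 he1
    have hnx : y ∉ K.Xp := fun h => hy (mem_union_left _ (mem_union_right _ h))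
    have hnx' : x ∉ K.Xp := fun h => hx (mem_union_left _ (mem_union_right _ h))
    have hxn : x ∉ D := fun hh => he2 (K.mem_oth.2 ⟨ha, Or.inl hh, hsf, hx, hy⟩)
    have hyn : y ∉ D := fun hh => he2 (K.mem_oth.2 ⟨ha, Or.inr hh, hsf, hx, hy⟩)
    rcases hxy with hh | hh
    · have := (mem_union.1 hh).resolve_left hxn
      exact ⟨ha, this, (K.chk_nb this ha).resolve_right hnx⟩
    · have := (mem_union.1 hh).resolve_left hyn
      exact ⟨ha, (K.chk_nb this ha.symm).resolve_right hnx', this⟩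
  have hcardE : ((K.oth (D ∪ K.chk k) \ K.oth D).card : ℝ) ≤ K.Nch * X.Δ := by
    have h1 : K.oth (D ∪ K.chk k) \ K.oth D ⊆ X.tch (K.chk k) := by
      intro e he
      induction e using Sym2.ind with
      | _ x y =>
        obtain ⟨a, b, -⟩ := hnewe x y he
        exact X.mem_tch.2 ⟨a, Or.inl b⟩
    have h2 : ((K.oth (D ∪ K.chk k) \ K.oth D).card : ℝ) ≤ (K.chk k).card * X.Δ := by
      exact_mod_cast (card_le_card h1).trans (X.tch_card _)
    exact h2.trans (mul_le_mul_of_nonneg_right (K.chk_card k) hΔ0)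
  obtain ⟨Ce, hCe, hcolE⟩ := Col.sdr (X := X) (mix (K.chk k) ρ ρ2) (K.oth (D ∪ K.chk k) \ K.oth D) Pl (by
    intro e he
    induction e using Sym2.ind with
    | _ x y =>
    obtain ⟨ha, hx, hy⟩ := hnewe x y he
    have hth := g3 x hx y hy ha
    rw [if_pos ⟨hx, hy⟩] at hth
    rw [X.lst_inter, hin x hx, hin y hy]
    have hth' : X.l * ((X.Vij (X.φ x) (X.φ y) ∩ Pl).card : ℝ) ≤
      ((bu_lk X.E (X.Vij (X.φ x) (X.φ y) ∩ Pl) (ρ2 x) (ρ2 y)).card : ℝ) := hth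
    obtain ⟨q, hq⟩ := X.Vij_q ha
    have h1 : (K.s : ℝ) ≤ ((X.Vij (X.φ x) (X.φ y) ∩ Pl).card : ℝ) := by rw [hq]; exact_mod_cast hfc q
    have h2 := mul_le_mul_of_nonneg_left h1 hl.le
    have h3 : ((K.oth (D ∪ K.chk k) \ K.oth D).card : ℝ) ≤
      ((bu_lk X.E (X.Vij (X.φ x) (X.φ y) ∩ Pl) (ρ2 x) (ρ2 y)).card : ℝ) := by linarith
    exact_mod_cast h3)
  have hsubo : K.oth D ⊆ K.oth (D ∪ K.chk k) := by
    intro e he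
    induction e using Sym2.ind with
    | _ x y =>
    obtain ⟨ha, hxy, hh⟩ := K.mem_oth.1 he
    exact K.mem_oth.2 ⟨ha, hxy.imp (mem_union_left _) (mem_union_left _), hh⟩
  have hcolO : X.Col (mix (K.chk k) ρ ρ2) (K.oth D) Cd := hc1.congr (by
    intro e he x hx
    refine (hout x ?_).symm
    obtain ⟨y, rfl⟩ := Sym2.mem_iff_exists.1 hx
    obtain ⟨ha, hxy, hsf, hxl, hyl⟩ := K.mem_oth.1 he
    intro hxk
    have hxD : x ∉ D := fun h => disjoint_left.1 hk h hxk
    exact hnoD y (hxy.resolve_left hxD) x hxk ha.symm)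
  refine ⟨Cd ∪ Ce, ?_, hc2.trans subset_union_left, ?_⟩
  · have := hcolO.union hcolE disjoint_sdiff (by
      rw [disjoint_left]
      intro c hc hc'
      exact mem_compl.1 (hCe hc') (mem_union_right _ hc))
    rwa [union_sdiff_of_subset hsubo] at this
  · rw [disjoint_union_left]
    refine ⟨hc3, ?_⟩
    rw [disjoint_left]
    intro c hc hc'
    exact mem_compl.1 (hCe hc) (mem_union_left _ hc')

theorem stageE [Nonempty V] (C : K.Cfg) {ρ0 : W → V} (h : K.Good C K.DD ρ0) :
    ∃ ρ, K.Good C K.LSᶜ ρ ∧ ∀ y ∈ K.DD, ρ y = ρ0 y := by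
  have hDC : ∀ k, Disjoint K.DD (K.chk k) := by
    intro k
    rw [disjoint_left]
    intro x hx hx'
    obtain ⟨h1, h2, h3, h4, h5⟩ := K.mem_chk.1 hx'
    rcases mem_union.1 hx with h | h
    · exact h1 (mem_sdiff.1 h).1
    · exact h4 h
  have hdis : ∀ g g' : Fin K.qn, g ≠ g' → Disjoint (K.chk g) (K.chk g') := by
    intro g g' hne
    rw [disjoint_left]
    intro x hx hx'
    exact hne ((K.mem_chk.1 hx).2.2.2.2.symm.trans (K.mem_chk.1 hx').2.2.2.2)
  obtain ⟨ρ, h1, h2, -⟩ := bu_seq (V := V) (W := W) (γ := Fin K.qn) (fun D ρ => K.Good C D ρ) K.chk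
    (fun _ _ => True) (fun _ _ _ _ _ => trivial) K.DD ρ0 h univ
    (fun g _ g' _ hne => hdis g g' hne)
    (by
      intro G' _ g _ hg ρ hG _ _
      obtain ⟨ρ', a, b⟩ := K.chunk_step C hG (by
        rw [disjoint_left]
        intro w hw
        rcases mem_union.1 hw with hw | hw
        · exact K.DD_LS hw
        · obtain ⟨k, -, hk⟩ := mem_biUnion.1 hw
          exact K.chk_LS hk) g (by
        rw [disjoint_union_left]
        refine ⟨hDC g, ?_⟩
        rw [disjoint_biUnion_left]
        intro g' hg'
        exact hdis g' g (fun (e : g' = g) => hg (e ▸ hg')))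
      exact ⟨ρ', a, b, trivial⟩)
  have hU : K.DD ∪ (univ : Finset (Fin K.qn)).biUnion K.chk = K.LSᶜ := by
    ext w
    rw [mem_compl]
    constructor
    · intro hw
      rcases mem_union.1 hw with hw | hw
      · exact K.DD_LS hw
      · obtain ⟨k, -, hk⟩ := mem_biUnion.1 hw
        exact K.chk_LS hk
    · intro hw
      unfold LS at hw
      rw [mem_union, mem_union, not_or, not_or] at hw
      by_cases hab : w ∈ K.Hab
      · exact mem_union_left _ (mem_union_left _ (mem_sdiff.2 ⟨hab, hw.2⟩))
      by_cases hus : w ∈ K.Us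
      · exact mem_union_left _ (mem_union_right _ hus)
      exact mem_union_right _ (mem_biUnion.2 ⟨K.χ w, mem_univ _, K.mem_chk.2 ⟨hab, hw.1.1, hw.1.2, hus, rfl⟩⟩)
  rw [hU] at h1
  refine ⟨ρ, h1, fun y hy => h2 y (fun hh => ?_)⟩
  obtain ⟨k, -, hk⟩ := mem_biUnion.1 hh
  exact disjoint_left.1 (hDC k) hy hk

end Pre
end BUCtx

namespace BUCtx
variable {r : ℕ} {V W : Type} [Fintype V] [Fintype W] {X : BUCtx r V W}
namespace Pre
variable (K : Pre X)

/-- target sets in the last phase -/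
noncomputable def AF (C : K.Cfg) (ρE : W → V) (z : W) : Finset V :=
  if z ∈ K.Xp then X.cand K.LSᶜ ρE (K.PB C.B1) (K.AY C.Y1 z) z else K.AY C.Y1 z

theorem AF_sub (C : K.Cfg) (ρE : W → V) (z : W) : K.AF C ρE z ⊆ X.Vc (X.φ z) := by
  unfold AF
  split_ifs
  · exact (X.cand_subset _ _ _ _ _).trans (K.AY_sub _ _)
  · exact K.AY_sub _ _

theorem AF_Y1 (C : K.Cfg) (ρE : W → V) {z : W} (hz : z ∈ K.Hre ∪ K.Xp) : K.AF C ρE z ⊆ C.Y1 := by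
  have h : K.AY C.Y1 z ⊆ C.Y1 := by unfold AY; rw [if_pos hz]; exact inter_subset_right
  unfold AF
  split_ifs
  · exact (X.cand_subset _ _ _ _ _).trans h
  · exact h

theorem AF_Hre (C : K.Cfg) (ρE : W → V) {z : W} (hz : z ∈ K.Hre) : K.AF C ρE z = X.Vc (X.φ z) ∩ C.Y1 := by
  unfold AF AY
  rw [if_neg (disjoint_left.1 K.dis4 hz), if_pos (mem_union_left _ hz)]

theorem AF_big (C : K.Cfg) {ρE : W → V} (h : K.Good C K.LSᶜ ρE) {z : W} (hz : z ∈ K.Hre ∪ K.Xp) :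
    X.l ^ X.Δ * (K.pv / 2) ≤ ((K.AF C ρE z).card : ℝ) := by
  have hY : (K.pv : ℝ) / 2 ≤ ((K.AY C.Y1 z).card : ℝ) := by
    unfold AY; rw [if_pos hz]; exact K.pv_half (C.hY1 _)
  have hp : (0:ℝ) ≤ K.pv / 2 := by positivity
  unfold AF
  split_ifs with hx
  · have hzB : z ∈ K.Bufᶜ := mem_compl.2 (fun hb => disjoint_left.1 K.dis2 (K.Buf_Hab hb) hx)
    refine le_trans ?_ (h.st.inv z hzB (by rw [mem_compl, not_not]; exact mem_union_left _ hz))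
    exact mul_le_mul (X.pow_dg _ _) hY hp (pow_nonneg X.l_pos.le _)
  · have := lD_le (X := X)
    nlinarith

theorem xr_Hre (q : X.PR) (k : Fin K.s) {z : W} (hz : z ∈ bu_B2 X.H (K.xr q k)) : z ∈ K.Hre := K.wR_sub _ hz
theorem sr_Hre (i : Fin r) (k : Fin K.s) {z : W} (hz : z ∈ bu_B2 X.H (K.sr i k)) : z ∈ K.Hre := K.wR_sub _ hz

theorem pr_cl {q : X.PR} {k : Fin K.s} {w : W} (h : w ∈ ({K.xr q k, K.yr q k} : Finset W)) :
    w ∈ bu_cl X.H {K.xr q k} := pair_sub_cl (K.xr_adj q k) h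

noncomputable def EP : Finset W :=
  (univ : Finset (X.PR × Fin K.s)).biUnion (fun t => {K.xr t.1 t.2, K.yr t.1 t.2})
noncomputable def EG : Finset W :=
  (univ : Finset (Fin r × Fin K.s)).biUnion (fun t => {K.sr t.1 t.2})

theorem EP_Hre : K.EP ⊆ K.Hre := by
  intro w hw
  obtain ⟨t, -, h⟩ := mem_biUnion.1 hw
  exact K.wR_sub _ (cl_sub_B2 _ (K.pr_cl h))

theorem EG_Hre : K.EG ⊆ K.Hre := by
  intro w hw
  obtain ⟨t, -, h⟩ := mem_biUnion.1 hw
  rw [mem_singleton] at h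
  rw [h]; exact K.wR_sub _ (self_B2 (X := X) _)

set_option maxHeartbeats 1600000 in
theorem stageF1 [Nonempty V] (C : K.Cfg) {ρE : W → V} (h : K.Good C K.LSᶜ ρE)
    (hI : C.I0 ⊆ K.LSᶜ.image ρE) (hBV : C.BV ⊆ K.LSᶜ.image ρE)
    (Lf : Fin r → Finset V) (hLf : ∀ i, Lf i = X.Vc i ∩ (C.Y0 ∪ C.Y1 ∪ K.LSᶜ.image ρE)ᶜ)
    (hLc : ∀ i, (Lf i).card = K.s)
    (Lg : X.PR → Finset V) (Cd : Finset V) (hCd : C.BC ⊆ Cd) (hLg : ∀ q, Lg q = X.Vq q ∩ (C.B0 ∪ C.B1 ∪ Cd)ᶜ)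
    (hLgc : ∀ q, (Lg q).card = K.s) :
    ∃ ρ, X.St (K.AF C ρE) (K.PB C.B1) (K.Hre ∪ K.Xp) K.SE2 (K.Hre ∪ K.Xp) ρ ∧
      (∀ w ∈ K.Hre ∪ K.Xp, ρ w ∈ C.Y1 ∨ ρ w ∈ Lf (X.φ w)) ∧
      (∀ i, ∀ v ∈ Lf i, v ∈ (K.Hre ∪ K.Xp).image ρ) ∧
      (∀ w ∈ K.Xp, ρ w ∈ K.AF C ρE w) ∧
      X.Col ρ K.PRp (univ.biUnion Lg) := by
  have hl := X.l_pos
  have he0 := X.e0_pos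
  have hlD := lD_pos (X := X)
  have hlD1 := lD_le (X := X)
  have hk8 := K.k8
  have hDe : 0 ≤ X.Δ * X.e0 := by positivity
  have hNre := K.Nre_nn
  have hpv : (0:ℝ) ≤ K.pv := by positivity
  have hl3 : X.l ^ (3 * X.Δ) = X.l ^ X.Δ * (X.l ^ X.Δ * X.l ^ X.Δ) := by
    rw [← pow_add, ← pow_add]; congr 1; ring
  have hl3le := l3_le (X := X)
  have hl3p : 0 < X.l ^ (3 * X.Δ) := pow_pos hl _
  have hPRpos : 0 < (K.pv : ℝ) := by
    by_contra hc
    have : (K.pv : ℝ) = 0 := le_antisymm (not_lt.1 hc) hpv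
    rw [this] at hk8
    simp only [mul_zero, zero_div] at hk8
    linarith
  have hHrecard : (K.Hre.card : ℝ) ≤ K.Nre := by
    have := K.n_re
    have h0 : (0:ℝ) ≤ K.Xp.card := by positivity
    linarith
  have hAbig : ∀ z ∈ K.Hre ∪ K.Xp, X.e0 ≤ X.l ^ (2 * X.Δ) * ((K.AF C ρE z).card : ℝ) := by
    intro z hz
    have h1 := mul_le_mul_of_nonneg_left (K.AF_big C h hz) (pow_nonneg hl.le (2 * X.Δ))
    refine le_trans ?_ h1
    refine K.e0_pv.trans ?_
    rw [← mul_assoc, ← pow_add, show 2 * X.Δ + X.Δ = 3 * X.Δ by ring]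
    have : X.l ^ (3 * X.Δ) * X.l ≤ X.l ^ (3 * X.Δ) := mul_le_of_le_one_right hl3p.le X.l_le_one
    have := mul_le_mul_of_nonneg_right this hpv
    have h0 : 0 ≤ X.l ^ (3 * X.Δ) * K.pv := by positivity
    linarith
  obtain ⟨vv, vv1, vv2, vv3⟩ := bu_enum Lf K.s
    (fun i j hij => by rw [hLf, hLf]; exact (X.vc_disj i j hij).mono inter_subset_left inter_subset_left) hLc
  obtain ⟨cc, cc1, cc2, cc3⟩ := bu_enum Lg K.s
    (fun i j hij => by rw [hLg, hLg]; exact (X.Vq_disj hij).mono inter_subset_left inter_subset_left) hLgc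
  have hB2dis : ∀ t t', t ≠ t' → ∀ w ∈ bu_B2 X.H (K.wR t), w ∉ bu_B2 X.H (K.wR t') :=
    fun t t' ht w hw hw' => disjoint_left.1 (K.wR_dis t t' ht) hw hw'
  have hS0 : X.St (K.AF C ρE) (K.PB C.B1) (K.Hre ∪ K.Xp) K.SE2 ∅ ρE := by
    refine ⟨by simp, by simp, by simp, ?_⟩
    intro z _ _
    simp [cand, dg]
  -- pairs
  obtain ⟨ρ1, p1, p2, p3⟩ := bu_seq (V := V) (W := W) (γ := X.PR × Fin K.s)
    (fun D ρ => X.St (K.AF C ρE) (K.PB C.B1) (K.Hre ∪ K.Xp) K.SE2 D ρ)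
    (fun t => {K.xr t.1 t.2, K.yr t.1 t.2})
    (fun t ρ => ({ρ (K.xr t.1 t.2), ρ (K.yr t.1 t.2), cc t.1 t.2} : Finset V) ∈ X.E ∧
      ρ (K.xr t.1 t.2) ∈ C.Y1 ∧ ρ (K.yr t.1 t.2) ∈ C.Y1)
    (by
      intro t ρ ρ' h hq
      rw [h _ (mem_insert_self _ _), h _ (mem_insert_of_mem (mem_singleton_self _))] at hq
      exact hq) ∅ ρE hS0 univ
    (by
      intro g _ g' _ hgg
      rw [disjoint_left]
      intro w hw hw'
      exact hB2dis (Sum.inr g) (Sum.inr g') (by simpa using hgg) w (cl_sub_B2 _ (K.pr_cl hw)) (cl_sub_B2 _ (K.pr_cl hw')))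
    (by
      intro G' _ g _ hg ρ hSt _ _
      obtain ⟨hφx, hφy, hadj⟩ := K.c_prr g.1 g.2
      have hDf : Disjoint (∅ ∪ G'.biUnion (fun t => ({K.xr t.1 t.2, K.yr t.1 t.2} : Finset W))) (bu_B2 X.H (K.xr g.1 g.2)) := by
        rw [empty_union, disjoint_biUnion_left]
        intro g' hg'
        rw [disjoint_left]
        intro w hw hw'
        exact hB2dis (Sum.inr g') (Sum.inr g) (by
          intro e
          have e' : g' = g := by simpa using e
          exact hg (e' ▸ hg')) w (cl_sub_B2 _ (K.pr_cl hw)) hw'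
      have hDsub : ∅ ∪ G'.biUnion (fun t => ({K.xr t.1 t.2, K.yr t.1 t.2} : Finset W)) ⊆ K.Hre := by
        rw [empty_union]
        refine (biUnion_subset_biUnion_of_subset_left _ (subset_univ _)).trans ?_
        exact K.EP_Hre
      have hDc : ((∅ ∪ G'.biUnion (fun t => ({K.xr t.1 t.2, K.yr t.1 t.2} : Finset W))).card : ℝ) ≤ K.Nre :=
        (Nat.cast_le.2 (card_le_card hDsub)).trans hHrecard
      have hxcl := self_cl (X := X) (K.xr g.1 g.2)
      have hycl := nb_cl (K.xr_adj g.1 g.2)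
      have ha1 := K.pv_half (C.hY1 g.1.1.1)
      have ha2 := K.pv_half (C.hY1 g.1.1.2)
      have hc := cc1 g.1 g.2
      rw [hLg, mem_inter, mem_compl, mem_union, not_or] at hc
      have hgc := C.gc g.1 _ hc.1 hc.2.1 (fun hh => hc.2.2 (hCd hh))
      obtain ⟨ρ', q1, q2, q3, q4, q5, -, -, -, -⟩ := hSt.pair (K.PB_symm C.B1) (K.xr g.1 g.2) (K.yr g.1 g.2) hadj
        (Or.inl (mem_union_right _ (mem_image.2 ⟨g, mem_univ _, rfl⟩)))
        (fresh_not hDf hxcl) (fresh_not hDf hycl) (fresh_dg hDf hxcl) (fresh_dg hDf hycl)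
        (X.Vc g.1.1.1 ∩ C.Y1) (X.Vc g.1.1.2 ∩ C.Y1) ∅
        (by rw [show X.φ (K.xr g.1 g.2) = g.1.1.1 from hφx]; exact inter_subset_left)
        (by rw [hφy]; exact inter_subset_left)
        (fun u v => ({u, v, cc g.1 g.2} : Finset V) ∈ X.E)
        (fun w _ z ha => K.PB_big C.hB1 ha)
        (by
          intro z hz
          have hzH : z ∈ K.Hre := by
            rcases hz with hz | hz
            · exact K.xr_Hre g.1 g.2 (cl_mem_B2 hxcl hz)
            · exact K.xr_Hre g.1 g.2 (cl_mem_B2 hycl hz)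
          exact ⟨mem_union_left _ hzH, K.AF_sub _ _ _, hAbig z (mem_union_left _ hzH)⟩)
        (X.l * K.pv / 8)
        (by
          rw [card_empty, Nat.cast_zero]
          have h1 : X.l ^ (3 * X.Δ) * (X.l * K.pv) ≤ X.l ^ X.Δ * (X.l * K.pv) :=
            mul_le_mul_of_nonneg_right hl3le (by positivity)
          have h2 : 0 ≤ X.l ^ X.Δ * (X.l * K.pv) := by positivity
          linarith)
        (by
          refine lt_of_lt_of_le ?_ hgc
          set a := ((X.Vc g.1.1.1 ∩ C.Y1).card : ℝ)
          set b := ((X.Vc g.1.1.2 ∩ C.Y1).card : ℝ)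
          have h1 : K.pv / 4 * (a + b) ≤ a * b := by
            nlinarith [mul_nonneg (sub_nonneg.2 ha1) (sub_nonneg.2 ha2), mul_nonneg hpv (sub_nonneg.2 ha1), mul_nonneg hpv (sub_nonneg.2 ha2)]
          have h2 : 0 < K.pv / 8 * (a + b) := by
            have : 0 < a + b := by linarith
            positivity
          have h3 : K.pv / 8 * (a + b) < a * b := by linarith
          have h4 := mul_lt_mul_of_pos_left h3 hl
          calc _ = X.l * (K.pv / 8 * (a + b)) := by ring
            _ < _ := h4)
      refine ⟨ρ', q1, ?_, q5, (mem_inter.1 q3).2, (mem_inter.1 q4).2⟩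
      intro y hy
      rw [mem_insert, mem_singleton, not_or] at hy
      exact q2 y hy.1 hy.2)
  rw [empty_union] at p1
  have p1' : X.St (K.AF C ρE) (K.PB C.B1) (K.Hre ∪ K.Xp) K.SE2 K.EP ρ1 := p1
  have hEPY : ∀ w ∈ K.EP, ρ1 w ∈ C.Y1 := by
    intro w hw
    obtain ⟨t, -, hw⟩ := mem_biUnion.1 hw
    have := p3 t (mem_univ _)
    rw [mem_insert, mem_singleton] at hw
    rcases hw with e | e
    · rw [e]; exact this.2.1
    · rw [e]; exact this.2.2
  have hEPG : ∀ t : Fin r × Fin K.s, Disjoint K.EP (bu_B2 X.H (K.sr t.1 t.2)) := by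
    intro t
    rw [disjoint_left]
    intro w hw hw'
    obtain ⟨t', -, hw⟩ := mem_biUnion.1 hw
    exact hB2dis (Sum.inr t') (Sum.inl t) (by simp) w (cl_sub_B2 _ (K.pr_cl hw)) hw'
  have hvL : ∀ i k, vv i k ∈ X.Vc i ∧ vv i k ∉ C.Y0 ∪ C.Y1 ∧ vv i k ∉ K.LSᶜ.image ρE := by
    intro i k
    have := vv1 i k
    rw [hLf, mem_inter, mem_compl, mem_union, not_or] at this
    exact this
  -- singles
  obtain ⟨ρ2, s1, s2, s3⟩ := bu_seq (V := V) (W := W) (γ := Fin r × Fin K.s)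
    (fun D ρ => X.St (K.AF C ρE) (K.PB C.B1) (K.Hre ∪ K.Xp) K.SE2 D ρ)
    (fun t => {K.sr t.1 t.2})
    (fun t ρ => ρ (K.sr t.1 t.2) = vv t.1 t.2)
    (by
      intro t ρ ρ' h hq
      rw [h _ (mem_singleton_self _)] at hq
      exact hq) K.EP ρ1 p1' univ
    (by
      intro g _ g' _ hgg
      rw [disjoint_left]
      intro w hw hw'
      rw [mem_singleton] at hw hw'
      have a1 : w ∈ bu_B2 X.H (K.sr g.1 g.2) := hw.symm ▸ self_B2 (X := X) (K.sr g.1 g.2)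
      have a2 : w ∈ bu_B2 X.H (K.sr g'.1 g'.2) := hw'.symm ▸ self_B2 (X := X) (K.sr g'.1 g'.2)
      exact hB2dis (Sum.inl g) (Sum.inl g') (by simpa using hgg) w a1 a2)
    (by
      intro G' _ g _ hg ρ hSt hoff hQ
      have hcl := self_cl (X := X) (K.sr g.1 g.2)
      have hφ : X.φ (K.sr g.1 g.2) = g.1 := K.c_sr _ _
      have hne : ∀ g' ∈ G', g' ≠ g := fun g' hg' (e : g' = g) => hg (e ▸ hg')
      have hDf : Disjoint (K.EP ∪ G'.biUnion (fun t => ({K.sr t.1 t.2} : Finset W))) (bu_B2 X.H (K.sr g.1 g.2)) := by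
        rw [disjoint_union_left]
        refine ⟨hEPG g, ?_⟩
        rw [disjoint_biUnion_left]
        intro g' hg'
        rw [disjoint_left]
        intro w hw hw'
        rw [mem_singleton] at hw
        have a1 : w ∈ bu_B2 X.H (K.sr g'.1 g'.2) := hw.symm ▸ self_B2 (X := X) (K.sr g'.1 g'.2)
        exact hB2dis (Sum.inl g') (Sum.inl g) (by
          intro e
          exact hne g' hg' (by simpa using e)) w a1 hw'
      obtain ⟨hv1, hv2, hv3⟩ := hvL g.1 g.2
      obtain ⟨ρ', q1, q2, q3⟩ := hSt.single (K.PB_symm C.B1) (K.sr g.1 g.2) (vv g.1 g.2)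
        (fresh_not hDf hcl) (by rw [hφ]; exact hv1)
        (by
          intro hv
          obtain ⟨w, hw, e⟩ := mem_image.1 hv
          rcases mem_union.1 hw with hw | hw
          · have : ρ w = ρ1 w := hoff w (by
              intro hh
              obtain ⟨t, -, hh⟩ := mem_biUnion.1 hh
              rw [mem_singleton] at hh
              exact disjoint_left.1 (hEPG t) hw (hh.symm ▸ self_B2 (X := X) (K.sr t.1 t.2)))
            rw [this] at e
            exact hv2 (mem_union_right _ (e ▸ hEPY w hw))
          · obtain ⟨t, ht, hw⟩ := mem_biUnion.1 hw
            rw [mem_singleton] at hw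
            rw [hw, hQ t ht] at e
            exact hne t ht (vv2 e))
        (fresh_dg hDf hcl)
        (by
          intro z _ ha
          have hzB := cl_mem_B2 hcl ha
          have hzH := K.sr_Hre g.1 g.2 hzB
          refine ⟨fresh_dg hDf (nb_cl ha), ?_⟩
          rw [K.AF_Hre C ρE hzH]
          have hR : X.R.Adj g.1 (X.φ z) := by
            have := X.hom _ _ ha
            rwa [hφ] at this
          have hgv := C.gv g.1 (X.φ z) hR (vv g.1 g.2) hv1 hv2 (fun hh => hv3 (hI hh)) (fun hh => hv3 (hBV hh))
          have hPB : K.PB C.B1 (K.sr g.1 g.2) z = X.Vij g.1 (X.φ z) ∩ C.B1 := by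
            have hLS : K.sr g.1 g.2 ∈ K.LS :=
              mem_union_left _ (mem_union_left _ (K.sr_Hre g.1 g.2 (self_B2 (X := X) _)))
            unfold PB
            rw [if_pos (Or.inl hLS), hφ]
          rw [hPB]
          exact hgv)
      exact ⟨ρ', q1, fun y hy => q2 y (by simpa using hy), q3⟩)
  have s1' : X.St (K.AF C ρE) (K.PB C.B1) (K.Hre ∪ K.Xp) K.SE2 (K.EP ∪ K.EG) ρ2 := s1
  have hoff2 : ∀ w ∈ K.EP, ρ2 w = ρ1 w := by
    intro w hw
    refine s2 w (fun hh => ?_)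
    obtain ⟨t, -, hh⟩ := mem_biUnion.1 hh
    rw [mem_singleton] at hh
    exact disjoint_left.1 (hEPG t) hw (hh.symm ▸ self_B2 (X := X) (K.sr t.1 t.2))
  set D1 := K.EP ∪ K.EG with hD1
  have hD1H : D1 ⊆ K.Hre := union_subset K.EP_Hre K.EG_Hre
  have hD1s : D1 ⊆ K.Hre ∪ K.Xp := hD1H.trans subset_union_left
  have hTb : ∀ y ∈ (K.Hre ∪ K.Xp) \ D1, X.l ^ X.Δ * (X.l ^ X.Δ * (K.pv / 2)) ≤
      ((X.cand D1 ρ2 (K.PB C.B1) (K.AF C ρE y) y).card : ℝ) := by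
    intro y hy
    obtain ⟨h1, h2⟩ := mem_sdiff.1 hy
    refine le_trans ?_ (s1'.inv y h1 h2)
    exact mul_le_mul (X.pow_dg _ _) (K.AF_big C h h1) (by positivity) (pow_nonneg hl.le _)
  have hTb2 : ∀ y ∈ (K.Hre ∪ K.Xp) \ D1, K.Nre + X.e0 + X.Δ * X.e0 <
      X.l ^ X.Δ * ((X.cand D1 ρ2 (K.PB C.B1) (K.AF C ρE y) y).card : ℝ) := by
    intro y hy
    have h1 := mul_le_mul_of_nonneg_left (hTb y hy) hlD.le
    have h2 : X.l ^ (3 * X.Δ) * X.l * K.pv / 16 ≤ X.l ^ X.Δ * (X.l ^ X.Δ * (X.l ^ X.Δ * (K.pv / 2))) := by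
      have e : X.l ^ X.Δ * (X.l ^ X.Δ * (X.l ^ X.Δ * (K.pv / 2))) = X.l ^ (3 * X.Δ) * K.pv / 2 := by rw [hl3]; ring
      rw [e]
      have : X.l ^ (3 * X.Δ) * X.l ≤ X.l ^ (3 * X.Δ) := mul_le_of_le_one_right hl3p.le X.l_le_one
      have := mul_le_mul_of_nonneg_right this hpv
      have h0 : 0 ≤ X.l ^ (3 * X.Δ) * K.pv := by positivity
      linarith
    linarith
  obtain ⟨ρ, g1, g2, g3, -, -⟩ := s1'.greedy (Q := Unit) (K.PB_symm C.B1) ((K.Hre ∪ K.Xp) \ D1) disjoint_sdiff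
    (fun y => X.cand D1 ρ2 (K.PB C.B1) (K.AF C ρE y) y) ∅ (fun z _ => X.Vc (X.φ z))
    (fun y _ z ha => K.PB_big C.hB1 ha)
    (fun y _ => (X.cand_subset _ _ _ _ _).trans (K.AF_sub _ _ _))
    (fun w hw y hy ha _ v hv => (mem_filter.1 hv).2 w hw ha)
    (by
      intro y hy
      have := hTb2 y hy
      linarith)
    (fun y _ z hz _ => ⟨K.AF_sub _ _ _, hAbig z hz⟩)
    (fun y _ z _ _ _ _ => ⟨Subset.refl _, K.e0_Vc1 _⟩)
    (fun y _ z _ _ => K.e0_Vc1 _)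
    (by
      intro y hy
      have := hTb2 y hy
      have h2 : (((K.Hre ∪ K.Xp) \ D1).card : ℝ) + D1.card ≤ K.Nre := by
        refine le_trans ?_ K.n_re
        have : ((K.Hre ∪ K.Xp) \ D1).card + D1.card ≤ K.Hre.card + K.Xp.card := by
          rw [card_sdiff_add_card_eq_card hD1s]
          exact card_union_le _ _
        exact_mod_cast this
      simp only [Fintype.card_unit, Nat.cast_one, mul_one, card_empty, Nat.cast_zero, zero_add]
      linarith)
  rw [union_sdiff_of_subset hD1s] at g1
  have hρD : ∀ w ∈ D1, ρ w = ρ2 w := fun w hw => g2 w (fun hh => (mem_sdiff.1 hh).2 hw)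
  have hρP : ∀ w ∈ K.EP, ρ w = ρ1 w := fun w hw => by
    rw [hρD w (mem_union_left _ hw), hoff2 w hw]
  have hsrEG : ∀ i k, K.sr i k ∈ K.EG := fun i k =>
    mem_biUnion.2 ⟨(i, k), mem_univ _, mem_singleton_self _⟩
  have hρG : ∀ i k, ρ (K.sr i k) = vv i k := by
    intro i k
    rw [hρD _ (mem_union_right _ (hsrEG i k))]
    exact s3 (i, k) (mem_univ _)
  refine ⟨ρ, g1, ?_, ?_, ?_, ?_⟩
  · intro w hw
    by_cases hwD : w ∈ D1
    · rcases mem_union.1 hwD with h1 | h1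
      · left; rw [hρP w h1]; exact hEPY w h1
      · right
        obtain ⟨⟨i, k⟩, -, e⟩ := mem_biUnion.1 h1
        rw [mem_singleton] at e
        rw [e, hρG]
        have : X.φ (K.sr i k) = i := K.c_sr _ _
        rw [this]
        exact vv1 i k
    · left
      exact K.AF_Y1 C ρE hw (X.cand_subset _ _ _ _ _ (g3 w (mem_sdiff.2 ⟨hw, hwD⟩)).1)
  · intro i v hv
    obtain ⟨k, hk⟩ := vv3 i v hv
    exact mem_image.2 ⟨K.sr i k, mem_union_left _ (K.EG_Hre (hsrEG i k)), by rw [hρG, hk]⟩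
  · intro w hw
    have hwD : w ∉ D1 := fun hh => disjoint_left.1 K.dis4 (hD1H hh) hw
    exact X.cand_subset _ _ _ _ _ (g3 w (mem_sdiff.2 ⟨mem_union_right _ hw, hwD⟩)).1
  · have hcol : X.Col ρ (univ.image (fun t : X.PR × Fin K.s => s(K.xr t.1 t.2, K.yr t.1 t.2)))
        (univ.image (fun t : X.PR × Fin K.s => cc t.1 t.2)) := by
      refine Col.of_fam (fun t : X.PR × Fin K.s => s(K.xr t.1 t.2, K.yr t.1 t.2)) (fun t => cc t.1 t.2) K.pr_inj cc2 ?_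
      intro t
      have hm : ∀ w ∈ ({K.xr t.1 t.2, K.yr t.1 t.2} : Finset W), w ∈ K.EP := fun w hw =>
        mem_biUnion.2 ⟨t, mem_univ _, hw⟩
      obtain ⟨hφx, hφy, hadj⟩ := K.c_prr t.1 t.2
      have hc := cc1 t.1 t.2
      rw [hLg, mem_inter] at hc
      refine X.mem_lst.2 ⟨?_, ?_⟩
      · rw [show X.φ (K.xr t.1 t.2) = t.1.1.1 from hφx, hφy]; exact hc.1
      · rw [hρP _ (hm _ (by simp)), hρP _ (hm _ (by simp))]
        exact (p3 t (mem_univ _)).1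
    have e : (univ : Finset (X.PR × Fin K.s)).image (fun t => cc t.1 t.2) = univ.biUnion Lg := by
      ext c
      rw [mem_image, mem_biUnion]
      constructor
      · rintro ⟨t, -, rfl⟩
        exact ⟨t.1, mem_univ _, cc1 _ _⟩
      · rintro ⟨q, -, hc⟩
        obtain ⟨k, hk⟩ := cc3 q c hc
        exact ⟨(q, k), mem_univ _, hk⟩
    rw [e] at hcol
    exact hcol

end Pre
end BUCtx

namespace BUCtx
variable {r : ℕ} {V W : Type} [Fintype V] [Fintype W] {X : BUCtx r V W}
namespace Pre
variable (K : Pre X)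

theorem oth_compl : K.oth K.LSᶜ ∪ K.PRp ∪ (K.late \ K.PRp) ∪ K.SF = X.edges := by
  ext e
  induction e using Sym2.ind with
  | _ x y =>
    have hPR := @PRp_late r V W _ _ X K s(x, y)
    have hSF := @SF_sub r V W _ _ X K s(x, y)
    have hls : s(x, y) ∈ K.late → s(x, y) ∈ X.edges := fun h => X.tch_sub _ h
    simp only [mem_union, mem_sdiff, K.mem_oth, mem_compl]
    constructor
    · rintro (((h | h) | h) | h)
      · exact X.mem_edges.2 h.1
      · exact hls (hPR h)
      · exact hls h.1
      · exact hSF h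
    · intro h
      have ha := X.mem_edges.1 h
      by_cases h1 : s(x, y) ∈ K.late
      · by_cases h2 : s(x, y) ∈ K.PRp
        · exact Or.inl (Or.inl (Or.inr h2))
        · exact Or.inl (Or.inr ⟨h1, h2⟩)
      · rw [K.mem_late ha, not_or] at h1
        by_cases h2 : s(x, y) ∈ K.SF
        · exact Or.inr h2
        · exact Or.inl (Or.inl (Or.inl ⟨ha, Or.inl h1.1, h2, h1.1, h1.2⟩))

theorem late_SE {e : Sym2 W} (h : e ∈ K.late) (hn : e ∉ K.PRp) : e ∉ K.SE2 := by
  rintro (h' | h')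
  · rcases mem_union.1 h' with h' | h'
    · rcases mem_union.1 h' with h' | h'
      · exact K.SF_late h' h
      · have := K.PBp_oth h'
        exact (mem_sdiff.1 this).2 (mem_union_right _ h)
    · exact hn h'
  · exact h' h

theorem LSc_cls (i : Fin r) : (K.LSᶜ.filter (fun y => X.φ y = i)).card + (K.LS.filter (fun y => X.φ y = i)).card
    = ((univ : Finset W).filter (fun y => X.φ y = i)).card := by
  rw [← card_union_of_disjoint, ← filter_union]
  · congr 2
    rw [union_comm, union_compl]
  · exact disjoint_filter_filter disjoint_compl_left

theorem Eq_split (q : X.PR) : (X.Eq q ∩ K.oth K.LSᶜ).card + (X.Eq q ∩ K.SF).card + (X.Eq q ∩ K.late).card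
    = (X.Eq q).card := by
  have h1 : Disjoint (K.oth K.LSᶜ) K.SF := by
    rw [disjoint_left]; intro e he hs
    exact (mem_sdiff.1 he).2 (mem_union_left _ hs)
  have h2 : Disjoint (K.oth K.LSᶜ ∪ K.SF) K.late := by
    rw [disjoint_left]; intro e he hs
    rcases mem_union.1 he with he | he
    · exact (mem_sdiff.1 he).2 (mem_union_right _ hs)
    · exact K.SF_late he hs
  rw [← card_union_of_disjoint (h1.mono inter_subset_right inter_subset_right), ← inter_union_distrib_left,
    ← card_union_of_disjoint (h2.mono inter_subset_right inter_subset_right), ← inter_union_distrib_left]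
  congr 1
  rw [inter_eq_left]
  intro e he
  have := X.Eq_sub q he
  rw [← K.oth_compl] at this
  simp only [mem_union, mem_sdiff] at this ⊢
  have := @PRp_late r V W _ _ X K e
  tauto

set_option maxHeartbeats 1600000 in
theorem stageF [Nonempty V] (C : K.Cfg) {ρE : W → V} (h : K.Good C K.LSᶜ ρE)
    (hI : C.I0 ⊆ K.LSᶜ.image ρE) (hBV : C.BV ⊆ K.LSᶜ.image ρE)
    (habs : ∀ ρ' : W → V, (∀ y ∈ K.DB, ρ' y = ρE y) → ∀ U ⊆ C.Y1, (∀ i, (X.Vc i ∩ U).card = K.pv) →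
          ∃ g : W → V, Set.InjOn g K.Buf ∧ ∀ b ∈ K.Buf, g b ∈ X.Vc (X.φ b) ∧ g b ∈ C.Y0 ∪ U ∧
            ∀ y, X.H.Adj y b → X.Th (K.PB C.B1 y b) (ρ' y) (g b)) :
    ∃ ρ : W → V, Function.Injective ρ ∧ (∀ x, ρ x ∈ X.Vc (X.φ x)) ∧ (∀ y ∈ K.LSᶜ, ρ y = ρE y) ∧
      (∀ x y, X.H.Adj x y → s(x, y) ∈ K.late → s(x, y) ∉ K.PRp → X.Th (K.PB C.B1 x y) (ρ x) (ρ y)) ∧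
      ∃ Cd CL, X.Col ρ (K.oth K.LSᶜ) Cd ∧ X.Col ρ K.PRp CL ∧ Disjoint Cd CL ∧
        Disjoint (Cd ∪ CL) (C.B0 ∪ C.B1) ∧ ∀ q, (X.Eq q ∩ K.PRp).card = K.s := by
  obtain ⟨Cd, hc1, hc2, hc3⟩ := h.col
  obtain ⟨ρF, f1, f2, f3, f4, f5⟩ := K.stageF1 C h hI hBV
    (fun i => X.Vc i ∩ (C.Y0 ∪ C.Y1 ∪ K.LSᶜ.image ρE)ᶜ) (fun i => rfl)
    (fun i => by
      have h1 := K.vert_count C h.st.inj h.st.mem h.dY i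
      have h2 := K.LSc_cls i
      omega)
    (fun q => X.Vq q ∩ (C.B0 ∪ C.B1 ∪ Cd)ᶜ) Cd hc2 (fun q => rfl)
    (fun q => by
      have h1 := K.col_count C hc1 (K.oth_sub _) hc3 q
      have h2 := K.Eq_split q
      omega)
  have hLgc : ∀ q, (X.Vq q ∩ (C.B0 ∪ C.B1 ∪ Cd)ᶜ).card = K.s := fun q => by
      have h1 := K.col_count C hc1 (K.oth_sub _) hc3 q
      have h2 := K.Eq_split q
      omega
  have hLfc : ∀ i, (X.Vc i ∩ (C.Y0 ∪ C.Y1 ∪ K.LSᶜ.image ρE)ᶜ).card = K.s := fun i => by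
      have h1 := K.vert_count C h.st.inj h.st.mem h.dY i
      have h2 := K.LSc_cls i
      omega
  set T := K.Hre ∪ K.Xp with hT
  have hTLS : T ⊆ K.LS := subset_union_left
  have hTB : Disjoint T K.Buf := by
    rw [disjoint_left]
    intro w hw hb
    have hb' := K.Buf_Hab hb
    rcases mem_union.1 hw with hw | hw
    · exact disjoint_left.1 K.dis1 hb' hw
    · exact disjoint_left.1 K.dis2 hb' hw
  have hnewF : ∀ y ∈ T, ρF y ∉ K.LSᶜ.image ρE := by
    intro y hy hm
    rcases f2 y hy with h' | h'
    · exact disjoint_left.1 h.dY hm (mem_union_right _ h')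
    · exact (mem_compl.1 (mem_inter.1 h').2) (mem_union_right _ hm)
  have hY0F : ∀ y ∈ T, ρF y ∉ C.Y0 := by
    intro y hy hm
    rcases f2 y hy with h' | h'
    · exact disjoint_left.1 C.dY hm h'
    · exact (mem_compl.1 (mem_inter.1 h').2) (mem_union_left _ (mem_union_left _ hm))
  have hdis : Disjoint K.LSᶜ T := disjoint_left.2 fun w hw hw' => (mem_compl.1 hw) (hTLS hw')
  have hG := h.st.extend (K.PB_symm C.B1) hdis f1.inj f1.mem hnewF f1.thk
    (by
      intro y hy z hz ha hse
      have hyL := mem_compl.1 hy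
      rcases mem_union.1 hz with hz' | hz'
      · exfalso
        apply hyL
        exact hTLS (mem_union.2 (K.ere z y ha.symm hz'))
      · have := f4 z hz'
        unfold AF at this
        rw [if_pos hz'] at this
        exact (mem_filter.1 this).2 y hy ha)
    (by
      intro z hz h1 h2
      exfalso
      rw [mem_compl] at hz h1
      have h1' := not_not.1 h1
      rcases mem_union.1 h1' with h' | h'
      · exact h2 h'
      · exact hz h')
  set ρG := mix T ρE ρF with hρG
  have hGE : ∀ y ∈ K.LSᶜ, ρG y = ρE y := fun y hy => mix_out (disjoint_left.1 hdis hy)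
  have hGF : ∀ y ∈ T, ρG y = ρF y := fun y hy => mix_in hy
  have hDBL : ∀ y ∈ K.DB, y ∈ K.LSᶜ := fun y hy =>
    mem_compl.2 (K.Hab_LS (K.DB_Hab hy) (K.DB_Buf hy))
  obtain ⟨g, g1, g2⟩ := habs ρG (fun y hy => hGE y (hDBL y hy)) (C.Y1 \ T.image ρF) sdiff_subset
    (by
      intro i
      have e1 := X.image_card f1.inj f1.mem i
      have e2 : (T.filter (fun y => X.φ y = i)).card = K.lc i := rfl
      have e3 := C.hY1 i
      have e4 := hLfc i
      have e5 : (X.Vc i ∩ T.image ρF).card = (X.Vc i ∩ T.image ρF ∩ C.Y1).card +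
          (X.Vc i ∩ (C.Y0 ∪ C.Y1 ∪ K.LSᶜ.image ρE)ᶜ).card := by
        rw [← card_union_of_disjoint]
        · congr 1
          ext v
          simp only [mem_union, mem_inter]
          constructor
          · rintro ⟨hv, hv2⟩
            obtain ⟨y, hy, rfl⟩ := mem_image.1 hv2
            rcases f2 y hy with h' | h'
            · exact Or.inl ⟨⟨hv, hv2⟩, h'⟩
            · refine Or.inr ⟨hv, ?_⟩
              exact (mem_inter.1 h').2
          · rintro (h' | h')
            · exact h'.1
            · exact ⟨h'.1, f3 i v (mem_inter.2 h')⟩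
        · rw [disjoint_left]
          intro v hv hv'
          exact (mem_compl.1 (mem_inter.1 hv').2) (mem_union_left _ (mem_union_right _ (mem_inter.1 hv).2))
      have e6 : (X.Vc i ∩ (C.Y1 \ T.image ρF)).card + (X.Vc i ∩ T.image ρF ∩ C.Y1).card = (X.Vc i ∩ C.Y1).card := by
        rw [← card_union_of_disjoint]
        · congr 1
          ext v
          simp only [mem_union, mem_inter, mem_sdiff]
          tauto
        · rw [disjoint_left]
          intro v hv hv'
          exact (mem_sdiff.1 (mem_inter.1 hv).2).2 (mem_inter.1 (mem_inter.1 hv').1).2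
      omega)
  set ρ := mix K.Buf ρG g with hρ
  have hO : ∀ y, y ∉ K.Buf → ρ y = ρG y := fun y hy => mix_out hy
  have hB : ∀ y ∈ K.Buf, ρ y = g y := fun y hy => mix_in hy
  have hcov : ∀ y, y ∉ K.Buf → y ∈ K.LSᶜ ∪ T := by
    intro y hy
    by_cases h' : y ∈ K.LS
    · exact mem_union_right _ ((mem_union.1 h').resolve_right hy)
    · exact mem_union_left _ (mem_compl.2 h')
  have hcross : ∀ x, x ∉ K.Buf → ∀ b ∈ K.Buf, ρG x ≠ g b := by
    intro x hx b hb e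
    have h3 := (g2 b hb).2.1
    rw [← e] at h3
    rcases mem_union.1 (hcov x hx) with h' | h'
    · rw [hGE x h'] at h3
      have hm : ρE x ∈ K.LSᶜ.image ρE := mem_image_of_mem _ h'
      refine disjoint_left.1 h.dY hm ?_
      rcases mem_union.1 h3 with h3 | h3
      · exact mem_union_left _ h3
      · exact mem_union_right _ (mem_sdiff.1 h3).1
    · rw [hGF x h'] at h3
      rcases mem_union.1 h3 with h3 | h3
      · exact hY0F x h' h3
      · exact (mem_sdiff.1 h3).2 (mem_image_of_mem _ h')
  have hLB : ∀ y ∈ K.LSᶜ, y ∉ K.Buf := fun y hy hb => (mem_compl.1 hy) (mem_union_right _ hb)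
  refine ⟨ρ, ?_, ?_, ?_, ?_, Cd, univ.biUnion (fun q => X.Vq q ∩ (C.B0 ∪ C.B1 ∪ Cd)ᶜ), ?_, ?_, ?_, ?_, ?_⟩
  · intro x y hxy
    by_cases hx : x ∈ K.Buf <;> by_cases hy : y ∈ K.Buf
    · rw [hB x hx, hB y hy] at hxy; exact g1 hx hy hxy
    · rw [hB x hx, hO y hy] at hxy; exact absurd hxy.symm (hcross y hy x hx)
    · rw [hO x hx, hB y hy] at hxy; exact absurd hxy (hcross x hx y hy)
    · rw [hO x hx, hO y hy] at hxy; exact hG.inj (hcov x hx) (hcov y hy) hxy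
  · intro x
    by_cases hx : x ∈ K.Buf
    · rw [hB x hx]; exact (g2 x hx).1
    · rw [hO x hx]; exact hG.mem x (hcov x hx)
  · intro y hy
    rw [hO y (hLB y hy), hGE y hy]
  · intro x y ha hl hp
    have hse := K.late_SE hl hp
    by_cases hy : y ∈ K.Buf
    · have hx : x ∉ K.Buf := K.DN_Buf (K.mem_DN.2 ⟨y, hy, ha.symm⟩)
      rw [hB y hy, hO x hx]; exact (g2 y hy).2.2 x ha
    · by_cases hx : x ∈ K.Buf
      · rw [hB x hx, hO y hy, K.PB_symm]; exact X.Th_comm ((g2 x hx).2.2 y ha.symm)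
      · rw [hO x hx, hO y hy]; exact hG.thk x (hcov x hx) y (hcov y hy) ha hse
  · refine hc1.congr ?_
    intro e he x hx
    induction e using Sym2.ind with
    | _ a b =>
      have hh := K.mem_oth.1 he
      have hxL : x ∈ K.LSᶜ := by
        rw [mem_compl]
        rcases Sym2.mem_iff.1 hx with rfl | rfl
        · exact hh.2.2.2.1
        · exact hh.2.2.2.2
      rw [hO x (hLB x hxL), hGE x hxL]
  · refine f5.congr ?_
    intro e he x hx
    have hxT : x ∈ T := by
      obtain ⟨⟨q, k⟩, -, rfl⟩ := mem_image.1 he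
      have hxr : K.xr q k ∈ K.Hre := K.wR_sub _ (self_B2 (X := X) (K.xr q k))
      rcases Sym2.mem_iff.1 hx with rfl | rfl
      · exact mem_union_left _ hxr
      · exact mem_union.2 (K.ere _ _ (K.xr_adj q k) hxr)
    rw [hO x (disjoint_left.1 hTB hxT), hGF x hxT]
  · rw [disjoint_left]
    intro c hc hc'
    obtain ⟨q, -, hq⟩ := mem_biUnion.1 hc'
    exact (mem_compl.1 (mem_inter.1 hq).2) (mem_union_right _ hc)
  · rw [disjoint_left]
    intro c hc hc'
    rcases mem_union.1 hc with hc | hc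
    · exact disjoint_left.1 hc3 hc hc'
    · obtain ⟨q, -, hq⟩ := mem_biUnion.1 hc
      exact (mem_compl.1 (mem_inter.1 hq).2) (mem_union_left _ hc')
  · intro q
    rw [← f5.card_q (K.PRp_late.trans (X.tch_sub _)) q, ← hLgc q]
    congr 1
    ext c
    simp only [mem_inter, mem_biUnion, mem_univ, true_and]
    constructor
    · rintro ⟨h1, q', h2, h3⟩
      exact ⟨h1, h3⟩
    · rintro ⟨h1, h3⟩
      exact ⟨h1, q, h1, h3⟩

set_option maxHeartbeats 1600000 in
theorem main [Nonempty V] : ∃ ρ : W → V, Function.Injective ρ ∧ (∀ x, ρ x ∈ X.Vc (X.φ x)) ∧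
    (∀ x ∈ K.Us, ρ x ∈ K.Ts x) ∧ ∃ C, X.Col ρ X.edges C := by
  obtain ⟨ρA, hA, B0, B1, a1, a2, a3, a4⟩ := K.stageA
  have hB1 : K.B1ok B1 := a3
  obtain ⟨ρB, hB, b1, Y0, Y1, b2, b3, b4, b5, b6, b7⟩ := K.stageB hB1 hA
  have hIc : ((K.DB.image ρB).card : ℝ) ≤ K.Nab :=
    (Nat.cast_le.2 (card_image_le.trans (card_le_card K.DB_Hab))).trans K.n_ab
  obtain ⟨C, rfl, rfl, rfl, rfl, hCI⟩ := K.exists_cfg a1 a2 hB1 b2 b3 b4 b5 b6 hIc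
  obtain ⟨ρC, hC, c1, c2, c3, c4⟩ := K.stageC C hB hCI.symm
  obtain ⟨ρD, hD, d1, d2⟩ := K.stageD C hC c2 c4
  obtain ⟨ρE, hE, e1⟩ := K.stageE C hD
  have hDBC : K.DB ⊆ K.DC := by
    intro y hy
    exact mem_union_left _ (mem_union_left _ hy)
  have hDDL : K.DD ⊆ K.LSᶜ := fun y hy => mem_compl.2 (K.DD_LS hy)
  have hEC : ∀ y ∈ K.DC, ρE y = ρC y := fun y hy => (e1 y (K.DC_DD hy)).trans (d1 y hy)
  have hEB : ∀ y ∈ K.DB, ρE y = ρB y := fun y hy => (hEC y (hDBC hy)).trans (c1 y hy)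
  obtain ⟨ρ, r1, r2, r3, r4, Cd, CL, r5, r6, r7, r8, r9⟩ := K.stageF C hE
    (by
      rw [hCI]
      intro v hv
      obtain ⟨y, hy, rfl⟩ := mem_image.1 hv
      rw [← hEB y hy]
      exact mem_image_of_mem _ (hDDL (K.DC_DD (hDBC hy))))
    (by
      intro v hv
      obtain ⟨y, hy, rfl⟩ := mem_image.1 (c3 hv)
      rw [← hEC y hy]
      exact mem_image_of_mem _ (hDDL (K.DC_DD hy)))
    (fun ρ' h => b7 ρ' (fun y hy => (h y hy).trans (hEB y hy)))
  have hlS : K.late \ K.PRp ⊆ X.edges := sdiff_subset.trans (X.tch_sub _)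
  obtain ⟨CS, s1, s2⟩ := Col.sdr (X := X) ρ (K.late \ K.PRp) C.B1 (by
    intro e he
    induction e using Sym2.ind with
    | _ x y =>
      obtain ⟨hl, hp⟩ := mem_sdiff.1 he
      have ha := X.mem_edges.1 (hlS he)
      have ht := r4 x y ha hl hp
      have hPB : K.PB C.B1 x y = X.Vij (X.φ x) (X.φ y) ∩ C.B1 := by
        unfold PB
        rw [if_pos ((K.mem_late ha).1 hl)]
      rw [hPB] at ht
      rw [X.lst_inter]
      have h1 : (((K.late \ K.PRp).card : ℕ) : ℝ) ≤ K.late.card := Nat.cast_le.2 (card_le_card sdiff_subset)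
      have h2 := K.late_card
      have h3 := K.k9
      obtain ⟨q, hq⟩ := X.Vij_q ha
      have h4 := K.pc_half C.hB1 q
      have h5 : X.l * ((X.Vij (X.φ x) (X.φ y) ∩ C.B1).card : ℝ) ≤
        ((bu_lk X.E (X.Vij (X.φ x) (X.φ y) ∩ C.B1) (ρ x) (ρ y)).card : ℝ) := ht
      rw [hq] at h5 ⊢
      have h6 := mul_le_mul_of_nonneg_left h4 X.l_pos.le
      have h7 := X.e0_pos
      have : (((K.late \ K.PRp).card : ℕ) : ℝ) ≤ ((bu_lk X.E (X.Vq q ∩ C.B1) (ρ x) (ρ y)).card : ℝ) := by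
        linarith
      exact_mod_cast this)
  have hDAL : ∀ y ∈ K.DA, ρ y = ρA y := by
    intro y hy
    have hyB : y ∈ K.DB := mem_union_left _ hy
    rw [r3 y (hDDL (K.DC_DD (hDBC hyB))), hEB y hyB, b1 y hy]
  obtain ⟨CF, t1, t2⟩ := a4 ρ hDAL (C.B1 \ CS) sdiff_subset (by
    intro q
    have u1 := s2.card_q hlS q
    have u2 := a3 q
    have u3 := r9 q
    have u4 : (X.Eq q ∩ K.PRp).card + (X.Eq q ∩ (K.late \ K.PRp)).card = (X.Eq q ∩ K.late).card := by
      rw [← card_union_of_disjoint, ← inter_union_distrib_left, union_sdiff_of_subset K.PRp_late]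
      exact disjoint_sdiff.mono inter_subset_right inter_subset_right
    have u5 : (X.Vq q ∩ (C.B1 \ CS)).card + (X.Vq q ∩ CS).card = (X.Vq q ∩ C.B1).card := by
      rw [← card_union_of_disjoint, ← inter_union_distrib_left, sdiff_union_of_subset s1]
      exact sdiff_disjoint.mono inter_subset_right inter_subset_right
    omega)
  refine ⟨ρ, r1, r2, ?_, Cd ∪ CL ∪ CS ∪ CF, ?_⟩
  · intro x hx
    have hxD : x ∈ K.DD := mem_union_right _ hx
    rw [r3 x (hDDL hxD), e1 x hxD]
    exact d2 x hx
  · rw [← K.oth_compl]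
    have v1 : Disjoint (Cd ∪ CL) CS := r8.mono_right (s1.trans subset_union_right)
    refine ((r5.union r6 ?_ r7).union s2 ?_ v1).union t2 ?_ ?_
    · rw [disjoint_left]; intro e he hp
      exact (mem_sdiff.1 he).2 (mem_union_right _ (K.PRp_late hp))
    · rw [disjoint_left]; intro e he hp
      rcases mem_union.1 he with he | he
      · exact (mem_sdiff.1 he).2 (mem_union_right _ (mem_sdiff.1 hp).1)
      · exact (mem_sdiff.1 hp).2 he
    · rw [disjoint_left]; intro e he hp
      have hnl := K.SF_late hp
      rcases mem_union.1 he with he | he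
      · rcases mem_union.1 he with he | he
        · exact (mem_sdiff.1 he).2 (mem_union_left _ hp)
        · exact hnl (K.PRp_late he)
      · exact hnl (mem_sdiff.1 he).1
    · rw [disjoint_left]; intro c hc hf
      have hf' := t1 hf
      rcases mem_union.1 hc with hc | hc
      · refine disjoint_left.1 r8 hc ?_
        rcases mem_union.1 hf' with h' | h'
        · exact mem_union_left _ h'
        · exact mem_union_right _ (mem_sdiff.1 h').1
      · rcases mem_union.1 hf' with h' | h'
        · exact disjoint_left.1 C.dB h' (s1 hc)
        · exact (mem_sdiff.1 h').2 hc

end Pre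
end BUCtx

/-! ## Typicality from half-superregularity -/

theorem bu_trip1 {V : Type} (E : Set (Finset V)) (S A P : Finset V) :
    tripCount E S A P = ∑ u ∈ S, ∑ v ∈ A, (bu_lk E P u v).card := by
  unfold tripCount
  rw [card_filter, sum_product]
  refine sum_congr rfl fun u _ => ?_
  rw [sum_product]
  refine sum_congr rfl fun v _ => ?_
  unfold bu_lk
  rw [card_filter]

theorem bu_trip2 {V : Type} (E : Set (Finset V)) (S A P : Finset V) :
    tripCount E S A P = ∑ c ∈ P, ((S ×ˢ A).filter (fun q => ({q.1, q.2, c} : Finset V) ∈ E)).card := by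
  rw [bu_trip1]
  have : ∀ u ∈ S, ∑ v ∈ A, (bu_lk E P u v).card =
      ∑ c ∈ P, ∑ v ∈ A, if ({u, v, c} : Finset V) ∈ E then 1 else 0 := by
    intro u _
    rw [sum_comm]
    refine sum_congr rfl fun v _ => ?_
    unfold bu_lk
    rw [card_filter]
  rw [sum_congr rfl this, sum_comm]
  refine sum_congr rfl fun c _ => ?_
  rw [card_filter, sum_product]

theorem bu_thsum {V : Type} (E : Set (Finset V)) (l : ℝ) (hl : 0 ≤ l) (A P : Finset V) (u : V) :
    ((∑ v ∈ A, (bu_lk E P u v).card : ℕ) : ℝ) ≤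
      ((A.filter (fun v => bu_Thk E l P u v)).card : ℝ) * P.card + l * (A.card * P.card) := by
  have h1 : ∀ v ∈ A, (((bu_lk E P u v).card : ℕ) : ℝ) ≤
      (if bu_Thk E l P u v then (P.card : ℝ) else 0) + l * P.card := by
    intro v _
    by_cases h : bu_Thk E l P u v
    · rw [if_pos h]
      have h2 : (((bu_lk E P u v).card : ℕ) : ℝ) ≤ P.card := Nat.cast_le.2 (card_le_card (filter_subset _ _))
      have : 0 ≤ l * (P.card : ℝ) := by positivity
      linarith
    · rw [if_neg h]
      unfold bu_Thk at h
      linarith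
  push_cast
  refine (sum_le_sum h1).trans ?_
  rw [sum_add_distrib, sum_const, nsmul_eq_mul, ← sum_filter, sum_const, nsmul_eq_mul]
  apply le_of_eq
  ring

theorem bu_typ {V : Type} {ε d e0 l : ℝ} {E : Set (Finset V)} {A0 B0 C0 : Finset V}
    (h : TripHalfSuper ε d E A0 B0 C0) (hl : 0 < l) (hd : d = 2 * l) (he : 0 < e0)
    (hA : ε * (A0.card : ℝ) ≤ e0) (hB : ε * (B0.card : ℝ) ≤ e0) (hC : ε * (C0.card : ℝ) ≤ e0) :
    ∀ P ⊆ C0, e0 ≤ (P.card : ℝ) → ∀ A ⊆ B0, e0 ≤ (A.card : ℝ) →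
    ((A0.filter (fun u => ((A.filter (fun v => bu_Thk E l P u v)).card : ℝ) <
      l * (A.card : ℝ))).card : ℝ) ≤ e0 := by
  intro P hP hPe A hAs hAe
  by_contra hcon
  push Not at hcon
  set S := A0.filter (fun u => ((A.filter (fun v => bu_Thk E l P u v)).card : ℝ) < l * (A.card : ℝ)) with hS
  have h1 := h.1 S (filter_subset _ _) A hAs P hP (by linarith) (by linarith) (by linarith)
  rw [bu_trip1] at h1
  have hPp : (0:ℝ) < P.card := by linarith
  have hSn : S.Nonempty := by
    rw [← card_pos]
    exact_mod_cast (by linarith : (0:ℝ) < S.card)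
  have h2 : ∀ u ∈ S, ((∑ v ∈ A, (bu_lk E P u v).card : ℕ) : ℝ) < d * (A.card * P.card) := by
    intro u hu
    refine (bu_thsum E l hl.le A P u).trans_lt ?_
    have h3 : ((A.filter (fun v => bu_Thk E l P u v)).card : ℝ) < l * (A.card : ℝ) := by
      simp only [hS, mem_filter] at hu
      exact hu.2
    have h4 := mul_lt_mul_of_pos_right h3 hPp
    rw [hd]
    linarith
  have h3 : ((∑ u ∈ S, ∑ v ∈ A, (bu_lk E P u v).card : ℕ) : ℝ) < ∑ _u ∈ S, d * (A.card * P.card : ℝ) := by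
    rw [Nat.cast_sum]
    exact sum_lt_sum_of_nonempty hSn h2
  rw [sum_const, nsmul_eq_mul] at h3
  have h5 : d * (S.card : ℝ) * A.card * P.card = S.card * (d * (A.card * P.card : ℝ)) := by ring
  linarith

theorem bu_ctyp {V : Type} {ε d e0 l : ℝ} {E : Set (Finset V)} {A0 B0 C0 : Finset V}
    (h : TripHalfSuper ε d E A0 B0 C0) (hl : 0 < l) (hd : d = 2 * l) (he : 0 < e0)
    (hA : ε * (A0.card : ℝ) ≤ e0) (hB : ε * (B0.card : ℝ) ≤ e0) (hC : ε * (C0.card : ℝ) ≤ e0) :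
    ∀ A ⊆ A0, e0 ≤ (A.card : ℝ) → ∀ B ⊆ B0, e0 ≤ (B.card : ℝ) →
    ((C0.filter (fun c => (((A ×ˢ B).filter
      (fun q => ({q.1, q.2, c} : Finset V) ∈ E)).card : ℝ) <
      l * ((A.card : ℝ) * (B.card : ℝ)))).card : ℝ) ≤ e0 := by
  intro A hAs hAe B hBs hBe
  by_contra hcon
  push Not at hcon
  set S := C0.filter (fun c => (((A ×ˢ B).filter
      (fun q => ({q.1, q.2, c} : Finset V) ∈ E)).card : ℝ) <
      l * ((A.card : ℝ) * (B.card : ℝ))) with hS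
  have h1 := h.1 A hAs B hBs S (filter_subset _ _) (by linarith) (by linarith) (by linarith)
  rw [bu_trip2] at h1
  have hSn : S.Nonempty := by
    rw [← card_pos]
    exact_mod_cast (by linarith : (0:ℝ) < S.card)
  have hAp : (0:ℝ) < A.card := by linarith
  have hBp : (0:ℝ) < B.card := by linarith
  have h2 : ∀ c ∈ S, (((A ×ˢ B).filter (fun q => ({q.1, q.2, c} : Finset V) ∈ E)).card : ℝ) <
      l * ((A.card : ℝ) * (B.card : ℝ)) := by
    intro c hc
    simp only [hS, mem_filter] at hc
    exact hc.2
  have h3 : ((∑ c ∈ S, ((A ×ˢ B).filter (fun q => ({q.1, q.2, c} : Finset V) ∈ E)).card : ℕ) : ℝ) <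
      ∑ _c ∈ S, l * ((A.card : ℝ) * (B.card : ℝ)) := by
    rw [Nat.cast_sum]
    exact sum_lt_sum_of_nonempty hSn h2
  rw [sum_const, nsmul_eq_mul] at h3
  have h5 : d * (A.card : ℝ) * B.card * S.card = 2 * (S.card * (l * (A.card * B.card : ℝ))) := by rw [hd]; ring
  have h6 : 0 ≤ (S.card * (l * (A.card * B.card : ℝ))) := by positivity
  linarith

theorem bu_vdeg {V : Type} {ε d l : ℝ} {E : Set (Finset V)} {A0 B0 C0 : Finset V}
    (h : TripHalfSuper ε d E A0 B0 C0) (hl : 0 < l) (hd : d = 2 * l) (hC : 0 < C0.card) :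
    ∀ u ∈ A0, l * (B0.card : ℝ) ≤ ((B0.filter (fun v => bu_Thk E l C0 u v)).card : ℝ) := by
  intro u hu
  have h1 := h.2.1 u hu
  rw [bu_trip1, sum_singleton] at h1
  have h2 := bu_thsum E l hl.le B0 C0 u
  have hCp : (0:ℝ) < C0.card := by exact_mod_cast hC
  have h3 : (l * (B0.card : ℝ)) * C0.card ≤ ((B0.filter (fun v => bu_Thk E l C0 u v)).card : ℝ) * C0.card := by
    rw [hd] at h1
    linarith
  exact le_of_mul_le_mul_right h3 hCp

theorem bu_cdeg {V : Type} {ε d l : ℝ} {E : Set (Finset V)} {A0 B0 C0 : Finset V}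
    (h : TripHalfSuper ε d E A0 B0 C0) (hl : 0 < l) (hd : d = 2 * l) :
    ∀ c ∈ C0, l * ((A0.card : ℝ) * (B0.card : ℝ)) ≤
      (((A0 ×ˢ B0).filter (fun q => ({q.1, q.2, c} : Finset V) ∈ E)).card : ℝ) := by
  intro c hc
  have h1 := h.2.2.2 c hc
  rw [bu_trip2, sum_singleton] at h1
  have : 0 ≤ l * ((A0.card : ℝ) * (B0.card : ℝ)) := by positivity
  rw [hd] at h1
  linarith

theorem bu_thm_mono {V : Type} {ε d d' : ℝ} {E : Set (Finset V)} {A0 B0 C0 : Finset V}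
    (h : TripHalfSuper ε d E A0 B0 C0) (hd : d' ≤ d) : TripHalfSuper ε d' E A0 B0 C0 := by
  obtain ⟨h1, h2, h3, h4⟩ := h
  refine ⟨fun A hA B hB C hC a b c => le_trans ?_ (h1 A hA B hB C hC a b c), fun x hx => le_trans ?_ (h2 x hx),
    fun x hx => le_trans ?_ (h3 x hx), fun x hx => le_trans ?_ (h4 x hx)⟩ <;> gcongr

/-- components of `H - X0` -/
theorem bu_comp {W : Type} [Fintype W] {H : SimpleGraph W} {μ : ℝ} (h : Separable H μ) :
    ∃ (X0 : Finset W) (β : Type) (comp : W → β), (X0.card : ℝ) ≤ μ * (Fintype.card W : ℝ) ∧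
      (∀ x y, H.Adj x y → x ∉ X0 → y ∉ X0 → comp x = comp y) ∧
      ∀ k, (((univ : Finset W).filter (fun w => w ∉ X0 ∧ comp w = k)).card : ℝ) ≤ μ * (Fintype.card W : ℝ) := by
  obtain ⟨X0, h0, h1⟩ := h
  obtain ⟨comp, hcomp⟩ : ∃ comp : W → Option (SimpleGraph.induce ((↑X0 : Set W)ᶜ) H).ConnectedComponent,
      ∀ w, ∀ h : w ∈ ((↑X0 : Set W)ᶜ), comp w = some (SimpleGraph.connectedComponentMk _ ⟨w, h⟩) :=
    ⟨fun w => if h : w ∈ ((↑X0 : Set W)ᶜ) then some (SimpleGraph.connectedComponentMk _ ⟨w, h⟩) else none,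
      fun w h => dif_pos h⟩
  refine ⟨X0, _, comp, h0, ?_, ?_⟩
  · intro x y ha hx hy
    have hx' : x ∈ ((↑X0 : Set W)ᶜ) := hx
    have hy' : y ∈ ((↑X0 : Set W)ᶜ) := hy
    rw [hcomp x hx', hcomp y hy']
    congr 1
    apply SimpleGraph.ConnectedComponent.sound
    apply SimpleGraph.Adj.reachable
    exact ha
  · intro k
    cases k with
    | none =>
      refine (Nat.cast_le.2 (le_of_eq (card_eq_zero.2 (eq_empty_of_forall_notMem (fun w hw => ?_))))).trans
        ((Nat.cast_zero (R := ℝ)).le.trans (le_trans (by positivity) h0))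
      simp only [mem_filter] at hw
      have hw' : w ∈ ((↑X0 : Set W)ᶜ) := hw.2.1
      have := hw.2.2
      rw [hcomp w hw'] at this
      cases this
    | some k =>
      refine le_trans (Nat.cast_le.2 ?_) (h1 k)
      have : (((univ : Finset W).filter (fun w => w ∉ X0 ∧ comp w = some k)) : Set W)
          ⊆ Subtype.val '' k.supp := by
        intro w hw
        simp only [coe_filter, mem_univ, true_and, Set.mem_ofPred_eq] at hw
        obtain ⟨hw, hk⟩ := hw
        have hw' : w ∈ ((↑X0 : Set W)ᶜ) := hw
        rw [hcomp w hw'] at hk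
        exact ⟨⟨w, hw'⟩, Option.some.inj hk, rfl⟩
      have h2 := Set.ncard_le_ncard this (Set.toFinite _)
      rw [Set.ncard_coe_finset, Set.ncard_image_of_injective _ Subtype.val_injective] at h2
      convert h2

namespace BUCtx

variable {r : ℕ} {V W : Type} [Fintype V] [Fintype W]

/-- One selection stage. -/
theorem stage (X : BUCtx r V W) [Nonempty W] {β τ ι : Type} [Fintype τ] [Fintype ι] (comp : W → β)
    (Xall Y : Finset W) (b q : ℕ) (hq : 1 ≤ q)
    (hadj : ∀ x y, X.H.Adj x y → x ∈ Y → y ∉ Xall → y ∈ Y ∧ comp x = comp y)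
    (hb : ∀ k, (Y.filter (fun w => comp w = k)).card ≤ b)
    (Good : τ → W → Prop) (f : ι → τ)
    (hsz : ∀ t, Fintype.card ι * (X.Δ + 1)^4 * q ≤
      (Y.filter (fun w => Good t w ∧ Disjoint (bu_B2 X.H w) Xall)).card) :
    ∃ K ⊆ Y, (∀ x y, X.H.Adj x y → x ∈ K → y ∉ Xall → y ∈ K) ∧
      (∀ x y, X.H.Adj x y → x ∈ Y \ K → y ∉ Xall → y ∈ Y \ K ∧ comp x = comp y) ∧
      K.card * q ≤ Fintype.card τ * (Y.card + q * b) ∧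
      ∃ w : ι → W, (∀ t, Good (f t) (w t) ∧ bu_B2 X.H (w t) ⊆ K) ∧
        ∀ t t', t ≠ t' → Disjoint (bu_B2 X.H (w t)) (bu_B2 X.H (w t')) := by
  obtain ⟨K, hK, h1, h2, h3⟩ := bu_select Y comp b q hq hb
    (fun t => Y.filter (fun w => Good t w ∧ Disjoint (bu_B2 X.H w) Xall)) (fun t => filter_subset _ _)
  have hKadj : ∀ x y, X.H.Adj x y → x ∈ K → y ∉ Xall → y ∈ K := by
    intro x y ha hx hy
    obtain ⟨k1, k2⟩ := hadj x y ha (hK hx) hy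
    exact h1 x hx y k1 k2
  refine ⟨K, hK, hKadj, ?_, h2, ?_⟩
  · intro x y ha hx hy
    obtain ⟨hx1, hx2⟩ := mem_sdiff.1 hx
    obtain ⟨k1, k2⟩ := hadj x y ha hx1 hy
    exact ⟨mem_sdiff.2 ⟨k1, fun hyK => hx2 (h1 y hyK x hx1 k2.symm)⟩, k2⟩
  · obtain ⟨w, hw1, hw2⟩ := bu_items X.H X.Δ X.deg (univ : Finset ι)
      (fun t => (Y.filter (fun w => Good (f t) w ∧ Disjoint (bu_B2 X.H w) Xall)) ∩ K) (by
        intro t _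
        have e := (hsz (f t)).trans (h3 (f t))
        rw [mul_comm] at e
        exact Nat.le_of_mul_le_mul_left e hq)
    refine ⟨w, fun t => ?_, fun t t' h => hw2 t (mem_univ _) t' (mem_univ _) h⟩
    have hm := mem_inter.1 (hw1 t (mem_univ _))
    simp only [mem_filter] at hm
    obtain ⟨⟨hwY, hg, hd⟩, hwK⟩ := hm
    refine ⟨hg, ?_⟩
    have hcl : bu_cl X.H {w t} ⊆ K := by
      intro z hz
      have hzX : z ∉ Xall := fun h => disjoint_left.1 hd (bu_sub_cl _ _ hz) h
      obtain ⟨s, hs, h⟩ := bu_mem_cl.1 hz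
      rw [mem_singleton.1 hs] at h
      rcases h with h | h
      · rw [h]; exact hwK
      · exact hKadj _ _ h hwK hzX
    intro y hy
    have hyX : y ∉ Xall := fun h => disjoint_left.1 hd hy h
    obtain ⟨z, hz, h⟩ := bu_mem_cl.1 hy
    rcases h with h | h
    · rw [h]; exact hcl hz
    · exact hKadj _ _ h (hcl hz) hyX

/-- good items -/
def Good (X : BUCtx r V W) : Fin r ⊕ X.PR → W → Prop
  | Sum.inl i, w => X.φ w = i
  | Sum.inr q, w => X.φ w = q.1.1 ∧ ∃ y, X.H.Adj w y ∧ X.φ y = q.1.2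

theorem good_l (X : BUCtx r V W) (i : Fin r) :
    ((univ : Finset W).filter (fun w => X.Good (Sum.inl i) w)).card = (X.Vc i).card := by
  rw [← X.vcard i]
  congr 1
  ext w
  constructor
  · intro h
    have h' := (mem_filter.1 h).2
    exact mem_filter.2 ⟨mem_univ _, h'⟩
  · intro h
    have h' := (mem_filter.1 h).2
    exact mem_filter.2 ⟨mem_univ _, h'⟩

theorem good_r (X : BUCtx r V W) (q : X.PR) :
    (X.Vq q).card ≤ ((univ : Finset W).filter (fun w => X.Good (Sum.inr q) w)).card * X.Δ := by
  rw [← X.Eq_card q]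
  have hsub : X.Eq q ⊆ ((univ : Finset W).filter (fun w => X.Good (Sum.inr q) w)).biUnion
      (fun w => (univ.filter (fun y => X.H.Adj w y)).image (fun y => s(w, y))) := by
    intro e he
    obtain ⟨x, y, rfl, ha, hx, hy⟩ := X.mem_Eq.1 he
    refine mem_biUnion.2 ⟨x, ?_, mem_image.2 ⟨y, ?_, rfl⟩⟩
    · simp only [mem_filter]
      exact ⟨mem_univ _, hx, y, ha, hy⟩
    · simp only [mem_filter]
      exact ⟨mem_univ _, ha⟩
  refine (card_le_card hsub).trans (card_biUnion_le_card_mul _ _ _ (fun w _ => ?_))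
  exact card_image_le.trans (X.deg w)

theorem avoid (X : BUCtx r V W) (Xall Y Z : Finset W) (P : W → Prop) (hY : ∀ w, w ∉ Xall → w ∉ Z → w ∈ Y) :
    ((univ : Finset W).filter P).card ≤
      (Y.filter (fun w => P w ∧ Disjoint (bu_B2 X.H w) Xall)).card + Xall.card * (X.Δ + 1) ^ 2 + Z.card := by
  have hsub : (univ : Finset W).filter P ⊆
      (Y.filter (fun w => P w ∧ Disjoint (bu_B2 X.H w) Xall)) ∪ bu_cl X.H (bu_cl X.H Xall) ∪ Z := by
    intro w hw
    simp only [mem_filter] at hw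
    by_cases hwZ : w ∈ Z
    · exact mem_union_right _ hwZ
    refine mem_union_left _ ?_
    by_cases hd : Disjoint (bu_B2 X.H w) Xall
    · refine mem_union_left _ ?_
      simp only [mem_filter]
      refine ⟨hY w (fun h => disjoint_left.1 hd ?_ h) hwZ, hw.2, hd⟩
      exact bu_sub_cl _ _ (bu_sub_cl _ _ (mem_singleton_self w))
    · refine mem_union_right _ ?_
      obtain ⟨y, hy, hyX⟩ := not_disjoint_iff.1 hd
      obtain ⟨z, hz, h⟩ := bu_mem_cl.1 hy
      obtain ⟨w', hw', h'⟩ := bu_mem_cl.1 hz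
      rw [mem_singleton.1 hw'] at h'
      have hzc : z ∈ bu_cl X.H Xall := by
        refine bu_mem_cl.2 ⟨y, hyX, ?_⟩
        rcases h with h | h
        · exact Or.inl h.symm
        · exact Or.inr h.symm
      refine bu_mem_cl.2 ⟨z, hzc, ?_⟩
      rcases h' with h' | h'
      · exact Or.inl h'.symm
      · exact Or.inr h'.symm
  refine (card_le_card hsub).trans ((card_union_le _ _).trans (Nat.add_le_add_right
    ((card_union_le _ _).trans (Nat.add_le_add_left ?_ _)) _))
  calc _ ≤ _ := bu_cl_card X.H X.Δ X.deg _
    _ ≤ (Xall.card * (X.Δ + 1)) * (X.Δ + 1) := Nat.mul_le_mul_right _ (bu_cl_card X.H X.Δ X.deg _)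
    _ = _ := by ring

theorem card_PR (X : BUCtx r V W) : Fintype.card X.PR ≤ r ^ 2 := by
  have := Fintype.card_le_of_injective (fun q : X.PR => q.1) Subtype.val_injective
  simpa [sq] using this


set_option maxHeartbeats 1600000 in
theorem prep (X : BUCtx r V W) [Nonempty V] [Nonempty W] (X0 : Finset W) {β : Type} (comp : W → β) (b : ℕ)
    (hcomp : ∀ x y, X.H.Adj x y → x ∉ X0 → y ∉ X0 → comp x = comp y)
    (hb : ∀ k, ((univ : Finset W).filter (fun w => w ∉ X0 ∧ comp w = k)).card ≤ b)
    (Us : Finset W) (Ts : W → Finset V)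
    (m clo chi vhi ν Nab Nre Nu Nch N ω x0 : ℝ) (pc Lc pv Lv s ξ q1 q2 q3 : ℕ)
    (hq1 : 1 ≤ q1) (hq2 : 1 ≤ q2) (hq3 : 1 ≤ q3)
    (hTs : ∀ x ∈ Us, Ts x ⊆ X.Vc (X.φ x) ∧ ν * m ≤ ((Ts x).card : ℝ))
    (hr : 1 ≤ r) (hm : 0 < m) (hν : 0 < ν) (hΔ : 1 ≤ X.Δ)
    (n_v : ∀ i, m ≤ ((X.Vc i).card : ℝ) ∧ ((X.Vc i).card : ℝ) ≤ vhi)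
    (n_c : ∀ q, clo ≤ ((X.Vq q).card : ℝ) ∧ ((X.Vq q).card : ℝ) ≤ chi)
    (n_u : (Us.card : ℝ) ≤ Nu) (n_x : (X0.card : ℝ) ≤ x0) (n_N : (Fintype.card W : ℝ) ≤ N)
    (w1 : ω ≤ m) (w2 : ω * X.Δ ≤ clo)
    (c1 : (x0 + Nu * (X.Δ + 1)) * (X.Δ + 1)^2 ≤ ω / 4)
    (c2 : ((r : ℝ) + r^2) * (N / q1 + b) ≤ Nab) (c2' : Nab ≤ ω / 4)
    (c3 : ((r : ℝ)^2 * (pc * (Lc + 1)) + r * (pv * (Lv + 1)) + (r + r^2) * ξ) * (X.Δ + 1)^4 * q1 ≤ ω / 2)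
    (c4 : ((r : ℝ) + r^2) * s * (X.Δ + 1)^4 * q2 ≤ ω / 2)
    (c5 : ((r : ℝ) + r^2) * (N / q2 + b) + (x0 + Nu * (X.Δ + 1)) ≤ Nre)
    (c6 : N / q3 + b ≤ Nch)
    (k1 : Nab + Nu + r * (pv * (Lv + 1) + Nre) + 2 + (r^2 + 2 * X.Δ + 3) * X.e0 ≤ X.l ^ (2 * X.Δ) * X.l^2 / 256 * m)
    (k1' : Nab + Nu + r * (pv * (Lv + 1) + Nre) + 2 + (r^2 + 2 * X.Δ + 3) * X.e0 ≤ X.l ^ X.Δ * (ν * m))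
    (k2 : (pc * Lc : ℝ) ≤ X.l^3 / 256 * clo)
    (k3 : (1 - X.l^2 / 64)^Lc * chi ≤ pc / 2)
    (k4 : pc * (Lc + 2) + X.Δ * (Nre + r * (pv * (Lv + 1))) + X.Δ * (Nab + Nu) + X.e0 + 1 ≤ X.l^2 / 16 * clo)
    (k5 : pv * (Lv + 3) + Nre + Nab ≤ X.l ^ (2 * X.Δ) * m)
    (k6 : (1 - X.l ^ X.Δ)^Lv * vhi ≤ pv / 2)
    (k7 : (s : ℝ) ≤ pv / 2 ∧ (s : ℝ) ≤ pc / 2)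
    (k8 : Nre + 2 + (X.Δ + 2) * X.e0 ≤ X.l ^ (3 * X.Δ) * X.l * pv / 16)
    (k9 : X.Δ * (Nre + r * (pv * (Lv + 1))) + X.e0 ≤ X.l * pc / 2)
    (k10 : Nch * (X.Δ + 1) + (X.Δ + 2) * X.e0 < X.l ^ X.Δ * X.l * s)
    (k11 : r * X.e0 ≤ ξ)
    (k12 : ξ ≤ s) :
    ∃ ρ : W → V, Function.Injective ρ ∧ (∀ x, ρ x ∈ X.Vc (X.φ x)) ∧ (∀ x ∈ Us, ρ x ∈ Ts x) ∧
      ∃ C, X.Col ρ X.edges C := by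
  obtain ⟨Xall, hXall⟩ : ∃ Xall, Xall = X0 ∪ bu_cl X.H Us := ⟨_, rfl⟩
  have hX0 : X0 ⊆ Xall := by rw [hXall]; exact subset_union_left
  have hcl : bu_cl X.H Us ⊆ Xall := by rw [hXall]; exact subset_union_right
  have hUs : Us ⊆ Xall := (bu_sub_cl _ _).trans hcl
  have hUsn : ∀ x y, X.H.Adj x y → x ∉ Xall → y ∉ Us := fun x y ha hx hy =>
    hx (hcl (bu_mem_cl.2 ⟨y, hy, Or.inr ha.symm⟩))
  have hNu : 0 ≤ Nu := le_trans (by positivity) n_u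
  have hXc : (Xall.card : ℝ) ≤ x0 + Nu * (X.Δ + 1) := by
    have h1 : Xall.card ≤ X0.card + Us.card * (X.Δ + 1) := by
      rw [hXall]
      exact (card_union_le _ _).trans (Nat.add_le_add_left (bu_cl_card X.H X.Δ X.deg _) _)
    have h2 : (Xall.card : ℝ) ≤ X0.card + Us.card * (X.Δ + 1) := by exact_mod_cast h1
    have h3 : (Us.card : ℝ) * (X.Δ + 1) ≤ Nu * (X.Δ + 1) := by gcongr
    linarith
  have hXc2 : (Xall.card : ℝ) * (X.Δ + 1)^2 ≤ ω / 4 := le_trans (by gcongr) c1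
  have hgood : ∀ t, ω ≤ (((univ : Finset W).filter (fun w => X.Good t w)).card : ℝ) := by
    intro t
    rcases t with i | q
    · rw [good_l]; exact w1.trans (n_v i).1
    · have h1 : ((X.Vq q).card : ℝ) ≤
          (((univ : Finset W).filter (fun w => X.Good (Sum.inr q) w)).card : ℝ) * X.Δ := by
        exact_mod_cast X.good_r q
      have h2 := (w2.trans (n_c q).1).trans h1
      exact le_of_mul_le_mul_right h2 (by exact_mod_cast hΔ)
  have hτ : (Fintype.card (Fin r ⊕ X.PR) : ℝ) ≤ r + r^2 := by
    have := X.card_PR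
    have h2 : Fintype.card (Fin r ⊕ X.PR) ≤ r + r^2 := by
      rw [Fintype.card_sum, Fintype.card_fin]; omega
    exact_mod_cast h2
  have hPR : (Fintype.card X.PR : ℝ) ≤ r^2 := by exact_mod_cast X.card_PR
  have hN0 : 0 ≤ N := le_trans (by positivity) n_N
  have hsel : ∀ (K Y : Finset W) (q : ℕ), 1 ≤ q →
      K.card * q ≤ Fintype.card (Fin r ⊕ X.PR) * (Y.card + q * b) → (K.card : ℝ) ≤ (r + r^2) * (N / q + b) := by
    intro K Y q hq h
    have hq0 : (0 : ℝ) < q := by exact_mod_cast hq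
    have h1 : (K.card : ℝ) * q ≤ Fintype.card (Fin r ⊕ X.PR) * (Y.card + q * b) := by exact_mod_cast h
    have h2 : (Y.card : ℝ) ≤ N := (Nat.cast_le.2 (card_le_univ Y)).trans n_N
    have h3 : (K.card : ℝ) * q ≤ ((r + r^2) * (N / q + b)) * q := by
      calc _ ≤ _ := h1
        _ ≤ ((r : ℝ) + r^2) * (N + q * b) := by gcongr
        _ = _ := by field_simp
    exact le_of_mul_le_mul_right h3 hq0
  -- first stage
  have hadj1 : ∀ x y, X.H.Adj x y → x ∈ univ \ Xall → y ∉ Xall → y ∈ univ \ Xall ∧ comp x = comp y := by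
    intro x y ha hx hy
    have hx' := (mem_sdiff.1 hx).2
    exact ⟨mem_sdiff.2 ⟨mem_univ _, hy⟩, hcomp x y ha (fun h => hx' (hX0 h)) (fun h => hy (hX0 h))⟩
  have hbY : ∀ Y : Finset W, (∀ w ∈ Y, w ∉ Xall) → ∀ k, (Y.filter (fun w => comp w = k)).card ≤ b := by
    intro Y hY k
    refine (card_le_card (fun w hw => ?_)).trans (hb k)
    simp only [mem_filter] at hw ⊢
    exact ⟨mem_univ _, fun h => hY w hw.1 (hX0 h), hw.2⟩
  obtain ⟨Hab, hab1, hab2, hab3, hab4, wA, hwA1, hwA2⟩ := X.stage comp Xall (univ \ Xall) b q1 hq1 hadj1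
    (hbY _ (fun w hw => (mem_sdiff.1 hw).2)) X.Good
    (fun t : (X.PR × Fin pc × Fin (Lc+1)) ⊕ (Fin r × Fin pv × Fin (Lv+1)) ⊕ (Fin r × Fin ξ) ⊕ (X.PR × Fin ξ) =>
      Sum.elim (fun a => Sum.inr a.1) (Sum.elim (fun a => Sum.inl a.1)
        (Sum.elim (fun a => Sum.inl a.1) (fun a => Sum.inr a.1))) t) (by
      intro t
      have h1 := X.avoid Xall (univ \ Xall) ∅ (X.Good t) (fun w hw _ => mem_sdiff.2 ⟨mem_univ _, hw⟩)
      have h2 : (((univ : Finset W).filter (fun w => X.Good t w)).card : ℝ) ≤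
        (((univ \ Xall).filter (fun w => X.Good t w ∧ Disjoint (bu_B2 X.H w) Xall)).card : ℝ)
          + Xall.card * (X.Δ + 1) ^ 2 := by
        rw [card_empty, add_zero] at h1
        exact_mod_cast h1
      have h3 := hgood t
      have h4 : (Fintype.card ((X.PR × Fin pc × Fin (Lc+1)) ⊕ (Fin r × Fin pv × Fin (Lv+1)) ⊕
          (Fin r × Fin ξ) ⊕ (X.PR × Fin ξ)) : ℝ) ≤
          (r : ℝ)^2 * (pc * (Lc + 1)) + r * (pv * (Lv + 1)) + (r + r^2) * ξ := by
        simp only [Fintype.card_sum, Fintype.card_prod, Fintype.card_fin]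
        push_cast
        have e1 : (Fintype.card X.PR : ℝ) * (pc * (Lc + 1)) ≤ r^2 * (pc * (Lc + 1)) := by gcongr
        have e2 : (Fintype.card X.PR : ℝ) * ξ ≤ r^2 * ξ := by gcongr
        linarith
      have h5 : (Fintype.card ((X.PR × Fin pc × Fin (Lc+1)) ⊕ (Fin r × Fin pv × Fin (Lv+1)) ⊕
          (Fin r × Fin ξ) ⊕ (X.PR × Fin ξ)) : ℝ) * (X.Δ + 1)^4 * q1 ≤ ω / 2 := le_trans (by gcongr) c3
      have hω : 0 ≤ ω := by
        have : (0:ℝ) ≤ (Xall.card : ℝ) * (X.Δ + 1)^2 := by positivity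
        linarith
      have h6 : (Fintype.card ((X.PR × Fin pc × Fin (Lc+1)) ⊕ (Fin r × Fin pv × Fin (Lv+1)) ⊕
          (Fin r × Fin ξ) ⊕ (X.PR × Fin ξ)) : ℝ) * (X.Δ + 1)^4 * q1 ≤
          (((univ \ Xall).filter (fun w => X.Good t w ∧ Disjoint (bu_B2 X.H w) Xall)).card : ℝ) := by linarith
      exact_mod_cast h6)
  have hHab : (Hab.card : ℝ) ≤ Nab := (hsel _ _ _ hq1 hab4).trans c2
  -- second stage
  obtain ⟨Hre, hre1, hre2, hre3, hre4, wR, hwR1, hwR2⟩ := X.stage comp Xall ((univ \ Xall) \ Hab) b q2 hq2 hab3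
    (hbY _ (fun w hw => (mem_sdiff.1 (mem_sdiff.1 hw).1).2)) X.Good
    (fun t : (Fin r × Fin s) ⊕ (X.PR × Fin s) =>
      Sum.elim (fun a => Sum.inl a.1) (fun a => Sum.inr a.1) t) (by
      intro t
      have h1 := X.avoid Xall ((univ \ Xall) \ Hab) Hab (X.Good t)
        (fun w hw hw' => mem_sdiff.2 ⟨mem_sdiff.2 ⟨mem_univ _, hw⟩, hw'⟩)
      have h2 : (((univ : Finset W).filter (fun w => X.Good t w)).card : ℝ) ≤
        ((((univ \ Xall) \ Hab).filter (fun w => X.Good t w ∧ Disjoint (bu_B2 X.H w) Xall)).card : ℝ)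
          + Xall.card * (X.Δ + 1) ^ 2 + Hab.card := by
        exact_mod_cast h1
      have h3 := hgood t
      have h4 : (Fintype.card ((Fin r × Fin s) ⊕ (X.PR × Fin s)) : ℝ) ≤ (r + r^2) * s := by
        simp only [Fintype.card_sum, Fintype.card_prod, Fintype.card_fin]
        push_cast
        have e2 : (Fintype.card X.PR : ℝ) * s ≤ r^2 * s := by gcongr
        linarith
      have h5 : (Fintype.card ((Fin r × Fin s) ⊕ (X.PR × Fin s)) : ℝ) * (X.Δ + 1)^4 * q2 ≤ ω / 2 :=
        le_trans (by gcongr) c4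
      have h6 : (Fintype.card ((Fin r × Fin s) ⊕ (X.PR × Fin s)) : ℝ) * (X.Δ + 1)^4 * q2 ≤
          ((((univ \ Xall) \ Hab).filter (fun w => X.Good t w ∧ Disjoint (bu_B2 X.H w) Xall)).card : ℝ) := by
        linarith
      exact_mod_cast h6)
  have hHre := hsel _ _ _ hq2 hre4
  -- chunks
  obtain ⟨χ, hχ⟩ := bu_bins (((univ \ Xall) \ Hab) \ Hre) comp b q3 hq3
    (hbY _ (fun w hw => (mem_sdiff.1 (mem_sdiff.1 (mem_sdiff.1 hw).1).1).2))
  have nHab : ∀ w ∈ Hab, w ∉ Xall := fun w hw => (mem_sdiff.1 (hab1 hw)).2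
  have nHre : ∀ w ∈ Hre, w ∉ Xall := fun w hw => (mem_sdiff.1 (mem_sdiff.1 (hre1 hw)).1).2
  have yex : ∀ q : X.PR, ∀ w, X.Good (Sum.inr q) w → ∃ y, X.φ w = q.1.1 ∧ X.φ y = q.1.2 ∧ X.H.Adj w y := by
    rintro q w ⟨h1, y, h2, h3⟩
    exact ⟨y, h1, h3, h2⟩
  choose! yy hyy using yex
  let K : Pre X :=
  { m := m, clo := clo, chi := chi, vhi := vhi, ν := ν, Nab := Nab, Nre := Nre, Nu := Nu, Nch := Nch
    pc := pc, Lc := Lc, pv := pv, Lv := Lv, s := s, ξ := ξ, qn := q3, Hab := Hab, Hre := Hre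
    Xp := Xall \ Us, Us := Us, χ := fun w => χ (comp w), Ts := Ts, wA := wA
    yc := fun q k l => yy q (wA (Sum.inl (q, k, l)))
    yb := fun q k => yy q (wA (Sum.inr (Sum.inr (Sum.inr (q, k)))))
    wR := wR
    yr := fun q k => yy q (wR (Sum.inr (q, k)))
    dis1 := disjoint_left.2 (fun w hw hw' => (mem_sdiff.1 (hre1 hw')).2 hw)
    dis2 := disjoint_left.2 (fun w hw hw' => nHab w hw (mem_sdiff.1 hw').1)
    dis3 := disjoint_left.2 (fun w hw hw' => nHab w hw (hUs hw'))
    dis4 := disjoint_left.2 (fun w hw hw' => nHre w hw (mem_sdiff.1 hw').1)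
    dis5 := disjoint_left.2 (fun w hw hw' => nHre w hw (hUs hw'))
    dis6 := disjoint_left.2 (fun w hw hw' => (mem_sdiff.1 hw).2 hw')
    eab := by
      intro x y ha hx
      by_cases hy : y ∈ Xall
      · exact Or.inr (mem_sdiff.2 ⟨hy, hUsn x y ha (nHab x hx)⟩)
      · exact Or.inl (hab2 x y ha hx hy)
    ere := by
      intro x y ha hx
      by_cases hy : y ∈ Xall
      · exact Or.inr (mem_sdiff.2 ⟨hy, hUsn x y ha (nHre x hx)⟩)
      · exact Or.inl (hre2 x y ha hx hy)
    eus := by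
      intro x y ha hx
      by_cases hy : y ∈ Us
      · exact Or.inl hy
      · exact Or.inr (mem_sdiff.2 ⟨hcl (bu_mem_cl.2 ⟨x, hx, Or.inr ha⟩), hy⟩)
    ech := by
      intro x y ha h1 h2 h3 h4 h5
      have hx : x ∉ Xall := fun h => h3 (mem_sdiff.2 ⟨h, h4⟩)
      have hy : y ∉ Xall := fun h => h5 (mem_sdiff.2 ⟨h, hUsn x y ha hx⟩)
      rw [hcomp x y ha (fun h => hx (hX0 h)) (fun h => hy (hX0 h))]
    hTs := hTs
    wA_sub := fun t => (hwA1 t).2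
    wA_dis := hwA2
    wR_sub := fun t => (hwR1 t).2
    wR_dis := hwR2
    c_col := fun q k l => hyy q _ (hwA1 (Sum.inl (q, k, l))).1
    c_buf := fun i k l => (hwA1 (Sum.inr (Sum.inl (i, k, l)))).1
    c_sg := fun i k => (hwA1 (Sum.inr (Sum.inr (Sum.inl (i, k))))).1
    c_pr := fun q k => hyy q _ (hwA1 (Sum.inr (Sum.inr (Sum.inr (q, k))))).1
    c_sr := fun i k => (hwR1 (Sum.inl (i, k))).1
    c_prr := fun q k => hyy q _ (hwR1 (Sum.inr (q, k))).1
    hr := hr, hm := hm, hν := hν, n_v := n_v, n_c := n_c, n_ab := hHab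
    n_re := by
      have : ((Xall \ Us).card : ℝ) ≤ Xall.card := Nat.cast_le.2 (card_le_card sdiff_subset)
      linarith
    n_u := n_u
    n_ch := by
      intro k
      have hq0 : (0 : ℝ) < q3 := by exact_mod_cast hq3
      have h1 : (((((univ \ Xall) \ Hab) \ Hre).filter (fun w => χ (comp w) = k)).card : ℝ) * q3 ≤
          ((((univ \ Xall) \ Hab) \ Hre).card : ℝ) + q3 * b := by exact_mod_cast hχ k
      have h2 : ((((univ \ Xall) \ Hab) \ Hre).card : ℝ) ≤ N := (Nat.cast_le.2 (card_le_univ _)).trans n_N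
      have h3 : (((((univ \ Xall) \ Hab) \ Hre).filter (fun w => χ (comp w) = k)).card : ℝ) ≤ N / q3 + b := by
        refine le_of_mul_le_mul_right (h1.trans ?_) hq0
        have : (N / q3 + b) * q3 = N + q3 * b := by field_simp
        rw [this]
        linarith
      refine (Nat.cast_le.2 (card_le_card (fun w hw => ?_))).trans (h3.trans c6)
      simp only [mem_filter, mem_sdiff] at hw ⊢
      refine ⟨⟨⟨⟨mem_univ _, fun h => hw.2.2.2.1 ⟨h, hw.2.2.2.2.1⟩⟩, hw.2.1⟩, hw.2.2.1⟩, hw.2.2.2.2.2⟩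
    k1 := k1, k1' := k1', k2 := k2, k3 := k3, k4 := k4, k5 := k5, k6 := k6, k7 := k7, k8 := k8
    k9 := k9, k10 := k10, k11 := k11, k12 := k12 }
  exact K.main

end BUCtx

theorem bu_ev (c B : ℝ) (hB : 0 < B) : ∀ᶠ t in nhdsWithin (0:ℝ) (Set.Ioi 0), c * t ≤ B := by
  have h1 : Filter.Tendsto (fun t : ℝ => c * t) (nhdsWithin (0:ℝ) (Set.Ioi 0)) (nhds (c * 0)) :=
    ((continuous_const.mul continuous_id).tendsto 0).mono_left nhdsWithin_le_nhds
  rw [mul_zero] at h1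
  exact (h1.eventually (gt_mem_nhds hB)).mono (fun t ht => le_of_lt ht)

theorem bu_evp : ∀ᶠ t in nhdsWithin (0:ℝ) (Set.Ioi 0), 0 < t := self_mem_nhdsWithin

theorem bu_q (c B : ℝ) (hB : 0 < B) : ∃ q : ℕ, 1 ≤ q ∧ c / q ≤ B := by
  obtain ⟨q, hq⟩ := exists_nat_gt (max (c / B) 0)
  have h0 : (0:ℝ) < q := (le_max_right _ _).trans_lt hq
  have h1 : c / B < q := (le_max_left _ _).trans_lt hq
  refine ⟨q, by exact_mod_cast h0, ?_⟩
  rw [div_le_iff₀ h0]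
  rw [div_lt_iff₀ hB] at h1
  linarith

/-- numerical constants -/
theorem bu_consts (R T D D4 D2 Δ M l π1 π2 A1 A2 A3 A4 A5 A8 A10 ω1 : ℝ)
    (hl : 0 < l) (hπ1 : 0 < π1) (hπ1' : π1 ≤ 1) (hπ2 : 0 < π2) (hπ2' : π2 ≤ 1)
    (hM : 0 < M) (hD : 0 < D) (hΔ : 0 < Δ)
    (hA1 : 0 < A1) (hA2 : 0 < A2) (hA3 : 0 < A3) (hA4 : 0 < A4) (hA5 : 0 < A5) (hA8 : 0 < A8)
    (hA10 : 0 < A10) (hω : 0 < ω1) :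
    ∃ (κ p v e σ h t : ℝ) (q1 q2 q3 Lc Lv : ℕ), 0 < κ ∧ 0 < p ∧ 0 < v ∧ 0 < e ∧ 0 < σ ∧ 0 < h ∧ 0 < t ∧
      1 ≤ q1 ∧ 1 ≤ q2 ∧ 1 ≤ q3 ∧
      (8 * κ ≤ A1 ∧ 8 * κ ≤ A2 ∧ (8 * Δ) * κ ≤ A4 ∧ 8 * κ ≤ A5 ∧ 4 * κ ≤ ω1) ∧
      T * (R * M) / q1 ≤ κ / 2 ∧
      (p * (Lc + 1) ≤ κ ∧ p * (Lc + 1) ≤ A3 ∧ (R^2 * D4 * q1) * (p * (Lc + 1)) ≤ ω1 / 8) ∧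
      (1 - π1)^Lc * (Δ * M) ≤ p / 16 ∧
      (v * (Lv + 1) ≤ κ ∧ R * (v * (Lv + 1)) ≤ κ ∧ (Δ * R) * (v * (Lv + 1)) ≤ l * p / 16 ∧
        (R * D4 * q1) * (v * (Lv + 1)) ≤ ω1 / 8) ∧
      (1 - π2)^Lv * M ≤ v / 16 ∧
      (R * e ≤ κ ∧ e ≤ κ ∧ Δ * e ≤ l * p / 16 ∧ e ≤ A8 * v / 8) ∧
      T * (R * M) / q2 ≤ e / 2 ∧
      (4 * σ ≤ v ∧ 4 * σ ≤ p ∧ (T * D4 * q2) * σ ≤ ω1 / 2) ∧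
      D * h ≤ A10 * σ / 8 ∧ (R * M) / q3 ≤ h / 2 ∧
      ((R^2 + 2 * Δ + 5) * t ≤ κ ∧ 2 * t ≤ κ ∧ T * t ≤ κ / 2 ∧ ((1 + D) * D2) * t ≤ ω1 / 4 ∧
        (T * (R + 1) * D4 * q1) * t ≤ ω1 / 4 ∧ t ≤ l * p / 16 ∧ (Δ + 3) * t ≤ A8 * v / 8 ∧
        (T + 1 + D) * t ≤ e / 2 ∧ (Δ + 2) * t ≤ A10 * σ / 8 ∧ t ≤ h / 2 ∧ (R + 1) * t ≤ σ / 2 ∧ t ≤ σ / 2) := by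
  obtain ⟨κ, hκ, κ1, κ2, κ3, κ4, κ5⟩ := (bu_evp.and ((bu_ev 8 A1 hA1).and ((bu_ev 8 A2 hA2).and
    ((bu_ev (8 * Δ) A4 hA4).and ((bu_ev 8 A5 hA5).and (bu_ev 4 ω1 hω)))))).exists
  obtain ⟨q1, hq1, hq1'⟩ := bu_q (T * (R * M)) (κ / 2) (by positivity)
  obtain ⟨θ1, hθ1, a1, a2, a3⟩ := (bu_evp.and ((bu_ev 1 κ hκ).and ((bu_ev 1 A3 hA3).and
    (bu_ev (|R^2 * D4 * q1|) (ω1 / 8) (by positivity))))).exists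
  obtain ⟨p, Lc, hp, hp1, hp2⟩ := bu_param θ1 π1 (Δ * M) hθ1 hπ1 hπ1' (by positivity)
  obtain ⟨θ2, hθ2, b1, b2, b3, b4⟩ := (bu_evp.and ((bu_ev 1 κ hκ).and ((bu_ev (|R|) κ hκ).and
    ((bu_ev (|Δ * R|) (l * p / 16) (by positivity)).and (bu_ev (|R * D4 * q1|) (ω1 / 8) (by positivity)))))).exists
  obtain ⟨v, Lv, hv, hv1, hv2⟩ := bu_param θ2 π2 M hθ2 hπ2 hπ2' hM
  obtain ⟨e, he, e1, e2, e3, e4⟩ := (bu_evp.and ((bu_ev R κ hκ).and ((bu_ev 1 κ hκ).and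
    ((bu_ev Δ (l * p / 16) (by positivity)).and (bu_ev 1 (A8 * v / 8) (by positivity)))))).exists
  obtain ⟨q2, hq2, hq2'⟩ := bu_q (T * (R * M)) (e / 2) (by positivity)
  obtain ⟨σ, hσ, s1, s2, s3⟩ := (bu_evp.and ((bu_ev 4 v hv).and ((bu_ev 4 p hp).and
    (bu_ev (T * D4 * q2) (ω1 / 2) (by positivity))))).exists
  obtain ⟨h, hh, h1⟩ := (bu_evp.and (bu_ev D (A10 * σ / 8) (by positivity))).exists
  obtain ⟨q3, hq3, hq3'⟩ := bu_q (R * M) (h / 2) (by positivity)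
  obtain ⟨t, ht, t1, t2, t3, t4, t5, t6, t7, t8, t9, t10, t11, t12⟩ := (bu_evp.and
    ((bu_ev (R^2 + 2 * Δ + 5) κ hκ).and ((bu_ev 2 κ hκ).and ((bu_ev T (κ / 2) (by positivity)).and
    ((bu_ev ((1 + D) * D2) (ω1 / 4) (by positivity)).and ((bu_ev (T * (R + 1) * D4 * q1) (ω1 / 4) (by positivity)).and
    ((bu_ev 1 (l * p / 16) (by positivity)).and ((bu_ev (Δ + 3) (A8 * v / 8) (by positivity)).and
    ((bu_ev (T + 1 + D) (e / 2) (by positivity)).and ((bu_ev (Δ + 2) (A10 * σ / 8) (by positivity)).and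
    ((bu_ev 1 (h / 2) (by positivity)).and ((bu_ev (R + 1) (σ / 2) (by positivity)).and
    (bu_ev 1 (σ / 2) (by positivity)))))))))))))).exists
  have hpL : 0 ≤ p * ((Lc:ℝ) + 1) := by positivity
  have hvL : 0 ≤ v * ((Lv:ℝ) + 1) := by positivity
  have aux : ∀ c x θ B : ℝ, 0 ≤ x → x ≤ θ → |c| * θ ≤ B → c * x ≤ B := by
    intro c x θ B h0 h1 h2
    calc c * x ≤ |c| * x := mul_le_mul_of_nonneg_right (le_abs_self c) h0
      _ ≤ |c| * θ := mul_le_mul_of_nonneg_left h1 (abs_nonneg c)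
      _ ≤ B := h2
  rw [one_mul] at a1 a2 b1 e2 e4 t6 t10 t12
  exact ⟨κ, p, v, e, σ, h, t, q1, q2, q3, Lc, Lv, hκ, hp, hv, he, hσ, hh, ht, hq1, hq2, hq3,
    ⟨κ1, κ2, κ3, κ4, κ5⟩, hq1', ⟨hp1.trans a1, hp1.trans a2, aux _ _ _ _ hpL hp1 a3⟩, hp2,
    ⟨hv1.trans b1, aux _ _ _ _ hvL hv1 b2, aux _ _ _ _ hvL hv1 b3, aux _ _ _ _ hvL hv1 b4⟩, hv2,
    ⟨e1, e2, e3, e4⟩, hq2', ⟨s1, s2, s3⟩, h1, hq3', ⟨t1, t2, t3, t4, t5, t6, t7, t8, t9, t10, t11, t12⟩⟩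

theorem bu_floor (x : ℝ) (hx : 2 ≤ x) : x / 2 ≤ (⌊x⌋₊ : ℝ) ∧ (⌊x⌋₊ : ℝ) ≤ x := by
  have := Nat.lt_floor_add_one x
  exact ⟨by linarith, Nat.floor_le (by linarith)⟩

set_option maxHeartbeats 1600000 in
theorem bu_numbers (r Δ : ℕ) (hr : 2 ≤ r) (hΔ : 1 ≤ Δ) (ν l δ : ℝ) (hν : 0 < ν) (hl : 0 < l) (hl1 : l ≤ 1/2)
    (hδ : 0 < δ) :
    ∃ (t : ℝ) (Lc Lv q1 q2 q3 : ℕ), 0 < t ∧ 1 ≤ q1 ∧ 1 ≤ q2 ∧ 1 ≤ q3 ∧ ∀ m : ℝ, 2 ≤ t * m → 0 < m →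
    ∃ (Nab Nre Nch : ℝ) (pc pv s ξ : ℕ), ∀ b : ℕ, (b : ℝ) ≤ t * m →
    (t * m + t * m * (Δ + 1)) * (Δ + 1)^2 ≤ (δ / Δ * m) / 4 ∧
    ((r : ℝ) + r^2) * (r * (1 / δ) * m / q1 + b) ≤ Nab ∧ Nab ≤ (δ / Δ * m) / 4 ∧
    ((r : ℝ)^2 * (pc * (Lc + 1)) + r * (pv * (Lv + 1)) + (r + r^2) * ξ) * (Δ + 1)^4 * q1 ≤ (δ / Δ * m) / 2 ∧
    ((r : ℝ) + r^2) * s * (Δ + 1)^4 * q2 ≤ (δ / Δ * m) / 2 ∧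
    ((r : ℝ) + r^2) * (r * (1 / δ) * m / q2 + b) + (t * m + t * m * (Δ + 1)) ≤ Nre ∧
    r * (1 / δ) * m / q3 + b ≤ Nch ∧
    Nab + t * m + r * (pv * (Lv + 1) + Nre) + 2 + (r^2 + 2 * Δ + 3) * (t * m) ≤ l ^ (2 * Δ) * l^2 / 256 * m ∧
    Nab + t * m + r * (pv * (Lv + 1) + Nre) + 2 + (r^2 + 2 * Δ + 3) * (t * m) ≤ l ^ Δ * (ν * m) ∧
    (pc * Lc : ℝ) ≤ l^3 / 256 * (δ * m) ∧
    (1 - l^2 / 64)^Lc * (Δ * (1 / δ) * m) ≤ pc / 2 ∧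
    pc * (Lc + 2) + Δ * (Nre + r * (pv * (Lv + 1))) + Δ * (Nab + t * m) + t * m + 1 ≤ l^2 / 16 * (δ * m) ∧
    pv * (Lv + 3) + Nre + Nab ≤ l ^ (2 * Δ) * m ∧
    (1 - l ^ Δ)^Lv * (1 / δ * m) ≤ pv / 2 ∧
    ((s : ℝ) ≤ pv / 2 ∧ (s : ℝ) ≤ pc / 2) ∧
    Nre + 2 + (Δ + 2) * (t * m) ≤ l ^ (3 * Δ) * l * pv / 16 ∧
    Δ * (Nre + r * (pv * (Lv + 1))) + t * m ≤ l * pc / 2 ∧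
    Nch * (Δ + 1) + (Δ + 2) * (t * m) < l ^ Δ * l * s ∧
    r * (t * m) ≤ ξ ∧ ξ ≤ s := by
  have hΔ0 : (0:ℝ) < Δ := by exact_mod_cast hΔ
  have hr0 : (0:ℝ) < r := by exact_mod_cast (by omega : 0 < r)
  obtain ⟨κ, p, v, e, σ, h, t, q1, q2, q3, Lc, Lv, hκ, hp, hv, he, hσ, hh, ht, hq1, hq2, hq3,
    ⟨κ1, κ2, κ3, κ4, κ5⟩, hq1', ⟨p1, p2, p3⟩, p4, ⟨v1, v2, v3, v4⟩, v5,
    ⟨e1, e2, e3, e4⟩, hq2', ⟨s1, s2, s3⟩, h1, hq3', ⟨t1, t2, t3, t4, t5, t6, t7, t8, t9, t10, t11, t12⟩⟩ :=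
    bu_consts r (r + r^2) (Δ + 1) ((Δ + 1)^4) ((Δ + 1)^2) Δ (1 / δ) l (l^2 / 64) (l ^ Δ)
      (l ^ (2 * Δ) * l^2 / 256) (l ^ Δ * ν) (l^3 / 256 * δ) (l^2 / 16 * δ) (l ^ (2 * Δ)) (l ^ (3 * Δ) * l / 16)
      (l ^ Δ * l) (δ / Δ) hl (by positivity) (by nlinarith) (by positivity) (pow_le_one₀ hl.le (by linarith))
      (by positivity) (by positivity) hΔ0 (by positivity) (by positivity) (by positivity) (by positivity)
      (by positivity) (by positivity) (by positivity) (by positivity)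
  refine ⟨t, Lc, Lv, q1, q2, q3, ht, hq1, hq2, hq3, fun m htm hm => ?_⟩
  have hq10 : (0:ℝ) < q1 := by exact_mod_cast hq1
  have hq20 : (0:ℝ) < q2 := by exact_mod_cast hq2
  have hq30 : (0:ℝ) < q3 := by exact_mod_cast hq3
  have hσm : 4 ≤ σ * m := by
    have := mul_le_mul_of_nonneg_right t12 hm.le
    linarith
  have hpm : 16 ≤ p * m := by
    have := mul_le_mul_of_nonneg_right s2 hm.le
    linarith
  have hvm : 16 ≤ v * m := by
    have := mul_le_mul_of_nonneg_right s1 hm.le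
    linarith
  obtain ⟨pc1, pc2⟩ := bu_floor (p * m) (by linarith)
  obtain ⟨pv1, pv2⟩ := bu_floor (v * m) (by linarith)
  obtain ⟨ss1, ss2⟩ := bu_floor (σ * m) (by linarith)
  have ξ1 := Nat.le_ceil ((r:ℝ) * (t * m))
  have ξ2 := Nat.ceil_lt_add_one (a := (r:ℝ) * (t * m)) (by positivity)
  generalize ⌊p * m⌋₊ = pc at pc1 pc2
  generalize ⌊v * m⌋₊ = pv at pv1 pv2
  generalize ⌊σ * m⌋₊ = s at ss1 ss2
  generalize ⌈(r:ℝ) * (t * m)⌉₊ = ξ at ξ1 ξ2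
  refine ⟨κ * m, e * m, h * m, pc, pv, s, ξ, fun b hb => ?_⟩
  have hpcL : (pc : ℝ) * (Lc + 1) ≤ p * (Lc + 1) * m := by
    have := mul_le_mul_of_nonneg_right pc2 (by positivity : (0:ℝ) ≤ (Lc:ℝ) + 1)
    linarith only [this]
  have hpvL : (pv : ℝ) * (Lv + 1) ≤ v * (Lv + 1) * m := by
    have := mul_le_mul_of_nonneg_right pv2 (by positivity : (0:ℝ) ≤ (Lv:ℝ) + 1)
    linarith only [this]
  have mm : ∀ {a b : ℝ}, a ≤ b → a * m ≤ b * m := fun h => mul_le_mul_of_nonneg_right h hm.le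
  have mc : ∀ {a b : ℝ} (c : ℝ), 0 ≤ c → a ≤ b → c * a ≤ c * b := fun c hc h => mul_le_mul_of_nonneg_left h hc
  have hxκ : (pc : ℝ) * (Lc + 1) ≤ κ * m := hpcL.trans (mm p1)
  have hyκ : (pv : ℝ) * (Lv + 1) ≤ κ * m := hpvL.trans (mm v1)
  have hryκ : (r : ℝ) * (pv * (Lv + 1)) ≤ κ * m := by
    have h1 := mc (r:ℝ) hr0.le hpvL
    have h2 := mm v2
    linarith only [h1, h2]
  have hpc0 : (0:ℝ) ≤ (pc : ℝ) * Lc := by positivity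
  have hpcn : (0:ℝ) ≤ (pc : ℝ) := by positivity
  have hpvn : (0:ℝ) ≤ (pv : ℝ) * Lv := by positivity
  have hbase : κ * m + t * m + r * (pv * (Lv + 1) + e * m) + 2 + (r^2 + 2 * Δ + 3) * (t * m) ≤ 8 * κ * m := by
    have h1 := mm e1
    have h2 := mm t1
    have h3 : 0 ≤ κ * m := by positivity
    linarith only [h1, h2, h3, hryκ, htm]
  have hT : (0:ℝ) ≤ r + r^2 := by positivity
  have hD4 : (0:ℝ) ≤ ((Δ:ℝ) + 1)^4 := by positivity
  refine ⟨?_, ?_, ?_, ?_, ?_, ?_, ?_, ?_, ?_, ?_, ?_, ?_, ?_, ?_, ?_, ?_, ?_, ?_, ?_, ?_⟩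
  · have := mm t4
    linarith only [this]
  · have h1 := mm hq1'
    have h2 := mm t3
    have h3 := mc _ hT hb
    have h4 : ((r : ℝ) + r^2) * (r * (1 / δ) * m / q1 + b) =
      (r + r ^ 2) * (r * (1 / δ)) / q1 * m + (r + r^2) * b := by ring
    rw [h4]; linarith only [h1, h2, h3]
  · have := mm κ5
    linarith only [this]
  · have h1 := mc ((r:ℝ)^2 * (Δ + 1)^4 * q1) (by positivity) hpcL
    have h2 := mc ((r:ℝ) * (Δ + 1)^4 * q1) (by positivity) hpvL
    have h3 : (ξ:ℝ) ≤ (r + 1) * (t * m) := by linarith only [ξ2, htm]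
    have h4 := mc (((r:ℝ) + r^2) * (Δ + 1)^4 * q1) (by positivity) h3
    have h5 := mm p3
    have h6 := mm v4
    have h7 := mm t5
    linarith only [h1, h2, h4, h5, h6, h7]
  · have h1 := mc (((r:ℝ) + r^2) * (Δ + 1)^4 * q2) (by positivity) ss2
    have h2 := mm s3
    linarith only [h1, h2]
  · have h1 := mm hq2'
    have h2 := mm t8
    have h3 := mc _ hT hb
    have h4 : ((r : ℝ) + r^2) * (r * (1 / δ) * m / q2 + b) =
      (r + r ^ 2) * (r * (1 / δ)) / q2 * m + (r + r^2) * b := by ring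
    rw [h4]; linarith only [h1, h2, h3]
  · have h1 := mm hq3'
    have h2 := mm t10
    have h4 : (r * (1 / δ) * m / q3 + b : ℝ) = (r * (1 / δ)) / q3 * m + b := by ring
    rw [h4]; linarith only [h1, h2, hb]
  · exact hbase.trans (mm κ1)
  · refine (hbase.trans (mm κ2)).trans (le_of_eq (by ring))
  · have := mm p2
    linarith only [this, hpcL, hpcn]
  · have := mm p4
    linarith only [this, pc1, hpm]
  · have h0 := mm κ3
    have h1 : κ * m ≤ Δ * (κ * m) := by
      have h : (1:ℝ) ≤ Δ := by exact_mod_cast hΔ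
      exact le_mul_of_one_le_left (by positivity) h
    have h2 := mc (Δ:ℝ) hΔ0.le (mm e2)
    have h3 := mc (Δ:ℝ) hΔ0.le hryκ
    have h4 := mm t2
    have h5 : t * m ≤ κ * m := by
      have : 0 ≤ t * m := by positivity
      linarith only [this, h4]
    have h6 := mc (Δ:ℝ) hΔ0.le h5
    have h7 : 0 ≤ Δ * (κ * m) := by positivity
    linarith only [h0, h1, h2, h3, h4, h6, h7, hxκ, hpc0, htm]
  · have h0 := mm κ4
    have h1 := mm e2
    have h2 : (0:ℝ) ≤ (pv:ℝ) := by positivity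
    have : 0 ≤ κ * m := by positivity
    linarith only [h0, h1, h2, this, hyκ, hpvn]
  · have := mm v5
    linarith only [this, pv1, hvm]
  · have h1 := mm s1
    have h2 := mm s2
    constructor <;> linarith only [h1, h2, ss2, pv1, pc1]
  · have h0 := mm e4
    have h1 := mm t7
    have h2 := mc (l ^ (3 * Δ) * l / 16) (by positivity) pv1
    have h3 : 0 ≤ l ^ (3 * Δ) * l / 16 * (v * m) := by positivity
    linarith only [h0, h1, h2, h3, htm]
  · have h0 := mm e3
    have h1 := mc ((Δ:ℝ) * r) (by positivity) hpvL
    have h2 := mm v3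
    have h3 := mm t6
    have h4 := mc l hl.le pc1
    have h5 : 0 ≤ l * (p * m) := by positivity
    linarith only [h0, h1, h2, h3, h4, h5]
  · have h0 := mm h1
    have h2 := mm t9
    have h3 := mc (l ^ Δ * l) (by positivity) ss1
    have h4 : 0 < l ^ Δ * l * (σ * m) := by positivity
    linarith only [h0, h2, h3, h4]
  · exact ξ1
  · have h0 := mm t11
    have h3 : (ξ:ℝ) ≤ s := by linarith only [h0, ξ2, htm, ss1]
    exact_mod_cast h3

theorem bu_eb {W : Type} [Fintype W] (H : SimpleGraph W) (Δ : ℕ) (hΔ : ∀ w, degOf H w ≤ Δ) (A B : Finset W) :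
    eBetween H A B ≤ A.card * Δ := by
  have hsub : (univ : Finset (Sym2 W)).filter
      (fun e => e ∈ H.edgeSet ∧ ∃ x ∈ A, ∃ y ∈ B, e = s(x, y)) ⊆ A.biUnion
      (fun w => (univ.filter (fun y => H.Adj w y)).image (fun y => s(w, y))) := by
    intro e he
    simp only [mem_filter] at he
    obtain ⟨_, he, x, hx, y, hy, rfl⟩ := he
    refine mem_biUnion.2 ⟨x, hx, mem_image.2 ⟨y, ?_, rfl⟩⟩
    simp only [mem_filter]
    exact ⟨mem_univ _, he⟩
  exact (card_le_card hsub).trans (card_biUnion_le_card_mul _ _ _ (fun w _ => card_image_le.trans (hΔ w)))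

/-! ## Statement 17 -/

theorem stmt17 (r Δ : ℕ) (hr : 2 ≤ r) (hΔ : 1 ≤ Δ) (ν d δ : ℝ)
    (hν : 0 < ν) (hd : 0 < d) (hδ : 0 < δ) :
    ∃ (ε μ α : ℝ) (m₀ : ℕ), 0 < ε ∧ 0 < μ ∧ 0 < α ∧
    ∀ m : ℕ, m₀ ≤ m →
    ∀ (V : Type) [Fintype V] (R : SimpleGraph (Fin r))
      (Vc : Fin r → Finset V) (Vij : Fin r → Fin r → Finset V)
      (E : Set (Finset V)),
      (∀ e ∈ E, e.card = 3) →
      (∀ i j, Vij i j = Vij j i) →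
      (∀ i j, i ≠ j → Disjoint (Vc i) (Vc j)) →
      (∀ i j k, R.Adj j k → Disjoint (Vc i) (Vij j k)) →
      (∀ i j k l, R.Adj i j → R.Adj k l → s(i, j) ≠ s(k, l) →
        Disjoint (Vij i j) (Vij k l)) →
      (∀ v : V, (∃ i, v ∈ Vc i) ∨ ∃ i j, R.Adj i j ∧ v ∈ Vij i j) →
      (∀ i, (m : ℝ) ≤ ((Vc i).card : ℝ) ∧ ((Vc i).card : ℝ) ≤ (m : ℝ) / δ) →
      (∀ i j, R.Adj i j → δ * (m : ℝ) ≤ ((Vij i j).card : ℝ)) →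
      (∀ i j, R.Adj i j → TripHalfSuper ε d E (Vc i) (Vc j) (Vij i j)) →
      ∀ (W : Type) [Fintype W] (H : SimpleGraph W) (φ : W → Fin r),
        Separable H μ → (∀ w, degOf H w ≤ Δ) →
        (∀ x y, H.Adj x y → R.Adj (φ x) (φ y)) →
        (∀ i : Fin r, ((univ : Finset W).filter (fun x => φ x = i)).card = (Vc i).card) →
        (∀ i j : Fin r, R.Adj i j →
          eBetween H ((univ : Finset W).filter (fun x => φ x = i))
            ((univ : Finset W).filter (fun x => φ x = j)) = (Vij i j).card) →
        ∀ (U : Fin r → Finset W) (Ts : W → Finset V),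
          (∀ i, ∀ x ∈ U i, φ x = i) →
          (∀ i, ((U i).card : ℝ) ≤ α * (m : ℝ)) →
          (∀ i, ∀ x ∈ U i, Ts x ⊆ Vc (φ x) ∧ ν * (m : ℝ) ≤ ((Ts x).card : ℝ)) →
          ∃ (ρv : W → V) (ρe : Sym2 W → V),
            Function.Injective ρv ∧ Set.InjOn ρe H.edgeSet ∧
            (∀ x, ∀ e ∈ H.edgeSet, ρv x ≠ ρe e) ∧
            (∀ x, ρv x ∈ Vc (φ x)) ∧
            (∀ x y, H.Adj x y → ρe s(x, y) ∈ Vij (φ x) (φ y) ∧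
              ({ρv x, ρv y, ρe s(x, y)} : Finset V) ∈ E) ∧
            (∀ i, ∀ x ∈ U i, ρv x ∈ Ts x) := by

  obtain ⟨l, hldef⟩ : ∃ l, l = min d 1 / 2 := ⟨_, rfl⟩
  have hl : 0 < l := by
    have : 0 < min d 1 := lt_min hd one_pos
    rw [hldef]; linarith
  have hl1 : l ≤ 1 / 2 := by
    have := min_le_right d 1
    rw [hldef]; linarith
  have hld : 2 * l ≤ d := by
    have := min_le_left d 1
    rw [hldef]; linarith
  have hΔ0 : (0:ℝ) < Δ := by exact_mod_cast hΔ
  have hΔ1 : (1:ℝ) ≤ Δ := by exact_mod_cast hΔ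
  have hr0 : (0:ℝ) < r := by exact_mod_cast (by omega : 0 < r)
  obtain ⟨t, Lc, Lv, q1, q2, q3, ht, hq1, hq2, hq3, hmain⟩ := bu_numbers r Δ hr hΔ ν l δ hν hl hl1 hδ
  refine ⟨t * δ / Δ, t * δ / r, t / r, ⌈2 / t⌉₊ + 1, by positivity, by positivity, by positivity, ?_⟩
  intro m hm V _ R Vc Vij E _ hsymm hvc hvcij hvij _ hvcard hvijcard hreg W _ H φ hsep hdeg hhom hfc hec U Ts hU hUc hTs
  have hm1 : (⌈2 / t⌉₊ : ℝ) + 1 ≤ m := by exact_mod_cast hm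
  have hm0 : (0:ℝ) < m := by
    have : (0:ℝ) ≤ (⌈2 / t⌉₊ : ℝ) := by positivity
    linarith
  have htm : 2 ≤ t * m := by
    have h1 := Nat.le_ceil (2 / t)
    have h2 : 2 / t ≤ m := by linarith
    rw [div_le_iff₀ ht] at h2
    linarith
  have htm0 : 0 < t * m := by linarith
  have hvhi : ∀ i, ((Vc i).card : ℝ) ≤ 1 / δ * m := by
    intro i
    have := (hvcard i).2
    rw [div_eq_mul_one_div] at this
    linarith
  have hδ1 : δ ≤ 1 := by
    have h1 := hvcard ⟨0, by omega⟩
    have h2 := h1.1.trans h1.2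
    rw [le_div_iff₀ hδ] at h2
    have h3 : (m:ℝ) * δ ≤ m * 1 := by linarith
    exact le_of_mul_le_mul_left h3 hm0
  have hchi : ∀ i j, R.Adj i j → ((Vij i j).card : ℝ) ≤ Δ * (1 / δ) * m := by
    intro i j hij
    have h1 := bu_eb H Δ hdeg ((univ : Finset W).filter (fun x => φ x = i)) ((univ : Finset W).filter (fun x => φ x = j))
    rw [hec i j hij, hfc i] at h1
    have h2 : ((Vij i j).card : ℝ) ≤ (Vc i).card * Δ := by exact_mod_cast h1
    have h3 := mul_le_mul_of_nonneg_right (hvhi i) hΔ0.le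
    linarith
  have hεv : ∀ i, t * δ / Δ * ((Vc i).card : ℝ) ≤ t * m := by
    intro i
    have h1 : t * δ / Δ * ((Vc i).card : ℝ) ≤ t * δ / Δ * (1 / δ * m) :=
      mul_le_mul_of_nonneg_left (hvhi i) (by positivity)
    have h2 : t * δ / Δ * (1 / δ * m) = t * m / Δ := by field_simp
    rw [h2] at h1
    exact h1.trans (div_le_self htm0.le hΔ1)
  have hεc : ∀ i j, R.Adj i j → t * δ / Δ * ((Vij i j).card : ℝ) ≤ t * m := by
    intro i j hij
    have h1 : t * δ / Δ * ((Vij i j).card : ℝ) ≤ t * δ / Δ * (Δ * (1 / δ) * m) :=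
      mul_le_mul_of_nonneg_left (hchi i j hij) (by positivity)
    have h2 : t * δ / Δ * (Δ * (1 / δ) * m) = t * m := by field_simp
    rwa [h2] at h1
  have hreg' : ∀ i j, R.Adj i j → TripHalfSuper (t * δ / Δ) (2 * l) E (Vc i) (Vc j) (Vij i j) :=
    fun i j hij => bu_thm_mono (hreg i j hij) hld
  have hvijpos : ∀ i j, R.Adj i j → 0 < (Vij i j).card := by
    intro i j hij
    have h1 := hvijcard i j hij
    have h2 : (0:ℝ) < δ * m := by positivity
    exact_mod_cast h2.trans_le h1
  have hW : (Fintype.card W : ℝ) ≤ r * (1 / δ) * m := by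
    have h1 : Fintype.card W = ∑ i : Fin r, (Vc i).card := by
      rw [← card_univ, card_eq_sum_card_fiberwise (f := φ) (t := univ) (fun x _ => by simp)]
      exact sum_congr rfl (fun i _ => hfc i)
    rw [h1, Nat.cast_sum]
    refine (sum_le_sum (fun i _ => hvhi i)).trans (le_of_eq ?_)
    rw [sum_const, card_univ, Fintype.card_fin, nsmul_eq_mul]
    ring
  have hμ : t * δ / r * (Fintype.card W : ℝ) ≤ t * m := by
    refine (mul_le_mul_of_nonneg_left hW (by positivity)).trans (le_of_eq ?_)
    field_simp
  let X : BUCtx r V W :=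
  { E := E, R := R, Vc := Vc, Vij := Vij, H := H, φ := φ, Δ := Δ, l := l, e0 := t * m
    l_pos := hl, l_le := hl1, e0_pos := htm0, vij_symm := hsymm, vc_disj := hvc, vcij_disj := hvcij
    vij_disj := hvij, deg := hdeg, hom := hhom
    typ := fun i j hij => bu_typ (hreg' i j hij) hl rfl htm0 (hεv i) (hεv j) (hεc i j hij)
    ctyp := fun i j hij => bu_ctyp (hreg' i j hij) hl rfl htm0 (hεv i) (hεv j) (hεc i j hij)
    vdeg := fun i j hij => bu_vdeg (hreg' i j hij) hl rfl (hvijpos i j hij)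
    cdeg := fun i j hij => bu_cdeg (hreg' i j hij) hl rfl
    vcard := hfc, ecard := hec }
  obtain ⟨X0, β, comp, hX0, hc1, hc2⟩ := bu_comp hsep
  have hb : ∀ k, ((univ : Finset W).filter (fun w => w ∉ X0 ∧ comp w = k)).card ≤ ⌊t * m⌋₊ :=
    fun k => Nat.le_floor ((hc2 k).trans hμ)
  have hne0 : 0 < (Vc ⟨0, by omega⟩).card := by
    have h1 := (hvcard ⟨0, by omega⟩).1
    exact_mod_cast hm0.trans_le h1
  haveI : Nonempty V := by
    obtain ⟨v, _⟩ := card_pos.1 hne0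
    exact ⟨v⟩
  haveI : Nonempty W := by
    rw [← hfc] at hne0
    obtain ⟨w, _⟩ := card_pos.1 hne0
    exact ⟨w⟩
  obtain ⟨Nab, Nre, Nch, pc, pv, s, ξ, hnum⟩ := hmain m htm hm0
  obtain ⟨c1, c2, c2', c3, c4, c5, c6, k1, k1', k2, k3, k4, k5, k6, k7, k8, k9, k10, k11, k12⟩ :=
    hnum ⌊t * m⌋₊ (Nat.floor_le htm0.le)
  have hUs : (((univ : Finset (Fin r)).biUnion U).card : ℝ) ≤ t * m := by
    have h1 : (((univ : Finset (Fin r)).biUnion U).card : ℝ) ≤ ∑ i, ((U i).card : ℝ) := by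
      exact_mod_cast card_biUnion_le
    refine h1.trans ((sum_le_sum (fun i _ => hUc i)).trans (le_of_eq ?_))
    rw [sum_const, card_univ, Fintype.card_fin, nsmul_eq_mul]
    field_simp
  have hTs' : ∀ x ∈ (univ : Finset (Fin r)).biUnion U, Ts x ⊆ Vc (φ x) ∧ ν * (m : ℝ) ≤ ((Ts x).card : ℝ) := by
    intro x hx
    obtain ⟨i, _, hi⟩ := mem_biUnion.1 hx
    exact hTs i x hi
  have hw1 : δ / Δ * m ≤ m := by
    have h1 : δ / Δ ≤ 1 := (div_le_one hΔ0).2 (hδ1.trans hΔ1)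
    have := mul_le_mul_of_nonneg_right h1 hm0.le
    linarith
  have hw2 : δ / Δ * m * Δ ≤ δ * m := le_of_eq (by field_simp)
  obtain ⟨ρ, h1, h2, h3, C, f, h4, _, h5⟩ := X.prep X0 comp ⌊t * m⌋₊ hc1 hb ((univ : Finset (Fin r)).biUnion U) Ts
    m (δ * m) (Δ * (1 / δ) * m) (1 / δ * m) ν Nab Nre (t * m) Nch (r * (1 / δ) * m) (δ / Δ * m) (t * m)
    pc Lc pv Lv s ξ q1 q2 q3 hq1 hq2 hq3 hTs' (by omega) hm0 hν hΔ
    (fun i => ⟨(hvcard i).1, hvhi i⟩) (fun q => ⟨hvijcard _ _ q.2.2, hchi _ _ q.2.2⟩) hUs (hX0.trans hμ) hW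
    hw1 hw2 c1 c2 c2' c3 c4 c5 c6 k1 k1' k2 k3 k4 k5 k6 k7 k8 k9 k10 k11 k12
  have hadj : ∀ x y, H.Adj x y → f s(x, y) ∈ Vij (φ x) (φ y) ∧ ({ρ x, ρ y, f s(x, y)} : Finset V) ∈ E :=
    fun x y ha => X.mem_lst.1 (h5 _ (X.mem_edges.2 ha))
  refine ⟨ρ, f, h1, ?_, ?_, h2, hadj, fun i x hx => h3 x (mem_biUnion.2 ⟨i, mem_univ _, hx⟩)⟩
  · intro e he e' he' hee
    induction e using Sym2.ind with
    | _ x y =>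
    induction e' using Sym2.ind with
    | _ x' y' =>
    exact h4 (mem_coe.2 (X.mem_edges.2 he)) (mem_coe.2 (X.mem_edges.2 he')) hee
  · intro x e he hxe
    induction e using Sym2.ind with
    | _ y z =>
    have ha : H.Adj y z := he
    have := (hadj y z ha).1
    rw [← hxe] at this
    exact disjoint_left.1 (hvcij (φ x) _ _ (hhom y z ha)) (h2 x) this
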